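/- Let d ≥ 2, let k be a positive integer, and let μ be a compactly supported Borel probability measure on ℝ^d satisfying μ(B(x,r)) ≤ A r^s for all x ∈ ℝ^d and r > 0, where s > d/2 + 1/(4k−1). Then the Mattila-type integral ∫_{(ℝ^d)^k} ∏_{j=1}^{k} |μ̂(ξ^j)|² ( ∫_{[1/2,2]^{k−1}} ∫_{O(d)^k} ( ∏_{j=1}^{k−1} |μ̂(r_j θ_j ξ^j)|² ) · |μ̂((r_1 ⋯ r_{k−1})^{−1} θ_k ξ^k)|² dλ_{O(d)}(θ_1) ⋯ dλ_{O(d)}(θ_k) dr_1 ⋯ dr_{k−1} ) dξ^1 ⋯ dξ^k is finite. -/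

import Mathlib

open MeasureTheory Metric
open scoped ENNReal RealInnerProductSpace

noncomputable instance matrixMeasurableSpace (m n : Type*) :
    MeasurableSpace (Matrix m n ℝ) := borel _

instance matrixBorelSpace (m n : Type*) : BorelSpace (Matrix m n ℝ) := ⟨rfl⟩

/-- The Fourier transform `μ̂(ξ) = ∫ e^{-2πi x·ξ} dμ(x)` of a finite Borel measure on `ℝ^d`. -/
noncomputable def measureFT {d : ℕ} (μ : Measure (EuclideanSpace ℝ (Fin d)))
    (ξ : EuclideanSpace ℝ (Fin d)) : ℂ :=
  ∫ x, Complex.exp (((-2 * Real.pi * ⟪x, ξ⟫ : ℝ) : ℂ) * Complex.I) ∂μ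

open scoped FourierTransform Pointwise Convolution SchwartzMap Topology

section Fourier
variable {E : Type*} [NormedAddCommGroup E] [InnerProductSpace ℝ E] [FiniteDimensional ℝ E]
  [MeasurableSpace E] [BorelSpace E]

theorem fourier_toLp_ae_eq {f : E → ℂ} (hf : Integrable f) (hf2 : MemLp f 2) :
    (𝓕 (hf2.toLp f) : Lp (α := E) ℂ 2 volume) =ᵐ[volume] 𝓕 f := by
  have hc : Continuous (𝓕 f) := VectorFourier.fourierIntegral_continuous Real.continuous_fourierChar
    (by simpa using continuous_inner) hf
  apply ae_eq_of_integral_contDiff_smul_eq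
  · exact ((Lp.memLp _).locallyIntegrable (by norm_num))
  · exact hc.locallyIntegrable
  intro g hg hgc
  let G : SchwartzMap E ℂ := HasCompactSupport.toSchwartzMap (f := fun x => (g x : ℂ))
    (hgc.comp_left (g := fun x : ℝ => (x : ℂ)) (by simp))
    (by exact Complex.ofRealCLM.contDiff.comp hg)
  have h1 := congrArg (fun T => T G) (Lp.fourier_toTemperedDistribution_eq (hf2.toLp f))
  simp only [TemperedDistribution.fourier_apply, Lp.toTemperedDistribution_apply] at h1
  have hGv : ∀ x, G x = (g x : ℂ) := fun x => rfl
  have h2 : ∫ x, g x • (𝓕 (hf2.toLp f) : Lp (α := E) ℂ 2 volume) x =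
      ∫ x, (G x) • (𝓕 (hf2.toLp f) : Lp (α := E) ℂ 2 volume) x := by
    refine integral_congr_ae (.of_forall fun x => ?_)
    simp [hGv]
  rw [h2, ← h1]
  have h3 : ∫ x, (𝓕 G) x • (hf2.toLp f) x = ∫ x, (𝓕 (G : E → ℂ)) x • f x := by
    refine integral_congr_ae ?_
    filter_upwards [hf2.coeFn_toLp] with x hx
    rw [hx]; rfl
  rw [h3]
  have h4 := VectorFourier.integral_fourierIntegral_smul_eq_flip (μ := (volume : Measure E))
    (ν := (volume : Measure E)) (L := innerₗ E) (e := Real.fourierChar) (f := (G : E → ℂ)) (g := f)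
    Real.continuous_fourierChar (by simpa using continuous_inner) G.integrable hf
  rw [flip_innerₗ] at h4
  exact h4

theorem memLp_fourier {f : E → ℂ} (hf : Integrable f) (hf2 : MemLp f 2) : MemLp (𝓕 f) 2 :=
  (memLp_congr_ae (fourier_toLp_ae_eq hf hf2)).1 (Lp.memLp _)

theorem toLp_fourier {f : E → ℂ} (hf : Integrable f) (hf2 : MemLp f 2) :
    (memLp_fourier hf hf2).toLp (𝓕 f) = 𝓕 (hf2.toLp f) := by
  apply Lp.ext
  exact (MemLp.coeFn_toLp _).trans (fourier_toLp_ae_eq hf hf2).symm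

theorem integral_conj_fourier_mul_fourier {f g : E → ℂ} (hf : Integrable f) (hf2 : MemLp f 2)
    (hg : Integrable g) (hg2 : MemLp g 2) :
    ∫ x, starRingEnd ℂ (𝓕 f x) * 𝓕 g x = ∫ x, starRingEnd ℂ (f x) * g x := by
  have h := Lp.inner_fourier_eq (hf2.toLp f) (hg2.toLp g)
  rw [← toLp_fourier hf hf2, ← toLp_fourier hg hg2, L2.inner_def, L2.inner_def] at h
  refine Eq.trans (integral_congr_ae ?_) (h.trans (integral_congr_ae ?_))
  · filter_upwards [(memLp_fourier hf hf2).coeFn_toLp, (memLp_fourier hg hg2).coeFn_toLp] with x h1 h2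
    rw [h1, h2]; simp [mul_comm]
  · filter_upwards [hf2.coeFn_toLp, hg2.coeFn_toLp] with x h1 h2
    rw [h1, h2]; simp [mul_comm]

/-- The square of the `L²` norm. -/
noncomputable def nsq (φ : E → ℂ) : ℝ≥0∞ := ∫⁻ x, ‖φ x‖ₑ ^ 2

theorem nsq_eq_eLpNorm_sq (f : E → ℂ) : nsq f = eLpNorm f 2 volume ^ 2 := by
  have h : eLpNorm f 2 volume = (∫⁻ x, ‖f x‖ₑ ^ (2:ℝ)) ^ (1/2 : ℝ) := by
    rw [eLpNorm_eq_lintegral_rpow_enorm_toReal (by norm_num) (by norm_num)]; simp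
  rw [h, nsq, ← ENNReal.rpow_natCast, ← ENNReal.rpow_mul]
  simp

theorem nsq_fourier {f : E → ℂ} (hf : Integrable f) (hf2 : MemLp f 2) :
    nsq (𝓕 f) = nsq f := by
  have h := Lp.norm_fourier_eq (hf2.toLp f)
  rw [← toLp_fourier hf hf2, Lp.norm_toLp, Lp.norm_toLp,
    ENNReal.toReal_eq_toReal_iff' (memLp_fourier hf hf2).2.ne hf2.2.ne] at h
  rw [nsq_eq_eLpNorm_sq, nsq_eq_eLpNorm_sq, h]

end Fourier

section Fourier
variable {E : Type*} [NormedAddCommGroup E] [InnerProductSpace ℝ E] [FiniteDimensional ℝ E]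
  [MeasurableSpace E] [BorelSpace E]

theorem fourier_add_of_integrable {f g : E → ℂ} (hf : Integrable f) (hg : Integrable g) :
    𝓕 (f + g) = 𝓕 f + 𝓕 g := by
  ext x
  simp only [Real.fourier_eq, Pi.add_apply, smul_add]
  exact integral_add ((Real.fourierIntegral_convergent_iff x).2 hf)
    ((Real.fourierIntegral_convergent_iff x).2 hg)

/-- `φ` is the Fourier transform of a function in `L¹ ∩ L²` vanishing off `S`. -/
def Spec (S : Set E) (φ : E → ℂ) : Prop :=
  ∃ f : E → ℂ, Integrable f ∧ MemLp f 2 ∧ (∀ ξ ∉ S, f ξ = 0) ∧ φ = 𝓕 f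

namespace Spec
variable {S T : Set E} {φ ψ : E → ℂ}

theorem mono (h : Spec S φ) (hST : S ⊆ T) : Spec T φ := by
  obtain ⟨f, h1, h2, h3, h4⟩ := h
  exact ⟨f, h1, h2, fun ξ hξ => h3 ξ fun h => hξ (hST h), h4⟩

theorem zero : Spec S (0 : E → ℂ) := by
  refine ⟨0, integrable_zero _ _ _, MemLp.zero, fun _ _ => rfl, ?_⟩
  ext x; simp [Real.fourier_eq]

theorem add (hφ : Spec S φ) (hψ : Spec S ψ) : Spec S (φ + ψ) := by
  obtain ⟨f, h1, h2, h3, rfl⟩ := hφ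
  obtain ⟨g, k1, k2, k3, rfl⟩ := hψ
  refine ⟨f + g, h1.add k1, h2.add k2, fun ξ hξ => by simp [h3 ξ hξ, k3 ξ hξ], ?_⟩
  exact (fourier_add_of_integrable h1 k1).symm

theorem sum {ι : Type*} {s : Finset ι} {φ : ι → E → ℂ} (h : ∀ i ∈ s, Spec S (φ i)) :
    Spec S (fun x => ∑ i ∈ s, φ i x) := by
  have h' : Spec S (∑ i ∈ s, φ i) := Finset.sum_induction _ (Spec S) (fun _ _ => add) zero h
  convert h' using 1
  ext x; simp

theorem continuous (h : Spec S φ) : Continuous φ := by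
  obtain ⟨f, h1, h2, h3, rfl⟩ := h
  exact VectorFourier.fourierIntegral_continuous Real.continuous_fourierChar
    (by simpa using continuous_inner) h1

theorem memLp (h : Spec S φ) : MemLp φ 2 := by
  obtain ⟨f, h1, h2, h3, rfl⟩ := h
  exact memLp_fourier h1 h2

theorem nsq_lt_top (h : Spec S φ) : nsq φ < ⊤ := by
  rw [nsq_eq_eLpNorm_sq]
  exact ENNReal.pow_lt_top h.memLp.2

theorem mul (hφ : Spec S φ) (hψ : Spec T ψ) : Spec (S + T) (fun x => φ x * ψ x) := by
  obtain ⟨f, h1, h2, h3, rfl⟩ := hφ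
  obtain ⟨g, k1, k2, k3, rfl⟩ := hψ
  have hi : Integrable (f ⋆[ContinuousLinearMap.mul ℂ ℂ] g) := h1.integrable_convolution _ k1
  refine ⟨f ⋆[ContinuousLinearMap.mul ℂ ℂ] g, hi, ?_, ?_, ?_⟩
  · have hF := (memLp_two_iff_integrable_sq_norm h2.1).1 h2
    have hG := (memLp_two_iff_integrable_sq_norm k2.1).1 k2
    have hb : ∀ x, ‖(f ⋆[ContinuousLinearMap.mul ℂ ℂ] g) x‖ ≤ (∫ t, ‖f t‖ ^ 2) + ∫ t, ‖g t‖ ^ 2 := by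
      intro x
      rw [convolution_def]
      have hG' : Integrable (fun t => ‖g (x - t)‖ ^ 2) := hG.comp_sub_left x
      calc _ ≤ ∫ t, (‖f t‖ ^ 2 + ‖g (x - t)‖ ^ 2) := by
            refine norm_integral_le_of_norm_le (hF.add hG') (.of_forall fun t => ?_)
            simp only [ContinuousLinearMap.mul_apply', norm_mul]
            nlinarith [sq_nonneg (‖f t‖ - ‖g (x - t)‖), sq_nonneg (‖f t‖), sq_nonneg (‖g (x - t)‖)]
        _ = _ := by
            rw [integral_add hF hG', integral_sub_left_eq_self (fun t => ‖g t‖ ^ 2) volume x]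
    rw [memLp_two_iff_integrable_sq_norm hi.1]
    refine (hi.norm.const_mul ((∫ t, ‖f t‖ ^ 2) + ∫ t, ‖g t‖ ^ 2)).mono' (hi.1.norm.pow 2)
      (.of_forall fun x => ?_)
    rw [Real.norm_of_nonneg (by positivity), sq]
    exact mul_le_mul_of_nonneg_right (hb x) (norm_nonneg _)
  · intro ξ hξ
    rw [convolution_def]
    refine integral_eq_zero_of_ae (.of_forall fun t => ?_)
    by_cases ht : t ∈ S
    · have : ξ - t ∉ T := fun h => hξ ⟨t, ht, _, h, by simp⟩
      simp [k3 _ this]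
    · simp [h3 _ ht]
  · ext x
    rw [Real.fourier_mul_convolution_eq h1 k1]

theorem integral_conj_mul_eq_zero (hφ : Spec S φ) (hψ : Spec T ψ) (hST : Disjoint S T) :
    ∫ x, starRingEnd ℂ (φ x) * ψ x = 0 := by
  obtain ⟨f, h1, h2, h3, rfl⟩ := hφ
  obtain ⟨g, k1, k2, k3, rfl⟩ := hψ
  rw [integral_conj_fourier_mul_fourier h1 h2 k1 k2]
  refine integral_eq_zero_of_ae (.of_forall fun t => ?_)
  by_cases ht : t ∈ S
  · simp [k3 t (Set.disjoint_left.1 hST ht)]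
  · simp [h3 t ht]

/-- Almost orthogonality. -/
theorem nsq_sum_le {ι : Type*} {s : Finset ι} {S : ι → Set E} {φ : ι → E → ℂ}
    (h : ∀ i ∈ s, Spec (S i) (φ i)) (N : ℕ)
    (hN : ∀ ξ, ∀ t ⊆ s, (∀ i ∈ t, ξ ∈ S i) → t.card ≤ N) :
    nsq (fun x => ∑ i ∈ s, φ i x) ≤ N * ∑ i ∈ s, nsq (φ i) := by
  classical
  choose! f h1 h2 h3 h4 using h
  have hs : (fun x => ∑ i ∈ s, φ i x) = 𝓕 (fun ξ => ∑ i ∈ s, f i ξ) := by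
    have key : ∀ t ⊆ s, (fun x => ∑ i ∈ t, φ i x) = 𝓕 (fun ξ => ∑ i ∈ t, f i ξ) := by
      intro t
      induction t using Finset.induction_on with
      | empty => intro _; ext x; simp [Real.fourier_eq]
      | insert a t ha ih =>
        intro hts
        have ih := ih (fun x hx => hts (Finset.mem_insert_of_mem hx))
        simp only [Finset.sum_insert ha]
        have : (fun x => φ a x + ∑ i ∈ t, φ i x) = φ a + fun x => ∑ i ∈ t, φ i x := rfl
        rw [this, ih, h4 a (hts (Finset.mem_insert_self _ _))]
        exact (fourier_add_of_integrable (h1 a (hts (Finset.mem_insert_self _ _)))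
          (integrable_finsetSum _ fun i hi => h1 i (hts (Finset.mem_insert_of_mem hi)))).symm
    exact key s subset_rfl
  rw [hs, nsq_fourier (integrable_finsetSum _ h1) (memLp_finsetSum _ h2)]
  have h5 : ∀ i ∈ s, nsq (φ i) = nsq (f i) := fun i hi => by
    rw [h4 i hi, nsq_fourier (h1 i hi) (h2 i hi)]
  rw [Finset.sum_congr rfl h5]
  simp only [nsq]
  rw [← lintegral_finsetSum' _ fun i hi => ((h1 i hi).1.enorm.pow_const 2), ← lintegral_const_mul' _ _ (by simp)]
  refine lintegral_mono fun ξ => ?_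
  set t := s.filter fun i => f i ξ ≠ 0 with ht
  have e1 : ∑ i ∈ s, f i ξ = ∑ i ∈ t, f i ξ := (Finset.sum_filter_ne_zero s).symm
  have hc : t.card ≤ N := hN ξ t (Finset.filter_subset _ _) fun i hi => by
    by_contra hx
    rw [ht, Finset.mem_filter] at hi
    exact hi.2 (h3 i hi.1 ξ hx)
  have hreal : ‖∑ i ∈ s, f i ξ‖ ^ 2 ≤ N * ∑ i ∈ s, ‖f i ξ‖ ^ 2 := by
    calc ‖∑ i ∈ s, f i ξ‖ ^ 2 ≤ (∑ i ∈ t, ‖f i ξ‖) ^ 2 := by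
          rw [e1]; gcongr; exact norm_sum_le _ _
      _ ≤ t.card * ∑ i ∈ t, ‖f i ξ‖ ^ 2 := sq_sum_le_card_mul_sum_sq
      _ ≤ N * ∑ i ∈ s, ‖f i ξ‖ ^ 2 := by
          gcongr
          exact Finset.filter_subset _ _
  have := ENNReal.ofReal_le_ofReal hreal
  rw [ENNReal.ofReal_mul (by positivity), ENNReal.ofReal_sum_of_nonneg (fun _ _ => by positivity)] at this
  simpa [ENNReal.ofReal_pow, ofReal_norm] using this

/-- Splitting a function along a finite measurable partition of frequency space. -/
theorem exists_split {ι : Type*} (hφ : Spec S φ) {s : Finset ι} {T : ι → Set E}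
    (hT : ∀ i, MeasurableSet (T i)) (hd : ∀ i j, i ≠ j → Disjoint (T i) (T j))
    (hc : ∀ ξ ∈ S, ∃ i ∈ s, ξ ∈ T i) :
    ∃ Φ : ι → E → ℂ, (∀ i, Spec (S ∩ T i) (Φ i)) ∧ (∀ x, φ x = ∑ i ∈ s, Φ i x) ∧
      ∑ i ∈ s, nsq (Φ i) ≤ nsq φ := by
  classical
  obtain ⟨f, h1, h2, h3, rfl⟩ := hφ
  refine ⟨fun i => 𝓕 ((T i).indicator f), fun i => ⟨_, h1.indicator (hT i), h2.indicator (hT i), ?_, rfl⟩, ?_, ?_⟩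
  · intro ξ hξ
    by_cases h : ξ ∈ T i
    · rw [Set.indicator_of_mem h]; exact h3 _ fun hs => hξ ⟨hs, h⟩
    · rw [Set.indicator_of_notMem h]
  · intro x
    simp only [Real.fourier_eq]
    rw [← integral_finsetSum]
    · refine integral_congr_ae (.of_forall fun ξ => ?_)
      simp only
      rw [← Finset.smul_sum]
      congr 1
      by_cases hξ : ξ ∈ S
      · obtain ⟨i, hi, hiT⟩ := hc ξ hξ
        rw [Finset.sum_eq_single i, Set.indicator_of_mem hiT]
        · intro j _ hj
          exact Set.indicator_of_notMem (fun h => Set.disjoint_left.1 (hd j i hj) h hiT) _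
        · exact fun h => absurd hi h
      · rw [h3 ξ hξ, Finset.sum_eq_zero]
        intro i _
        by_cases h : ξ ∈ T i
        · rw [Set.indicator_of_mem h, h3 ξ hξ]
        · rw [Set.indicator_of_notMem h]
    · intro i _
      exact (Real.fourierIntegral_convergent_iff x).2 (h1.indicator (hT i))
  · have : ∀ i ∈ s, nsq (𝓕 ((T i).indicator f)) = ∫⁻ ξ in T i, ‖f ξ‖ₑ ^ 2 := by
      intro i _
      rw [nsq_fourier (h1.indicator (hT i)) (h2.indicator (hT i)), nsq, ← lintegral_indicator (hT i)]
      refine lintegral_congr fun ξ => ?_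
      by_cases h : ξ ∈ T i <;> simp [h]
    rw [Finset.sum_congr rfl this, nsq_fourier h1 h2, nsq,
      ← lintegral_biUnion_finset (fun i _ j _ hij => hd i j hij) (fun i _ => hT i)]
    exact setLIntegral_le_lintegral _ _

end Spec
end Fourier

theorem sq_lintegral_mul_le {α : Type*} [MeasurableSpace α] {μ : Measure α} {k g : α → ℝ≥0∞}
    (hk : AEMeasurable k μ) (hg : AEMeasurable g μ) :
    (∫⁻ x, k x * g x ∂μ) ^ 2 ≤ (∫⁻ x, k x ∂μ) * ∫⁻ x, k x * g x ^ 2 ∂μ := by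
  have h := ENNReal.lintegral_mul_le_Lp_mul_Lq μ Real.HolderConjugate.two_two
    (f := fun x => k x ^ (1/2 : ℝ)) (g := fun x => k x ^ (1/2 : ℝ) * g x)
    (hk.pow_const _) ((hk.pow_const _).mul hg)
  have e0 : ∀ x : ℝ≥0∞, x ^ (1/2:ℝ) * x ^ (1/2:ℝ) = x := fun x => by
    rw [← ENNReal.rpow_add_of_nonneg _ _ (by norm_num) (by norm_num)]; norm_num
  have e1 : ∀ x : ℝ≥0∞, (x ^ (1/2:ℝ)) ^ (2:ℝ) = x := fun x => by
    rw [← ENNReal.rpow_mul]; norm_num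
  have e2 : ∀ x : ℝ≥0∞, (x ^ (1/2:ℝ)) ^ 2 = x := fun x => by rw [sq, e0]
  simp only [Pi.mul_apply, ← mul_assoc, e0, e1] at h
  simp only [ENNReal.mul_rpow_of_nonneg _ _ (by norm_num : (0:ℝ) ≤ 2), e1] at h
  calc _ ≤ _ := pow_le_pow_left' h 2
    _ = _ := by simp only [mul_pow, e2, ENNReal.rpow_ofNat]

section Fourier
variable {E : Type*} [NormedAddCommGroup E] [InnerProductSpace ℝ E] [FiniteDimensional ℝ E]
  [MeasurableSpace E] [BorelSpace E]

theorem integral_mul_fourier_sub {f ρ : E → ℂ} (hf : Integrable f) (hρ : Integrable ρ) (x : E) :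
    ∫ y, ρ y * 𝓕 f (x - y) = 𝓕 (fun ξ => 𝓕⁻ ρ ξ * f ξ) x := by
  have hI : Integrable (fun p : E × E => ρ p.1 * ((Real.fourierChar (-⟪p.2, x - p.1⟫) : ℂ) * f p.2))
      (volume.prod volume) := by
    have h := hρ.mul_prod hf
    have hc : Continuous fun p : E × E => (Real.fourierChar (-⟪p.2, x - p.1⟫) : ℂ) := by
      have := Real.continuous_fourierChar
      fun_prop
    refine (h.bdd_mul (c := 1) hc.aestronglyMeasurable
      (.of_forall fun p => (Circle.norm_coe _).le)).congr (.of_forall fun p => by ring)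
  simp only [Real.fourier_eq, Real.fourierInv_eq, Circle.smul_def, smul_eq_mul]
  simp only [← integral_const_mul, ← integral_mul_const]
  rw [integral_integral_swap hI]
  refine integral_congr_ae (.of_forall fun ξ => ?_)
  simp only
  refine integral_congr_ae (.of_forall fun y => ?_)
  have : (-⟪ξ, x - y⟫ : ℝ) = -⟪ξ, x⟫ + ⟪y, ξ⟫ := by
    rw [inner_sub_right, real_inner_comm ξ y]; ring
  simp only [this, AddChar.map_add_eq_mul, Circle.coe_mul]
  ring

namespace Spec
variable {S T : Set E} {φ ψ : E → ℂ}

theorem repro (hφ : Spec S φ) {ρ : E → ℂ} (hρ : Integrable ρ) (hb : ∀ ξ ∈ S, 𝓕⁻ ρ ξ = 1) (x : E) :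
    φ x = ∫ y, ρ y * φ (x - y) := by
  obtain ⟨f, h1, h2, h3, rfl⟩ := hφ
  rw [integral_mul_fourier_sub h1 hρ]
  refine congrArg (fun F : E → ℂ => 𝓕 F x) (funext fun ξ => ?_)
  by_cases h : ξ ∈ S
  · rw [hb ξ h, one_mul]
  · rw [h3 ξ h, mul_zero]

theorem enorm_sq_le (hφ : Spec S φ) {ρ : E → ℂ} (hρ : Integrable ρ) (hb : ∀ ξ ∈ S, 𝓕⁻ ρ ξ = 1)
    (x : E) :
    ‖φ x‖ₑ ^ 2 ≤ (∫⁻ y, ‖ρ y‖ₑ) * ∫⁻ y, ‖ρ y‖ₑ * ‖φ (x - y)‖ₑ ^ 2 := by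
  have h : ‖φ x‖ₑ ≤ ∫⁻ y, ‖ρ y‖ₑ * ‖φ (x - y)‖ₑ := by
    conv_lhs => rw [hφ.repro hρ hb x]
    refine (enorm_integral_le_lintegral_enorm _).trans_eq ?_
    simp [enorm_mul]
  refine (pow_le_pow_left' h 2).trans (sq_lintegral_mul_le hρ.1.enorm ?_)
  have := hφ.continuous
  exact (Continuous.enorm (by fun_prop)).aemeasurable

theorem conv {k : E → ℂ} (hk : Spec T k) {ρ : E → ℂ} (hρ : Integrable ρ) :
    Spec T (fun x => ∫ y, ρ y * k (x - y)) := by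
  obtain ⟨b, h1, h2, h3, rfl⟩ := hk
  have hc : Continuous (𝓕⁻ ρ) := by
    rw [show 𝓕⁻ ρ = fun x => 𝓕 ρ (-x) from funext fun x => Real.fourierInv_eq_fourier_neg ρ x]
    have : Continuous (𝓕 ρ) := VectorFourier.fourierIntegral_continuous Real.continuous_fourierChar
      (by simpa using continuous_inner) hρ
    fun_prop
  have hbd : ∀ ξ, ‖𝓕⁻ ρ ξ‖ ≤ ∫ y, ‖ρ y‖ := fun ξ => by
    rw [Real.fourierInv_eq_fourier_neg]
    exact VectorFourier.norm_fourierIntegral_le_integral_norm _ _ _ _ _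
  refine ⟨fun ξ => 𝓕⁻ ρ ξ * b ξ, ?_, ?_, ?_, ?_⟩
  · exact h1.bdd_mul hc.aestronglyMeasurable (.of_forall hbd)
  · exact MemLp.of_le_mul (c := ∫ y, ‖ρ y‖) h2 (hc.aestronglyMeasurable.mul h2.1)
      (.of_forall fun ξ => by
        simp only [norm_mul]; exact mul_le_mul_of_nonneg_right (hbd ξ) (norm_nonneg _))
  · intro ξ hξ; simp [h3 ξ hξ]
  · ext x
    rw [← integral_mul_fourier_sub h1 hρ]

end Spec
end Fourier

section Fourier
variable {E : Type*} [NormedAddCommGroup E] [InnerProductSpace ℝ E] [FiniteDimensional ℝ E]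
  [MeasurableSpace E] [BorelSpace E]

namespace Spec
variable {S T : Set E} {φ ψ : E → ℂ}

theorem of_tendsto (hS : Bornology.IsBounded S) {g : ℕ → E → ℂ} (hg : ∀ n, Spec S (g n))
    (hφ : Continuous φ) (hφ2 : MemLp φ 2)
    (hlim : Filter.Tendsto (fun n => nsq (g n - φ)) Filter.atTop (𝓝 0)) : Spec S φ := by
  choose f h1 h2 h3 h4 using hg
  have hgL : ∀ n, MemLp (g n) 2 := fun n => (h4 n) ▸ memLp_fourier (h1 n) (h2 n)
  have hG : ∀ n, (hgL n).toLp (g n) = 𝓕 ((h2 n).toLp (f n)) := fun n => by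
    rw [← toLp_fourier (h1 n) (h2 n)]; congr 1; exact h4 n
  have hlim2 : Filter.Tendsto (fun n => (hgL n).toLp (g n)) Filter.atTop (𝓝 (hφ2.toLp φ)) := by
    rw [Lp.tendsto_Lp_iff_tendsto_eLpNorm'']
    have : ∀ n, eLpNorm (g n - φ) 2 volume = (nsq (g n - φ)) ^ (1/2 : ℝ) := fun n => by
      rw [nsq_eq_eLpNorm_sq, ← ENNReal.rpow_natCast, ← ENNReal.rpow_mul]; norm_num
    simp only [this]
    have := (ENNReal.continuous_rpow_const (y := (1/2:ℝ))).tendsto 0 |>.comp hlim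
    rw [ENNReal.zero_rpow_of_pos (by norm_num)] at this
    exact this
  set F : Lp (α := E) ℂ 2 volume := 𝓕⁻ (hφ2.toLp φ)
  have hF : 𝓕 F = hφ2.toLp φ := FourierTransform.fourier_fourierInv_eq _
  have hlim3 : Filter.Tendsto (fun n => (h2 n).toLp (f n)) Filter.atTop (𝓝 F) := by
    have : ∀ n, (h2 n).toLp (f n) = 𝓕⁻ ((hgL n).toLp (g n)) := fun n => by
      rw [hG, FourierTransform.fourierInv_fourier_eq]
    simp only [this]
    exact ((Lp.fourierTransformₗᵢ E ℂ).symm.continuous.tendsto _).comp hlim2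
  obtain ⟨ns, -, hns⟩ := (tendstoInMeasure_of_tendsto_Lp hlim3).exists_seq_tendsto_ae
  have hF0 : ∀ᵐ ξ, ξ ∉ S → F ξ = 0 := by
    have hall : ∀ᵐ ξ, ∀ n, (h2 n).toLp (f n) ξ = f n ξ := ae_all_iff.2 fun n => (h2 n).coeFn_toLp
    filter_upwards [hns, hall] with ξ hξ hξ2 hS'
    simp only [hξ2, h3 _ ξ hS'] at hξ
    exact tendsto_nhds_unique hξ tendsto_const_nhds
  classical
  set f' : E → ℂ := S.indicator F
  have hff : f' =ᵐ[volume] F := by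
    filter_upwards [hF0] with ξ hξ
    by_cases h : ξ ∈ S
    · simp [f', h]
    · simp [f', h, hξ h]
  have hf2 : MemLp f' 2 := (memLp_congr_ae hff).2 (Lp.memLp F)
  obtain ⟨r, hr⟩ := hS.subset_closedBall 0
  have hf1 : Integrable f' := by
    have : IntegrableOn f' (closedBall 0 r) := by
      have hr2 : MemLp f' 2 (volume.restrict (closedBall 0 r)) := hf2.restrict _
      have : IsFiniteMeasure ((volume : Measure E).restrict (closedBall 0 r)) :=
        ⟨by simpa using measure_closedBall_lt_top⟩
      exact hr2.integrable (by norm_num)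
    rw [← integrable_indicator_iff measurableSet_closedBall] at this
    refine this.congr (.of_forall fun ξ => ?_)
    by_cases h : ξ ∈ closedBall (0:E) r
    · rw [Set.indicator_of_mem h]
    · rw [Set.indicator_of_notMem h]
      exact (Set.indicator_of_notMem (fun h' => h (hr h')) _).symm
  refine ⟨f', hf1, hf2, fun ξ hξ => by simp [f', hξ], ?_⟩
  have hc : Continuous (𝓕 f') := VectorFourier.fourierIntegral_continuous Real.continuous_fourierChar
      (by simpa using continuous_inner) hf1
  refine (Continuous.ae_eq_iff_eq volume hφ hc).1 ?_
  have e1 : hf2.toLp f' = F := Lp.ext (hf2.coeFn_toLp.trans hff)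
  have e2 := fourier_toLp_ae_eq hf1 hf2
  rw [e1, hF] at e2
  exact hφ2.coeFn_toLp.symm.trans e2

theorem conv_mul (hφ : Spec S φ) {k : E → ℂ} (hk : Spec T k) (hki : Integrable k)
    (hST : Bornology.IsBounded (T + S)) {ρ : E → ℂ} (hρ : Measurable ρ) (hρ1 : ∀ x, ‖ρ x‖ ≤ 1) :
    Spec (T + S) (fun x => (∫ y, ρ y * k (x - y)) * φ x) := by
  set ρn : ℕ → E → ℂ := fun n => (closedBall (0:E) n).indicator ρ
  have hρn1 : ∀ n x, ‖ρn n x‖ ≤ 1 := fun n x =>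
    (norm_indicator_le_norm_self _ _).trans (hρ1 x)
  have hρn : ∀ n, Integrable (ρn n) := fun n => by
    refine (integrable_indicator_iff measurableSet_closedBall).2 ?_
    exact Measure.integrableOn_of_bounded (M := 1) measure_closedBall_lt_top.ne
      hρ.aestronglyMeasurable (.of_forall hρ1)
  have hkx : ∀ x, Integrable (fun y => ‖k (x - y)‖) := fun x => (hki.comp_sub_left x).norm
  have hbd : ∀ (σ : E → ℂ), (∀ x, ‖σ x‖ ≤ 1) → ∀ x, ‖∫ y, σ y * k (x - y)‖ ≤ ∫ y, ‖k y‖ := by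
    intro σ hσ x
    rw [← integral_sub_left_eq_self (fun y => ‖k y‖) volume x]
    refine norm_integral_le_of_norm_le (hkx x) (.of_forall fun y => ?_)
    rw [norm_mul]
    exact mul_le_of_le_one_left (norm_nonneg _) (hσ y)
  set A : E → ℂ := fun x => ∫ y, ρ y * k (x - y)
  have hAc : Continuous A := by
    have htail : Filter.Tendsto (fun n : ℕ => ∫ y, ((closedBall (0:E) n)ᶜ).indicator (fun y => ‖k y‖) y)
        Filter.atTop (𝓝 0) := by
      have : (0:ℝ) = ∫ _ : E, (0:ℝ) := by simp
      rw [this]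
      refine tendsto_integral_of_dominated_convergence (fun y => ‖k y‖) (fun n => ?_) hki.norm
        (fun n => .of_forall fun y => ?_) (.of_forall fun y => ?_)
      · exact hki.norm.1.indicator measurableSet_closedBall.compl
      · exact (norm_indicator_le_norm_self _ _).trans (by simp)
      · refine tendsto_const_nhds.congr' ?_
        filter_upwards [Filter.eventually_ge_atTop ⌈‖y‖⌉₊] with n hn
        refine (Set.indicator_of_notMem ?_ _).symm
        simpa using (Nat.le_ceil _).trans (by exact_mod_cast hn)
    have hunif : TendstoLocallyUniformly (fun n x => ∫ y, ρn n y * k (x - y)) A Filter.atTop := by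
      refine Metric.tendstoLocallyUniformly_iff.2 fun ε hε x => ?_
      obtain ⟨m, hm⟩ := exists_nat_ge (‖x‖ + 1)
      refine ⟨ball x 1, ball_mem_nhds _ one_pos, ?_⟩
      have := (htail.comp (Filter.tendsto_sub_atTop_nat m)).eventually (gt_mem_nhds hε)
      filter_upwards [this, Filter.eventually_ge_atTop m] with n hn hmn x' hx'
      refine lt_of_le_of_lt ?_ hn
      have hx'm : ‖x'‖ ≤ m := by
        have h1 : ‖x' - x‖ < 1 := by simpa [dist_eq_norm] using hx'
        have h2 := norm_le_insert' x' x
        linarith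
      rw [dist_eq_norm, ← integral_sub ((hki.comp_sub_left x').bdd_mul (c := 1)
        hρ.aestronglyMeasurable (.of_forall hρ1)) ((hki.comp_sub_left x').bdd_mul (c := 1)
        (hρn n).1 (.of_forall (hρn1 n))), Function.comp_apply,
        ← integral_sub_left_eq_self (((closedBall (0:E) _)ᶜ).indicator _) volume x']
      refine norm_integral_le_of_norm_le ?_ (.of_forall fun y => ?_)
      · exact ((hki.norm.indicator measurableSet_closedBall.compl).comp_sub_left x')
      · rw [← sub_mul, norm_mul]
        by_cases hy : y ∈ closedBall (0:E) n
        · simp only [ρn, Set.indicator_of_mem hy, sub_self, norm_zero, zero_mul]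
          exact Set.indicator_nonneg (fun _ _ => norm_nonneg _) _
        · simp only [ρn, Set.indicator_of_notMem hy, sub_zero]
          rw [Set.indicator_of_mem]
          · exact mul_le_of_le_one_left (norm_nonneg _) (hρ1 y)
          · simp only [mem_closedBall, dist_zero_right, not_le, Set.mem_compl_iff] at hy ⊢
            rw [Nat.cast_sub hmn]
            have := norm_le_insert x' y
            have h3 : ‖y‖ ≤ ‖x'‖ + ‖x' - y‖ := by simpa using norm_sub_le x' (x' - y)
            linarith
    exact hunif.continuous (.of_forall fun n => (conv hk (hρn n)).continuous)
  have hlimA : ∀ x, Filter.Tendsto (fun n => ∫ y, ρn n y * k (x - y)) Filter.atTop (𝓝 (A x)) := by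
    intro x
    refine tendsto_integral_of_dominated_convergence _ (fun n => ?_) (hkx x) (fun n => ?_) ?_
    · exact ((hρn n).1).mul (hki.comp_sub_left x).1
    · refine .of_forall fun y => ?_
      rw [norm_mul]; exact mul_le_of_le_one_left (norm_nonneg _) (hρn1 n y)
    · refine .of_forall fun y => Filter.Tendsto.mul_const _ ?_
      refine tendsto_const_nhds.congr' ?_
      filter_upwards [Filter.eventually_ge_atTop ⌈‖y‖⌉₊] with n hn
      refine (Set.indicator_of_mem ?_ _).symm
      simpa using (Nat.le_ceil _).trans (by exact_mod_cast hn)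
  have hAφ : MemLp (fun x => A x * φ x) 2 :=
    MemLp.of_le_mul (c := ∫ y, ‖k y‖) hφ.memLp (hAc.mul hφ.continuous).aestronglyMeasurable
      (.of_forall fun x => by
        rw [norm_mul]; exact mul_le_mul_of_nonneg_right (hbd ρ hρ1 x) (norm_nonneg _))
  refine of_tendsto hST (g := fun n x => (∫ y, ρn n y * k (x - y)) * φ x)
    (fun n => (conv hk (hρn n)).mul hφ) (hAc.mul hφ.continuous) hAφ ?_
  have h0 : (0 : ℝ≥0∞) = ∫⁻ _ : E, 0 := by simp
  rw [h0]
  refine tendsto_lintegral_of_dominated_convergence'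
    (fun x => ENNReal.ofReal (2 * ∫ y, ‖k y‖) ^ 2 * ‖φ x‖ₑ ^ 2) (fun n => ?_) (fun n => ?_) ?_ ?_
  · have := ((conv hk (hρn n)).mul hφ).continuous.sub (hAc.mul hφ.continuous)
    exact (Continuous.enorm this).measurable.pow_const 2 |>.aemeasurable
  · refine .of_forall fun x => ?_
    beta_reduce
    rw [← mul_pow]
    refine pow_le_pow_left' ?_ 2
    simp only [Pi.sub_apply, ← sub_mul, enorm_mul]
    refine mul_le_mul_left ?_ _
    rw [← ofReal_norm]
    refine ENNReal.ofReal_le_ofReal ((norm_sub_le _ _).trans ?_)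
    linarith [hbd ρ hρ1 x, hbd _ (hρn1 n) x]
  · have := hφ.nsq_lt_top
    rw [lintegral_const_mul' _ _ (by finiteness)]
    exact ENNReal.mul_ne_top (by finiteness) this.ne
  · refine .of_forall fun x => ?_
    have : Filter.Tendsto (fun n => (∫ y, ρn n y * k (x - y)) * φ x - A x * φ x) Filter.atTop (𝓝 0) := by
      have := ((hlimA x).mul_const (φ x)).sub_const (A x * φ x)
      simpa using this
    have := (ENNReal.continuous_pow 2).tendsto _ |>.comp this.enorm
    simp only [enorm_zero, ne_eq, OfNat.ofNat_ne_zero, not_false_eq_true, zero_pow] at this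
    exact this

end Spec
end Fourier

/-- The decaying weight `(1 + t)⁻ᴺ`. -/
noncomputable def dec (N : ℕ) (t : ℝ≥0∞) : ℝ≥0∞ := (1 + t)⁻¹ ^ N

theorem dec_le_one (N : ℕ) (t : ℝ≥0∞) : dec N t ≤ 1 :=
  pow_le_one' (ENNReal.inv_le_one.2 le_self_add) N

theorem dec_ne_top (N : ℕ) (t : ℝ≥0∞) : dec N t ≠ ⊤ := ((dec_le_one N t).trans_lt ENNReal.one_lt_top).ne

theorem dec_anti_left {N M : ℕ} (h : N ≤ M) (t : ℝ≥0∞) : dec M t ≤ dec N t :=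
  pow_le_pow_right_of_le_one' (ENNReal.inv_le_one.2 le_self_add) h

theorem dec_add (N M : ℕ) (t : ℝ≥0∞) : dec (N + M) t = dec N t * dec M t := pow_add _ _ _

theorem dec_ne_zero (N : ℕ) {t : ℝ≥0∞} (ht : t ≠ ⊤) : dec N t ≠ 0 :=
  pow_ne_zero _ (ENNReal.inv_ne_zero.2 (by finiteness))

theorem pow_mul_dec (N : ℕ) {t : ℝ≥0∞} (ht : t ≠ ⊤) : (1 + t) ^ N * dec N t = 1 := by
  rw [dec, ← mul_pow, ENNReal.mul_inv_cancel (by simp) (by finiteness), one_pow]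

theorem dec_le_mul_dec (N : ℕ) {t t' u : ℝ≥0∞} (hu : u ≠ ⊤) (ht : t ≠ ⊤) (h : t' ≤ t + u) :
    dec N t ≤ (1 + u) ^ N * dec N t' := by
  unfold dec
  rw [← mul_pow]
  refine pow_le_pow_left' ?_ N
  have h1 : 1 + t' ≤ (1 + u) * (1 + t) := by
    calc 1 + t' ≤ 1 + (t + u) := by gcongr
      _ ≤ 1 + (t + u) + u * t := le_self_add
      _ = (1 + u) * (1 + t) := by ring
  calc (1 + t)⁻¹ = (1 + u) * ((1 + u) * (1 + t))⁻¹ := by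
        rw [ENNReal.mul_inv (by simp) (by simp), ← mul_assoc,
          ENNReal.mul_inv_cancel (by simp) (by finiteness), one_mul]
    _ ≤ (1 + u) * (1 + t')⁻¹ := by gcongr

theorem measurable_dec (N : ℕ) : Measurable (dec N) := by unfold dec; fun_prop

@[fun_prop]
theorem Measurable.dec {α : Type*} [MeasurableSpace α] {N : ℕ} {f : α → ℝ≥0∞} (hf : Measurable f) :
    Measurable (fun x => _root_.dec N (f x)) := (measurable_dec N).comp hf

section Fourier
variable {E : Type*} [NormedAddCommGroup E] [InnerProductSpace ℝ E] [FiniteDimensional ℝ E]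
  [MeasurableSpace E] [BorelSpace E]

theorem dec_enorm_eq (N : ℕ) (x : E) : dec N ‖x‖ₑ = ENNReal.ofReal ((1 + ‖x‖) ^ (-(N : ℝ))) := by
  rw [Real.rpow_neg (by positivity), Real.rpow_natCast, ← inv_pow, ENNReal.ofReal_pow (by positivity),
    ENNReal.ofReal_inv_of_pos (by positivity), ENNReal.ofReal_add zero_le_one (norm_nonneg _),
    ofReal_norm, ENNReal.ofReal_one, dec]

theorem lintegral_dec_lt_top {N : ℕ} (hN : Module.finrank ℝ E < N) :
    ∫⁻ x : E, dec N ‖x‖ₑ < ⊤ := by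
  simp only [dec_enorm_eq]
  exact finite_integral_one_add_norm (by exact_mod_cast hN)

theorem SchwartzMap.exists_enorm_le_dec (f : 𝓢(E, ℂ)) (N : ℕ) :
    ∃ C : ℝ≥0∞, C ≠ ⊤ ∧ ∀ x, ‖f x‖ₑ ≤ C * dec N ‖x‖ₑ := by
  refine ⟨ENNReal.ofReal (2 ^ N * (Finset.Iic (N, 0)).sup (fun m => SchwartzMap.seminorm ℝ m.1 m.2) f),
    ENNReal.ofReal_ne_top, fun x => ?_⟩
  have h := SchwartzMap.one_add_le_sup_seminorm_apply (𝕜 := ℝ) (m := (N, 0)) le_rfl le_rfl f x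
  rw [norm_iteratedFDeriv_zero] at h
  rw [dec_enorm_eq, ← ENNReal.ofReal_mul (by positivity), ← ofReal_norm]
  refine ENNReal.ofReal_le_ofReal ?_
  rw [Real.rpow_neg (by positivity), Real.rpow_natCast, ← div_eq_mul_inv, le_div_iff₀ (by positivity),
    mul_comm]
  exact h

theorem lintegral_comp_linearEquiv (A : E ≃ₗ[ℝ] E) {F : E → ℝ≥0∞} (hF : Measurable F) :
    ∫⁻ x, F (A x) = ENNReal.ofReal |(LinearMap.det (A : E →ₗ[ℝ] E))|⁻¹ * ∫⁻ x, F x := by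
  have hd : LinearMap.det (A : E →ₗ[ℝ] E) ≠ 0 := (LinearEquiv.isUnit_det' A).ne_zero
  have hm : Measurable A := A.toContinuousLinearEquiv.continuous.measurable
  rw [← lintegral_map hF hm, show (A : E → E) = ((A : E →ₗ[ℝ] E) : E → E) from rfl,
    Measure.map_linearMap_addHaar_eq_smul_addHaar _ hd, lintegral_smul_measure, abs_inv, smul_eq_mul]

theorem integral_comp_linearEquiv (A : E ≃ₗ[ℝ] E) (F : E → ℂ) :
    ∫ x, F (A x) = ((|(LinearMap.det (A : E →ₗ[ℝ] E))|⁻¹ : ℝ) : ℂ) * ∫ x, F x := by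
  have hd : LinearMap.det (A : E →ₗ[ℝ] E) ≠ 0 := (LinearEquiv.isUnit_det' A).ne_zero
  have he := A.toContinuousLinearEquiv.toHomeomorph.measurableEmbedding.integral_map (μ := volume) F
  have := Measure.map_linearMap_addHaar_eq_smul_addHaar (volume : Measure E) hd
  change Measure.map (A.toContinuousLinearEquiv.toHomeomorph) volume = _ at this
  rw [this, integral_smul_measure, ENNReal.toReal_ofReal (abs_nonneg _), abs_inv] at he
  rw [← Complex.real_smul]
  exact he.symm

theorem quasiMeasurePreserving_linearEquiv (A : E ≃ₗ[ℝ] E) :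
    Measure.QuasiMeasurePreserving A (volume : Measure E) volume := by
  have hd : LinearMap.det (A : E →ₗ[ℝ] E) ≠ 0 := (LinearEquiv.isUnit_det' A).ne_zero
  refine ⟨A.toContinuousLinearEquiv.continuous.measurable, ?_⟩
  have := Measure.map_linearMap_addHaar_eq_smul_addHaar (volume : Measure E) hd
  rw [show (A : E → E) = ((A : E →ₗ[ℝ] E) : E → E) from rfl, this]
  exact Measure.smul_absolutelyContinuous

namespace Spec
variable {S T : Set E} {φ ψ : E → ℂ}

theorem const_mul (hφ : Spec S φ) (c : ℂ) : Spec S (fun x => c * φ x) := by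
  obtain ⟨f, h1, h2, h3, rfl⟩ := hφ
  refine ⟨fun ξ => c * f ξ, h1.const_mul c, h2.const_mul c, fun ξ hξ => by simp [h3 ξ hξ], ?_⟩
  ext x
  simp only [Real.fourier_eq, Circle.smul_def, smul_eq_mul, ← integral_const_mul]
  congr 1; ext; ring

/-- Modulation and linear change of variables. -/
theorem affine (hφ : Spec S φ) {L : E → E} (Lt : E ≃ₗ[ℝ] E) (hL : ∀ x ξ, ⟪ξ, L x⟫ = ⟪Lt ξ, x⟫)
    (p : E) :
    Spec {ζ | Lt.symm (ζ - p) ∈ S} (fun x => (Real.fourierChar (-⟪p, x⟫) : ℂ) * φ (L x)) := by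
  obtain ⟨f, h1, h2, h3, rfl⟩ := hφ
  set D : ℝ := |LinearMap.det (Lt.symm : E →ₗ[ℝ] E)|
  have hD : 0 < D := abs_pos.2 (LinearEquiv.isUnit_det' Lt.symm).ne_zero
  have hm : Measurable Lt.symm := Lt.symm.toContinuousLinearEquiv.continuous.measurable
  have hq := (quasiMeasurePreserving_linearEquiv Lt.symm)
  have hfm : AEStronglyMeasurable (fun ζ => f (Lt.symm ζ)) volume := h1.1.comp_quasiMeasurePreserving hq
  have key : ∀ F : E → ℝ≥0∞, AEMeasurable F → ∫⁻ x, F x < ⊤ → ∫⁻ x, F (Lt.symm x) < ⊤ := by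
    intro F hF hF'
    have e := lintegral_congr_ae (hq.ae_eq_comp hF.ae_eq_mk)
    simp only [Function.comp_def] at e
    rw [e, lintegral_comp_linearEquiv _ hF.measurable_mk, ← lintegral_congr_ae hF.ae_eq_mk]
    exact ENNReal.mul_lt_top ENNReal.ofReal_lt_top hF'
  have i1 : Integrable (fun ζ => f (Lt.symm ζ)) := ⟨hfm, key _ h1.1.enorm h1.2⟩
  have i2 : MemLp (fun ζ => f (Lt.symm ζ)) 2 := by
    rw [memLp_two_iff_integrable_sq_norm hfm]
    have := ((memLp_two_iff_integrable_sq_norm h2.1).1 h2)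
    exact ⟨hfm.norm.pow 2, key _ this.1.enorm this.2⟩
  refine ⟨fun ζ => (D : ℂ) * f (Lt.symm (ζ - p)), (i1.comp_sub_right p).const_mul _,
    (i2.comp_measurePreserving (measurePreserving_sub_right volume p)).const_mul _,
    fun ζ hζ => ?_, ?_⟩
  · beta_reduce; rw [h3 _ hζ, mul_zero]
  · ext x
    simp only [Real.fourier_eq, Circle.smul_def, smul_eq_mul]
    rw [← integral_add_right_eq_self (fun v => (Real.fourierChar (-⟪v, x⟫) : ℂ) *
      ((D : ℂ) * f (Lt.symm (v - p)))) p]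
    simp only [add_sub_cancel_right]
    have := integral_comp_linearEquiv Lt.symm (fun ξ => (Real.fourierChar (-⟪Lt ξ + p, x⟫) : ℂ) *
      ((D : ℂ) * f ξ))
    simp only [LinearEquiv.apply_symm_apply] at this
    rw [this, ← integral_const_mul, ← integral_const_mul]
    congr 1
    ext ξ
    rw [hL, inner_add_left, neg_add, AddChar.map_add_eq_mul, Circle.coe_mul]
    have : ((|LinearMap.det (Lt.symm : E →ₗ[ℝ] E)|⁻¹ : ℝ) : ℂ) * D = 1 := by
      rw [← Complex.ofReal_mul, inv_mul_cancel₀ hD.ne', Complex.ofReal_one]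
    linear_combination (-(Real.fourierChar (-⟪Lt ξ, x⟫) : ℂ) * (Real.fourierChar (-⟪p, x⟫) : ℂ) * f ξ) * this

end Spec

theorem enorm_circle (z : Circle) : ‖(z : ℂ)‖ₑ = 1 := by
  rw [← ofReal_norm, Circle.norm_coe, ENNReal.ofReal_one]

theorem exists_schwartz_fourierInv_eq_one (r : ℝ) :
    ∃ ρ : 𝓢(E, ℂ), ∀ ξ, ‖ξ‖ ≤ r → 𝓕⁻ (ρ : E → ℂ) ξ = 1 := by
  let g : ContDiffBump (0 : E) := ⟨max r 1, max r 1 + 1, by positivity, by linarith⟩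
  let G : 𝓢(E, ℂ) := HasCompactSupport.toSchwartzMap (f := fun x => (g x : ℂ))
    (g.hasCompactSupport.comp_left (g := fun x : ℝ => (x : ℂ)) (by simp))
    (Complex.ofRealCLM.contDiff.comp g.contDiff)
  refine ⟨𝓕 G, fun ξ hξ => ?_⟩
  rw [← SchwartzMap.fourierInv_coe, FourierTransform.fourierInv_fourier_eq]
  change ((g ξ : ℝ) : ℂ) = 1
  rw [g.one_of_mem_closedBall]
  · simp
  · rw [mem_closedBall, dist_zero_right]; exact hξ.trans (le_max_left r 1)

theorem exists_enorm_sq_le_dec (E : Type*) [NormedAddCommGroup E] [InnerProductSpace ℝ E]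
    [FiniteDimensional ℝ E] [MeasurableSpace E] [BorelSpace E] (r : ℝ) (N : ℕ) :
    ∃ C : ℝ≥0∞, C ≠ ⊤ ∧ ∀ (L : E ≃ₗ[ℝ] E) (Lt : E ≃ₗ[ℝ] E), (∀ x ξ, ⟪ξ, L x⟫ = ⟪Lt ξ, x⟫) →
      ∀ (p : E) (φ : E → ℂ), Spec {ζ | ‖Lt.symm (ζ - p)‖ ≤ r} φ → ∀ x,
      ‖φ x‖ₑ ^ 2 ≤ C * ∫⁻ y, ENNReal.ofReal |LinearMap.det (L : E →ₗ[ℝ] E)| *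
        dec N ‖L (x - y)‖ₑ * ‖φ y‖ₑ ^ 2 := by
  obtain ⟨ρ, hρ⟩ := exists_schwartz_fourierInv_eq_one (E := E) r
  obtain ⟨C, hC, hdec⟩ := ρ.exists_enorm_le_dec N
  have hI : ∫⁻ y, ‖ρ y‖ₑ ≠ ⊤ := (ρ.integrable.2).ne
  refine ⟨(∫⁻ y, ‖ρ y‖ₑ) * C, ENNReal.mul_ne_top hI hC, fun L Lt hLt p φ hφ x => ?_⟩
  have hadj : ∀ x ξ, ⟪ξ, L.symm x⟫ = ⟪Lt.symm ξ, x⟫ := fun x ξ => by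
    have := hLt (L.symm x) (Lt.symm ξ)
    simpa using this.symm
  have h := hφ.affine Lt.symm hadj (-(Lt.symm p))
  have hc := hφ.continuous
  have h' := (h.mono (T := {ζ | ‖ζ‖ ≤ r}) (fun ζ hζ => by simpa using hζ)).enorm_sq_le
    ρ.integrable (fun ξ hξ => hρ ξ hξ) (L x)
  simp only [enorm_mul, enorm_circle, one_mul, LinearEquiv.symm_apply_apply, map_sub] at h'
  refine h'.trans ?_
  rw [mul_assoc]
  refine mul_le_mul_right ?_ _
  have e := lintegral_comp_linearEquiv L.symm
    (F := fun y => C * dec N ‖L y‖ₑ * ‖φ (x - y)‖ₑ ^ 2) (by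
      have := L.toContinuousLinearEquiv.continuous.measurable
      have h2 : Measurable L := this
      have h3 := hc.measurable
      fun_prop)
  have hdet : |LinearMap.det (L.symm : E →ₗ[ℝ] E)|⁻¹ = |LinearMap.det (L : E →ₗ[ℝ] E)| := by
    rw [← LinearEquiv.coe_det, ← LinearEquiv.coe_det, LinearEquiv.det_symm]; simp
  rw [hdet] at e
  calc _ ≤ ∫⁻ y, C * dec N ‖L (L.symm y)‖ₑ * ‖φ (x - L.symm y)‖ₑ ^ 2 := by
        refine lintegral_mono fun y => ?_
        rw [LinearEquiv.apply_symm_apply]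
        gcongr
        exact hdec y
    _ = _ := e
    _ = _ := by
      rw [← lintegral_sub_left_eq_self _ x, ← lintegral_const_mul', ← lintegral_const_mul' _ _ hC]
      · congr 1; ext y; rw [sub_sub_cancel]; ring
      · exact ENNReal.ofReal_ne_top

end Fourier

section Fourier
variable {E : Type*} [NormedAddCommGroup E] [InnerProductSpace ℝ E] [FiniteDimensional ℝ E]
  [MeasurableSpace E] [BorelSpace E]

/-- A nonnegative band-limited rapidly decreasing kernel of integral one. -/
structure IsMollifier (k : E → ℝ) : Prop where
  cont : Continuous k
  nonneg : ∀ x, 0 ≤ k x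
  integrable : Integrable k
  integral_one : ∫ x, k x = 1
  pos_zero : 0 < k 0
  spec : Spec (closedBall 0 1) (fun x => (k x : ℂ))
  decay : ∀ N : ℕ, ∃ C : ℝ≥0∞, C ≠ ⊤ ∧ ∀ x, ENNReal.ofReal (k x) ≤ C * dec N ‖x‖ₑ

theorem exists_isMollifier : ∃ k : E → ℝ, IsMollifier k := by
  let g : ContDiffBump (0 : E) := ⟨1 / 4, 1 / 2, by norm_num, by norm_num⟩
  let G : 𝓢(E, ℂ) := HasCompactSupport.toSchwartzMap (f := fun x => (g x : ℂ))
    (g.hasCompactSupport.comp_left (g := fun x : ℝ => (x : ℂ)) (by simp))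
    (Complex.ofRealCLM.contDiff.comp g.contDiff)
  have hG : ∀ x, G x = (g x : ℂ) := fun x => rfl
  have hspec : Spec (closedBall (0 : E) (1 / 2)) (𝓕 (G : E → ℂ)) := by
    refine ⟨G, G.integrable, G.memLp 2, fun ξ hξ => ?_, rfl⟩
    rw [hG, g.zero_of_le_dist, Complex.ofReal_zero]
    exact (not_le.1 hξ).le
  have hreal : ∀ x, starRingEnd ℂ (𝓕 (G : E → ℂ) x) = 𝓕 (G : E → ℂ) x := by
    intro x
    simp only [Real.fourier_eq, Circle.smul_def, smul_eq_mul]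
    rw [← integral_conj, ← integral_neg_eq_self]
    congr 1; ext v
    rw [hG, hG, g.neg, map_mul, Complex.conj_ofReal, inner_neg_left, neg_neg, ← Circle.coe_inv_eq_conj,
      ← AddChar.map_neg_eq_inv]
  set F : E → ℝ := fun x => ‖𝓕 (G : E → ℂ) x‖ ^ 2
  have hFeq : ∀ x, ((F x : ℝ) : ℂ) = 𝓕 (G : E → ℂ) x * 𝓕 (G : E → ℂ) x := fun x => by
    simp only [F]
    rw [Complex.ofReal_pow, ← Complex.conj_mul', hreal]
  have hFspec : Spec (closedBall (0 : E) 1) (fun x => ((F x : ℝ) : ℂ)) := by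
    simp only [hFeq]
    refine (hspec.mul hspec).mono ?_
    rintro _ ⟨a, ha, b, hb, rfl⟩
    simp only [mem_closedBall, dist_zero_right] at *
    linarith [norm_add_le a b]
  have hFc : Continuous F := by have := hspec.continuous; fun_prop
  have hFi : Integrable F := by
    have := hspec.memLp
    exact (memLp_two_iff_integrable_sq_norm this.1).1 this
  have hF0 : 0 < F 0 := by
    have : 𝓕 (G : E → ℂ) 0 = ((∫ x, g x : ℝ) : ℂ) := by
      rw [Real.fourier_eq, ← integral_complex_ofReal]
      congr 1; ext v; simp [hG]
    simp only [F, this]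
    have := g.integral_pos (μ := volume)
    exact pow_pos (norm_pos_iff.2 (Complex.ofReal_ne_zero.2 this.ne')) 2
  have hpos : 0 < ∫ x, F x := by
    rw [integral_pos_iff_support_of_nonneg (fun x => by positivity) hFi]
    exact hFc.isOpen_support.measure_pos _ ⟨0, hF0.ne'⟩
  have hF' : ∀ x, F x = ‖𝓕 (G : E → ℂ) x‖ ^ 2 := fun x => rfl
  have hFn : ∀ x, 0 ≤ F x := fun x => by positivity
  clear_value F
  refine ⟨fun x => (∫ x, F x)⁻¹ * F x, by fun_prop, fun x => mul_nonneg (inv_nonneg.2 hpos.le) (hFn x), hFi.const_mul _, ?_, by positivity, ?_, ?_⟩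
  · rw [integral_const_mul, inv_mul_cancel₀ hpos.ne']
  · simpa using hFspec.const_mul (((∫ x, F x)⁻¹ : ℝ) : ℂ)
  · intro N
    obtain ⟨C, hC, h⟩ := (𝓕 G).exists_enorm_le_dec N
    refine ⟨ENNReal.ofReal (∫ x, F x)⁻¹ * C ^ 2, by finiteness, fun x => ?_⟩
    rw [ENNReal.ofReal_mul (inv_nonneg.2 hpos.le), mul_assoc]
    refine mul_le_mul_right ?_ _
    rw [hF', ENNReal.ofReal_pow (norm_nonneg _), ofReal_norm]
    calc _ ≤ (C * dec N ‖x‖ₑ) ^ 2 := pow_le_pow_left' (h x) 2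
      _ = C ^ 2 * dec N ‖x‖ₑ * dec N ‖x‖ₑ := by ring
      _ ≤ C ^ 2 * dec N ‖x‖ₑ * 1 := by gcongr; exact dec_le_one _ _
      _ = _ := mul_one _

/-- The average of `ρ` against the mollifier `k` adapted to `L`. -/
noncomputable def avg (k : E → ℝ) (L : E ≃ₗ[ℝ] E) (ρ : E → ℝ) (x : E) : ℝ :=
  ∫ z, ρ (x - L.symm z) * k z

namespace IsMollifier
variable {k : E → ℝ} {L Lt : E ≃ₗ[ℝ] E} {ρ : E → ℝ}

theorem integrable_avg (hk : IsMollifier k) (hρ : Measurable ρ) (h0 : ∀ x, 0 ≤ ρ x) (h1 : ∀ x, ρ x ≤ 1) (x : E) :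
    Integrable (fun z => ρ (x - L.symm z) * k z) := by
  have hm : Measurable L.symm := L.symm.toContinuousLinearEquiv.continuous.measurable
  refine hk.integrable.bdd_mul (c := 1)
    (by fun_prop : Measurable fun z => ρ (x - L.symm z)).aestronglyMeasurable (.of_forall fun z => ?_)
  rw [Real.norm_of_nonneg (h0 _)]; exact h1 _

theorem avg_nonneg (hk : IsMollifier k) (h0 : ∀ x, 0 ≤ ρ x) (x : E) : 0 ≤ avg k L ρ x :=
  integral_nonneg fun z => mul_nonneg (h0 _) (hk.nonneg z)

theorem ofReal_avg (hk : IsMollifier k) (hρ : Measurable ρ) (h0 : ∀ x, 0 ≤ ρ x) (h1 : ∀ x, ρ x ≤ 1) (x : E) :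
    ENNReal.ofReal (avg k L ρ x) =
      ∫⁻ z, ENNReal.ofReal (ρ (x - L.symm z)) * ENNReal.ofReal (k z) := by
  rw [avg, ofReal_integral_eq_lintegral_ofReal (hk.integrable_avg hρ h0 h1 x)
    (.of_forall fun z => mul_nonneg (h0 _) (hk.nonneg z))]
  congr 1; ext z; rw [ENNReal.ofReal_mul (h0 _)]

theorem avg_le_one (hk : IsMollifier k) (hρ : Measurable ρ) (h0 : ∀ x, 0 ≤ ρ x) (h1 : ∀ x, ρ x ≤ 1) (x : E) :
    avg k L ρ x ≤ 1 := by
  rw [← hk.integral_one]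
  refine integral_mono (hk.integrable_avg hρ h0 h1 x) hk.integrable fun z => ?_
  exact mul_le_of_le_one_left (hk.nonneg z) (h1 _)

theorem sum_avg (hk : IsMollifier k) {ι : Type*} (s : Finset ι) {ρ : ι → E → ℝ} (hρ : ∀ i, Measurable (ρ i))
    (h0 : ∀ i x, 0 ≤ ρ i x) (h1 : ∀ i x, ρ i x ≤ 1) (hs : ∀ x, ∑ i ∈ s, ρ i x = 1) (x : E) :
    ∑ i ∈ s, avg k L (ρ i) x = 1 := by
  simp only [avg]
  rw [← integral_finsetSum _ fun i _ => hk.integrable_avg (hρ i) (h0 i) (h1 i) x]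
  simp only [← Finset.sum_mul, hs, one_mul, hk.integral_one]

theorem coe_avg (x : E) : ((avg k L ρ x : ℝ) : ℂ) =
    ∫ y, (ρ y : ℂ) * ((|LinearMap.det (L : E →ₗ[ℝ] E)| : ℝ) * (k (L (x - y)) : ℂ)) := by
  have hdet : |LinearMap.det (L.symm : E →ₗ[ℝ] E)|⁻¹ = |LinearMap.det (L : E →ₗ[ℝ] E)| := by
    rw [← LinearEquiv.coe_det, ← LinearEquiv.coe_det, LinearEquiv.det_symm]; simp
  have e := integral_comp_linearEquiv L.symm (fun y => (ρ (x - y) : ℂ) * (k (L y) : ℂ))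
  rw [hdet] at e
  rw [avg, ← integral_complex_ofReal, ← integral_sub_left_eq_self
    (fun y => (ρ y : ℂ) * ((|LinearMap.det (L : E →ₗ[ℝ] E)| : ℝ) * (k (L (x - y)) : ℂ))) volume x]
  simp only [LinearEquiv.apply_symm_apply] at e
  simp only [sub_sub_cancel, Complex.ofReal_mul]
  rw [e, ← integral_const_mul]
  congr 1; ext; ring

theorem spec_kernel (hk : IsMollifier k) (hL : ∀ x ξ, ⟪ξ, L x⟫ = ⟪Lt ξ, x⟫) :
    Spec {ζ | ‖Lt.symm ζ‖ ≤ 1} (fun x => ((|LinearMap.det (L : E →ₗ[ℝ] E)| : ℝ) : ℂ) * (k (L x) : ℂ)) := by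
  have := (hk.spec.affine Lt hL 0).const_mul ((|LinearMap.det (L : E →ₗ[ℝ] E)| : ℝ) : ℂ)
  simpa using this

theorem spec_avg (hk : IsMollifier k) (hL : ∀ x ξ, ⟪ξ, L x⟫ = ⟪Lt ξ, x⟫) (hρ : Integrable ρ) :
    Spec {ζ | ‖Lt.symm ζ‖ ≤ 1} (fun x => (avg k L ρ x : ℂ)) := by
  simp only [coe_avg]
  exact (hk.spec_kernel hL).conv hρ.ofReal

theorem spec_avg_mul (hk : IsMollifier k) {S : Set E} {φ : E → ℂ} (hφ : Spec S φ) (hS : Bornology.IsBounded S)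
    (hL : ∀ x ξ, ⟪ξ, L x⟫ = ⟪Lt ξ, x⟫) (hρ : Measurable ρ) (h0 : ∀ x, 0 ≤ ρ x) (h1 : ∀ x, ρ x ≤ 1) :
    Spec ({ζ | ‖Lt.symm ζ‖ ≤ 1} + S) (fun x => (avg k L ρ x : ℂ) * φ x) := by
  simp only [coe_avg]
  have hbd : Bornology.IsBounded {ζ | ‖Lt.symm ζ‖ ≤ 1} := by
    have := (isCompact_closedBall (0 : E) 1).image Lt.toContinuousLinearEquiv.continuous
    refine this.isBounded.subset fun ζ hζ => ⟨Lt.symm ζ, by simpa using hζ, by simp⟩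
  refine hφ.conv_mul (hk.spec_kernel hL) ?_ (hbd.add hS) (by fun_prop) (fun x => ?_)
  · refine Integrable.const_mul ?_ _
    have hm : Measurable L := L.toContinuousLinearEquiv.continuous.measurable
    have hc := hk.cont
    refine Integrable.ofReal ⟨(by fun_prop : Measurable fun x => k (L x)).aestronglyMeasurable, ?_⟩
    have := lintegral_comp_linearEquiv L (F := fun x => ‖k x‖ₑ) (by fun_prop)
    rw [HasFiniteIntegral, this]
    exact ENNReal.mul_lt_top ENNReal.ofReal_lt_top hk.integrable.2
  · rw [Complex.norm_real, Real.norm_of_nonneg (h0 x)]; exact h1 x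

end IsMollifier

/-- The tube map: `x ↦ r⁻¹ (x - ⟪x, e⟫ ν) + r⁻² ⟪x, e⟫ e`. -/
noncomputable def tubeMap {r : ℝ} (hr : 0 < r) {e ν : E} (he : ‖e‖ = 1) (hν : ⟪ν, e⟫ = 1) : E ≃ₗ[ℝ] E where
  toFun x := r⁻¹ • (x - ⟪x, e⟫ • ν) + (r⁻¹ ^ 2 * ⟪x, e⟫) • e
  map_add' x y := by simp only [inner_add_left]; module
  map_smul' c x := by simp only [inner_smul_left, RingHom.id_apply]; simp; module
  invFun y := r • (y - ⟪y, e⟫ • e) + (r ^ 2 * ⟪y, e⟫) • ν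
  left_inv x := by
    have hee : ⟪e, e⟫ = 1 := by simp [he]
    simp only [inner_add_left, inner_sub_left, inner_smul_left, hν, hee, conj_trivial, mul_one,
      sub_self, mul_zero, zero_add]
    match_scalars <;> field_simp <;> ring
  right_inv y := by
    have hee : ⟪e, e⟫ = 1 := by simp [he]
    simp only [inner_add_left, inner_sub_left, inner_smul_left, hν, hee, conj_trivial, mul_one,
      sub_self, mul_zero, zero_add]
    match_scalars <;> field_simp <;> ring

/-- The adjoint of `tubeMap`. -/
noncomputable def plateMap {r : ℝ} (hr : 0 < r) {e ν : E} (he : ‖e‖ = 1) (hν : ⟪ν, e⟫ = 1) : E ≃ₗ[ℝ] E where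
  toFun ξ := r⁻¹ • (ξ - ⟪ξ, ν⟫ • e) + (r⁻¹ ^ 2 * ⟪ξ, e⟫) • e
  map_add' x y := by simp only [inner_add_left]; module
  map_smul' c x := by simp only [inner_smul_left, RingHom.id_apply]; simp; module
  invFun ζ := r • (ζ - ⟪ζ, e⟫ • e) + (r ^ 2 * ⟪ζ, ν⟫) • e
  left_inv x := by
    have hee : ⟪e, e⟫ = 1 := by simp [he]
    have hν' : ⟪e, ν⟫ = 1 := by rw [real_inner_comm, hν]
    simp only [inner_add_left, inner_sub_left, inner_smul_left, hν', hee, conj_trivial, mul_one,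
      sub_self, mul_zero, zero_add]
    match_scalars <;> field_simp <;> ring
  right_inv y := by
    have hee : ⟪e, e⟫ = 1 := by simp [he]
    have hν' : ⟪e, ν⟫ = 1 := by rw [real_inner_comm, hν]
    simp only [inner_add_left, inner_sub_left, inner_smul_left, hν', hee, conj_trivial, mul_one,
      sub_self, mul_zero, zero_add]
    match_scalars <;> field_simp <;> ring

section tube
variable {r : ℝ} (hr : 0 < r) {e ν : E} (he : ‖e‖ = 1) (hν : ⟪ν, e⟫ = 1)

theorem tubeMap_apply (x : E) : tubeMap hr he hν x = r⁻¹ • (x - ⟪x, e⟫ • ν) + (r⁻¹ ^ 2 * ⟪x, e⟫) • e := rfl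

theorem inner_tubeMap (x ξ : E) : ⟪ξ, tubeMap hr he hν x⟫ = ⟪plateMap hr he hν ξ, x⟫ := by
  change ⟪ξ, r⁻¹ • (x - ⟪x, e⟫ • ν) + (r⁻¹ ^ 2 * ⟪x, e⟫) • e⟫ =
    ⟪r⁻¹ • (ξ - ⟪ξ, ν⟫ • e) + (r⁻¹ ^ 2 * ⟪ξ, e⟫) • e, x⟫
  simp only [inner_add_left, inner_sub_left, inner_smul_left, inner_add_right, inner_sub_right,
    inner_smul_right, conj_trivial, real_inner_comm x e]
  ring

theorem abs_det_tubeMap : |LinearMap.det (tubeMap hr he hν : E →ₗ[ℝ] E)| =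
    r⁻¹ ^ (Module.finrank ℝ E + 1) := by
  have : (tubeMap hr he hν : E →ₗ[ℝ] E) =
      r⁻¹ • LinearMap.transvection (innerₗ E e : Module.Dual ℝ E) (r⁻¹ • e - ν) := by
    ext x
    simp only [LinearEquiv.coe_coe, tubeMap_apply, LinearMap.smul_apply, LinearMap.transvection.apply,
      innerₗ_apply_apply, real_inner_comm x e]
    module
  rw [this, LinearMap.det_smul, LinearMap.transvection.det]
  have hee : ⟪e, e⟫ = 1 := by simp [he]
  simp only [innerₗ_apply_apply, inner_sub_right, inner_smul_right, hee, real_inner_comm ν e, hν]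
  rw [show (1:ℝ) + (r⁻¹ * 1 - 1) = r⁻¹ by ring, ← pow_succ, abs_of_pos (by positivity)]

end tube
end Fourier

section Fourier
variable {E : Type*} [NormedAddCommGroup E] [InnerProductSpace ℝ E] [FiniteDimensional ℝ E]
  [MeasurableSpace E] [BorelSpace E]

/-- Band-limited majorants of indicator functions which decay rapidly off the given set. -/
theorem exists_localizer (N : ℕ) : ∃ C : ℝ≥0∞, C ≠ ⊤ ∧ ∀ {l : ℝ}, 0 < l → ∀ {q : Set E},
    Bornology.IsBounded q → q.Nonempty → ∃ g : E → ℝ, (∀ x, 0 ≤ g x) ∧ (∀ x ∈ q, 1 ≤ g x) ∧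
      Spec (closedBall 0 l⁻¹) (fun x => (g x : ℂ)) ∧
      ∀ x, ENNReal.ofReal (g x) ≤ C * dec N (ENNReal.ofReal (infDist x q / l)) := by
  obtain ⟨k, hk⟩ := exists_isMollifier (E := E)
  set c : ℝ := ∫ z in closedBall (0 : E) 1, k z
  have hc : 0 < c := by
    rw [setIntegral_pos_iff_support_of_nonneg_ae (.of_forall hk.nonneg) hk.integrable.integrableOn]
    have : 0 < volume (Function.support k ∩ ball 0 1) :=
      (hk.cont.isOpen_support.inter isOpen_ball).measure_pos _ ⟨0, hk.pos_zero.ne', by simp⟩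
    exact this.trans_le (measure_mono (Set.inter_subset_inter_right _ ball_subset_closedBall))
  set D := Module.finrank ℝ E + 1
  obtain ⟨C, hC, hdecay⟩ := hk.decay (N + D)
  refine ⟨ENNReal.ofReal c⁻¹ * (C * (2 ^ N * ∫⁻ z : E, dec D ‖z‖ₑ)), ?_, ?_⟩
  · have := (lintegral_dec_lt_top (E := E) (N := D) (Nat.lt_succ_self _)).ne
    finiteness
  intro l hl q hq hqn
  let L : E ≃ₗ[ℝ] E := LinearEquiv.smulOfNeZero ℝ E l⁻¹ (inv_ne_zero hl.ne')
  have hLs : ∀ z, L.symm z = l • z := fun z => by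
    rw [LinearEquiv.symm_apply_eq]; simp [L, smul_smul, hl.ne']
  have hL : ∀ x ξ, ⟪ξ, L x⟫ = ⟪L ξ, x⟫ := fun x ξ => by
    simp [L, inner_smul_left, inner_smul_right]
  set Q := cthickening l q
  have hQm : MeasurableSet Q := isClosed_cthickening.measurableSet
  set ρ : E → ℝ := Q.indicator 1
  have hρm : Measurable ρ := measurable_one.indicator hQm
  have h0 : ∀ x, 0 ≤ ρ x := fun x => Set.indicator_nonneg (fun _ _ => zero_le_one) x
  have h1 : ∀ x, ρ x ≤ 1 := fun x => Set.indicator_le_self' (fun _ _ => zero_le_one) x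
  have hρi : Integrable ρ := by
    refine (integrable_indicator_iff hQm).2 (integrableOn_const ?_)
    exact (hq.cthickening.measure_lt_top).ne
  refine ⟨fun x => c⁻¹ * avg k L ρ x, fun x => mul_nonneg (by positivity) (hk.avg_nonneg h0 x), ?_, ?_, ?_⟩
  · intro x hx
    rw [← inv_mul_cancel₀ hc.ne']
    refine mul_le_mul_of_nonneg_left ?_ (by positivity)
    simp only [c]
    rw [avg, ← integral_indicator isClosed_closedBall.measurableSet]
    refine integral_mono (hk.integrable.indicator isClosed_closedBall.measurableSet)
      (hk.integrable_avg hρm h0 h1 x) fun z => ?_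
    by_cases hz : z ∈ closedBall (0 : E) 1
    · rw [Set.indicator_of_mem hz]
      have : x - L.symm z ∈ Q := by
        refine mem_cthickening_of_dist_le _ x _ _ hx ?_
        rw [dist_eq_norm, hLs, sub_sub_cancel_left, norm_neg, norm_smul, Real.norm_of_nonneg hl.le]
        exact mul_le_of_le_one_right hl.le (by simpa using hz)
      simp [ρ, this]
    · rw [Set.indicator_of_notMem hz]
      exact mul_nonneg (h0 _) (hk.nonneg z)
  · have := (hk.spec_avg (L := L) hL hρi).const_mul ((c⁻¹ : ℝ) : ℂ)
    simp only [← Complex.ofReal_mul] at this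
    refine this.mono fun ζ hζ => ?_
    simp only [Set.mem_ofPred_eq, hLs, norm_smul, Real.norm_of_nonneg hl.le] at hζ
    rw [mem_closedBall_zero_iff, ← one_div, le_div_iff₀' hl]
    exact hζ
  · intro x
    rw [ENNReal.ofReal_mul (by positivity), mul_assoc]
    gcongr
    rw [hk.ofReal_avg hρm h0 h1]
    calc _ ≤ ∫⁻ z, C * (2 ^ N * dec N (ENNReal.ofReal (infDist x q / l))) * dec D ‖z‖ₑ := by
          refine lintegral_mono fun z => ?_
          by_cases hz : x - L.symm z ∈ Q
          · have hd : infDist x q / l ≤ ‖z‖ + 1 := by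
              have e1 : infDist (x - L.symm z) q ≤ l :=
                ENNReal.toReal_le_of_le_ofReal hl.le hz
              have e2 := infDist_le_infDist_add_dist (x := x) (y := x - L.symm z) (s := q)
              rw [dist_eq_norm, hLs, sub_sub_cancel, norm_smul, Real.norm_of_nonneg hl.le] at e2
              rw [div_le_iff₀ hl]
              rw [hLs] at e1
              nlinarith
            have hd' : ENNReal.ofReal (infDist x q / l) ≤ ‖z‖ₑ + 1 := by
              rw [← ofReal_norm, ← ENNReal.ofReal_one, ← ENNReal.ofReal_add (by positivity) zero_le_one]
              exact ENNReal.ofReal_le_ofReal hd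
            calc _ ≤ 1 * (C * dec (N + D) ‖z‖ₑ) := by
                  gcongr
                  · exact ENNReal.ofReal_le_one.2 (h1 _)
                  · exact hdecay z
              _ = C * dec N ‖z‖ₑ * dec D ‖z‖ₑ := by rw [dec_add]; ring
              _ ≤ C * (2 ^ N * dec N (ENNReal.ofReal (infDist x q / l))) * dec D ‖z‖ₑ := by
                  gcongr
                  have := dec_le_mul_dec N ENNReal.one_ne_top enorm_ne_top hd'
                  rwa [one_add_one_eq_two] at this
          · simp [ρ, hz]
      _ = _ := by
          rw [lintegral_const_mul _ (by fun_prop)]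
          ring

/-- The unit cells of the lattice spanned by a fixed orthonormal basis. -/
def cell (z : Fin (Module.finrank ℝ E) → ℤ) : Set E :=
  {ξ | ∀ j, ⌊⟪stdOrthonormalBasis ℝ E j, ξ⟫⌋ = z j}

theorem measurableSet_cell (z : Fin (Module.finrank ℝ E) → ℤ) : MeasurableSet (cell z : Set E) := by
  have : (cell z : Set E) = ⋂ j, {ξ | ⌊⟪stdOrthonormalBasis ℝ E j, ξ⟫⌋ = z j} := by
    ext; simp [cell]
  rw [this]
  refine MeasurableSet.iInter fun j => ?_
  have hm : Measurable fun ξ : E => ⌊⟪stdOrthonormalBasis ℝ E j, ξ⟫⌋ :=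
    Int.measurable_floor.comp (by fun_prop)
  exact hm (measurableSet_singleton (z j))

theorem disjoint_cell {z z' : Fin (Module.finrank ℝ E) → ℤ} (h : z ≠ z') :
    Disjoint (cell z : Set E) (cell z') := by
  rw [Set.disjoint_left]
  intro ξ h1 h2
  exact h (funext fun j => (h1 j).symm.trans (h2 j))

theorem norm_sub_le_of_mem_cell {z : Fin (Module.finrank ℝ E) → ℤ} {ξ η : E} (hξ : ξ ∈ cell z)
    (hη : η ∈ cell z) : ‖ξ - η‖ ≤ √(Module.finrank ℝ E) := by
  refine Real.le_sqrt_of_sq_le ?_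
  rw [← (stdOrthonormalBasis ℝ E).sum_sq_norm_inner_right]
  calc _ ≤ ∑ j : Fin (Module.finrank ℝ E), (1 : ℝ) := by
        refine Finset.sum_le_sum fun j _ => ?_
        rw [inner_sub_right, Real.norm_eq_abs, sq_abs]
        have := Int.abs_sub_lt_one_of_floor_eq_floor ((hξ j).trans (hη j).symm)
        rw [abs_lt] at this
        nlinarith
    _ = _ := by simp

theorem exists_ball_subset_cell (z : Fin (Module.finrank ℝ E) → ℤ) :
    ∃ c : E, ball c (1 / 2) ⊆ cell z := by
  set b := stdOrthonormalBasis ℝ E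
  refine ⟨∑ j, ((z j : ℝ) + 1 / 2) • b j, fun ξ hξ j => ?_⟩
  rw [mem_ball, dist_eq_norm] at hξ
  have h1 := abs_real_inner_le_norm (b j) (ξ - ∑ j, ((z j : ℝ) + 1 / 2) • b j)
  rw [b.norm_eq_one, one_mul, inner_sub_right, b.orthonormal.inner_right_fintype] at h1
  have h2 := abs_lt.1 (h1.trans_lt hξ)
  rw [Int.floor_eq_iff]
  constructor <;> linarith [h2.1, h2.2]

/-- Sums of rapidly decreasing functions over points indexed by distinct cells. -/
theorem exists_sum_dec_le {N : ℕ} (hN : Module.finrank ℝ E < N) (C : ℝ) : ∃ B : ℝ≥0∞, B ≠ ⊤ ∧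
    ∀ (Θ : Finset (Fin (Module.finrank ℝ E) → ℤ)) (q : (Fin (Module.finrank ℝ E) → ℤ) → E),
      (∀ z ∈ Θ, ∃ ξ ∈ cell z, ‖q z - ξ‖ ≤ C) → ∀ a, ∑ z ∈ Θ, dec N ‖q z - a‖ₑ ≤ B := by
  set v : ℝ≥0∞ := volume (ball (0 : E) (1 / 2))
  have hv : v ≠ 0 := (measure_ball_pos _ _ (by norm_num)).ne'
  have hv' : v ≠ ⊤ := measure_ball_lt_top.ne
  set D : ℝ := |C| + √(Module.finrank ℝ E)
  refine ⟨v⁻¹ * ((1 + ENNReal.ofReal D) ^ N * ∫⁻ y : E, dec N ‖y‖ₑ), ?_, fun Θ q hq a => ?_⟩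
  · have := (lintegral_dec_lt_top (E := E) hN).ne
    finiteness
  rw [← ENNReal.mul_le_iff_le_inv hv hv', Finset.mul_sum]
  calc ∑ z ∈ Θ, v * dec N ‖q z - a‖ₑ
      ≤ ∑ z ∈ Θ, ∫⁻ y in cell z, (1 + ENNReal.ofReal D) ^ N * dec N ‖y - a‖ₑ := by
        refine Finset.sum_le_sum fun z hz => ?_
        obtain ⟨c, hc⟩ := exists_ball_subset_cell (E := E) z
        obtain ⟨ξ, hξ, hξ'⟩ := hq z hz
        have hvc : v ≤ volume (cell z : Set E) := by
          simp only [v]; rw [← Measure.addHaar_ball_center volume c]; exact measure_mono hc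
        calc v * dec N ‖q z - a‖ₑ ≤ dec N ‖q z - a‖ₑ * volume (cell z : Set E) := by
              rw [mul_comm]; gcongr
          _ = ∫⁻ y in cell z, dec N ‖q z - a‖ₑ := by simp
          _ ≤ _ := by
              refine setLIntegral_mono' (measurableSet_cell z) fun y hy => ?_
              refine dec_le_mul_dec N ENNReal.ofReal_ne_top enorm_ne_top ?_
              rw [← ofReal_norm, ← ofReal_norm, ← ENNReal.ofReal_add (by positivity) (by positivity)]
              refine ENNReal.ofReal_le_ofReal ?_
              have := norm_sub_le_of_mem_cell hξ hy
              have e : y - a = (q z - a) - (q z - ξ) - (ξ - y) := by abel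
              rw [e]
              linarith [norm_sub_le (q z - a - (q z - ξ)) (ξ - y), norm_sub_le (q z - a) (q z - ξ),
                le_abs_self C]
    _ = ∫⁻ y in ⋃ z ∈ Θ, cell z, (1 + ENNReal.ofReal D) ^ N * dec N ‖y - a‖ₑ := by
        rw [lintegral_biUnion_finset (fun z _ z' _ h => disjoint_cell h) (fun z _ => measurableSet_cell z)]
    _ ≤ ∫⁻ y, (1 + ENNReal.ofReal D) ^ N * dec N ‖y - a‖ₑ := setLIntegral_le_lintegral _ _
    _ = _ := by
        rw [lintegral_const_mul _ (by fun_prop), lintegral_sub_right_eq_self (fun y => dec N ‖y‖ₑ) a]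

end Fourier

section Fourier
variable {E : Type*} [NormedAddCommGroup E] [InnerProductSpace ℝ E]

/-- The component of `x` orthogonal to `e`. -/
def hpart (e x : E) : E := x - ⟪x, e⟫ • e

theorem hpart_add (e x y : E) : hpart e (x + y) = hpart e x + hpart e y := by
  simp only [hpart, inner_add_left]; module

theorem hpart_sub (e x y : E) : hpart e (x - y) = hpart e x - hpart e y := by
  simp only [hpart, inner_sub_left]; module

theorem hpart_smul (e x : E) (c : ℝ) : hpart e (c • x) = c • hpart e x := by
  simp only [hpart, inner_smul_left, conj_trivial]; module

theorem norm_hpart_le {e : E} (he : ‖e‖ = 1) (x : E) : ‖hpart e x‖ ≤ ‖x‖ := by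
  have hee : ⟪e, e⟫ = 1 := by simp [he]
  refine le_of_sq_le_sq ?_ (norm_nonneg _)
  rw [← real_inner_self_eq_norm_sq, ← real_inner_self_eq_norm_sq]
  simp only [hpart, inner_sub_left, inner_sub_right, inner_smul_left, inner_smul_right, conj_trivial, hee,
    real_inner_comm x e]
  nlinarith [sq_nonneg ⟪x, e⟫]

theorem norm_le_norm_hpart_add {e : E} (he : ‖e‖ = 1) (x : E) : ‖x‖ ≤ ‖hpart e x‖ + |⟪x, e⟫| := by
  have : x = hpart e x + ⟪x, e⟫ • e := by simp [hpart]
  calc ‖x‖ = ‖hpart e x + ⟪x, e⟫ • e‖ := by rw [← this]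
    _ ≤ _ := by
      refine (norm_add_le _ _).trans ?_
      rw [norm_smul, he, mul_one, Real.norm_eq_abs]

theorem inner_eq_inner_hpart (e x : E) {v : E} (hv : ⟪v, e⟫ = 0) : ⟪x, v⟫ = ⟪hpart e x, v⟫ := by
  rw [hpart, inner_sub_left, inner_smul_left, real_inner_comm v e, hv]; simp

theorem inner_left_eq_sub (e x : E) {v : E} (hv : ⟪v, e⟫ = 1) : ⟪x, e⟫ = ⟪x, v⟫ - ⟪hpart e x, v⟫ := by
  rw [hpart, inner_sub_left, inner_smul_left, real_inner_comm v e, hv]; simp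

/-- A uniformly convex hypersurface piece which is a graph over the orthogonal complement of `e`;
`ν p` is the normal at `p`, normalized so that its component along `e` is `e`. -/
structure IsCap (e : E) (ν : E → E) (c C : ℝ) (S : Set E) : Prop where
  norm_e : ‖e‖ = 1
  inner_normal : ∀ p, ⟪ν p, e⟫ = 1
  pos : 0 < c
  one_le : 1 ≤ C
  norm_normal : ∀ p ∈ S, ‖ν p‖ ≤ 1 + C * C
  lower : ∀ p ∈ S, ∀ p' ∈ S, c * ‖hpart e (p - p')‖ ^ 2 ≤ ⟪p - p', ν p⟫
  upper : ∀ p ∈ S, ∀ p' ∈ S, ⟪p - p', ν p⟫ ≤ C * ‖hpart e (p - p')‖ ^ 2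
  lip : ∀ p ∈ S, ∀ p' ∈ S, ‖ν p - ν p'‖ ≤ C * ‖hpart e (p - p')‖
  diam : ∀ p ∈ S, ∀ p' ∈ S, ‖hpart e (p - p')‖ ≤ C

/-- The plate of dimensions `a / r` and `a / r ^ 2` at `p`. -/
def plate (e : E) (ν : E → E) (r a : ℝ) (p : E) : Set E :=
  {ζ | r * ‖hpart e (ζ - p)‖ ≤ a ∧ r ^ 2 * |⟪ζ - p, ν p⟫| ≤ a}

/-- The anisotropic neighbourhood of `S` at scale `r`. -/
def nbhd (e : E) (ν : E → E) (r a : ℝ) (S : Set E) : Set E := {ζ | ∃ p ∈ S, ζ ∈ plate e ν r a p}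

theorem plate_mono {e : E} {ν : E → E} {r a b : ℝ} (h : a ≤ b) (p : E) :
    plate e ν r a p ⊆ plate e ν r b p := fun _ hζ => ⟨hζ.1.trans h, hζ.2.trans h⟩

theorem nbhd_mono {e : E} {ν : E → E} {r a b : ℝ} (h : a ≤ b) {S T : Set E} (hS : S ⊆ T) :
    nbhd e ν r a S ⊆ nbhd e ν r b T := fun _ ⟨p, hp, h'⟩ => ⟨p, hS hp, plate_mono h p h'⟩

namespace IsCap
variable {e : E} {ν : E → E} {c C : ℝ} {S T : Set E}

theorem subset (hS : IsCap e ν c C S) (h : T ⊆ S) : IsCap e ν c C T where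
  norm_e := hS.norm_e
  inner_normal := hS.inner_normal
  pos := hS.pos
  one_le := hS.one_le
  norm_normal p hp := hS.norm_normal p (h hp)
  lower p hp p' hp' := hS.lower p (h hp) p' (h hp')
  upper p hp p' hp' := hS.upper p (h hp) p' (h hp')
  lip p hp p' hp' := hS.lip p (h hp) p' (h hp')
  diam p hp p' hp' := hS.diam p (h hp) p' (h hp')

theorem abs_inner_le (hS : IsCap e ν c C S) {p p' : E} (hp : p ∈ S) (hp' : p' ∈ S) :
    |⟪p - p', ν p⟫| ≤ C * ‖hpart e (p - p')‖ ^ 2 := by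
  rw [abs_of_nonneg ((by have := hS.pos; positivity : (0:ℝ) ≤ _).trans (hS.lower p hp p' hp'))]
  exact hS.upper p hp p' hp'

theorem inner_normal_sub (hS : IsCap e ν c C S) (p p' : E) : ⟪ν p - ν p', e⟫ = 0 := by
  rw [inner_sub_left, hS.inner_normal, hS.inner_normal, sub_self]

theorem norm_sub_le (hS : IsCap e ν c C S) {p p' : E} (hp : p ∈ S) (hp' : p' ∈ S) :
    ‖p - p'‖ ≤ (2 + 2 * C * C) * ‖hpart e (p - p')‖ := by
  have h1 := norm_le_norm_hpart_add hS.norm_e (p - p')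
  have h2 := hS.abs_inner_le hp hp'
  have h3 := abs_real_inner_le_norm (hpart e (p - p')) (ν p)
  have h4 := hS.norm_normal p hp
  have h5 := hS.diam p hp p' hp'
  rw [inner_left_eq_sub e _ (hS.inner_normal p)] at h1
  have h6 := abs_sub ⟪p - p', ν p⟫ ⟪hpart e (p - p'), ν p⟫
  have h7 : ‖hpart e (p - p')‖ * ‖ν p‖ ≤ ‖hpart e (p - p')‖ * (1 + C * C) := by gcongr
  have h8 : C * ‖hpart e (p - p')‖ ^ 2 ≤ C * C * ‖hpart e (p - p')‖ := by
    have := hS.one_le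
    rw [pow_two, ← mul_assoc, mul_right_comm]; gcongr
  linarith

theorem norm_sub_le_of_mem_plate (hS : IsCap e ν c C S) {r a : ℝ} (hr : 1 ≤ r) {p ζ : E} (hp : p ∈ S)
    (hζ : ζ ∈ plate e ν r a p) : r * ‖ζ - p‖ ≤ (3 + C * C) * a := by
  have h1 := norm_le_norm_hpart_add hS.norm_e (ζ - p)
  have h3 := abs_real_inner_le_norm (hpart e (ζ - p)) (ν p)
  have h4 := hS.norm_normal p hp
  rw [inner_left_eq_sub e _ (hS.inner_normal p)] at h1
  have h6 := abs_sub ⟪ζ - p, ν p⟫ ⟪hpart e (ζ - p), ν p⟫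
  have h7 : ‖hpart e (ζ - p)‖ * ‖ν p‖ ≤ ‖hpart e (ζ - p)‖ * (1 + C * C) := by gcongr
  obtain ⟨h8, h9⟩ := hζ
  have h10 : r * |⟪ζ - p, ν p⟫| ≤ r ^ 2 * |⟪ζ - p, ν p⟫| := by
    gcongr; nlinarith
  have h11 : r * ‖ζ - p‖ ≤ r * (‖hpart e (ζ - p)‖ + (|⟪ζ - p, ν p⟫| + ‖hpart e (ζ - p)‖ * (1 + C * C))) := by
    gcongr; linarith
  have h12 : (1 + C * C) * (r * ‖hpart e (ζ - p)‖) ≤ (1 + C * C) * a := by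
    have := hS.one_le
    gcongr
  linarith

theorem plate_subset_plate (hS : IsCap e ν c C S) {r a b : ℝ} (hr : 1 ≤ r) {p p' : E} (hp : p ∈ S)
    (hp' : p' ∈ S) (hb : r * ‖hpart e (p - p')‖ ≤ b) :
    plate e ν r a p' ⊆ plate e ν r (a + b + C * a * b + C * b ^ 2) p := by
  rintro ζ ⟨h1, h2⟩
  have hr0 : 0 < r := by linarith
  have hC := hS.one_le
  have ha : 0 ≤ a := le_trans (by positivity) h1
  have hb0 : 0 ≤ b := le_trans (by positivity) hb
  have e1 : ζ - p = (ζ - p') - (p - p') := by abel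
  constructor
  · rw [e1, hpart_sub]
    have := _root_.norm_sub_le (hpart e (ζ - p')) (hpart e (p - p'))
    have : r * ‖hpart e (ζ - p') - hpart e (p - p')‖ ≤ r * (‖hpart e (ζ - p')‖ + ‖hpart e (p - p')‖) := by gcongr
    have : 0 ≤ C * a * b + C * b ^ 2 := by positivity
    linarith
  · have e2 : ⟪ζ - p, ν p⟫ = ⟪ζ - p', ν p'⟫ + ⟪hpart e (ζ - p'), ν p - ν p'⟫ - ⟪p - p', ν p⟫ := by
      rw [← inner_eq_inner_hpart e _ (hS.inner_normal_sub p p'), e1, inner_sub_left, inner_sub_right]; ring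
    have h3 := hS.abs_inner_le hp hp'
    have h4 := abs_real_inner_le_norm (hpart e (ζ - p')) (ν p - ν p')
    have h5 : ‖hpart e (ζ - p')‖ * ‖ν p - ν p'‖ ≤ ‖hpart e (ζ - p')‖ * (C * ‖hpart e (p - p')‖) := by
      gcongr; exact hS.lip p hp p' hp'
    have h6 : |⟪ζ - p, ν p⟫| ≤ |⟪ζ - p', ν p'⟫| + ‖hpart e (ζ - p')‖ * (C * ‖hpart e (p - p')‖) +
        C * ‖hpart e (p - p')‖ ^ 2 := by
      rw [e2]
      refine (abs_sub _ _).trans (add_le_add ((abs_add_le _ _).trans (add_le_add le_rfl (h4.trans h5))) h3)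
    have h7 : r * ‖hpart e (ζ - p')‖ * (C * (r * ‖hpart e (p - p')‖)) ≤ a * (C * b) := by gcongr
    have h8 : C * (r * ‖hpart e (p - p')‖) ^ 2 ≤ C * b ^ 2 := by gcongr
    calc r ^ 2 * |⟪ζ - p, ν p⟫| ≤ r ^ 2 * (|⟪ζ - p', ν p'⟫| + ‖hpart e (ζ - p')‖ * (C * ‖hpart e (p - p')‖) +
        C * ‖hpart e (p - p')‖ ^ 2) := by gcongr
      _ ≤ _ := by linarith

theorem isBounded (hS : IsCap e ν c C S) : Bornology.IsBounded S := by
  rcases S.eq_empty_or_nonempty with rfl | ⟨p0, h0⟩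
  · exact Bornology.isBounded_empty
  refine isBounded_closedBall (x := p0) (r := (2 + 2 * C * C) * C) |>.subset fun p hp => ?_
  rw [mem_closedBall, dist_eq_norm]
  refine (hS.norm_sub_le hp h0).trans ?_
  have := hS.one_le
  gcongr
  exact hS.diam p hp p0 h0

theorem isBounded_nbhd (hS : IsCap e ν c C S) {r a : ℝ} (hr : 1 ≤ r) : Bornology.IsBounded (nbhd e ν r a S) := by
  have hc := hS.isBounded.cthickening (δ := (3 + C * C) * a)
  refine hc.subset ?_
  rintro ζ ⟨p, hp, hζ⟩
  refine mem_cthickening_of_dist_le _ p _ _ hp ?_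
  rw [dist_eq_norm]
  exact le_trans (le_mul_of_one_le_left (norm_nonneg _) hr) (hS.norm_sub_le_of_mem_plate hr hp hζ)

variable [FiniteDimensional ℝ E] [MeasurableSpace E] [BorelSpace E]

/-- The tube map in the direction `ν p`. -/
noncomputable def tube (hS : IsCap e ν c C S) {r : ℝ} (hr : 0 < r) (p : E) : E ≃ₗ[ℝ] E :=
  tubeMap hr hS.norm_e (hS.inner_normal p)

/-- The adjoint of `IsCap.tube`. -/
noncomputable def dualTube (hS : IsCap e ν c C S) {r : ℝ} (hr : 0 < r) (p : E) : E ≃ₗ[ℝ] E :=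
  plateMap hr hS.norm_e (hS.inner_normal p)

theorem tube_apply (hS : IsCap e ν c C S) {r : ℝ} (hr : 0 < r) (p x : E) : hS.tube hr p x =
    r⁻¹ • (x - ⟪x, e⟫ • ν p) + (r⁻¹ ^ 2 * ⟪x, e⟫) • e := rfl

theorem inner_tube (hS : IsCap e ν c C S) {r : ℝ} (hr : 0 < r) (p x ξ : E) : ⟪ξ, hS.tube hr p x⟫ = ⟪hS.dualTube hr p ξ, x⟫ :=
  inner_tubeMap ..

theorem abs_det_tube (hS : IsCap e ν c C S) {r : ℝ} (hr : 0 < r) (p : E) : |LinearMap.det (hS.tube hr p : E →ₗ[ℝ] E)| =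
    r⁻¹ ^ (Module.finrank ℝ E + 1) := abs_det_tubeMap ..

theorem dualTube_symm_apply (hS : IsCap e ν c C S) {r : ℝ} (hr : 0 < r) (p x : E) :
    (hS.dualTube hr p).symm x = r • hpart e x + (r ^ 2 * ⟪x, ν p⟫) • e := rfl

theorem plate_subset (hS : IsCap e ν c C S) {r : ℝ} (hr : 0 < r) {a : ℝ} (p : E) :
    plate e ν r a p ⊆ {ζ | ‖(hS.dualTube hr p).symm (ζ - p)‖ ≤ 2 * a} := by
  rintro ζ ⟨h1, h2⟩
  rw [Set.mem_ofPred_eq, hS.dualTube_symm_apply]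
  refine (norm_add_le _ _).trans ?_
  rw [norm_smul, norm_smul, hS.norm_e, Real.norm_of_nonneg hr.le, norm_mul, Real.norm_of_nonneg (by positivity),
    Real.norm_eq_abs]
  linarith

theorem add_plate_subset (hS : IsCap e ν c C S) {r : ℝ} (hr : 0 < r) {a : ℝ} (p : E) :
    {ζ | ‖(hS.dualTube hr p).symm ζ‖ ≤ 1} + plate e ν r a p ⊆ plate e ν r (a + 1) p := by
  rintro _ ⟨ζ, h, ξ, ⟨h1, h2⟩, rfl⟩
  have hee : ⟪e, e⟫ = 1 := by simp [hS.norm_e]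
  have h3 : hpart e ((hS.dualTube hr p).symm ζ) = r • hpart e ζ := by
    rw [hS.dualTube_symm_apply]
    simp only [hpart, inner_add_left, inner_sub_left, inner_smul_left, hee, conj_trivial]
    module
  have h4 : ⟪(hS.dualTube hr p).symm ζ, e⟫ = r ^ 2 * ⟪ζ, ν p⟫ := by
    rw [hS.dualTube_symm_apply]
    simp only [hpart, inner_add_left, inner_sub_left, inner_smul_left, hee, conj_trivial]
    ring
  have h5 := (norm_hpart_le hS.norm_e ((hS.dualTube hr p).symm ζ)).trans h
  rw [h3, norm_smul, Real.norm_of_nonneg hr.le] at h5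
  have h6 := (abs_real_inner_le_norm ((hS.dualTube hr p).symm ζ) e).trans (mul_le_of_le_one_right (norm_nonneg _) hS.norm_e.le)
  rw [h4, abs_mul, abs_of_nonneg (by positivity)] at h6
  replace h6 := h6.trans h
  simp only [plate, Set.mem_ofPred_eq]
  rw [add_sub_assoc, hpart_add, inner_add_left]
  constructor
  · have := norm_add_le (hpart e ζ) (hpart e (ξ - p))
    nlinarith
  · have := abs_add_le ⟪ζ, ν p⟫ ⟪ξ - p, ν p⟫
    nlinarith [sq_nonneg r]

end IsCap

/-- The points `p z` are spread out at scale `1 / r`. -/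
def IsNet [FiniteDimensional ℝ E] {ι : Type*} (r : ℝ) (B : ℝ≥0∞) (Θ : Finset ι) (p : ι → E) : Prop :=
  ∀ a : E, ∑ z ∈ Θ, dec (Module.finrank ℝ E + 1) ‖r • (p z - a)‖ₑ ≤ B

/-- Wave packet decomposition in frequency. -/
theorem exists_isNet_decomp [FiniteDimensional ℝ E] [MeasurableSpace E] [BorelSpace E] (C a : ℝ) :
    ∃ a' : ℝ, ∃ B : ℝ≥0∞, B ≠ ⊤ ∧ ∀ {e : E} {ν : E → E} {c : ℝ} {S : Set E}, IsCap e ν c C S → ∀ {r : ℝ}, 1 ≤ r →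
      ∃ (Θ : Finset (Fin (Module.finrank ℝ E) → ℤ)) (p : (Fin (Module.finrank ℝ E) → ℤ) → E),
        (∀ z ∈ Θ, p z ∈ S) ∧ IsNet r B Θ p ∧ ∀ u, Spec (nbhd e ν r a S) u →
          ∃ U : (Fin (Module.finrank ℝ E) → ℤ) → E → ℂ, (∀ z ∈ Θ, Spec (plate e ν r a' (p z)) (U z)) ∧
            (∀ x, u x = ∑ z ∈ Θ, U z x) ∧ ∑ z ∈ Θ, nsq (U z) ≤ nsq u := by
  classical
  obtain ⟨B, hB, hsum⟩ := exists_sum_dec_le (E := E) (Nat.lt_succ_self _) ((3 + C * C) * a)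
  set b := 2 * a + √(Module.finrank ℝ E)
  refine ⟨a + b + C * a * b + C * b ^ 2, B, hB, fun {e ν c S} hS {r} hr => ?_⟩
  have hr0 : 0 < r := by linarith
  set Tz : (Fin (Module.finrank ℝ E) → ℤ) → Set E := fun z => {ξ | r • ξ ∈ cell z}
  set X := nbhd e ν r a S
  obtain ⟨K, hK⟩ := (hS.isBounded_nbhd (a := a) hr).exists_norm_le
  set T : ℤ := ⌈r * K⌉ + 1
  set Θ := (Fintype.piFinset fun _ : Fin (Module.finrank ℝ E) => Finset.Icc (-T) T).filter
    fun z => (X ∩ Tz z).Nonempty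
  have hpt : ∀ z, ∃ p ξ, z ∈ Θ → p ∈ S ∧ ξ ∈ plate e ν r a p ∧ r • ξ ∈ cell z := fun z => by
    by_cases hz : z ∈ Θ
    · obtain ⟨ξ, ⟨p, hp, h1⟩, h2⟩ := (Finset.mem_filter.1 hz).2
      exact ⟨p, ξ, fun _ => ⟨hp, h1, h2⟩⟩
    · exact ⟨0, 0, fun h => absurd h hz⟩
  choose p ξ hp using hpt
  refine ⟨Θ, p, fun z hz => (hp z hz).1, fun a0 => ?_, fun u hu => ?_⟩
  · have := hsum Θ (fun z => r • p z) (fun z hz => ⟨r • ξ z, (hp z hz).2.2, ?_⟩) (r • a0)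
    · simpa only [smul_sub] using this
    · rw [← smul_sub, norm_smul, Real.norm_of_nonneg hr0.le, ← norm_neg, neg_sub]
      exact hS.norm_sub_le_of_mem_plate hr (hp z hz).1 (hp z hz).2.1
  · have hcov : ∀ η ∈ X, ∃ z ∈ Θ, η ∈ Tz z := by
      intro η hη
      refine ⟨fun j => ⌊⟪stdOrthonormalBasis ℝ E j, r • η⟫⌋, ?_, fun j => rfl⟩
      refine Finset.mem_filter.2 ⟨Fintype.mem_piFinset.2 fun j => ?_, ⟨η, hη, fun j => rfl⟩⟩
      have h1 := abs_real_inner_le_norm (stdOrthonormalBasis ℝ E j) (r • η)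
      rw [OrthonormalBasis.norm_eq_one, one_mul, norm_smul, Real.norm_of_nonneg hr0.le] at h1
      have h2 := abs_le.1 (h1.trans (mul_le_mul_of_nonneg_left (hK η hη) hr0.le))
      have h3 := Int.le_ceil (r * K)
      rw [Finset.mem_Icc]
      constructor
      · rw [Int.le_floor]; simp only [T]; push_cast; linarith
      · refine Int.le_of_lt_add_one (Int.floor_lt.2 ?_); simp only [T]; push_cast; linarith
    obtain ⟨U, h1, h2, h3⟩ := hu.exists_split (s := Θ) (T := Tz)
      (fun z => (measurable_const_smul r) (measurableSet_cell z))
      (fun z z' h => (disjoint_cell h).preimage _) hcov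
    refine ⟨U, fun z hz => (h1 z).mono ?_, h2, h3⟩
    rintro η ⟨⟨p', hp', hη⟩, hηz⟩
    obtain ⟨g1, g2, g3⟩ := hp z hz
    refine hS.plate_subset_plate hr g1 hp' ?_ hη
    have h4 := norm_sub_le_of_mem_cell hηz g3
    rw [← smul_sub, norm_smul, Real.norm_of_nonneg hr0.le] at h4
    have h5 : p z - p' = (η - p') - (ξ z - p z) - (η - ξ z) := by abel
    have h6 : ‖hpart e (p z - p')‖ ≤ ‖hpart e (η - p')‖ + ‖hpart e (ξ z - p z)‖ + ‖η - ξ z‖ := by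
      rw [h5, hpart_sub, hpart_sub]
      refine (norm_sub_le _ _).trans (add_le_add (norm_sub_le _ _) (norm_hpart_le hS.norm_e _))
    have := hη.1
    have := g2.1
    have : r * ‖hpart e (p z - p')‖ ≤ r * (‖hpart e (η - p')‖ + ‖hpart e (ξ z - p z)‖ + ‖η - ξ z‖) := by gcongr
    simp only [b]
    linarith

end Fourier

section Fourier
variable {E : Type*} [NormedAddCommGroup E] [InnerProductSpace ℝ E]

theorem le_mul_of_quadratic_le {c t z Λ r A₁ A₂ A₃ M : ℝ} (hc : 0 < c) (hM : 0 < M) (hz : 0 ≤ z)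
    (hΛ : 1 ≤ Λ) (hr : 0 < r) (h₁ : 0 ≤ A₁) (h₂ : 0 ≤ A₂) (h₃ : 0 ≤ A₃) (ht : r ^ 2 ≤ M * t)
    (h : c * t * z ^ 2 ≤ A₁ * t * z + A₂ * r ^ 2 * Λ * z + A₃ * Λ * r ^ 2) :
    z ≤ ((A₁ + A₂ * M + A₃ * M) / c + 1) * Λ := by
  have ht0 : 0 < t := by nlinarith [pow_pos hr 2]
  by_contra! hlt
  set K := (A₁ + A₂ * M + A₃ * M) / c + 1
  have hK : A₁ + A₂ * M + A₃ * M = c * (K - 1) := by simp only [K]; field_simp; ring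
  have hK1 : 1 ≤ K := by simp only [K]; have : 0 ≤ (A₁ + A₂ * M + A₃ * M) / c := by positivity
                         linarith
  have hz1 : 1 ≤ z := by nlinarith
  have e1 : A₂ * r ^ 2 * Λ * z ≤ A₂ * (M * t) * Λ * z := by gcongr
  have e2 : A₃ * Λ * r ^ 2 ≤ A₃ * Λ * (M * t) * z := by
    calc A₃ * Λ * r ^ 2 ≤ A₃ * Λ * (M * t) := by gcongr
      _ ≤ _ := le_mul_of_one_le_right (by positivity) hz1
  have e3 : A₁ * t * z ≤ A₁ * t * z * Λ := le_mul_of_one_le_right (by positivity) hΛ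
  have e4 : c * t * z ^ 2 ≤ (c * (K - 1)) * Λ * (t * z) := by rw [← hK]; linarith
  have e5 : c * z ≤ c * (K - 1) * Λ := by
    refine le_of_mul_le_mul_right ?_ (by positivity : 0 < t * z)
    linarith
  have : z ≤ (K - 1) * Λ := le_of_mul_le_mul_left (by linarith) hc
  nlinarith

/-- The constant in `IsCap.transversal`. -/
noncomputable def transConst (c C D κ g M : ℝ) : ℝ :=
  (C * g / (2 * c * D) + (4 + 6 * C * κ / c) * M + 2 * g / (c * D) * M) / c + 1 + 8 * M * C

theorem transConst_pos {c C D κ g M : ℝ} (hc : 0 < c) (hC : 0 < C) (hD : 0 < D) (hκ : 0 < κ) (hg : 0 ≤ g)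
    (hM : 0 < M) : 0 < transConst c C D κ g M := by unfold transConst; positivity

theorem mul_le_transConst {c C D κ g M r t T δ Λ : ℝ} (hc : 0 < c) (hC : 0 < C) (hD : 0 < D) (hκ : 0 < κ)
    (hκc : 3 * C ^ 2 * κ ≤ 2 * c ^ 2) (hg : 0 ≤ g) (hM : 0 < M) (hr : 0 < r) (ht : 0 ≤ t)
    (hδ : 0 ≤ δ) (hδC : δ ≤ C) (hΛ : 1 ≤ Λ)
    (hT : T * (2 * c * D) ≤ t * (C * δ) + 4 * (r * Λ))
    (hP : 2 * c * δ ^ 2 * t ≤ T * (3 * C * κ * D * δ + g / r) + δ * (4 * (r * Λ)))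
    (hrM : r ^ 2 ≤ M * t ∨ r ≤ 8 * M * Λ) : r * δ ≤ transConst c C D κ g M * Λ := by
  have hΛ0 : 0 < Λ := by linarith
  have hT' : T ≤ (t * (C * δ) + 4 * (r * Λ)) / (2 * c * D) := by
    rw [le_div_iff₀ (by positivity)]; exact hT
  unfold transConst
  rcases hrM with hcase | hcase
  · have main : c * t * (r * δ) ^ 2 ≤ (C * g / (2 * c * D)) * t * (r * δ) +
        (4 + 6 * C * κ / c) * r ^ 2 * Λ * (r * δ) + (2 * g / (c * D)) * Λ * r ^ 2 := by
      have s1 : 2 * c * δ ^ 2 * t ≤ (t * (C * δ) + 4 * (r * Λ)) / (2 * c * D) *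
          (3 * C * κ * D * δ + g / r) + δ * (4 * (r * Λ)) := hP.trans (by gcongr)
      have s2 : (t * (C * δ) + 4 * (r * Λ)) / (2 * c * D) * (3 * C * κ * D * δ + g / r) =
          3 * C ^ 2 * κ / (2 * c) * t * δ ^ 2 + (C * g / (2 * c * D)) * t * δ / r +
          (6 * C * κ / c) * r * Λ * δ + (2 * g / (c * D)) * Λ := by
        field_simp; ring
      have s3 : 3 * C ^ 2 * κ / (2 * c) * t * δ ^ 2 ≤ c * t * δ ^ 2 := by
        gcongr; rw [div_le_iff₀ (by positivity)]; linarith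
      have s4 : c * t * δ ^ 2 ≤ (C * g / (2 * c * D)) * t * δ / r + (4 + 6 * C * κ / c) * r * Λ * δ +
          (2 * g / (c * D)) * Λ := by linarith
      calc c * t * (r * δ) ^ 2 = r ^ 2 * (c * t * δ ^ 2) := by ring
        _ ≤ _ := mul_le_mul_of_nonneg_left s4 (by positivity)
        _ = _ := by field_simp
    have := le_mul_of_quadratic_le hc hM (by positivity) hΛ hr (by positivity)
      (by positivity) (by positivity) hcase main
    exact this.trans (mul_le_mul_of_nonneg_right (le_add_of_nonneg_right (by positivity)) hΛ0.le)
  · calc r * δ ≤ (8 * M * Λ) * C := by gcongr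
      _ = 8 * M * C * Λ := by ring
      _ ≤ _ := mul_le_mul_of_nonneg_right (le_add_of_nonneg_left (by positivity)) hΛ0.le

namespace IsCap
variable {e : E} {ν : E → E} {c C : ℝ} {S T : Set E}

theorem le_inner_sub (hS : IsCap e ν c C S) {p q : E} (hp : p ∈ S) (hq : q ∈ S) :
    2 * c * ‖hpart e (p - q)‖ ^ 2 ≤ ⟪p - q, ν p - ν q⟫ := by
  have h1 := hS.lower p hp q hq
  have h2 := hS.lower q hq p hp
  rw [← neg_sub p q, inner_neg_left] at h2
  have : hpart e (-(p - q)) = - hpart e (p - q) := by simp only [hpart, inner_neg_left]; module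
  rw [this, norm_neg] at h2
  rw [inner_sub_right]; linarith

theorem le_norm_sub_normal (hS : IsCap e ν c C S) {p q : E} (hp : p ∈ S) (hq : q ∈ S) :
    2 * c * ‖hpart e (p - q)‖ ≤ ‖ν p - ν q‖ := by
  have h1 := hS.le_inner_sub hp hq
  rw [inner_eq_inner_hpart e _ (hS.inner_normal_sub p q)] at h1
  have h2 := h1.trans (real_inner_le_norm _ _)
  rcases (norm_nonneg (hpart e (p - q))).eq_or_lt with h0 | h0
  · rw [← h0]; simp
  · refine le_of_mul_le_mul_left ?_ h0
    linarith

theorem abs_inner_sub_le (hS : IsCap e ν c C S) {p q k : E} {ρ : ℝ} (hp : p ∈ S) (hq : q ∈ S) (hk : k ∈ S)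
    (h₁ : ‖hpart e (p - q)‖ ≤ ρ) (h₂ : ‖hpart e (k - p)‖ ≤ ρ) :
    |⟪p - q, ν k⟫| ≤ 2 * C * ρ * ‖hpart e (p - q)‖ := by
  have e1 : ⟪p - q, ν k⟫ = ⟪p - q, ν p⟫ + ⟪hpart e (p - q), ν k - ν p⟫ := by
    rw [← inner_eq_inner_hpart e _ (hS.inner_normal_sub k p), inner_sub_right]; ring
  have hC := hS.one_le
  have h3 := hS.abs_inner_le hp hq
  have h4 := abs_real_inner_le_norm (hpart e (p - q)) (ν k - ν p)
  have h5 : ‖hpart e (p - q)‖ * ‖ν k - ν p‖ ≤ ‖hpart e (p - q)‖ * (C * ρ) := by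
    gcongr; exact (hS.lip k hk p hp).trans (by gcongr)
  have h6 : C * ‖hpart e (p - q)‖ ^ 2 ≤ C * (ρ * ‖hpart e (p - q)‖) := by rw [pow_two]; gcongr
  rw [e1]
  linarith [abs_add_le ⟪p - q, ν p⟫ ⟪hpart e (p - q), ν k - ν p⟫]

variable [FiniteDimensional ℝ E] [MeasurableSpace E] [BorelSpace E]

theorem norm_sub_smul_le (hS : IsCap e ν c C S) {r : ℝ} (hr : 0 < r) (p x : E) :
    ‖x - ⟪x, e⟫ • ν p‖ ≤ r * ‖hS.tube hr p x‖ := by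
  have hee : ⟪e, e⟫ = 1 := by simp [hS.norm_e]
  have h : hpart e (hS.tube hr p x) = r⁻¹ • (x - ⟪x, e⟫ • ν p) := by
    rw [hS.tube_apply]
    simp only [hpart, inner_add_left, inner_sub_left, inner_smul_left, hee, conj_trivial, hS.inner_normal]
    module
  have := norm_hpart_le hS.norm_e (hS.tube hr p x)
  rw [h, norm_smul, norm_inv, Real.norm_of_nonneg hr.le, inv_mul_le_iff₀ hr] at this
  exact this

theorem abs_inner_le_tube (hS : IsCap e ν c C S) {r : ℝ} (hr : 0 < r) (p x : E) : |⟪x, e⟫| ≤ r ^ 2 * ‖hS.tube hr p x‖ := by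
  have hee : ⟪e, e⟫ = 1 := by simp [hS.norm_e]
  have h : ⟪hS.tube hr p x, e⟫ = r⁻¹ ^ 2 * ⟪x, e⟫ := by
    rw [hS.tube_apply]
    simp only [inner_add_left, inner_sub_left, inner_smul_left, hee, conj_trivial, hS.inner_normal]
    ring
  have := (abs_real_inner_le_norm (hS.tube hr p x) e).trans_eq (by rw [hS.norm_e, mul_one])
  rw [h, abs_mul, abs_of_nonneg (by positivity), inv_pow, inv_mul_le_iff₀ (by positivity)] at this
  exact this

end IsCap

variable [FiniteDimensional ℝ E] [MeasurableSpace E] [BorelSpace E]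

/-- Transversality: two points in the intersection of a tube with a cone of tubes through `x` are
close to each other, and so are the directions of the corresponding tubes. -/
theorem exists_transversal {c C D b M κ : ℝ} (hc : 0 < c) (hC : 1 ≤ C) (hD : 0 < D) (hb : 0 ≤ b) (hM : 0 < M)
    (hκ : 0 < κ) (hκc : 3 * C ^ 2 * κ ≤ 2 * c ^ 2) :
    ∃ K : ℝ, 0 < K ∧ ∀ {e : E} {ν : E → E} {S : Set E} (hS : IsCap e ν c C S) {S₁ S₂ : Set E},
      S₁ ⊆ S → S₂ ⊆ S →
      (∀ p ∈ S₁, ∀ q ∈ S₂, D ≤ ‖hpart e (p - q)‖) →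
      (∀ p ∈ S₁, ∀ q ∈ S₁, ‖hpart e (p - q)‖ ≤ κ * D) →
      (∀ p ∈ S₂, ∀ q ∈ S₂, ‖hpart e (p - q)‖ ≤ κ * D) →
      ∀ {r : ℝ} (hr : 0 < r) {k q q' p p' x y y' y₀ : E} {Λ σ : ℝ}, k ∈ S₁ → p ∈ S₁ → p' ∈ S₁ →
      q ∈ S₂ → q' ∈ S₂ → |σ| = 1 → r * ‖(q - q') - σ • (p - p')‖ ≤ b → 1 ≤ Λ →
      ‖hS.tube hr q (y - x)‖ ≤ Λ → ‖hS.tube hr q' (y' - x)‖ ≤ Λ →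
      ‖hS.tube hr k (y - y₀)‖ ≤ Λ → ‖hS.tube hr k (y' - y₀)‖ ≤ Λ →
      r ^ 2 ≤ M * (‖y - x‖ + 3 * Λ * r) →
      r * ‖q - q'‖ ≤ K * Λ ∧ ‖y - y'‖ ≤ K * Λ ^ 2 * r := by
  set N := 1 + C * C
  have hN : 1 ≤ N := by simp only [N]; nlinarith
  set g := (2 * C * κ * D + N) * b with hgd
  have hg : 0 ≤ g := by positivity
  set K₀ := transConst c C D κ g (2 * M * N)
  have hK₀ : 0 < K₀ := transConst_pos hc (by linarith) hD hκ hg (by positivity)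
  set K := (2 + 2 * C * C) * K₀ + (2 + N * ((C * K₀ + 4) / (2 * c * D)))
  refine ⟨K, by positivity, ?_⟩
  intro e ν S hS S₁ S₂ h1S h2S hsep hd1 hd2 r hr k q q' p p' x y y' y₀ Λ σ hk hp hp' hq hq' hσ hcone hΛ l1 l2 l3 l4 hM'
  have hΛ0 : 0 < Λ := by linarith
  have hΛ2 : Λ ≤ Λ ^ 2 := le_self_pow₀ hΛ two_ne_zero
  set t := ⟪y - x, e⟫
  set t' := ⟪y' - x, e⟫
  set δ := ‖hpart e (q - q')‖
  have hδ : 0 ≤ δ := norm_nonneg _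
  have f1 : ‖y - x - t • ν q‖ ≤ r * Λ := (hS.norm_sub_smul_le hr q _).trans (by gcongr)
  have f2 : ‖y' - x - t' • ν q'‖ ≤ r * Λ := (hS.norm_sub_smul_le hr q' _).trans (by gcongr)
  have f3 : ‖y - y₀ - ⟪y - y₀, e⟫ • ν k‖ ≤ r * Λ := (hS.norm_sub_smul_le hr k _).trans (by gcongr)
  have f4 : ‖y' - y₀ - ⟪y' - y₀, e⟫ • ν k‖ ≤ r * Λ := (hS.norm_sub_smul_le hr k _).trans (by gcongr)
  have ft : |t| ≤ r ^ 2 * Λ := (hS.abs_inner_le_tube hr q _).trans (by gcongr)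
  have f5 : ‖(y - y') - (t - t') • ν k‖ ≤ 2 * (r * Λ) := by
    have e1 : (y - y') - (t - t') • ν k =
        (y - y₀ - ⟪y - y₀, e⟫ • ν k) - (y' - y₀ - ⟪y' - y₀, e⟫ • ν k) := by
      simp only [t, t', inner_sub_left]; module
    rw [e1]; linarith [_root_.norm_sub_le (y - y₀ - ⟪y - y₀, e⟫ • ν k) (y' - y₀ - ⟪y' - y₀, e⟫ • ν k)]
  set V := t • (ν q - ν q') - (t - t') • (ν k - ν q')
  have hVd : V = t • (ν q - ν q') - (t - t') • (ν k - ν q') := rfl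
  have hV : ‖V‖ ≤ 4 * (r * Λ) := by
    have e1 : V = (y - y' - (t - t') • ν k) - (y - x - t • ν q) + (y' - x - t' • ν q') := by
      simp only [V]; module
    rw [e1]
    linarith [norm_add_le ((y - y' - (t - t') • ν k) - (y - x - t • ν q)) (y' - x - t' • ν q'),
      _root_.norm_sub_le (y - y' - (t - t') • ν k) (y - x - t • ν q)]
  have hV0 : ⟪V, e⟫ = 0 := by
    simp only [V, inner_sub_left, inner_smul_left, hS.inner_normal]; simp
  clear_value V t t' g
  have hδ1 : ‖hpart e (p - p')‖ ≤ δ + b / r := by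
    have e1 : hpart e (q - q') - hpart e ((q - q') - σ • (p - p')) = σ • hpart e (p - p') := by
      rw [← hpart_sub, ← hpart_smul]; congr 1; abel
    have e2 : ‖hpart e (p - p')‖ = ‖σ • hpart e (p - p')‖ := by
      rw [norm_smul, Real.norm_eq_abs, hσ, one_mul]
    rw [e2, ← e1]
    refine (_root_.norm_sub_le _ _).trans (add_le_add le_rfl ((norm_hpart_le hS.norm_e _).trans ?_))
    rw [le_div_iff₀' hr]; exact hcone
  have hG : |⟪q - q', ν k - ν q'⟫| ≤ 3 * C * κ * D * δ + g / r := by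
    have g1 : |⟪q - q', ν q'⟫| ≤ C * (κ * D * δ) := by
      have := hS.abs_inner_le (h2S hq') (h2S hq)
      have e1 : hpart e (q' - q) = - hpart e (q - q') := by rw [hpart_sub, hpart_sub]; abel
      rw [← neg_sub q q', inner_neg_left, abs_neg, neg_sub, e1, norm_neg] at this
      refine this.trans ?_
      rw [pow_two]; gcongr; exact hd2 q hq q' hq'
    have g2 : |⟪p - p', ν k⟫| ≤ 2 * C * (κ * D) * (δ + b / r) :=
      (hS.abs_inner_sub_le (h1S hp) (h1S hp') (h1S hk) (hd1 p hp p' hp') (hd1 k hk p hp)).trans (by gcongr)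
    have g3 : |⟪(q - q') - σ • (p - p'), ν k⟫| ≤ b / r * N := by
      refine (abs_real_inner_le_norm _ _).trans ?_
      gcongr
      · rw [le_div_iff₀' hr]; exact hcone
      · exact hS.norm_normal k (h1S hk)
    have e1 : ⟪q - q', ν k - ν q'⟫ =
        ⟪(q - q') - σ • (p - p'), ν k⟫ + σ * ⟪p - p', ν k⟫ - ⟪q - q', ν q'⟫ := by
      rw [inner_sub_right, inner_sub_left _ (σ • (p - p')), inner_smul_left]; simp
    rw [e1]
    have g4 := abs_sub (⟪(q - q') - σ • (p - p'), ν k⟫ + σ * ⟪p - p', ν k⟫) ⟪q - q', ν q'⟫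
    have g5 := abs_add_le ⟪(q - q') - σ • (p - p'), ν k⟫ (σ * ⟪p - p', ν k⟫)
    rw [abs_mul, hσ, one_mul] at g5
    have e2 : g / r = 2 * C * (κ * D) * (b / r) + b / r * N := by rw [hgd]; ring
    rw [e2]
    linarith
  have hT : |t - t'| * (2 * c * D) ≤ |t| * (C * δ) + 4 * (r * Λ) := by
    have g1 : 2 * c * D ≤ ‖ν k - ν q'‖ :=
      le_trans (by gcongr; exact hsep k hk q' hq') (hS.le_norm_sub_normal (h1S hk) (h2S hq'))
    have e1 : (t - t') • (ν k - ν q') = t • (ν q - ν q') - V := by rw [hVd]; abel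
    have g2 := _root_.norm_sub_le (t • (ν q - ν q')) V
    rw [← e1, norm_smul, norm_smul, Real.norm_eq_abs, Real.norm_eq_abs] at g2
    have g3 : |t| * ‖ν q - ν q'‖ ≤ |t| * (C * δ) := by gcongr; exact hS.lip q (h2S hq) q' (h2S hq')
    have g4 : |t - t'| * (2 * c * D) ≤ |t - t'| * ‖ν k - ν q'‖ := by gcongr
    linarith
  have hP : 2 * c * δ ^ 2 * |t| ≤ |t - t'| * (3 * C * κ * D * δ + g / r) + δ * (4 * (r * Λ)) := by
    have g1 := hS.le_inner_sub (h2S hq) (h2S hq')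
    have e1 : t * ⟪q - q', ν q - ν q'⟫ = (t - t') * ⟪q - q', ν k - ν q'⟫ + ⟪hpart e (q - q'), V⟫ := by
      rw [← inner_eq_inner_hpart e _ hV0]
      rw [hVd]; simp only [inner_sub_right, inner_smul_right]; ring
    have g2 := abs_real_inner_le_norm (hpart e (q - q')) V
    have g3 : |⟪hpart e (q - q'), V⟫| ≤ δ * (4 * (r * Λ)) := g2.trans (by gcongr)
    have g4 := abs_add_le ((t - t') * ⟪q - q', ν k - ν q'⟫) ⟪hpart e (q - q'), V⟫
    rw [← e1, abs_mul, abs_mul, abs_of_nonneg (le_trans (by positivity) g1)] at g4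
    have g5 : |t| * (2 * c * δ ^ 2) ≤ |t| * ⟪q - q', ν q - ν q'⟫ := by gcongr
    have g6 : |t - t'| * |⟪q - q', ν k - ν q'⟫| ≤ |t - t'| * (3 * C * κ * D * δ + g / r) := by gcongr
    linarith
  have hT' : |t - t'| ≤ (|t| * (C * δ) + 4 * (r * Λ)) / (2 * c * D) := by
    rw [le_div_iff₀ (by positivity)]; exact hT
  have hz : r * δ ≤ K₀ * Λ := by
    refine mul_le_transConst hc (by linarith) hD hκ hκc hg (by positivity) hr (abs_nonneg t) hδ
      (hS.diam q (h2S hq) q' (h2S hq')) hΛ hT hP ?_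
    rcases le_or_gt (r ^ 2) (2 * M * N * |t|) with hcase | hcase
    · exact .inl hcase
    · right
      have s1 : ‖y - x‖ ≤ |t| * N + r * Λ := by
        have e1 : y - x = t • ν q + (y - x - t • ν q) := by abel
        rw [e1]
        refine (norm_add_le _ _).trans (add_le_add ?_ f1)
        rw [norm_smul, Real.norm_eq_abs]; gcongr; exact hS.norm_normal q (h2S hq)
      have : M * ‖y - x‖ ≤ M * (|t| * N + r * Λ) := by gcongr
      have s2 : r ≤ 8 * M * Λ := le_of_mul_le_mul_left (by linarith) hr
      refine s2.trans (mul_le_mul_of_nonneg_right (mul_le_mul_of_nonneg_left ?_ (by norm_num)) hΛ0.le)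
      have : M ≤ M * N := le_mul_of_one_le_right hM.le hN
      have : M * N ≤ 2 * (M * N) := by linarith
      linarith
  have hNk : ‖ν k‖ ≤ N := hS.norm_normal k (h1S hk)
  clear_value K₀ N
  constructor
  · calc r * ‖q - q'‖ ≤ r * ((2 + 2 * C * C) * δ) := by gcongr; exact hS.norm_sub_le (h2S hq) (h2S hq')
      _ = (2 + 2 * C * C) * (r * δ) := by ring
      _ ≤ (2 + 2 * C * C) * (K₀ * Λ) := by gcongr
      _ ≤ K * Λ := by
        rw [← mul_assoc]; gcongr; simp only [K]
        have : 0 ≤ (2 + N * ((C * K₀ + 4) / (2 * c * D))) := by positivity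
        linarith
  · have s1 : |t| * (C * δ) + 4 * (r * Λ) ≤ (C * K₀ + 4) * (r * Λ ^ 2) := by
      have : |t| * (C * δ) ≤ (r ^ 2 * Λ) * (C * δ) := by gcongr
      have : (r * Λ * C) * (r * δ) ≤ (r * Λ * C) * (K₀ * Λ) := by gcongr
      have : 4 * (r * Λ) ≤ 4 * (r * Λ ^ 2) := by gcongr
      linarith
    have s2 : |t - t'| ≤ (C * K₀ + 4) / (2 * c * D) * (r * Λ ^ 2) := by
      refine hT'.trans ?_
      rw [div_mul_eq_mul_div]; gcongr
    have e1 : y - y' = (y - y' - (t - t') • ν k) + (t - t') • ν k := by abel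
    calc ‖y - y'‖ ≤ 2 * (r * Λ) + |t - t'| * N := by
          rw [e1]
          refine (norm_add_le _ _).trans (add_le_add f5 ?_)
          rw [norm_smul, Real.norm_eq_abs]; gcongr
      _ ≤ 2 * (r * Λ ^ 2) + (C * K₀ + 4) / (2 * c * D) * (r * Λ ^ 2) * N := by gcongr
      _ = (2 + N * ((C * K₀ + 4) / (2 * c * D))) * (r * Λ ^ 2) := by ring
      _ ≤ K * (r * Λ ^ 2) := by
          gcongr; simp only [K]
          have : 0 ≤ (2 + 2 * C * C) * K₀ := by positivity
          linarith
      _ = _ := by ring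

end Fourier

theorem dec_mul_dec_le (N : ℕ) (s t : ℝ≥0∞) : dec N s * dec N t ≤ dec N (s + t) := by
  unfold dec
  rw [← mul_pow, ← ENNReal.mul_inv (by simp) (by simp)]
  gcongr
  calc 1 + (s + t) ≤ 1 + (s + t) + s * t := le_self_add
    _ = _ := by ring

theorem dec_mul_le_of_le {t u K : ℝ≥0∞} {j : ℕ} (n : ℕ) (ht : t ≠ ⊤) (hu : u ≠ ⊤)
    (h : 1 + u ≤ K * (1 + t) ^ j) : dec (j * n) t ≤ K ^ n * dec n u := by
  unfold dec
  rw [pow_mul, ← mul_pow]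
  refine pow_le_pow_left' ?_ n
  rw [← div_eq_mul_inv, ENNReal.le_div_iff_mul_le (by simp) (by simp [hu])]
  calc (1 + t)⁻¹ ^ j * (1 + u) ≤ (1 + t)⁻¹ ^ j * (K * (1 + t) ^ j) := by gcongr
    _ = K * ((1 + t)⁻¹ * (1 + t)) ^ j := by rw [mul_pow]; ring
    _ = K := by rw [ENNReal.inv_mul_cancel (by simp) (by finiteness), one_pow, mul_one]

theorem exists_forall_le_two_mul {ι : Type*} [Nonempty ι] {f : ι → ℝ} (h : ∀ i, 1 ≤ f i) :
    ∃ i, ∀ j, f i ≤ 2 * f j := by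
  have hb : BddBelow (Set.range f) := ⟨1, by rintro _ ⟨i, rfl⟩; exact h i⟩
  have h1 : 1 ≤ ⨅ i, f i := le_ciInf h
  obtain ⟨i, hi⟩ := exists_lt_of_ciInf_lt (show ⨅ i, f i < 2 * ⨅ i, f i by linarith)
  exact ⟨i, fun j => hi.le.trans (by linarith [ciInf_le hb j])⟩

section Fourier
variable {E : Type*} [NormedAddCommGroup E] [InnerProductSpace ℝ E]

/-- Two separated small pieces of a uniformly convex hypersurface. -/
structure IsCapPair (e : E) (ν : E → E) (c C D : ℝ) (S S₁ S₂ : Set E) : Prop where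
  cap : IsCap e ν c C S
  subset₁ : S₁ ⊆ S
  subset₂ : S₂ ⊆ S
  pos : 0 < D
  sep : ∀ p ∈ S₁, ∀ q ∈ S₂, D ≤ ‖hpart e (p - q)‖
  diam₁ : ∀ p ∈ S₁, ∀ q ∈ S₁, 3 * C ^ 2 * ‖hpart e (p - q)‖ ≤ 2 * c ^ 2 * D
  diam₂ : ∀ p ∈ S₂, ∀ q ∈ S₂, 3 * C ^ 2 * ‖hpart e (p - q)‖ ≤ 2 * c ^ 2 * D

theorem IsCapPair.symm {e : E} {ν : E → E} {c C D : ℝ} {S S₁ S₂ : Set E} (h : IsCapPair e ν c C D S S₁ S₂) :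
    IsCapPair e ν c C D S S₂ S₁ where
  cap := h.cap
  subset₁ := h.subset₂
  subset₂ := h.subset₁
  pos := h.pos
  sep p hp q hq := by
    have := h.sep q hq p hp
    rwa [hpart_sub, norm_sub_rev, ← hpart_sub] at this
  diam₁ := h.diam₂
  diam₂ := h.diam₁

variable [FiniteDimensional ℝ E] [MeasurableSpace E] [BorelSpace E]

theorem lintegral_dec_div (N : ℕ) {r : ℝ} (hr : 0 < r) (y₀ : E) :
    ∫⁻ y : E, dec N (ENNReal.ofReal (‖y - y₀‖ / r)) =
      ENNReal.ofReal r ^ Module.finrank ℝ E * ∫⁻ y : E, dec N ‖y‖ₑ := by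
  rw [lintegral_sub_right_eq_self (fun y => dec N (ENNReal.ofReal (‖y‖ / r))) y₀]
  have h := lintegral_comp_linearEquiv (LinearEquiv.smulOfNeZero ℝ E r⁻¹ (by positivity))
    (F := fun y => dec N ‖y‖ₑ) (by fun_prop)
  have hd : LinearMap.det ((LinearEquiv.smulOfNeZero ℝ E r⁻¹ (by positivity) : E ≃ₗ[ℝ] E) : E →ₗ[ℝ] E) =
      r⁻¹ ^ Module.finrank ℝ E := by
    rw [show ((LinearEquiv.smulOfNeZero ℝ E r⁻¹ (by positivity) : E ≃ₗ[ℝ] E) : E →ₗ[ℝ] E) =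
      r⁻¹ • LinearMap.id from by ext; simp, LinearMap.det_smul, LinearMap.det_id, mul_one]
  rw [hd, abs_of_pos (by positivity), ← inv_pow, inv_inv, ENNReal.ofReal_pow hr.le] at h
  rw [← h]
  congr 1; ext y
  rw [LinearEquiv.smulOfNeZero_apply, ← ofReal_norm, norm_smul, Real.norm_of_nonneg (by positivity),
    inv_mul_eq_div]

/-- The tubes through `x` whose directions lie on a curve meet a transversal tube in few places. -/
theorem exists_cone_bound {c C D b M : ℝ} (hc : 0 < c) (hC : 1 ≤ C) (hD : 0 < D) (hb : 0 ≤ b) (hM : 0 < M)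
    {B : ℝ≥0∞} (hB : B ≠ ⊤) :
    ∃ C' : ℝ≥0∞, C' ≠ ⊤ ∧ ∀ {e : E} {ν : E → E} {S S₁ S₂ : Set E} (h : IsCapPair e ν c C D S S₁ S₂)
      {r : ℝ} (hr : 0 < r) {ι₁ ι₂ : Type} {Θ₁ : Finset ι₁} {Θ₂ : Finset ι₂} {p₁ : ι₁ → E} {p₂ : ι₂ → E},
      (∀ z ∈ Θ₁, p₁ z ∈ S₁) → (∀ z ∈ Θ₂, p₂ z ∈ S₂) → IsNet r B Θ₁ p₁ → IsNet r B Θ₂ p₂ →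
      ∀ {P : Finset (ι₁ × ι₂)}, P ⊆ Θ₁ ×ˢ Θ₂ → ∀ {π₁ π₂ : E} {σ : ℝ}, |σ| = 1 →
      (∀ z ∈ P, r * ‖(p₂ z.2 - π₂) - σ • (p₁ z.1 - π₁)‖ ≤ b) →
      ∀ {k : E}, k ∈ S₁ → ∀ {Q Q' : Set E}, Q.Nonempty → Q'.Nonempty →
      (∀ x ∈ Q, ∀ y ∈ Q', r ^ 2 ≤ M * ‖y - x‖) → ∀ x y₀ : E,
      ∑ z ∈ P, ∫⁻ y, dec (3 * (Module.finrank ℝ E + 1)) (ENNReal.ofReal (infDist x Q / r)) *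
        dec (3 * (Module.finrank ℝ E + 1)) (ENNReal.ofReal (infDist y Q' / r)) *
        dec (3 * (Module.finrank ℝ E + 1)) ‖h.cap.tube hr (p₂ z.2) (y - x)‖ₑ *
        dec (3 * (Module.finrank ℝ E + 1)) ‖h.cap.tube hr k (y - y₀)‖ₑ ≤
      C' * ENNReal.ofReal r ^ Module.finrank ℝ E := by
  classical
  set n := Module.finrank ℝ E + 1
  have hκ : 0 < 2 * c ^ 2 / (3 * C ^ 2) := by positivity
  obtain ⟨K, hK, htr⟩ := exists_transversal (E := E) (b := 2 * b) hc hC hD (by positivity) hM hκ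
    (by rw [mul_div_cancel₀]; positivity)
  set I := ∫⁻ y : E, dec n ‖y‖ₑ
  have hI : I < ⊤ := lintegral_dec_lt_top (Nat.lt_succ_self _)
  set K₁ : ℝ≥0∞ := ENNReal.ofReal (1 + 2 * K)
  set K₂ : ℝ≥0∞ := ENNReal.ofReal (1 + 4 * K)
  set K₃ : ℝ≥0∞ := (1 + ENNReal.ofReal b) ^ n
  refine ⟨K₁ ^ n * K₂ ^ n * I * (K₃ * B * B), by finiteness, ?_⟩
  intro e ν S S₁ S₂ h r hr ι₁ ι₂ Θ₁ Θ₂ p₁ p₂ hp₁ hp₂ hn₁ hn₂ P hP π₁ π₂ σ hσ hcone k hk Q Q' hQ hQ' hfar x y₀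
  rcases P.eq_empty_or_nonempty with rfl | ⟨z₀, hz₀⟩
  · simp
  let lam : {z // z ∈ P} × E → ℝ := fun w => 1 + (infDist x Q / r + infDist w.2 Q' / r +
    ‖h.cap.tube hr (p₂ w.1.1.2) (w.2 - x)‖ + ‖h.cap.tube hr k (w.2 - y₀)‖)
  have hlam : ∀ w, 1 ≤ lam w := fun w => by
    have h1 : 0 ≤ infDist x Q / r := div_nonneg infDist_nonneg hr.le
    have h2 : 0 ≤ infDist w.2 Q' / r := div_nonneg infDist_nonneg hr.le
    simp only [lam]; linarith [norm_nonneg (h.cap.tube hr (p₂ w.1.1.2) (w.2 - x)),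
      norm_nonneg (h.cap.tube hr k (w.2 - y₀))]
  have : Nonempty ({z // z ∈ P} × E) := ⟨(⟨z₀, hz₀⟩, 0)⟩
  obtain ⟨⟨zs, ys⟩, hmin⟩ := exists_forall_le_two_mul hlam
  have hσσ : σ * σ = 1 := by rcases abs_eq zero_le_one |>.1 hσ with rfl | rfl <;> norm_num
  have hmemP : ∀ z ∈ P, z.1 ∈ Θ₁ ∧ z.2 ∈ Θ₂ := fun z hz => Finset.mem_product.1 (hP hz)
  have hdiam : ∀ T : Set E, (∀ p ∈ T, ∀ q ∈ T, 3 * C ^ 2 * ‖hpart e (p - q)‖ ≤ 2 * c ^ 2 * D) →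
      ∀ p ∈ T, ∀ q ∈ T, ‖hpart e (p - q)‖ ≤ 2 * c ^ 2 / (3 * C ^ 2) * D := fun T hT p hp q hq => by
    rw [div_mul_eq_mul_div, le_div_iff₀' (by positivity)]; exact hT p hp q hq
  -- the pointwise bound
  have key : ∀ z ∈ P, ∀ y : E, dec (3 * n) (ENNReal.ofReal (infDist x Q / r)) *
        dec (3 * n) (ENNReal.ofReal (infDist y Q' / r)) *
        dec (3 * n) ‖h.cap.tube hr (p₂ z.2) (y - x)‖ₑ *
        dec (3 * n) ‖h.cap.tube hr k (y - y₀)‖ₑ ≤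
      K₁ ^ n * dec n ‖r • (p₂ z.2 - p₂ zs.1.2)‖ₑ * (K₂ ^ n * dec n (ENNReal.ofReal (‖y - ys‖ / r))) := by
    intro z hz y
    have h1 : 0 ≤ infDist x Q / r := div_nonneg infDist_nonneg hr.le
    have h2 : 0 ≤ infDist y Q' / r := div_nonneg infDist_nonneg hr.le
    set t : ℝ := infDist x Q / r + infDist y Q' / r +
      ‖h.cap.tube hr (p₂ z.2) (y - x)‖ + ‖h.cap.tube hr k (y - y₀)‖ with htd
    have ht0 : 0 ≤ t := by positivity
    have hlt : lam (⟨z, hz⟩, y) = 1 + t := rfl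
    have hL : lam (zs, ys) ≤ 2 * (1 + t) := by rw [← hlt]; exact hmin _
    have hs1 : 0 ≤ infDist ys Q' / r := div_nonneg infDist_nonneg hr.le
    have hs2 : ‖h.cap.tube hr (p₂ zs.1.2) (ys - x)‖ ≤ 2 * (1 + t) := by
      refine le_trans ?_ hL
      simp only [lam]; linarith [norm_nonneg (h.cap.tube hr k (ys - y₀))]
    have hs3 : ‖h.cap.tube hr k (ys - y₀)‖ ≤ 2 * (1 + t) := by
      refine le_trans ?_ hL
      simp only [lam]; linarith [norm_nonneg (h.cap.tube hr (p₂ zs.1.2) (ys - x))]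
    have hn1 := norm_nonneg (h.cap.tube hr (p₂ z.2) (y - x))
    have hn2 := norm_nonneg (h.cap.tube hr k (y - y₀))
    have hclose : ∀ (w : E) (T : Set E), T.Nonempty → infDist w T / r ≤ t →
        ∃ w' ∈ T, ‖w - w'‖ ≤ (1 + t) * r := fun w T hT hw => by
      obtain ⟨w', hw', hlt⟩ := (infDist_lt_iff hT).1 (show infDist w T < (1 + t) * r by
        rw [div_le_iff₀ hr] at hw; linarith)
      exact ⟨w', hw', by rw [← dist_eq_norm]; exact hlt.le⟩
    obtain ⟨x', hx', hxx⟩ := hclose x Q hQ (by linarith)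
    obtain ⟨y', hy', hyy⟩ := hclose y Q' hQ' (by linarith)
    have hM' : r ^ 2 ≤ M * (‖y - x‖ + 3 * (2 * (1 + t)) * r) := by
      refine (hfar x' hx' y' hy').trans ?_
      gcongr
      have e1 : y' - x' = (y - x) - (y - y') + (x - x') := by abel
      rw [e1]
      have := norm_add_le ((y - x) - (y - y')) (x - x')
      have := _root_.norm_sub_le (y - x) (y - y')
      have : 0 ≤ (1 + t) * r := by positivity
      linarith
    have hcc : r * ‖(p₂ z.2 - p₂ zs.1.2) - σ • (p₁ z.1 - p₁ zs.1.1)‖ ≤ 2 * b := by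
      have e1 : (p₂ z.2 - p₂ zs.1.2) - σ • (p₁ z.1 - p₁ zs.1.1) =
        ((p₂ z.2 - π₂) - σ • (p₁ z.1 - π₁)) - ((p₂ zs.1.2 - π₂) - σ • (p₁ zs.1.1 - π₁)) := by module
      rw [e1]
      have := hcone z hz
      have := hcone zs.1 zs.2
      have := mul_le_mul_of_nonneg_left (_root_.norm_sub_le ((p₂ z.2 - π₂) - σ • (p₁ z.1 - π₁))
        ((p₂ zs.1.2 - π₂) - σ • (p₁ zs.1.1 - π₁))) hr.le
      linarith
    obtain ⟨c1, c2⟩ := htr h.cap h.subset₁ h.subset₂ h.sep (hdiam _ h.diam₁) (hdiam _ h.diam₂) hr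
      (y₀ := y₀) hk (hp₁ _ (hmemP z hz).1) (hp₁ _ (hmemP zs.1 zs.2).1) (hp₂ _ (hmemP z hz).2)
      (hp₂ _ (hmemP zs.1 zs.2).2) hσ hcc (Λ := 2 * (1 + t)) (by linarith) (by linarith) hs2 (by linarith) hs3 hM'
    have ofr : ∀ s : ℝ, 0 ≤ s → 1 + ENNReal.ofReal s = ENNReal.ofReal (1 + s) := fun s hs => by
      rw [ENNReal.ofReal_add zero_le_one hs, ENNReal.ofReal_one]
    have d1 : dec (1 * n) (ENNReal.ofReal t) ≤ K₁ ^ n * dec n ‖r • (p₂ z.2 - p₂ zs.1.2)‖ₑ := by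
      refine dec_mul_le_of_le n (by finiteness) (by finiteness) ?_
      rw [← ofReal_norm, ofr _ (norm_nonneg _), ofr _ ht0, pow_one, ← ENNReal.ofReal_mul (by positivity),
        norm_smul, Real.norm_of_nonneg hr.le]
      refine ENNReal.ofReal_le_ofReal ?_
      linarith
    have d2 : dec (2 * n) (ENNReal.ofReal t) ≤ K₂ ^ n * dec n (ENNReal.ofReal (‖y - ys‖ / r)) := by
      refine dec_mul_le_of_le n (by finiteness) (by finiteness) ?_
      rw [ofr _ (by positivity), ofr _ ht0, ← ENNReal.ofReal_pow (by positivity),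
        ← ENNReal.ofReal_mul (by positivity)]
      refine ENNReal.ofReal_le_ofReal ?_
      have : ‖y - ys‖ / r ≤ K * (2 * (1 + t)) ^ 2 := by rw [div_le_iff₀ hr]; exact c2
      have : 1 ≤ (1 + t) ^ 2 := one_le_pow₀ (by linarith)
      linarith
    calc _ ≤ dec (3 * n) (ENNReal.ofReal t) := by
          rw [htd, ENNReal.ofReal_add (by positivity) hn2, ENNReal.ofReal_add (by positivity) hn1,
            ENNReal.ofReal_add h1 h2, ofReal_norm, ofReal_norm]
          refine le_trans ?_ (dec_mul_dec_le _ _ _)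
          gcongr
          refine le_trans ?_ (dec_mul_dec_le _ _ _)
          gcongr
          exact dec_mul_dec_le _ _ _
      _ = dec (1 * n) (ENNReal.ofReal t) * dec (2 * n) (ENNReal.ofReal t) := by
          rw [← dec_add]; congr 1; ring
      _ ≤ _ := by gcongr
  -- the number of first components
  have hcount : ∀ z ∈ P, 1 ≤ K₃ * dec n ‖r • (p₁ z.1 - (π₁ + σ • (p₂ z.2 - π₂)))‖ₑ := by
    intro z hz
    have e1 : p₁ z.1 - (π₁ + σ • (p₂ z.2 - π₂)) = (-σ) • ((p₂ z.2 - π₂) - σ • (p₁ z.1 - π₁)) := by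
      rw [smul_sub (-σ) (p₂ z.2 - π₂), smul_smul, neg_mul, hσσ]; module
    have e2 : ‖r • (p₁ z.1 - (π₁ + σ • (p₂ z.2 - π₂)))‖ₑ ≤ ENNReal.ofReal b := by
      rw [← ofReal_norm, norm_smul, e1, norm_smul, norm_neg, Real.norm_of_nonneg hr.le, Real.norm_eq_abs, hσ,
        one_mul]
      exact ENNReal.ofReal_le_ofReal (hcone z hz)
    have := dec_le_mul_dec n (t := 0) (u := ENNReal.ofReal b) (by finiteness) (by simp) (e2.trans (zero_add _).ge)
    refine le_trans ?_ this
    simp [dec]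
  have hbound : ∀ z ∈ P, (∫⁻ y, dec (3 * n) (ENNReal.ofReal (infDist x Q / r)) *
        dec (3 * n) (ENNReal.ofReal (infDist y Q' / r)) *
        dec (3 * n) ‖h.cap.tube hr (p₂ z.2) (y - x)‖ₑ * dec (3 * n) ‖h.cap.tube hr k (y - y₀)‖ₑ) ≤
      K₁ ^ n * K₂ ^ n * (ENNReal.ofReal r ^ Module.finrank ℝ E * I) * K₃ *
      (dec n ‖r • (p₂ z.2 - p₂ zs.1.2)‖ₑ * dec n ‖r • (p₁ z.1 - (π₁ + σ • (p₂ z.2 - π₂)))‖ₑ) := by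
    intro z hz
    refine (lintegral_mono fun y => key z hz y).trans ?_
    rw [lintegral_const_mul' _ _ (by have := dec_ne_top n ‖r • (p₂ z.2 - p₂ zs.1.2)‖ₑ; finiteness),
      lintegral_const_mul' _ _ (by finiteness), lintegral_dec_div n hr]
    refine (le_mul_of_one_le_right' (hcount z hz)).trans_eq ?_
    ring
  refine (Finset.sum_le_sum hbound).trans ?_
  rw [← Finset.mul_sum]
  have hsum : ∑ z ∈ P, dec n ‖r • (p₂ z.2 - p₂ zs.1.2)‖ₑ *
      dec n ‖r • (p₁ z.1 - (π₁ + σ • (p₂ z.2 - π₂)))‖ₑ ≤ B * B := by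
    refine (Finset.sum_le_sum_of_subset hP).trans ?_
    rw [Finset.sum_product_right]
    calc _ ≤ ∑ z₂ ∈ Θ₂, dec n ‖r • (p₂ z₂ - p₂ zs.1.2)‖ₑ * B := by
          refine Finset.sum_le_sum fun z₂ _ => ?_
          dsimp only
          rw [← Finset.mul_sum]
          gcongr
          exact hn₁ _
      _ ≤ _ := by rw [← Finset.sum_mul]; gcongr; exact hn₂ _
  calc _ ≤ K₁ ^ n * K₂ ^ n * (ENNReal.ofReal r ^ Module.finrank ℝ E * I) * K₃ * (B * B) := by gcongr
    _ = _ := by ring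

end Fourier

theorem ENNReal.le_add_of_sq_le_mul {x a b : ℝ≥0∞} (h : x ^ 2 ≤ a * b) : x ≤ a + b := by
  refine (ENNReal.pow_le_pow_left_iff two_ne_zero).1 (h.trans ?_)
  calc a * b ≤ a * b + (a * a + b * b + a * b) := le_self_add
    _ = (a + b) ^ 2 := by ring

theorem ENNReal.mul_le_sq_add_sq (a b : ℝ≥0∞) : a * b ≤ a ^ 2 + b ^ 2 :=
  ENNReal.le_add_of_sq_le_mul (by rw [mul_pow])

section Fourier
variable {E : Type*} [NormedAddCommGroup E] [InnerProductSpace ℝ E] [FiniteDimensional ℝ E]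

theorem IsNet.card_le {ι : Type*} {r b : ℝ} (hr : 0 ≤ r) {B : ℝ≥0∞} {Θ : Finset ι} {p : ι → E} (h : IsNet r B Θ p)
    {t : Finset ι} (ht : t ⊆ Θ) {ξ : E} (hξ : ∀ z ∈ t, r * ‖p z - ξ‖ ≤ b) :
    (t.card : ℝ≥0∞) ≤ (1 + ENNReal.ofReal b) ^ (Module.finrank ℝ E + 1) * B := by
  set n := Module.finrank ℝ E + 1
  calc (t.card : ℝ≥0∞) = ∑ z ∈ t, 1 := by simp
    _ ≤ ∑ z ∈ t, (1 + ENNReal.ofReal b) ^ n * dec n ‖r • (p z - ξ)‖ₑ := by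
        refine Finset.sum_le_sum fun z hz => ?_
        refine le_trans (by simp [dec]) (dec_le_mul_dec n (t := 0) (by finiteness) (by simp) ?_)
        rw [zero_add, ← ofReal_norm, norm_smul, Real.norm_of_nonneg hr]
        exact ENNReal.ofReal_le_ofReal (hξ z hz)
    _ ≤ _ := by
        rw [← Finset.mul_sum]
        gcongr
        exact (Finset.sum_le_sum_of_subset ht).trans (h ξ)

variable [MeasurableSpace E] [BorelSpace E]

theorem lintegral_mul_enorm_sum_sq_le {J : Type*} [DecidableEq J] {s : Finset J} {φ : J → E → ℂ} {g : E → ℝ} (hg : ∀ x, 0 ≤ g x)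
    {P : J → J → Prop} [∀ a b, Decidable (P a b)]
    (hintegrable : ∀ a ∈ s, ∀ b ∈ s, Integrable fun x => starRingEnd ℂ (φ b x) * ((g x : ℂ) * φ a x))
    (h0 : ∀ a ∈ s, ∀ b ∈ s, ¬ P a b → ∫ x, starRingEnd ℂ (φ b x) * ((g x : ℂ) * φ a x) = 0) :
    ∫⁻ x, ENNReal.ofReal (g x) * ‖∑ a ∈ s, φ a x‖ₑ ^ 2 ≤
      ∑ a ∈ s, ∑ b ∈ s, if P a b then ∫⁻ x, ENNReal.ofReal (g x) * (‖φ a x‖ₑ * ‖φ b x‖ₑ) else 0 := by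
  have e1 : ∀ x, (∑ a ∈ s, ∑ b ∈ s, starRingEnd ℂ (φ b x) * ((g x : ℂ) * φ a x)) =
      ((g x * ‖∑ a ∈ s, φ a x‖ ^ 2 : ℝ) : ℂ) := fun x => by
    push_cast
    rw [← Complex.conj_mul', map_sum, Finset.sum_mul_sum, Finset.mul_sum, Finset.sum_comm]
    refine Finset.sum_congr rfl fun a _ => ?_
    rw [Finset.mul_sum]
    exact Finset.sum_congr rfl fun b _ => by ring
  have e2 : ∀ x, ENNReal.ofReal (g x) * ‖∑ a ∈ s, φ a x‖ₑ ^ 2 =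
      ‖∑ a ∈ s, ∑ b ∈ s, starRingEnd ℂ (φ b x) * ((g x : ℂ) * φ a x)‖ₑ := fun x => by
    rw [e1, ← ofReal_norm, ← ofReal_norm, Complex.norm_real, Real.norm_of_nonneg (by have := hg x; positivity),
      ENNReal.ofReal_mul (hg x), ENNReal.ofReal_pow (norm_nonneg _)]
  have hi : Integrable fun x => ∑ a ∈ s, ∑ b ∈ s, starRingEnd ℂ (φ b x) * ((g x : ℂ) * φ a x) :=
    integrable_finsetSum _ fun a ha => integrable_finsetSum _ fun b hb => hintegrable a ha b hb
  have e3 : ∫⁻ x, ENNReal.ofReal (g x) * ‖∑ a ∈ s, φ a x‖ₑ ^ 2 =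
      ‖∫ x, ∑ a ∈ s, ∑ b ∈ s, starRingEnd ℂ (φ b x) * ((g x : ℂ) * φ a x)‖ₑ := by
    simp_rw [e2]
    rw [← ofReal_integral_norm_eq_lintegral_enorm hi, ← ofReal_norm]
    congr 1
    simp_rw [e1]
    rw [integral_complex_ofReal, Complex.norm_real, Real.norm_of_nonneg]
    · refine integral_congr_ae (.of_forall fun x => ?_)
      have := hg x
      simp only [Complex.norm_real]
      rw [Real.norm_of_nonneg (by positivity)]
    · exact integral_nonneg fun x => by have := hg x; positivity
  rw [e3, integral_finsetSum _ fun a ha => integrable_finsetSum _ fun b hb => hintegrable a ha b hb]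
  refine (enorm_sum_le _ _).trans (Finset.sum_le_sum fun a ha => ?_)
  rw [integral_finsetSum _ fun b hb => hintegrable a ha b hb]
  refine (enorm_sum_le _ _).trans (Finset.sum_le_sum fun b hb => ?_)
  split_ifs with hP
  · refine (enorm_integral_le_lintegral_enorm _).trans (lintegral_mono fun x => le_of_eq ?_)
    rw [enorm_mul, enorm_mul, ← ofReal_norm (starRingEnd ℂ (φ b x)), RCLike.norm_conj, ofReal_norm,
      ← ofReal_norm (g x : ℂ), Complex.norm_real, Real.norm_of_nonneg (hg x)]
    ring
  · rw [h0 a ha b hb hP, enorm_zero]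

/-- The average of `f` over the tube through `x` adapted to `L`. -/
noncomputable def mass (N : ℕ) (L : E ≃ₗ[ℝ] E) (f : E → ℝ≥0∞) (x : E) : ℝ≥0∞ :=
  ∫⁻ y, dec N ‖L (y - x)‖ₑ * f y

theorem dec_linearEquiv_le (N : ℕ) (L : E ≃ₗ[ℝ] E) (y x x' : E) :
    dec N ‖L (y - x)‖ₑ ≤ (1 + ‖L (x - x')‖ₑ) ^ N * dec N ‖L (y - x')‖ₑ := by
  refine dec_le_mul_dec N (by finiteness) (by finiteness) ?_
  rw [show y - x' = (y - x) + (x - x') by abel, map_add]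
  exact enorm_add_le _ _

theorem measurable_linearEquiv (L : E ≃ₗ[ℝ] E) : Measurable L :=
  L.toContinuousLinearEquiv.continuous.measurable

section mass
variable {N : ℕ} {L : E ≃ₗ[ℝ] E} {f : E → ℝ≥0∞}

theorem mass_le_lintegral (x : E) : mass N L f x ≤ ∫⁻ y, f y :=
  lintegral_mono fun _ => mul_le_of_le_one_left' (dec_le_one _ _)

theorem measurable_mass (hf : Measurable f) : Measurable (mass N L f) := by
  have := measurable_linearEquiv L
  unfold mass
  exact Measurable.lintegral_prod_right' (f := fun z : E × E => dec N ‖L (z.2 - z.1)‖ₑ * f z.2) (by fun_prop)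

theorem mass_le_mul_mass (x x' : E) : mass N L f x ≤ (1 + ‖L (x - x')‖ₑ) ^ N * mass N L f x' := by
  unfold mass
  rw [← lintegral_const_mul' _ _ (by finiteness)]
  refine lintegral_mono fun y => ?_
  rw [← mul_assoc]
  gcongr
  exact dec_linearEquiv_le N L y x x'

theorem mass_ne_zero (hf : Measurable f) (h : ∫⁻ y, f y ≠ 0) (x : E) : mass N L f x ≠ 0 := by
  have := measurable_linearEquiv L
  intro h0
  unfold mass at h0
  rw [lintegral_eq_zero_iff (by fun_prop)] at h0
  refine h ((lintegral_eq_zero_iff hf).2 (h0.mono fun y hy => ?_))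
  exact (mul_eq_zero.1 hy).resolve_left (dec_ne_zero N (by finiteness))

variable {ι : Type*} {I : Finset ι} {F : ι → E → ℝ≥0∞}

theorem sum_mass_le_mul (x x' : E) :
    ∑ i ∈ I, mass N L (F i) x ≤ (1 + ‖L (x - x')‖ₑ) ^ N * ∑ i ∈ I, mass N L (F i) x' := by
  rw [Finset.mul_sum]
  exact Finset.sum_le_sum fun i _ => mass_le_mul_mass x x'

open Classical in
/-- The proportion of the total mass that comes from the `i`-th function. -/
noncomputable def massRatio (N : ℕ) (L : E ≃ₗ[ℝ] E) (I : Finset ι) (F : ι → E → ℝ≥0∞) (i : ι) (x : E) : ℝ :=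
  if i ∈ I then (mass N L (F i) x / ∑ j ∈ I, mass N L (F j) x).toReal else 0

theorem massRatio_nonneg (i : ι) (x : E) : 0 ≤ massRatio N L I F i x := by
  unfold massRatio; split_ifs
  · exact ENNReal.toReal_nonneg
  · exact le_rfl

theorem mass_div_sum_le_one {i : ι} (hi : i ∈ I) (x : E) :
    mass N L (F i) x / ∑ j ∈ I, mass N L (F j) x ≤ 1 :=
  ENNReal.div_le_of_le_mul (by
    rw [one_mul]; exact Finset.single_le_sum (f := fun j => mass N L (F j) x) (fun _ _ => zero_le) hi)

theorem massRatio_le_one (i : ι) (x : E) : massRatio N L I F i x ≤ 1 := by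
  unfold massRatio; split_ifs with hi
  · exact ENNReal.toReal_le_of_le_ofReal zero_le_one (by simpa using mass_div_sum_le_one hi x)
  · exact zero_le_one

theorem measurable_massRatio (hF : ∀ i ∈ I, Measurable (F i)) (i : ι) : Measurable (massRatio N L I F i) := by
  unfold massRatio
  split_ifs with hi
  · have h1 := measurable_mass (N := N) (L := L) (hF i hi)
    have h2 : Measurable fun x => ∑ j ∈ I, mass N L (F j) x :=
      Finset.measurable_fun_sum _ fun j hj => measurable_mass (hF j hj)
    fun_prop
  · exact measurable_const

theorem sum_massRatio (hF : ∀ i ∈ I, Measurable (F i)) (hfin : ∀ i ∈ I, ∫⁻ y, F i y ≠ ⊤)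
    (hne : ∃ i ∈ I, ∫⁻ y, F i y ≠ 0) (x : E) : ∑ i ∈ I, massRatio N L I F i x = 1 := by
  have h1 : ∑ i ∈ I, massRatio N L I F i x =
      ∑ i ∈ I, (mass N L (F i) x / ∑ j ∈ I, mass N L (F j) x).toReal :=
    Finset.sum_congr rfl fun i hi => by rw [massRatio, if_pos hi]
  rw [h1, ← ENNReal.toReal_sum fun i hi => ((mass_div_sum_le_one hi x).trans_lt ENNReal.one_lt_top).ne]
  simp_rw [div_eq_mul_inv]
  rw [← Finset.sum_mul, ENNReal.mul_inv_cancel, ENNReal.toReal_one]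
  · obtain ⟨i, hi, h⟩ := hne
    intro h0
    exact mass_ne_zero (hF i hi) h x (Finset.sum_eq_zero_iff.1 h0 i hi)
  · exact ENNReal.sum_ne_top.2 fun i hi => ((mass_le_lintegral x).trans_lt (hfin i hi).lt_top).ne

theorem IsMollifier.exists_avg_massRatio_mul_le {k : E → ℝ} (hk : IsMollifier k) (N : ℕ) :
    ∃ C : ℝ≥0∞, C ≠ ⊤ ∧ ∀ (L : E ≃ₗ[ℝ] E) {ι : Type} {I : Finset ι} {F : ι → E → ℝ≥0∞},
      (∀ i ∈ I, Measurable (F i)) → (∀ i ∈ I, ∫⁻ y, F i y ≠ ⊤) → (∃ i ∈ I, ∫⁻ y, F i y ≠ 0) →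
      ∀ i ∈ I, ∀ x, ENNReal.ofReal (avg k L (massRatio N L I F i) x) * ∑ j ∈ I, mass N L (F j) x ≤
        C * mass N L (F i) x := by
  set n := Module.finrank ℝ E + 1
  obtain ⟨C, hC, hdecay⟩ := hk.decay (N + N + n)
  have hI : ∫⁻ y : E, dec n ‖y‖ₑ < ⊤ := lintegral_dec_lt_top (Nat.lt_succ_self _)
  refine ⟨C * ∫⁻ y : E, dec n ‖y‖ₑ, by finiteness, fun L ι I F hF hfin hne i hi x => ?_⟩
  have htop : ∀ x, ∑ j ∈ I, mass N L (F j) x ≠ ⊤ := fun x =>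
    ENNReal.sum_ne_top.2 fun i hi => ((mass_le_lintegral x).trans_lt (hfin i hi).lt_top).ne
  have hnz : ∀ x, ∑ j ∈ I, mass N L (F j) x ≠ 0 := fun x h0 => by
    obtain ⟨i, hi, h⟩ := hne
    exact mass_ne_zero (hF i hi) h x (Finset.sum_eq_zero_iff.1 h0 i hi)
  rw [hk.ofReal_avg (measurable_massRatio hF i) (massRatio_nonneg i) (massRatio_le_one i),
    ← lintegral_mul_const' _ _ (htop x), ← lintegral_const_mul' _ _ hC,
    ← lintegral_mul_const' _ _ ((mass_le_lintegral x).trans_lt (hfin i hi).lt_top).ne]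
  refine lintegral_mono fun z => ?_
  set m := fun x => ∑ j ∈ I, mass N L (F j) x
  set x' := x - L.symm z
  have hL : ‖L (x - x')‖ₑ = ‖z‖ₑ := by simp [x']
  have hL' : ‖L (x' - x)‖ₑ = ‖z‖ₑ := by simp [x']
  have h1 : ENNReal.ofReal (massRatio N L I F i x') = mass N L (F i) x' / m x' := by
    rw [massRatio, if_pos hi, ENNReal.ofReal_toReal ((mass_div_sum_le_one hi _).trans_lt ENNReal.one_lt_top).ne]
  have h2 : m x ≤ (1 + ‖z‖ₑ) ^ N * m x' := hL ▸ sum_mass_le_mul x x'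
  have h3 : mass N L (F i) x' ≤ (1 + ‖z‖ₑ) ^ N * mass N L (F i) x := hL' ▸ mass_le_mul_mass x' x
  rw [h1]
  calc mass N L (F i) x' / m x' * ENNReal.ofReal (k z) * m x
      ≤ ((1 + ‖z‖ₑ) ^ N * mass N L (F i) x) / m x' * (C * dec (N + N + n) ‖z‖ₑ) * ((1 + ‖z‖ₑ) ^ N * m x') := by
        gcongr; exact hdecay z
    _ = C * (((1 + ‖z‖ₑ) ^ N * dec N ‖z‖ₑ) * ((1 + ‖z‖ₑ) ^ N * dec N ‖z‖ₑ) * dec n ‖z‖ₑ) *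
          mass N L (F i) x * ((m x')⁻¹ * m x') := by
        rw [dec_add, dec_add, div_eq_mul_inv]; ring
    _ = _ := by
        rw [ENNReal.inv_mul_cancel (hnz x') (htop x'), pow_mul_dec N (by finiteness)]; ring

theorem exists_lintegral_mul_div_mass_le (E : Type*) [NormedAddCommGroup E] [InnerProductSpace ℝ E]
    [FiniteDimensional ℝ E] [MeasurableSpace E] [BorelSpace E] (r : ℝ) (N : ℕ) :
    ∃ C : ℝ≥0∞, C ≠ ⊤ ∧ ∀ (L : E ≃ₗ[ℝ] E) (Lt : E ≃ₗ[ℝ] E), (∀ x ξ, ⟪ξ, L x⟫ = ⟪Lt ξ, x⟫) →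
      ∀ (p : E) (φ : E → ℂ), Spec {ζ | ‖Lt.symm (ζ - p)‖ ≤ r} φ →
      ∀ {ι : Type} {I : Finset ι} {F : ι → E → ℝ≥0∞},
      (∀ i ∈ I, Measurable (F i)) → (∀ i ∈ I, ∫⁻ y, F i y ≠ ⊤) → (∃ i ∈ I, ∫⁻ y, F i y ≠ 0) →
      ∀ i ∈ I, ∫⁻ x, F i x * (‖φ x‖ₑ ^ 2 / ∑ j ∈ I, mass N L (F j) x) ≤
        C * ENNReal.ofReal |LinearMap.det (L : E →ₗ[ℝ] E)| * nsq φ := by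
  obtain ⟨C, hC, hloc⟩ := exists_enorm_sq_le_dec E r (N + N)
  refine ⟨C, hC, fun L Lt hL p φ hφ ι I F hF hfin hne i hi => ?_⟩
  have hmL := measurable_linearEquiv L
  set m := fun x => ∑ j ∈ I, mass N L (F j) x
  have htop : ∀ x, m x ≠ ⊤ := fun x =>
    ENNReal.sum_ne_top.2 fun i hi => ((mass_le_lintegral x).trans_lt (hfin i hi).lt_top).ne
  have hnz : ∀ x, m x ≠ 0 := fun x h0 => by
    obtain ⟨i, hi, h⟩ := hne
    exact mass_ne_zero (hF i hi) h x (Finset.sum_eq_zero_iff.1 h0 i hi)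
  have hmm : Measurable m := Finset.measurable_fun_sum _ fun j hj => measurable_mass (hF j hj)
  have hφm : Measurable φ := hφ.continuous.measurable
  have hFm := hF i hi
  set δ := ENNReal.ofReal |LinearMap.det (L : E →ₗ[ℝ] E)|
  have hδ : δ ≠ ⊤ := by finiteness
  have h1 : ∀ x, ‖φ x‖ₑ ^ 2 / m x ≤ C * δ * ∫⁻ y, dec N ‖L (x - y)‖ₑ * (‖φ y‖ₑ ^ 2 / m y) := by
    intro x
    refine (ENNReal.div_le_div_right (hloc L Lt hL p φ hφ x) _).trans ?_
    rw [div_eq_mul_inv, mul_assoc, mul_assoc, ← lintegral_mul_const' _ _ (ENNReal.inv_ne_top.2 (hnz x)),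
      ← lintegral_const_mul' δ _ hδ]
    refine mul_le_mul_right (lintegral_mono fun y => ?_) C
    have h2 : (m x)⁻¹ ≤ (1 + ‖L (x - y)‖ₑ) ^ N * (m y)⁻¹ := by
      have h3 : m y ≤ (1 + ‖L (x - y)‖ₑ) ^ N * m x := by
        have := sum_mass_le_mul (N := N) (L := L) (I := I) (F := F) y x
        rwa [← neg_sub x y, map_neg, enorm_neg] at this
      rw [← div_eq_mul_inv, ENNReal.le_div_iff_mul_le (.inl (hnz y)) (.inl (htop y))]
      calc (m x)⁻¹ * m y ≤ (m x)⁻¹ * ((1 + ‖L (x - y)‖ₑ) ^ N * m x) := by gcongr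
        _ = (1 + ‖L (x - y)‖ₑ) ^ N * ((m x)⁻¹ * m x) := by ring
        _ = _ := by rw [ENNReal.inv_mul_cancel (hnz x) (htop x), mul_one]
    calc δ * dec (N + N) ‖L (x - y)‖ₑ * ‖φ y‖ₑ ^ 2 * (m x)⁻¹
        ≤ δ * dec (N + N) ‖L (x - y)‖ₑ * ‖φ y‖ₑ ^ 2 * ((1 + ‖L (x - y)‖ₑ) ^ N * (m y)⁻¹) := by gcongr
      _ = δ * (((1 + ‖L (x - y)‖ₑ) ^ N * dec N ‖L (x - y)‖ₑ) * dec N ‖L (x - y)‖ₑ) * (‖φ y‖ₑ ^ 2 / m y) := by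
          rw [dec_add, div_eq_mul_inv]; ring
      _ = _ := by rw [pow_mul_dec N (by finiteness), one_mul, mul_assoc]
  calc ∫⁻ x, F i x * (‖φ x‖ₑ ^ 2 / m x)
      ≤ ∫⁻ x, C * δ * ∫⁻ y, F i x * (dec N ‖L (x - y)‖ₑ * (‖φ y‖ₑ ^ 2 / m y)) := by
        refine lintegral_mono fun x => ?_
        rw [lintegral_const_mul _ (by fun_prop)]
        calc _ ≤ F i x * _ := mul_le_mul_right (h1 x) _
          _ = _ := by ring
    _ = C * δ * ∫⁻ y, ∫⁻ x, F i x * (dec N ‖L (x - y)‖ₑ * (‖φ y‖ₑ ^ 2 / m y)) := by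
        rw [lintegral_const_mul' _ _ (by finiteness), lintegral_lintegral_swap]
        exact (by fun_prop : Measurable fun z : E × E =>
          F i z.1 * (dec N ‖L (z.1 - z.2)‖ₑ * (‖φ z.2‖ₑ ^ 2 / m z.2))).aemeasurable
    _ ≤ C * δ * nsq φ := by
        unfold nsq
        gcongr with y
        calc ∫⁻ x, F i x * (dec N ‖L (x - y)‖ₑ * (‖φ y‖ₑ ^ 2 / m y))
            = mass N L (F i) y * (‖φ y‖ₑ ^ 2 / m y) := by
              rw [mass, ← lintegral_mul_const _ (by fun_prop)]
              congr 1; ext x; ring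
          _ = ‖φ y‖ₑ ^ 2 * (mass N L (F i) y / m y) := by simp only [div_eq_mul_inv]; ring
          _ ≤ ‖φ y‖ₑ ^ 2 := mul_le_of_le_one_right' (mass_div_sum_le_one hi y)

end mass
end Fourier

section Fourier
variable {E : Type*} [NormedAddCommGroup E] [InnerProductSpace ℝ E] [FiniteDimensional ℝ E]
  [MeasurableSpace E] [BorelSpace E]

theorem ofReal_inv_pow_mul_pow {r : ℝ} (hr : 0 < r) (d : ℕ) :
    ENNReal.ofReal (r⁻¹ ^ (d + 1)) * ENNReal.ofReal r ^ d = ENNReal.ofReal r⁻¹ := by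
  rw [← ENNReal.ofReal_pow hr.le, ← ENNReal.ofReal_mul (by positivity)]
  congr 1
  rw [pow_succ, mul_right_comm, ← mul_pow, inv_mul_cancel₀ hr.ne', one_pow, one_mul]

theorem exists_cone_mass_bound {c C D b M : ℝ} (hc : 0 < c) (hC : 1 ≤ C) (hD : 0 < D) (hb : 0 ≤ b) (hM : 0 < M)
    (a : ℝ) {B : ℝ≥0∞} (hB : B ≠ ⊤) :
    ∃ C' : ℝ≥0∞, C' ≠ ⊤ ∧ ∀ {e : E} {ν : E → E} {S S₁ S₂ : Set E} (h : IsCapPair e ν c C D S S₁ S₂)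
      {r : ℝ} (hr : 0 < r) {ι₁ ι₂ : Type} {Θ₁ : Finset ι₁} {Θ₂ : Finset ι₂} {p₁ : ι₁ → E} {p₂ : ι₂ → E},
      (∀ z ∈ Θ₁, p₁ z ∈ S₁) → (∀ z ∈ Θ₂, p₂ z ∈ S₂) → IsNet r B Θ₁ p₁ → IsNet r B Θ₂ p₂ →
      ∀ {P : Finset (ι₁ × ι₂)}, P ⊆ Θ₁ ×ˢ Θ₂ → ∀ {π₁ π₂ : E} {σ : ℝ}, |σ| = 1 →
      (∀ z ∈ P, r * ‖(p₂ z.2 - π₂) - σ • (p₁ z.1 - π₁)‖ ≤ b) →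
      ∀ {Q Q' : Set E}, Q.Nonempty → Q'.Nonempty →
      (∀ x ∈ Q, ∀ y ∈ Q', r ^ 2 ≤ M * ‖y - x‖) → ∀ {U : ι₁ → E → ℂ},
      (∀ z ∈ Θ₁, Spec (plate e ν r a (p₁ z)) (U z)) → ∀ x,
      dec (3 * (Module.finrank ℝ E + 1)) (ENNReal.ofReal (infDist x Q / r)) *
        ∑ z ∈ P, mass (3 * (Module.finrank ℝ E + 1)) (h.cap.tube hr (p₂ z.2))
          (fun y => dec (3 * (Module.finrank ℝ E + 1)) (ENNReal.ofReal (infDist y Q' / r)) *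
            ∑ κ ∈ Θ₁, ‖U κ y‖ₑ ^ 2) x ≤
      C' * ENNReal.ofReal r⁻¹ * ∑ κ ∈ Θ₁, nsq (U κ) := by
  obtain ⟨C₁, hC₁, hcone⟩ := exists_cone_bound (E := E) hc hC hD hb hM hB
  set N := 3 * (Module.finrank ℝ E + 1)
  obtain ⟨C₂, hC₂, hloc⟩ := exists_enorm_sq_le_dec E (2 * a) N
  refine ⟨C₂ * C₁, by finiteness, ?_⟩
  intro e ν S S₁ S₂ h r hr ι₁ ι₂ Θ₁ Θ₂ p₁ p₂ hp₁ hp₂ hn₁ hn₂ P hP π₁ π₂ σ hσ hP' Q Q' hQ hQ' hfar U hU x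
  have hmT : ∀ p, Measurable (h.cap.tube hr p) := fun p => measurable_linearEquiv _
  have hmd : ∀ T : Set E, Measurable fun y => infDist y T := fun T => measurable_infDist
  have hUm : ∀ κ ∈ Θ₁, Measurable (U κ) := fun κ hκ => (hU κ hκ).continuous.measurable
  set A := dec N (ENNReal.ofReal (infDist x Q / r))
  have hA : A ≠ ⊤ := dec_ne_top _ _
  set γ : E → ℝ≥0∞ := fun y => dec N (ENNReal.ofReal (infDist y Q' / r))
  have hγ : Measurable γ := by have := hmd Q'; fun_prop
  set δ := ENNReal.ofReal (r⁻¹ ^ (Module.finrank ℝ E + 1))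
  have hδ : δ ≠ ⊤ := by finiteness
  have hterm : ∀ z, ∀ κ ∈ Θ₁, A * ∫⁻ y, dec N ‖h.cap.tube hr (p₂ z) (y - x)‖ₑ * (γ y * ‖U κ y‖ₑ ^ 2) ≤
      C₂ * δ * ∫⁻ y₀, ‖U κ y₀‖ₑ ^ 2 * ∫⁻ y, A * γ y *
        dec N ‖h.cap.tube hr (p₂ z) (y - x)‖ₑ * dec N ‖h.cap.tube hr (p₁ κ) (y - y₀)‖ₑ := by
    intro z κ hκ
    have hm1 := hmT (p₂ z)
    have hm2 := hmT (p₁ κ)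
    have hm3 := hUm κ hκ
    have hpt : ∀ y, ‖U κ y‖ₑ ^ 2 ≤
        C₂ * (δ * ∫⁻ y₀, dec N ‖h.cap.tube hr (p₁ κ) (y - y₀)‖ₑ * ‖U κ y₀‖ₑ ^ 2) := by
      intro y
      have := hloc (h.cap.tube hr (p₁ κ)) (h.cap.dualTube hr (p₁ κ)) (fun x ξ => h.cap.inner_tube hr _ _ _)
        (p₁ κ) (U κ) ((hU κ hκ).mono (h.cap.plate_subset hr _)) y
      rw [h.cap.abs_det_tube] at this
      simp_rw [mul_assoc] at this
      rwa [lintegral_const_mul' _ _ hδ] at this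
    calc A * ∫⁻ y, dec N ‖h.cap.tube hr (p₂ z) (y - x)‖ₑ * (γ y * ‖U κ y‖ₑ ^ 2)
        ≤ A * ∫⁻ y, dec N ‖h.cap.tube hr (p₂ z) (y - x)‖ₑ * (γ y *
            (C₂ * (δ * ∫⁻ y₀, dec N ‖h.cap.tube hr (p₁ κ) (y - y₀)‖ₑ * ‖U κ y₀‖ₑ ^ 2))) := by
          gcongr with y; exact hpt y
      _ = C₂ * δ * ∫⁻ y, ∫⁻ y₀, ‖U κ y₀‖ₑ ^ 2 * (A * γ y *
        dec N ‖h.cap.tube hr (p₂ z) (y - x)‖ₑ * dec N ‖h.cap.tube hr (p₁ κ) (y - y₀)‖ₑ) := by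
          rw [← lintegral_const_mul' _ _ hA, ← lintegral_const_mul' _ _ (by finiteness)]
          congr 1; ext y
          rw [show A * (dec N ‖h.cap.tube hr (p₂ z) (y - x)‖ₑ * (γ y *
            (C₂ * (δ * ∫⁻ y₀, dec N ‖h.cap.tube hr (p₁ κ) (y - y₀)‖ₑ * ‖U κ y₀‖ₑ ^ 2)))) =
            C₂ * δ * ((A * γ y * dec N ‖h.cap.tube hr (p₂ z) (y - x)‖ₑ) *
            ∫⁻ y₀, dec N ‖h.cap.tube hr (p₁ κ) (y - y₀)‖ₑ * ‖U κ y₀‖ₑ ^ 2) by ring,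
            ← lintegral_const_mul _ (by fun_prop)]
          congr 2; ext y₀; ring
      _ = _ := by
          rw [lintegral_lintegral_swap]
          · congr 2; ext y₀
            rw [lintegral_const_mul _ (by fun_prop)]
          · exact (by fun_prop : Measurable fun w : E × E => ‖U κ w.2‖ₑ ^ 2 * (A * γ w.1 *
              dec N ‖h.cap.tube hr (p₂ z) (w.1 - x)‖ₑ *
              dec N ‖h.cap.tube hr (p₁ κ) (w.1 - w.2)‖ₑ)).aemeasurable
  have hinner : ∀ z κ, Measurable fun y₀ => ∫⁻ y, A * γ y *
        dec N ‖h.cap.tube hr (p₂ z) (y - x)‖ₑ * dec N ‖h.cap.tube hr (p₁ κ) (y - y₀)‖ₑ := by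
    intro z κ
    have hm1 := hmT (p₂ z)
    have hm2 := hmT (p₁ κ)
    exact Measurable.lintegral_prod_right' (f := fun w : E × E => A * γ w.2 *
        dec N ‖h.cap.tube hr (p₂ z) (w.2 - x)‖ₑ * dec N ‖h.cap.tube hr (p₁ κ) (w.2 - w.1)‖ₑ) (by fun_prop)
  have hκ : ∀ κ ∈ Θ₁, ∑ z ∈ P, A * ∫⁻ y, dec N ‖h.cap.tube hr (p₂ z.2) (y - x)‖ₑ * (γ y * ‖U κ y‖ₑ ^ 2) ≤
      C₂ * C₁ * ENNReal.ofReal r⁻¹ * nsq (U κ) := by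
    intro κ hκ
    have hm3 := hUm κ hκ
    refine (Finset.sum_le_sum fun z _ => hterm z.2 κ hκ).trans ?_
    rw [← Finset.mul_sum, ← lintegral_finsetSum _ fun z _ => by have := hinner z.2 κ; fun_prop]
    calc _ ≤ C₂ * δ * ∫⁻ y₀, ‖U κ y₀‖ₑ ^ 2 * (C₁ * ENNReal.ofReal r ^ Module.finrank ℝ E) := by
          gcongr with y₀
          rw [← Finset.mul_sum]
          gcongr
          exact hcone h hr hp₁ hp₂ hn₁ hn₂ hP hσ hP' (hp₁ κ hκ) hQ hQ' hfar x y₀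
      _ = C₂ * C₁ * (δ * ENNReal.ofReal r ^ Module.finrank ℝ E) * nsq (U κ) := by
          rw [lintegral_mul_const' _ _ (by finiteness), nsq]; ring
      _ = _ := by rw [ofReal_inv_pow_mul_pow hr]
  calc _ = ∑ κ ∈ Θ₁, ∑ z ∈ P, A * ∫⁻ y, dec N ‖h.cap.tube hr (p₂ z.2) (y - x)‖ₑ * (γ y * ‖U κ y‖ₑ ^ 2) := by
        rw [Finset.mul_sum, Finset.sum_comm]
        refine Finset.sum_congr rfl fun z _ => ?_
        rw [← Finset.mul_sum, mass, ← lintegral_finsetSum' _ fun κ hκ => by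
          have hm1 := hmT (p₂ z.2)
          have hm3 := hUm κ hκ
          exact (by fun_prop : Measurable fun y =>
            dec N ‖h.cap.tube hr (p₂ z.2) (y - x)‖ₑ * (γ y * ‖U κ y‖ₑ ^ 2)).aemeasurable]
        simp_rw [← Finset.mul_sum]
        rfl
    _ ≤ ∑ κ ∈ Θ₁, C₂ * C₁ * ENNReal.ofReal r⁻¹ * nsq (U κ) := Finset.sum_le_sum hκ
    _ = _ := by rw [Finset.mul_sum]

end Fourier

theorem Finset.sum_product_swap_fst {α β M : Type*} [AddCommMonoid M] (s : Finset α) (t : Finset β)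
    (f : α → β → α → β → M) :
    ∑ a ∈ s ×ˢ t, ∑ b ∈ s ×ˢ t, f a.1 a.2 b.1 b.2 = ∑ a ∈ s ×ˢ t, ∑ b ∈ s ×ˢ t, f b.1 a.2 a.1 b.2 := by
  simp only [Finset.sum_product]
  rw [Finset.sum_comm]
  conv_rhs => rw [Finset.sum_comm]
  refine Finset.sum_congr rfl fun y _ => ?_
  rw [Finset.sum_comm]

/-- Schur's test type bound for sums over quadruples. -/
theorem sum_sum_lintegral_mul_le {X : Type*} [MeasurableSpace X] {μ : Measure X} {ι₁ ι₂ : Type*} {Θ₁ : Finset ι₁} {Θ₂ : Finset ι₂}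
    {f : ι₁ → X → ℝ≥0∞} {α β m : ι₂ → X → ℝ≥0∞} {G : X → ℝ≥0∞} (hG : Measurable G)
    (hf : ∀ z ∈ Θ₁, Measurable (f z)) (hβ : ∀ z ∈ Θ₂, Measurable (β z)) (hm : ∀ z ∈ Θ₂, Measurable (m z))
    (hα : ∀ z ∈ Θ₂, ∀ x, α z x ^ 2 ≤ β z x * m z x)
    {R R' : ι₁ × ι₂ → ι₁ × ι₂ → Prop} [∀ a b, Decidable (R a b)] [∀ a b, Decidable (R' a b)]
    (hR : ∀ a b, R a b → R b a) (hR' : ∀ a b, R (b.1, a.2) (a.1, b.2) → R' a b) {Y : ℝ≥0∞}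
    (h : ∑ a ∈ Θ₁ ×ˢ Θ₂, ∑ b ∈ Θ₁ ×ˢ Θ₂,
      (if R a b then ∫⁻ x, G x * (f a.1 x ^ 2 * (β a.2 x * m b.2 x)) ∂μ else 0) ≤ Y)
    (h' : ∑ a ∈ Θ₁ ×ˢ Θ₂, ∑ b ∈ Θ₁ ×ˢ Θ₂,
      (if R' a b then ∫⁻ x, G x * (f a.1 x ^ 2 * (β a.2 x * m b.2 x)) ∂μ else 0) ≤ Y) :
    ∑ a ∈ Θ₁ ×ˢ Θ₂, ∑ b ∈ Θ₁ ×ˢ Θ₂,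
      (if R a b then ∫⁻ x, G x * ((f a.1 x * α a.2 x) * (f b.1 x * α b.2 x)) ∂μ else 0) ≤ 4 * Y := by
  set H : ι₁ → ι₂ → ι₂ → ℝ≥0∞ := fun z y y' => ∫⁻ x, G x * (f z x ^ 2 * (β y x * m y' x)) ∂μ
  have hRR : ∀ a b, R a b ↔ R b a := fun a b => ⟨hR a b, hR b a⟩
  have hpt : ∀ a ∈ Θ₁ ×ˢ Θ₂, ∀ b ∈ Θ₁ ×ˢ Θ₂,
      ∫⁻ x, G x * ((f a.1 x * α a.2 x) * (f b.1 x * α b.2 x)) ∂μ ≤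
        H a.1 a.2 b.2 + H b.1 b.2 a.2 + H b.1 a.2 b.2 + H a.1 b.2 a.2 := by
    intro a ha b hb
    obtain ⟨ha1, ha2⟩ := Finset.mem_product.1 ha
    obtain ⟨hb1, hb2⟩ := Finset.mem_product.1 hb
    have m1 := hf _ ha1
    have m2 := hf _ hb1
    have m3 := hβ _ ha2
    have m4 := hβ _ hb2
    have m5 := hm _ ha2
    have m6 := hm _ hb2
    simp only [H]
    rw [← lintegral_add_left (by fun_prop), ← lintegral_add_left (by fun_prop), ← lintegral_add_left (by fun_prop)]
    refine lintegral_mono fun x => ?_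
    have e1 : α a.2 x * α b.2 x ≤ β a.2 x * m b.2 x + β b.2 x * m a.2 x := by
      refine ENNReal.le_add_of_sq_le_mul ?_
      calc (α a.2 x * α b.2 x) ^ 2 = α a.2 x ^ 2 * α b.2 x ^ 2 := by ring
        _ ≤ (β a.2 x * m a.2 x) * (β b.2 x * m b.2 x) := mul_le_mul' (hα _ ha2 x) (hα _ hb2 x)
        _ = _ := by ring
    calc G x * ((f a.1 x * α a.2 x) * (f b.1 x * α b.2 x))
        = G x * ((f a.1 x * f b.1 x) * (α a.2 x * α b.2 x)) := by ring
      _ ≤ G x * ((f a.1 x ^ 2 + f b.1 x ^ 2) * (β a.2 x * m b.2 x + β b.2 x * m a.2 x)) := by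
          gcongr; exact ENNReal.mul_le_sq_add_sq _ _
      _ = _ := by ring
  have t2 : ∑ a ∈ Θ₁ ×ˢ Θ₂, ∑ b ∈ Θ₁ ×ˢ Θ₂, (if R a b then H b.1 b.2 a.2 else 0) ≤ Y := by
    rw [Finset.sum_comm]; simp_rw [hRR]; exact h
  have t3 : ∑ a ∈ Θ₁ ×ˢ Θ₂, ∑ b ∈ Θ₁ ×ˢ Θ₂, (if R a b then H b.1 a.2 b.2 else 0) ≤ Y := by
    have := Finset.sum_product_swap_fst Θ₁ Θ₂ fun x y x' y' => if R (x, y) (x', y') then H x' y y' else 0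
    simp only [Prod.mk.eta] at this
    rw [this]
    refine le_trans (Finset.sum_le_sum fun a _ => Finset.sum_le_sum fun b _ => ?_) h'
    split_ifs with h1 h2 h2
    · exact le_rfl
    · exact absurd (hR' a b h1) h2
    · exact zero_le
    · exact zero_le
  have t4 : ∑ a ∈ Θ₁ ×ˢ Θ₂, ∑ b ∈ Θ₁ ×ˢ Θ₂, (if R a b then H a.1 b.2 a.2 else 0) ≤ Y := by
    rw [Finset.sum_comm]; simp_rw [hRR]; exact t3
  calc _ ≤ ∑ a ∈ Θ₁ ×ˢ Θ₂, ∑ b ∈ Θ₁ ×ˢ Θ₂, ((if R a b then H a.1 a.2 b.2 else 0) +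
        (if R a b then H b.1 b.2 a.2 else 0) + (if R a b then H b.1 a.2 b.2 else 0) +
        (if R a b then H a.1 b.2 a.2 else 0)) := by
        refine Finset.sum_le_sum fun a ha => Finset.sum_le_sum fun b hb => ?_
        split_ifs
        · exact hpt a ha b hb
        · simp
    _ ≤ Y + Y + Y + Y := by
        simp only [Finset.sum_add_distrib]
        exact add_le_add (add_le_add (add_le_add h t2) t3) t4
    _ = 4 * Y := by ring

section Fourier
variable {E : Type*} [NormedAddCommGroup E] [InnerProductSpace ℝ E] [FiniteDimensional ℝ E]

theorem IsNet.mono {ι : Type*} {r : ℝ} {B B' : ℝ≥0∞} {Θ : Finset ι} {p : ι → E} (h : IsNet r B Θ p) (hB : B ≤ B') :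
    IsNet r B' Θ p := fun a => (h a).trans hB

theorem IsCap.norm_add_sub_add_le {e : E} {ν : E → E} {c C : ℝ} {S : Set E} (hS : IsCap e ν c C S) {r a₁ a₂ : ℝ} (hr : 1 ≤ r)
    {p₁ p₂ q₁ q₂ : E} (h₁ : p₁ ∈ S) (h₂ : p₂ ∈ S) (h₃ : q₁ ∈ S) (h₄ : q₂ ∈ S)
    (h : ¬ Disjoint (plate e ν r a₁ q₁ + plate e ν r a₂ q₂)
      (closedBall 0 r⁻¹ + (plate e ν r a₁ p₁ + plate e ν r a₂ p₂))) :
    r * ‖(q₂ - p₂) - (-1 : ℝ) • (q₁ - p₁)‖ ≤ 1 + 2 * ((3 + C * C) * (|a₁| + |a₂|)) := by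
  obtain ⟨ξ, ⟨y₁, k1, y₂, k2, h5⟩, ⟨z, hz, _, ⟨x₁, k3, x₂, k4, rfl⟩, h6⟩⟩ := Set.not_disjoint_iff.1 h
  dsimp only at h5 h6
  have hr0 : 0 < r := by linarith
  have g1 := hS.norm_sub_le_of_mem_plate hr h₃ k1
  have g2 := hS.norm_sub_le_of_mem_plate hr h₄ k2
  have g3 := hS.norm_sub_le_of_mem_plate hr h₁ k3
  have g4 := hS.norm_sub_le_of_mem_plate hr h₂ k4
  have g5 : r * ‖z‖ ≤ 1 := by
    have : ‖z‖ ≤ r⁻¹ := by simpa using hz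
    calc r * ‖z‖ ≤ r * r⁻¹ := by gcongr
      _ = 1 := mul_inv_cancel₀ hr0.ne'
  have e1 : (q₂ - p₂) - (-1 : ℝ) • (q₁ - p₁) = z + ((x₁ - p₁) + (x₂ - p₂)) - ((y₁ - q₁) + (y₂ - q₂)) := by
    have : y₁ + y₂ = z + (x₁ + x₂) := h5.trans h6.symm
    rw [show z + ((x₁ - p₁) + (x₂ - p₂)) - ((y₁ - q₁) + (y₂ - q₂)) =
      (z + (x₁ + x₂)) - (y₁ + y₂) + ((q₂ - p₂) - (-1 : ℝ) • (q₁ - p₁)) by module, this]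
    abel
  have hC : 0 ≤ 3 + C * C := by nlinarith
  have m1 : (3 + C * C) * a₁ ≤ (3 + C * C) * |a₁| := by gcongr; exact le_abs_self _
  have m2 : (3 + C * C) * a₂ ≤ (3 + C * C) * |a₂| := by gcongr; exact le_abs_self _
  have n1 : ‖z + ((x₁ - p₁) + (x₂ - p₂)) - ((y₁ - q₁) + (y₂ - q₂))‖ ≤
      ‖z‖ + (‖x₁ - p₁‖ + ‖x₂ - p₂‖) + (‖y₁ - q₁‖ + ‖y₂ - q₂‖) :=
    (_root_.norm_sub_le _ _).trans (add_le_add ((norm_add_le _ _).trans (add_le_add le_rfl (norm_add_le _ _)))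
      (norm_add_le _ _))
  rw [e1]
  have := mul_le_mul_of_nonneg_left n1 hr0.le
  linarith

end Fourier

section Fourier
variable {E : Type*} [NormedAddCommGroup E] [InnerProductSpace ℝ E] [FiniteDimensional ℝ E]

/-- A weight concentrated near `Q` at scale `r`. -/
noncomputable def wt (r : ℝ) (Q : Set E) (x : E) : ℝ≥0∞ :=
  dec (3 * (Module.finrank ℝ E + 1)) (ENNReal.ofReal (infDist x Q / r))

/-- The square function of a family of functions, weighted to a neighbourhood of `Q`. -/
noncomputable def sqfun {ι : Type*} (r : ℝ) (Q : Set E) (Θ : Finset ι) (U : ι → E → ℂ) (x : E) : ℝ≥0∞ :=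
  wt r Q x * ∑ κ ∈ Θ, ‖U κ x‖ₑ ^ 2

variable [MeasurableSpace E] [BorelSpace E]

theorem measurable_wt (r : ℝ) (Q : Set E) : Measurable (wt r Q) := by
  have : Measurable fun y => infDist y Q := measurable_infDist
  unfold wt; fun_prop

theorem measurable_sqfun {ι : Type*} (r : ℝ) (Q : Set E) {Θ : Finset ι} {U : ι → E → ℂ}
    (hU : ∀ z ∈ Θ, Measurable (U z)) : Measurable (sqfun r Q Θ U) := by
  refine (measurable_wt r Q).mul (Finset.measurable_fun_sum _ fun z hz => ?_)
  have := hU z hz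
  fun_prop

theorem lintegral_sum_enorm_sq {ι : Type*} {Θ : Finset ι} {U : ι → E → ℂ}
    (hU : ∀ z ∈ Θ, Measurable (U z)) : ∫⁻ x, ∑ z ∈ Θ, ‖U z x‖ₑ ^ 2 = ∑ z ∈ Θ, nsq (U z) :=
  lintegral_finsetSum' _ fun z hz => by have := hU z hz; fun_prop

theorem lintegral_sqfun_le {ι : Type*} (r : ℝ) (Q : Set E) {Θ : Finset ι} {U : ι → E → ℂ}
    (hU : ∀ z ∈ Θ, Measurable (U z)) : ∫⁻ x, sqfun r Q Θ U x ≤ ∑ z ∈ Θ, nsq (U z) := by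
  rw [← lintegral_sum_enorm_sq hU]
  exact lintegral_mono fun x => mul_le_of_le_one_left' (dec_le_one _ _)

open Classical in
theorem exists_far_sum_le {c C D b M : ℝ} (hc : 0 < c) (hC : 1 ≤ C) (hD : 0 < D) (hb : 0 ≤ b) (hM : 0 < M)
    (a₁ a₂ : ℝ) {B : ℝ≥0∞} (hB : B ≠ ⊤) :
    ∃ C' : ℝ≥0∞, C' ≠ ⊤ ∧ ∀ {e : E} {ν : E → E} {S S₁ S₂ : Set E} (h : IsCapPair e ν c C D S S₁ S₂)
      {r : ℝ} (hr : 0 < r) {ι₁ ι₂ : Type} {Θ₁ : Finset ι₁} {Θ₂ : Finset ι₂} {p₁ : ι₁ → E} {p₂ : ι₂ → E},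
      (∀ z ∈ Θ₁, p₁ z ∈ S₁) → (∀ z ∈ Θ₂, p₂ z ∈ S₂) → IsNet r B Θ₁ p₁ → IsNet r B Θ₂ p₂ →
      ∀ {σ : ℝ}, |σ| = 1 → ∀ {ι : Type} {I : Finset ι} {Q : ι → Set E}, (∀ i ∈ I, (Q i).Nonempty) →
      ∀ {U : ι → ι₁ → E → ℂ}, (∀ i ∈ I, ∀ z ∈ Θ₁, Spec (plate e ν r a₁ (p₁ z)) (U i z)) →
      ∀ {w : ι₂ → E → ℂ}, (∀ z ∈ Θ₂, Spec (plate e ν r a₂ (p₂ z)) (w z)) →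
      (∃ i ∈ I, ∫⁻ x, sqfun r (Q i) Θ₁ (U i) x ≠ 0) →
      ∀ i ∈ I, ∀ j ∈ I, (∀ x ∈ Q i, ∀ y ∈ Q j, r ^ 2 ≤ M * ‖y - x‖) →
      ∑ a ∈ Θ₁ ×ˢ Θ₂, ∑ a' ∈ Θ₁ ×ˢ Θ₂,
        (if r * ‖(p₂ a'.2 - p₂ a.2) - σ • (p₁ a'.1 - p₁ a.1)‖ ≤ b then
          ∫⁻ x, (wt r (Q i) x * wt r (Q i) x) * (‖U i a.1 x‖ₑ ^ 2 * ((‖w a.2 x‖ₑ ^ 2 /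
            ∑ l ∈ I, mass (3 * (Module.finrank ℝ E + 1)) (h.cap.tube hr (p₂ a.2)) (sqfun r (Q l) Θ₁ (U l)) x) *
            mass (3 * (Module.finrank ℝ E + 1)) (h.cap.tube hr (p₂ a'.2)) (sqfun r (Q j) Θ₁ (U j)) x)) else 0) ≤
      C' * ENNReal.ofReal r⁻¹ * ENNReal.ofReal (r⁻¹ ^ (Module.finrank ℝ E + 1)) *
        (∑ z ∈ Θ₁, nsq (U j z)) * ∑ z ∈ Θ₂, nsq (w z) := by
  obtain ⟨C₁, hC₁, hcone⟩ := exists_cone_mass_bound (E := E) hc hC hD hb hM a₁ hB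
  obtain ⟨C₂, hC₂, hdiv⟩ := exists_lintegral_mul_div_mass_le E (2 * a₂) (3 * (Module.finrank ℝ E + 1))
  set N := 3 * (Module.finrank ℝ E + 1)
  refine ⟨C₁ * C₂, by finiteness, ?_⟩
  intro e ν S S₁ S₂ h r hr ι₁ ι₂ Θ₁ Θ₂ p₁ p₂ hp₁ hp₂ hn₁ hn₂ σ hσ ι I Q hQ U hU w hw hne i hi j hj hfar
  have hUm : ∀ i ∈ I, ∀ z ∈ Θ₁, Measurable (U i z) := fun i hi z hz => (hU i hi z hz).continuous.measurable
  have hwm : ∀ z ∈ Θ₂, Measurable (w z) := fun z hz => (hw z hz).continuous.measurable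
  have hF : ∀ l ∈ I, Measurable (sqfun r (Q l) Θ₁ (U l)) := fun l hl => measurable_sqfun _ _ (hUm l hl)
  have hfin : ∀ l ∈ I, ∫⁻ x, sqfun r (Q l) Θ₁ (U l) x ≠ ⊤ := fun l hl =>
    ((lintegral_sqfun_le r (Q l) (hUm l hl)).trans_lt
      (ENNReal.sum_lt_top.2 fun z hz => (hU l hl z hz).nsq_lt_top)).ne
  have hwt := measurable_wt r (Q i)
  set m : ι₂ → E → ℝ≥0∞ := fun z => mass N (h.cap.tube hr (p₂ z)) (sqfun r (Q j) Θ₁ (U j))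
  set β : ι₂ → E → ℝ≥0∞ := fun z x => ‖w z x‖ₑ ^ 2 /
    ∑ l ∈ I, mass N (h.cap.tube hr (p₂ z)) (sqfun r (Q l) Θ₁ (U l)) x
  have hm : ∀ z, Measurable (m z) := fun z => measurable_mass (hF j hj)
  have hβ : ∀ z ∈ Θ₂, Measurable (β z) := fun z hz => by
    have h2 : Measurable fun x => ∑ l ∈ I, mass N (h.cap.tube hr (p₂ z)) (sqfun r (Q l) Θ₁ (U l)) x :=
      Finset.measurable_fun_sum _ fun l hl => measurable_mass (hF l hl)
    have h3 := hwm z hz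
    simp only [β]
    fun_prop
  set X := ∑ z ∈ Θ₁, nsq (U j z)
  have hrow : ∀ a ∈ Θ₁ ×ˢ Θ₂, ∑ a' ∈ Θ₁ ×ˢ Θ₂,
      (if r * ‖(p₂ a'.2 - p₂ a.2) - σ • (p₁ a'.1 - p₁ a.1)‖ ≤ b then
        ∫⁻ x, (wt r (Q i) x * wt r (Q i) x) * (‖U i a.1 x‖ₑ ^ 2 * (β a.2 x * m a'.2 x)) else 0) ≤
      (C₁ * ENNReal.ofReal r⁻¹ * X) * ∫⁻ x, (wt r (Q i) x * ‖U i a.1 x‖ₑ ^ 2) * β a.2 x := by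
    intro a ha
    obtain ⟨ha1, ha2⟩ := Finset.mem_product.1 ha
    have m1 := hUm i hi _ ha1
    have m2 := hβ _ ha2
    rw [← Finset.sum_filter, ← lintegral_finsetSum _ (fun a' _ => by have := hm a'.2; fun_prop),
      ← lintegral_const_mul _ (by fun_prop)]
    refine lintegral_mono fun x => ?_
    set P := (Θ₁ ×ˢ Θ₂).filter fun a' => r * ‖(p₂ a'.2 - p₂ a.2) - σ • (p₁ a'.1 - p₁ a.1)‖ ≤ b
    have := hcone h hr hp₁ hp₂ hn₁ hn₂ (P := P) (Finset.filter_subset _ _) hσ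
      (fun z hz => (Finset.mem_filter.1 hz).2) (hQ i hi) (hQ j hj) hfar (hU j hj) x
    calc ∑ a' ∈ P, (wt r (Q i) x * wt r (Q i) x) * (‖U i a.1 x‖ₑ ^ 2 * (β a.2 x * m a'.2 x))
        = ((wt r (Q i) x * ‖U i a.1 x‖ₑ ^ 2) * β a.2 x) * (wt r (Q i) x * ∑ a' ∈ P, m a'.2 x) := by
          rw [Finset.mul_sum, Finset.mul_sum]
          exact Finset.sum_congr rfl fun _ _ => by ring
      _ ≤ ((wt r (Q i) x * ‖U i a.1 x‖ₑ ^ 2) * β a.2 x) * (C₁ * ENNReal.ofReal r⁻¹ * X) :=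
          mul_le_mul_right this _
      _ = _ := by ring
  have hcol : ∀ z ∈ Θ₂, ∑ y ∈ Θ₁, ∫⁻ x, (wt r (Q i) x * ‖U i y x‖ₑ ^ 2) * β z x ≤
      C₂ * ENNReal.ofReal (r⁻¹ ^ (Module.finrank ℝ E + 1)) * nsq (w z) := by
    intro z hz
    rw [← lintegral_finsetSum _ (fun y hy => by have := hUm i hi y hy; have := hβ z hz; fun_prop)]
    have := hdiv (h.cap.tube hr (p₂ z)) (h.cap.dualTube hr (p₂ z)) (fun x ξ => h.cap.inner_tube hr _ _ _)
      (p₂ z) (w z) ((hw z hz).mono (h.cap.plate_subset hr _)) hF hfin hne i hi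
    rw [h.cap.abs_det_tube] at this
    refine le_trans (lintegral_mono fun x => le_of_eq ?_) this
    rw [sqfun, ← Finset.sum_mul, Finset.mul_sum]
  calc _ ≤ ∑ a ∈ Θ₁ ×ˢ Θ₂, (C₁ * ENNReal.ofReal r⁻¹ * X) * ∫⁻ x, (wt r (Q i) x * ‖U i a.1 x‖ₑ ^ 2) * β a.2 x :=
        Finset.sum_le_sum hrow
    _ = (C₁ * ENNReal.ofReal r⁻¹ * X) * ∑ z ∈ Θ₂, ∑ y ∈ Θ₁, ∫⁻ x, (wt r (Q i) x * ‖U i y x‖ₑ ^ 2) * β z x := by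
        rw [← Finset.mul_sum, Finset.sum_product_right]
    _ ≤ (C₁ * ENNReal.ofReal r⁻¹ * X) *
          ∑ z ∈ Θ₂, C₂ * ENNReal.ofReal (r⁻¹ ^ (Module.finrank ℝ E + 1)) * nsq (w z) :=
        mul_le_mul_right (Finset.sum_le_sum hcol) _
    _ = _ := by rw [← Finset.mul_sum]; ring

end Fourier

section Fourier
variable {E : Type*} [NormedAddCommGroup E] [InnerProductSpace ℝ E] [FiniteDimensional ℝ E]
  [MeasurableSpace E] [BorelSpace E]

theorem Spec.integrable_conj_mul {S T : Set E} {φ ψ : E → ℂ} (hφ : Spec S φ) (hψ : Spec T ψ) :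
    Integrable fun x => starRingEnd ℂ (φ x) * ψ x :=
  MemLp.integrable_mul (p := 2) (q := 2) hφ.memLp.star hψ.memLp

theorem exists_nsq_sum_plate_le {C a : ℝ} {B : ℝ≥0∞} (hB : B ≠ ⊤) : ∃ N : ℕ, ∀ {e : E} {ν : E → E} {c : ℝ} {S : Set E},
    IsCap e ν c C S → ∀ {r : ℝ}, 1 ≤ r → ∀ {ι : Type} {Θ : Finset ι} {p : ι → E}, (∀ z ∈ Θ, p z ∈ S) → IsNet r B Θ p →
    ∀ {U : ι → E → ℂ}, (∀ z ∈ Θ, Spec (plate e ν r a (p z)) (U z)) →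
    nsq (fun x => ∑ z ∈ Θ, U z x) ≤ N * ∑ z ∈ Θ, nsq (U z) := by
  set K := (1 + ENNReal.ofReal ((3 + C * C) * a)) ^ (Module.finrank ℝ E + 1) * B
  obtain ⟨N, hN⟩ := ENNReal.exists_nat_gt (show K ≠ ⊤ by finiteness)
  refine ⟨N, fun hS r hr ι Θ p hp hn U hU => Spec.nsq_sum_le hU N fun ξ t ht hξ => ?_⟩
  have := hn.card_le (by linarith) ht (ξ := ξ) (b := (3 + C * C) * a) fun z hz => by
    rw [norm_sub_rev]; exact hS.norm_sub_le_of_mem_plate hr (hp z (ht hz)) (hξ z hz)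
  exact_mod_cast this.trans hN.le

theorem exists_far_decomp {c C D : ℝ} (hc : 0 < c) (hC : 1 ≤ C) (hD : 0 < D) (a₁ a₂ : ℝ) :
    ∃ (a' : ℝ) (C₀ : ℝ≥0∞), C₀ ≠ ⊤ ∧ ∀ {M : ℝ}, 0 < M → ∃ C₁ : ℝ≥0∞, C₁ ≠ ⊤ ∧
      ∀ {e : E} {ν : E → E} {S S₁ S₂ : Set E}, IsCapPair e ν c C D S S₁ S₂ →
      ∀ {r : ℝ}, 1 ≤ r → ∀ {ι : Type} {I : Finset ι}, I.Nonempty → ∀ {Q : ι → Set E},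
      (∀ i ∈ I, Bornology.IsBounded (Q i)) → (∀ i ∈ I, (Q i).Nonempty) →
      ∀ {u : ι → E → ℂ}, (∀ i ∈ I, Spec (nbhd e ν r a₁ S₁) (u i)) → ∀ {w : E → ℂ}, Spec (nbhd e ν r a₂ S₂) w →
      ∃ W : ι → E → ℂ, (∀ i ∈ I, Spec (nbhd e ν r a' S₂) (W i)) ∧ (∀ x, w x = ∑ i ∈ I, W i x) ∧
        ∑ i ∈ I, nsq (W i) ≤ C₀ * nsq w ∧
        ∀ i ∈ I, ∀ j ∈ I, (∀ x ∈ Q i, ∀ y ∈ Q j, r ^ 2 ≤ M * ‖y - x‖) →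
          ∫⁻ x in Q i, ‖u i x * W j x‖ₑ ^ 2 ≤ C₁ * ENNReal.ofReal r⁻¹ *
            ENNReal.ofReal (r⁻¹ ^ (Module.finrank ℝ E + 1)) * nsq (u j) * nsq w := by
  classical
  obtain ⟨k, hk⟩ := exists_isMollifier (E := E)
  obtain ⟨b₁, B₁, hB₁, hdec₁⟩ := exists_isNet_decomp (E := E) C a₁
  obtain ⟨b₂, B₂, hB₂, hdec₂⟩ := exists_isNet_decomp (E := E) C a₂
  have hB : B₁ + B₂ ≠ ⊤ := by finiteness
  obtain ⟨N₀, hN₀⟩ := exists_nsq_sum_plate_le (E := E) (C := C) (a := b₂ + 1) hB₂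
  set N := 3 * (Module.finrank ℝ E + 1) with hNdef
  obtain ⟨Cg, hCg, hloc⟩ := exists_localizer (E := E) (N + N)
  obtain ⟨Ca, hCa, havg⟩ := hk.exists_avg_massRatio_mul_le N
  set b := 1 + 2 * ((3 + C * C) * (|b₁| + |b₂ + 1|))
  have hb : 0 ≤ b := by positivity
  refine ⟨max (b₂ + 1) a₂, N₀ + 1, by finiteness, fun {M} hM => ?_⟩
  obtain ⟨C₁, hC₁, hfarsum⟩ := exists_far_sum_le (E := E) hc hC hD hb hM b₁ b₂ hB
  refine ⟨Cg * (4 * (Ca * C₁)), by finiteness, ?_⟩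
  intro e ν S S₁ S₂ h r hr1 ι I hI Q hQb hQ u hu w hw
  have hr : 0 < r := by linarith
  obtain ⟨Θ₁, p₁, hp₁, hn₁, hd₁⟩ := hdec₁ (h.cap.subset h.subset₁) hr1
  obtain ⟨Θ₂, p₂, hp₂, hn₂, hd₂⟩ := hdec₂ (h.cap.subset h.subset₂) hr1
  choose! U hU hUsum hUn using fun i (hi : i ∈ I) => hd₁ (u i) (hu i hi)
  obtain ⟨v, hv, hvsum, hvn⟩ := hd₂ w hw
  have hUm : ∀ i ∈ I, ∀ z ∈ Θ₁, Measurable (U i z) := fun i hi z hz => (hU i hi z hz).continuous.measurable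
  have hF : ∀ l ∈ I, Measurable (sqfun r (Q l) Θ₁ (U l)) := fun l hl => measurable_sqfun _ _ (hUm l hl)
  have hfin : ∀ l ∈ I, ∫⁻ x, sqfun r (Q l) Θ₁ (U l) x ≠ ⊤ := fun l hl =>
    ((lintegral_sqfun_le r (Q l) (hUm l hl)).trans_lt
      (ENNReal.sum_lt_top.2 fun z hz => (hU l hl z hz).nsq_lt_top)).ne
  by_cases hne : ∃ i ∈ I, ∫⁻ x, sqfun r (Q i) Θ₁ (U i) x ≠ 0
  swap
  · push Not at hne
    obtain ⟨i₀, hi₀⟩ := hI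
    have hn : nsq (0 : E → ℂ) = 0 := by simp [nsq]
    refine ⟨fun i => if i = i₀ then w else 0, fun i hi => ?_, fun x => ?_, ?_, fun i hi j hj _ => ?_⟩
    · dsimp only
      split_ifs
      · exact hw.mono (nbhd_mono (le_max_right _ _) subset_rfl)
      · exact Spec.zero
    · simp [ite_apply, hi₀]
    · dsimp only
      rw [Finset.sum_eq_single i₀ (fun i _ hi => by rw [if_neg hi, hn]) (fun h => absurd hi₀ h), if_pos rfl]
      exact le_mul_of_one_le_left' (by simp)
    · refine le_trans (setLIntegral_le_lintegral _ _) ?_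
      refine le_of_eq_of_le ?_ zero_le
      have h0 := (lintegral_eq_zero_iff (hF i hi)).1 (hne i hi)
      refine lintegral_eq_zero_of_ae_eq_zero (h0.mono fun x hx => ?_)
      have h1 : ∑ κ ∈ Θ₁, ‖U i κ x‖ₑ ^ 2 = 0 := (mul_eq_zero.1 hx).resolve_left (dec_ne_zero _ (by finiteness))
      have h2 : u i x = 0 := by
        rw [hUsum i hi]
        refine Finset.sum_eq_zero fun z hz => ?_
        simpa using Finset.sum_eq_zero_iff.1 h1 z hz
      simp [h2]
  set F : ι → E → ℝ≥0∞ := fun i => sqfun r (Q i) Θ₁ (U i) with hFdef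
  set L := fun z => h.cap.tube hr (p₂ z)
  set ρ : ι → (Fin (Module.finrank ℝ E) → ℤ) → E → ℝ := fun j z => avg k (L z) (massRatio N (L z) I F j)
  set A : ι → (Fin (Module.finrank ℝ E) → ℤ) → E → ℂ := fun j z x => (ρ j z x : ℂ) * v z x
  have hρ0 : ∀ j z x, 0 ≤ ρ j z x := fun j z x => hk.avg_nonneg (massRatio_nonneg j) x
  have hρ1 : ∀ j z x, ρ j z x ≤ 1 := fun j z x =>
    hk.avg_le_one (measurable_massRatio hF j) (massRatio_nonneg j) (massRatio_le_one j) x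
  have hρs : ∀ z x, ∑ j ∈ I, ρ j z x = 1 := fun z x =>
    hk.sum_avg I (fun j => measurable_massRatio hF j) (fun j => massRatio_nonneg j) (fun j => massRatio_le_one j)
      (sum_massRatio hF hfin hne) x
  have hA : ∀ j, ∀ z ∈ Θ₂, Spec (plate e ν r (b₂ + 1) (p₂ z)) (A j z) := fun j z hz => by
    refine (hk.spec_avg_mul (hv z hz) ?_ (fun x ξ => h.cap.inner_tube hr _ _ _) (measurable_massRatio hF j)
      (massRatio_nonneg j) (massRatio_le_one j)).mono (h.cap.add_plate_subset hr _)
    exact (h.cap.isBounded_nbhd (a := b₂) hr1).subset fun ζ hζ => ⟨p₂ z, h.subset₂ (hp₂ z hz), hζ⟩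
  have hAe : ∀ j z x, ‖A j z x‖ₑ = ENNReal.ofReal (ρ j z x) * ‖v z x‖ₑ := fun j z x => by
    rw [enorm_mul, ← ofReal_norm, Complex.norm_real, Real.norm_of_nonneg (hρ0 _ _ _)]
  have hρsq : ∀ j z x, ENNReal.ofReal (ρ j z x) ^ 2 ≤ ENNReal.ofReal (ρ j z x) := fun j z x => by
    rw [sq]; exact mul_le_of_le_one_left' (by simpa using hρ1 j z x)
  refine ⟨fun j x => ∑ z ∈ Θ₂, A j z x, fun j _ => ?_, fun x => ?_, ?_, ?_⟩
  · refine Spec.sum fun z hz => (hA j z hz).mono fun ζ hζ => ⟨p₂ z, hp₂ z hz, ?_⟩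
    exact plate_mono (le_max_left _ _) _ hζ
  · rw [Finset.sum_comm, hvsum]
    refine Finset.sum_congr rfl fun z _ => ?_
    simp only [A]
    rw [← Finset.sum_mul, ← Complex.ofReal_sum, hρs, Complex.ofReal_one, one_mul]
  · calc ∑ j ∈ I, nsq (fun x => ∑ z ∈ Θ₂, A j z x) ≤ ∑ j ∈ I, N₀ * ∑ z ∈ Θ₂, nsq (A j z) :=
          Finset.sum_le_sum fun j _ => hN₀ (h.cap.subset h.subset₂) hr1 hp₂ hn₂ (hA j)
      _ = N₀ * ∑ z ∈ Θ₂, ∑ j ∈ I, nsq (A j z) := by rw [← Finset.mul_sum, Finset.sum_comm]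
      _ ≤ N₀ * ∑ z ∈ Θ₂, nsq (v z) := by
          refine mul_le_mul_right (Finset.sum_le_sum fun z hz => ?_) _
          rw [← lintegral_sum_enorm_sq (fun j _ => (hA j z hz).continuous.measurable)]
          refine lintegral_mono fun x => ?_
          calc ∑ j ∈ I, ‖A j z x‖ₑ ^ 2 ≤ ∑ j ∈ I, ENNReal.ofReal (ρ j z x) * ‖v z x‖ₑ ^ 2 := by
                refine Finset.sum_le_sum fun j _ => ?_
                rw [hAe, mul_pow]
                exact mul_le_mul_left (hρsq j z x) _
            _ = ‖v z x‖ₑ ^ 2 := by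
                rw [← Finset.sum_mul, ← ENNReal.ofReal_sum_of_nonneg fun j _ => hρ0 j z x, hρs, ENNReal.ofReal_one,
                  one_mul]
      _ ≤ (N₀ + 1) * nsq w := mul_le_mul' (by simp) hvn
  · intro i hi j hj hfar
    obtain ⟨g, hg0, hg1, hgS, hgd⟩ := hloc hr (hQb i hi) (hQ i hi)
    set φ : (Fin (Module.finrank ℝ E) → ℤ) × (Fin (Module.finrank ℝ E) → ℤ) → E → ℂ :=
      fun a x => U i a.1 x * A j a.2 x
    have hφ : ∀ a ∈ Θ₁ ×ˢ Θ₂, Spec (plate e ν r b₁ (p₁ a.1) + plate e ν r (b₂ + 1) (p₂ a.2)) (φ a) := fun a ha =>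
      (hU i hi _ (Finset.mem_product.1 ha).1).mul (hA j _ (Finset.mem_product.1 ha).2)
    have hprod : ∀ x, u i x * ∑ z ∈ Θ₂, A j z x = ∑ a ∈ Θ₁ ×ˢ Θ₂, φ a x := fun x => by
      rw [hUsum i hi, Finset.sum_mul_sum, Finset.sum_product]
    have hgm : Measurable g := by
      have := hgS.continuous
      have h2 : g = fun x => ((g x : ℂ)).re := by ext x; simp
      rw [h2]; exact (Complex.continuous_re.comp this).measurable
    have step1 : ∫⁻ x in Q i, ‖u i x * ∑ z ∈ Θ₂, A j z x‖ₑ ^ 2 ≤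
        ∫⁻ x, ENNReal.ofReal (g x) * ‖∑ a ∈ Θ₁ ×ˢ Θ₂, φ a x‖ₑ ^ 2 := by
      simp_rw [hprod]
      refine le_trans (setLIntegral_mono ?_ fun x hx => ?_) (setLIntegral_le_lintegral _ _)
      · have : Measurable fun x => ∑ a ∈ Θ₁ ×ˢ Θ₂, φ a x :=
          Finset.measurable_fun_sum _ fun a ha => (hφ a ha).continuous.measurable
        fun_prop
      · exact le_mul_of_one_le_left' (by simpa using hg1 x hx)
    have step2 := lintegral_mul_enorm_sum_sq_le (s := Θ₁ ×ˢ Θ₂) (φ := φ) hg0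
      (P := fun a a' => r * ‖(p₂ a'.2 - p₂ a.2) - (-1 : ℝ) • (p₁ a'.1 - p₁ a.1)‖ ≤ b)
      (fun a ha a' ha' => (hφ a' ha').integrable_conj_mul (hgS.mul (hφ a ha)))
      (fun a ha a' ha' hP => by
        refine (hφ a' ha').integral_conj_mul_eq_zero (hgS.mul (hφ a ha)) ?_
        by_contra hcon
        obtain ⟨ha1, ha2⟩ := Finset.mem_product.1 ha
        obtain ⟨ha1', ha2'⟩ := Finset.mem_product.1 ha'
        exact hP (h.cap.norm_add_sub_add_le hr1 (h.subset₁ (hp₁ _ ha1)) (h.subset₂ (hp₂ _ ha2))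
          (h.subset₁ (hp₁ _ ha1')) (h.subset₂ (hp₂ _ ha2')) hcon))
    have hwt := measurable_wt r (Q i)
    have hgle : ∀ x, ENNReal.ofReal (g x) ≤ Cg * (wt r (Q i) x * wt r (Q i) x) := fun x => by
      rw [wt, ← dec_add]; exact hgd x
    have hnet₁ : IsNet r (B₁ + B₂) Θ₁ p₁ := hn₁.mono le_self_add
    have hnet₂ : IsNet r (B₁ + B₂) Θ₂ p₂ := hn₂.mono le_add_self
    set Y := C₁ * ENNReal.ofReal r⁻¹ * ENNReal.ofReal (r⁻¹ ^ (Module.finrank ℝ E + 1)) *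
        (∑ z ∈ Θ₁, nsq (U j z)) * ∑ z ∈ Θ₂, nsq (v z)
    set β : (Fin (Module.finrank ℝ E) → ℤ) → E → ℝ≥0∞ := fun z x => ‖v z x‖ₑ ^ 2 / ∑ l ∈ I, mass N (L z) (F l) x
    set m : (Fin (Module.finrank ℝ E) → ℤ) → E → ℝ≥0∞ := fun z => mass N (L z) (F j)
    have hYσ : ∀ σ : ℝ, |σ| = 1 → ∑ a ∈ Θ₁ ×ˢ Θ₂, ∑ a' ∈ Θ₁ ×ˢ Θ₂,
        (if r * ‖(p₂ a'.2 - p₂ a.2) - σ • (p₁ a'.1 - p₁ a.1)‖ ≤ b then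
          ∫⁻ x, (wt r (Q i) x * wt r (Q i) x) * (‖U i a.1 x‖ₑ ^ 2 * ((Ca * β a.2 x) * m a'.2 x)) else 0) ≤
        Ca * Y := by
      intro σ hσ
      refine le_trans (le_of_eq ?_) (mul_le_mul_right (hfarsum h hr hp₁ hp₂ hnet₁ hnet₂ hσ hQ hU hv hne i hi j hj hfar) Ca)
      simp_rw [Finset.mul_sum]
      refine Finset.sum_congr rfl fun a _ => Finset.sum_congr rfl fun a' _ => ?_
      rw [mul_ite, mul_zero, ← lintegral_const_mul' _ _ hCa]
      congr 2
      ext x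
      simp only [β, m]
      ring
    have step3 := sum_sum_lintegral_mul_le (μ := (volume : Measure E)) (Θ₁ := Θ₁) (Θ₂ := Θ₂)
      (f := fun z x => ‖U i z x‖ₑ) (α := fun z x => ‖A j z x‖ₑ) (β := fun z x => Ca * β z x) (m := m)
      (G := fun x => wt r (Q i) x * wt r (Q i) x) (by fun_prop)
      (fun z hz => (hUm i hi z hz).enorm)
      (fun z hz => by
        have h2 : Measurable fun x => ∑ l ∈ I, mass N (L z) (F l) x :=
          Finset.measurable_fun_sum _ fun l hl => measurable_mass (hF l hl)
        have h3 := (hv z hz).continuous.measurable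
        simp only [β]
        fun_prop)
      (fun z _ => measurable_mass (hF j hj))
      (fun z hz x => by
        have h1 : ENNReal.ofReal (ρ j z x) ≤ Ca * mass N (L z) (F j) x / ∑ l ∈ I, mass N (L z) (F l) x := by
          rw [ENNReal.le_div_iff_mul_le]
          · exact havg (L z) hF hfin hne j hj x
          · left; intro h0
            obtain ⟨i, hi, h⟩ := hne
            exact mass_ne_zero (hF i hi) h x (Finset.sum_eq_zero_iff.1 h0 i hi)
          · left
            exact ENNReal.sum_ne_top.2 fun i hi => ((mass_le_lintegral x).trans_lt (hfin i hi).lt_top).ne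
        rw [hAe, mul_pow]
        calc ENNReal.ofReal (ρ j z x) ^ 2 * ‖v z x‖ₑ ^ 2
            ≤ (Ca * mass N (L z) (F j) x / ∑ l ∈ I, mass N (L z) (F l) x) * ‖v z x‖ₑ ^ 2 :=
              mul_le_mul_left ((hρsq j z x).trans h1) _
          _ = _ := by simp only [β, m, div_eq_mul_inv]; ring)
      (R := fun a a' => r * ‖(p₂ a'.2 - p₂ a.2) - (-1 : ℝ) • (p₁ a'.1 - p₁ a.1)‖ ≤ b)
      (R' := fun a a' => r * ‖(p₂ a'.2 - p₂ a.2) - (1 : ℝ) • (p₁ a'.1 - p₁ a.1)‖ ≤ b)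
      (fun a a' haa => by
        rwa [← norm_neg, show -((p₂ a.2 - p₂ a'.2) - (-1 : ℝ) • (p₁ a.1 - p₁ a'.1)) =
          (p₂ a'.2 - p₂ a.2) - (-1 : ℝ) • (p₁ a'.1 - p₁ a.1) by module])
      (fun a a' haa => by
        rwa [show (p₂ a'.2 - p₂ a.2) - (1 : ℝ) • (p₁ a'.1 - p₁ a.1) =
          (p₂ a'.2 - p₂ a.2) - (-1 : ℝ) • (p₁ a.1 - p₁ a'.1) by module])
      (hYσ (-1) (by simp)) (hYσ 1 (by simp))
    calc _ ≤ _ := step1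
      _ ≤ _ := step2
      _ ≤ ∑ a ∈ Θ₁ ×ˢ Θ₂, ∑ a' ∈ Θ₁ ×ˢ Θ₂,
          (if r * ‖(p₂ a'.2 - p₂ a.2) - (-1 : ℝ) • (p₁ a'.1 - p₁ a.1)‖ ≤ b then
            Cg * ∫⁻ x, (wt r (Q i) x * wt r (Q i) x) * ((‖U i a.1 x‖ₑ * ‖A j a.2 x‖ₑ) * (‖U i a'.1 x‖ₑ * ‖A j a'.2 x‖ₑ))
            else 0) := by
          refine Finset.sum_le_sum fun a _ => Finset.sum_le_sum fun a' _ => ?_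
          split_ifs
          · rw [← lintegral_const_mul' _ _ hCg]
            refine lintegral_mono fun x => ?_
            simp only [φ, enorm_mul]
            exact (mul_le_mul_left (hgle x) _).trans_eq (mul_assoc _ _ _)
          · exact le_rfl
      _ ≤ Cg * (4 * (Ca * Y)) := by
          refine le_trans (le_of_eq ?_) (mul_le_mul_right step3 Cg)
          simp_rw [Finset.mul_sum, mul_ite, mul_zero]
      _ ≤ Cg * (4 * (Ca * (C₁ * ENNReal.ofReal r⁻¹ * ENNReal.ofReal (r⁻¹ ^ (Module.finrank ℝ E + 1)) *
            nsq (u j) * nsq w))) := by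
          refine mul_le_mul_right (mul_le_mul_right (mul_le_mul_right ?_ _) _) _
          exact mul_le_mul' (mul_le_mul_right (hUn j hj) _) hvn
      _ = _ := by ring

end Fourier

section Fourier
variable {E : Type*} [NormedAddCommGroup E] [InnerProductSpace ℝ E]

theorem hpart_self {e : E} (he : ‖e‖ = 1) : hpart e e = 0 := by
  simp [hpart, he]

theorem IsCap.abs_le_of_mem_nbhd {e : E} {ν : E → E} {c C : ℝ} {S : Set E} (hS : IsCap e ν c C S) {r a : ℝ}
    (hr : 1 ≤ r) {ζ : E} {s : ℝ} (h : ζ ∈ nbhd e ν r a S) (h' : ζ + s • e ∈ nbhd e ν r a S) :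
    r ^ 2 * |s| ≤ a + (a + 2 * a + C * a * (2 * a) + C * (2 * a) ^ 2) := by
  obtain ⟨p, hp, h1, h2⟩ := h
  obtain ⟨p', hp', h3⟩ := h'
  have hr0 : 0 < r := by linarith
  have e1 : hpart e (p - p') = hpart e (ζ + s • e - p') - hpart e (ζ - p) := by
    rw [← hpart_sub, show ζ + s • e - p' - (ζ - p) = (p - p') + s • e by abel, hpart_add, hpart_smul,
      hpart_self hS.norm_e, smul_zero, add_zero]
  have h4 : r * ‖hpart e (p - p')‖ ≤ 2 * a := by
    have := mul_le_mul_of_nonneg_left (_root_.norm_sub_le (hpart e (ζ + s • e - p')) (hpart e (ζ - p))) hr0.le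
    rw [← e1] at this
    linarith [h3.1]
  have h5 := (hS.plate_subset_plate hr hp hp' h4 h3).2
  have e2 : ⟪ζ + s • e - p, ν p⟫ = ⟪ζ - p, ν p⟫ + s := by
    rw [show ζ + s • e - p = (ζ - p) + s • e by abel, inner_add_left, inner_smul_left, real_inner_comm,
      real_inner_comm (ν p) e, hS.inner_normal]
    simp
  rw [e2] at h5
  have h6 : |s| ≤ |⟪ζ - p, ν p⟫| + |⟪ζ - p, ν p⟫ + s| := by
    have := abs_sub (⟪ζ - p, ν p⟫ + s) ⟪ζ - p, ν p⟫
    rw [add_sub_cancel_left] at this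
    linarith
  have := mul_le_mul_of_nonneg_left h6 (sq_nonneg r)
  linarith

variable [FiniteDimensional ℝ E] [MeasurableSpace E] [BorelSpace E]

theorem one_div_one_add_sq_eq (t : ℝ) :
    (∫ s : ℝ in Set.Ioi 0, Complex.exp ((-1 - 2 * Real.pi * t * Complex.I) * s)).re = 1 / (1 + (2 * Real.pi * t) ^ 2) := by
  rw [integral_exp_mul_complex_Ioi (by simp)]
  simp only [Complex.ofReal_zero, mul_zero, Complex.exp_zero, Complex.div_re, Complex.neg_re, Complex.one_re, Complex.normSq_apply]
  simp
  ring

/-- Energy estimate on a slab for functions whose spectrum is thin in one direction. -/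
theorem Spec.lintegral_slab_le {S : Set E} {φ : E → ℂ} (hφ : Spec S φ) {e : E} {δ : ℝ} (hδ : 0 ≤ δ)
    (hS : ∀ ζ ∈ S, ∀ s : ℝ, ζ + s • e ∈ S → |s| ≤ δ) {ρ : ℝ} (hρ : 0 < ρ) (t₀ : ℝ) :
    ∫⁻ x, ENNReal.ofReal (1 / (1 + (2 * Real.pi * ((⟪x, e⟫ - t₀) / ρ)) ^ 2)) * ‖φ x‖ₑ ^ 2 ≤
      ENNReal.ofReal (δ * ρ) * nsq φ := by
  set τ : E → ℝ := fun x => (⟪x, e⟫ - t₀) / ρ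
  have hτ : Continuous τ := by fun_prop
  set k : E → ℝ := fun x => 1 / (1 + (2 * Real.pi * τ x) ^ 2)
  have hk0 : ∀ x, 0 ≤ k x := fun x => by positivity
  have hk1 : ∀ x, k x ≤ 1 := fun x => by
    rw [div_le_one (by positivity)]; nlinarith [sq_nonneg (2 * Real.pi * τ x)]
  have hkc : Continuous k := by
    refine continuous_const.div (by fun_prop) fun x => ?_
    positivity
  have hφc := hφ.continuous
  have hsq : Integrable fun x => ‖φ x‖ ^ 2 := (memLp_two_iff_integrable_sq_norm hφc.aestronglyMeasurable).1 hφ.memLp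
  set Q := ∫ x, ‖φ x‖ ^ 2
  have hQ : nsq φ = ENNReal.ofReal Q := by
    rw [ofReal_integral_eq_lintegral_ofReal hsq (.of_forall fun x => by positivity)]
    refine lintegral_congr fun x => ?_
    rw [ENNReal.ofReal_pow (norm_nonneg _), ofReal_norm]
  have hQ0 : 0 ≤ Q := integral_nonneg fun x => by positivity
  set μ := volume.restrict (Set.Ioi (0 : ℝ))
  set G : E → ℝ → ℂ := fun x s => ((‖φ x‖ ^ 2 : ℝ) : ℂ) * Complex.exp ((-1 - 2 * Real.pi * τ x * Complex.I) * s)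
  have hexp : Integrable (fun s : ℝ => Real.exp (-s)) μ := integrableOn_exp_neg_Ioi 0
  have hG : Integrable (Function.uncurry G) (volume.prod μ) := by
    refine (hsq.mul_prod hexp).mono' ?_ (.of_forall fun z => ?_)
    · have : Continuous (Function.uncurry G) := by
        simp only [G, Function.uncurry_def]; fun_prop
      exact this.aestronglyMeasurable
    · simp only [Function.uncurry, G]
      rw [norm_mul, Complex.norm_real, Complex.norm_exp]
      simp
  have hsw := integral_integral_swap hG
  have hinner : ∀ s : ℝ, 0 < s → ‖∫ x, G x s‖ ≤ Q := fun s hs => by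
    refine norm_integral_le_of_norm_le hsq (.of_forall fun x => ?_)
    simp only [G]
    rw [norm_mul, Complex.norm_real, Complex.norm_exp]
    simp
    have : Real.exp (-s) ≤ 1 := by simpa using hs.le
    nlinarith [sq_nonneg ‖φ x‖]
  have hzero : ∀ s : ℝ, δ * ρ < s → ∫ x, G x s = 0 := fun s hs => by
    have h1 := hφ.affine (L := id) (LinearEquiv.refl ℝ E) (fun x ξ => rfl) ((s / ρ) • e)
    have h2 := hφ.integral_conj_mul_eq_zero h1 (by
      rw [Set.disjoint_left]
      intro ζ hζ hζ'
      have h3 := hS _ hζ' (s / ρ) (by simpa using hζ)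
      have h4 : δ < s / ρ := by rwa [lt_div_iff₀ hρ]
      linarith [le_abs_self (s / ρ)])
    have h5 : ∀ x, G x s = (Complex.exp (-s) * Complex.exp (2 * Real.pi * (t₀ / ρ) * s * Complex.I)) *
        (starRingEnd ℂ (φ x) * ((Real.fourierChar (-⟪(s / ρ) • e, x⟫) : ℂ) * φ (id x))) := fun x => by
      simp only [G, τ, id]
      rw [show starRingEnd ℂ (φ x) * ((Real.fourierChar (-⟪(s / ρ) • e, x⟫) : ℂ) * φ x) =
        (starRingEnd ℂ (φ x) * φ x) * (Real.fourierChar (-⟪(s / ρ) • e, x⟫) : ℂ) by ring, Complex.conj_mul',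
        Real.fourierChar_apply, mul_left_comm, ← Complex.exp_add, ← Complex.exp_add, inner_smul_left, real_inner_comm]
      push_cast
      congr 2
      simp
      ring
    simp_rw [h5]
    rw [integral_const_mul, h2, mul_zero]
  have hre : ∫ x, k x * ‖φ x‖ ^ 2 = (∫ x, ∫ s, G x s ∂μ).re := by
    have hG' : Integrable fun x => ∫ s, G x s ∂μ := hG.integral_prod_left
    rw [← RCLike.re_to_complex, ← integral_re hG']
    refine integral_congr_ae (.of_forall fun x => ?_)
    simp only [G]
    rw [integral_const_mul, RCLike.re_to_complex, Complex.re_ofReal_mul, one_div_one_add_sq_eq]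
    ring
  have hintegrable : Integrable fun x => k x * ‖φ x‖ ^ 2 :=
    hsq.bdd_mul hkc.aestronglyMeasurable (.of_forall fun x => by rw [Real.norm_of_nonneg (hk0 x)]; exact hk1 x)
  have hfin : ∫ x, k x * ‖φ x‖ ^ 2 ≤ δ * ρ * Q := by
    rw [hre, hsw]
    refine (Complex.re_le_norm _).trans ?_
    have hb : Integrable ((Set.Ioc 0 (δ * ρ)).indicator fun _ => Q) μ :=
      ((integrable_indicator_iff measurableSet_Ioc).2 (integrableOn_const (by simp))).restrict
    refine (norm_integral_le_of_norm_le hb ((ae_restrict_mem measurableSet_Ioi).mono fun s hs => ?_)).trans ?_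
    · by_cases h1 : s ≤ δ * ρ
      · rw [Set.indicator_of_mem (by exact ⟨hs, h1⟩)]; exact hinner s hs
      · rw [hzero s (not_le.1 h1), norm_zero]
        exact Set.indicator_nonneg (fun _ _ => hQ0) _
    · rw [integral_indicator measurableSet_Ioc, Measure.restrict_restrict measurableSet_Ioc,
        Set.inter_eq_left.2 Set.Ioc_subset_Ioi_self]
      simp [mul_nonneg hδ hρ.le]
  calc _ = ENNReal.ofReal (∫ x, k x * ‖φ x‖ ^ 2) := by
        rw [ofReal_integral_eq_lintegral_ofReal hintegrable (.of_forall fun x => mul_nonneg (hk0 x) (by positivity))]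
        refine lintegral_congr fun x => ?_
        rw [ENNReal.ofReal_mul (hk0 x), ENNReal.ofReal_pow (norm_nonneg _), ofReal_norm]
    _ ≤ ENNReal.ofReal (δ * ρ * Q) := ENNReal.ofReal_le_ofReal hfin
    _ = _ := by rw [ENNReal.ofReal_mul (by positivity), hQ]

end Fourier

section Fourier
variable {E : Type*} [NormedAddCommGroup E] [InnerProductSpace ℝ E]

theorem IsCap.ball_add_nbhd_subset {e : E} {ν : E → E} {c C : ℝ} {S : Set E} (hS : IsCap e ν c C S) {r m a : ℝ}
    (hm : 1 ≤ m) (ha : 2 * a ≤ m) (hr : m ≤ r) :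
    closedBall 0 (2 * (1 + C * C) * (r / m) ^ 2)⁻¹ + nbhd e ν r a S ⊆ nbhd e ν (r / m) 1 S := by
  rintro _ ⟨z, hz, ξ, ⟨p, hp, h1, h2⟩, rfl⟩
  refine ⟨p, hp, ?_⟩
  have hC := hS.one_le
  have hm0 : 0 < m := by linarith
  have hq : 1 ≤ r / m := by rwa [one_le_div hm0]
  obtain ⟨q, hrq⟩ : ∃ q, r / m = q := ⟨_, rfl⟩
  rw [hrq] at hq hz ⊢
  have hr' : r = q * m := by rw [← hrq]; field_simp
  have hz' : 2 * (1 + C * C) * q ^ 2 * ‖z‖ ≤ 1 := by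
    have h3 : ‖z‖ ≤ (2 * (1 + C * C) * q ^ 2)⁻¹ := by simpa using hz
    calc 2 * (1 + C * C) * q ^ 2 * ‖z‖ ≤ 2 * (1 + C * C) * q ^ 2 * (2 * (1 + C * C) * q ^ 2)⁻¹ := by gcongr
      _ = 1 := mul_inv_cancel₀ (by positivity)
  have e1 : z + ξ - p = z + (ξ - p) := by abel
  have hν := hS.norm_normal p hp
  have h3 : m * (q * ‖hpart e (ξ - p)‖) ≤ m * (1 / 2) := by rw [hr'] at h1; linarith
  have h4 : m * (q ^ 2 * |⟪ξ - p, ν p⟫|) ≤ m * (1 / 2) := by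
    have h5 : m * (q ^ 2 * |⟪ξ - p, ν p⟫|) ≤ m * (m * (q ^ 2 * |⟪ξ - p, ν p⟫|)) :=
      mul_le_mul_of_nonneg_left (le_mul_of_one_le_left (by positivity) hm) hm0.le
    rw [hr'] at h2
    linarith
  have h3' := le_of_mul_le_mul_left h3 hm0
  have h4' := le_of_mul_le_mul_left h4 hm0
  have hq2 : q * ‖z‖ ≤ q ^ 2 * ‖z‖ := by gcongr; nlinarith
  have hC2 : q ^ 2 * ‖z‖ ≤ (1 + C * C) * (q ^ 2 * ‖z‖) := le_mul_of_one_le_left (by positivity) (by nlinarith)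
  have hq0 : 0 ≤ q := by linarith
  constructor
  · rw [e1, hpart_add]
    have h5 := (norm_add_le (hpart e z) (hpart e (ξ - p))).trans
      (add_le_add (norm_hpart_le hS.norm_e z) le_rfl)
    have := mul_le_mul_of_nonneg_left h5 hq0
    linarith
  · rw [e1, inner_add_left]
    have h5 := (abs_add_le ⟪z, ν p⟫ ⟪ξ - p, ν p⟫).trans (add_le_add ((abs_real_inner_le_norm z (ν p)).trans
      (mul_le_mul_of_nonneg_left hν (norm_nonneg z))) le_rfl)
    have := mul_le_mul_of_nonneg_left h5 (sq_nonneg q)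
    linarith

variable [FiniteDimensional ℝ E] [MeasurableSpace E] [BorelSpace E]

theorem dec_one_ofReal {t : ℝ} (ht : 0 ≤ t) : dec 1 (ENNReal.ofReal t) = ENNReal.ofReal (1 + t)⁻¹ := by
  rw [dec, pow_one, ENNReal.ofReal_inv_of_pos (by linarith), ENNReal.ofReal_add zero_le_one ht, ENNReal.ofReal_one]

/-- Localization to a ball of radius `(r / m) ^ 2`. -/
theorem exists_localize (E : Type*) [NormedAddCommGroup E] [InnerProductSpace ℝ E] [FiniteDimensional ℝ E]
    [MeasurableSpace E] [BorelSpace E] {C a : ℝ} (hC : 1 ≤ C) (ha : 0 ≤ a) : ∃ K : ℝ≥0∞, K ≠ ⊤ ∧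
    ∀ {e : E} {ν : E → E} {c : ℝ} {S : Set E}, IsCap e ν c C S →
    ∀ {r m : ℝ}, 1 ≤ m → 2 * a ≤ m → m ≤ r → ∀ (x₀ : E) {φ : E → ℂ}, Spec (nbhd e ν r a S) φ →
    ∃ ψ, Spec (nbhd e ν (r / m) 1 S) ψ ∧ (∀ x ∈ closedBall x₀ ((r / m) ^ 2), ‖φ x‖ₑ ≤ ‖ψ x‖ₑ) ∧
      nsq ψ ≤ K * ENNReal.ofReal (m⁻¹ ^ 2) * nsq φ := by
  obtain ⟨Cg, hCg, hloc⟩ := exists_localizer (E := E) 1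
  set Λ := 2 * (1 + C * C)
  have hΛ : 1 ≤ Λ := by nlinarith
  set κ := 1 + (2 * Real.pi * Λ) ^ 2
  set δ := a + (a + 2 * a + C * a * (2 * a) + C * (2 * a) ^ 2)
  have hδ : 0 ≤ δ := by positivity
  refine ⟨Cg ^ 2 * ENNReal.ofReal κ * ENNReal.ofReal δ, by finiteness, ?_⟩
  intro e ν c S hS r m hm ham hr x₀ φ hφ
  have hm0 : 0 < m := by linarith
  have hr0 : 0 < r := by linarith
  set ρ := (r / m) ^ 2
  have hρ : 0 < ρ := by positivity
  obtain ⟨g, hg0, hg1, hgS, hgd⟩ := hloc (l := Λ * ρ) (by positivity) (q := closedBall x₀ ρ) isBounded_closedBall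
    ⟨x₀, mem_closedBall_self hρ.le⟩
  have hge : ∀ x, ‖((g x : ℝ) : ℂ)‖ₑ = ENNReal.ofReal (g x) := fun x => by
    rw [← ofReal_norm, Complex.norm_real, Real.norm_of_nonneg (hg0 x)]
  refine ⟨fun x => (g x : ℂ) * φ x, (hgS.mul hφ).mono (hS.ball_add_nbhd_subset hm ham hr), fun x hx => ?_, ?_⟩
  · rw [enorm_mul, hge]
    exact le_mul_of_one_le_left' (by simpa using hg1 x hx)
  have hen := hφ.lintegral_slab_le (e := e) (δ := δ / r ^ 2) (by positivity) (fun ζ hζ s hs => by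
    rw [le_div_iff₀ (by positivity), mul_comm]
    exact hS.abs_le_of_mem_nbhd (by linarith) hζ hs) hρ ⟪x₀, e⟫
  have hpt : ∀ x, ENNReal.ofReal (g x) ^ 2 ≤ Cg ^ 2 * ENNReal.ofReal κ *
      ENNReal.ofReal (1 / (1 + (2 * Real.pi * ((⟪x, e⟫ - ⟪x₀, e⟫) / ρ)) ^ 2)) := by
    intro x
    set t := infDist x (closedBall x₀ ρ) / (Λ * ρ)
    have ht : 0 ≤ t := div_nonneg infDist_nonneg (by positivity)
    have h1 : |(⟪x, e⟫ - ⟪x₀, e⟫) / ρ| ≤ Λ * (1 + t) := by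
      rw [abs_div, abs_of_pos hρ, div_le_iff₀ hρ, ← inner_sub_left]
      refine (abs_real_inner_le_norm _ _).trans ?_
      rw [hS.norm_e, mul_one]
      have h2 : dist x x₀ - ρ ≤ infDist x (closedBall x₀ ρ) := by
        refine (le_infDist ⟨x₀, mem_closedBall_self hρ.le⟩).2 fun y hy => ?_
        have := dist_triangle x y x₀
        have := mem_closedBall.1 hy
        linarith
      rw [dist_eq_norm] at h2
      have h3 : Λ * (1 + t) * ρ = Λ * ρ + infDist x (closedBall x₀ ρ) := by
        simp only [t]; field_simp
      rw [h3]
      nlinarith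
    set τ := (⟪x, e⟫ - ⟪x₀, e⟫) / ρ
    have h4 : 1 + (2 * Real.pi * τ) ^ 2 ≤ κ * (1 + t) ^ 2 := by
      have h5 : τ ^ 2 ≤ (Λ * (1 + t)) ^ 2 := sq_le_sq' (by linarith [abs_le.1 h1]) (abs_le.1 h1).2
      have h6 : (2 * Real.pi) ^ 2 * τ ^ 2 ≤ (2 * Real.pi) ^ 2 * (Λ * (1 + t)) ^ 2 := by gcongr
      have h7 : 1 ≤ (1 + t) ^ 2 := by nlinarith
      simp only [κ]
      nlinarith
    calc ENNReal.ofReal (g x) ^ 2 ≤ (Cg * ENNReal.ofReal (1 + t)⁻¹) ^ 2 := by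
          rw [← dec_one_ofReal ht]; exact pow_le_pow_left' (hgd x) 2
      _ = Cg ^ 2 * ENNReal.ofReal ((1 + t)⁻¹ ^ 2) := by
          rw [mul_pow, ENNReal.ofReal_pow (by positivity)]
      _ ≤ Cg ^ 2 * ENNReal.ofReal (κ * (1 / (1 + (2 * Real.pi * τ) ^ 2))) := by
          refine mul_le_mul_right (ENNReal.ofReal_le_ofReal ?_) _
          rw [inv_pow, mul_one_div, inv_eq_one_div, div_le_div_iff₀ (by positivity) (by positivity)]
          linarith
      _ = _ := by rw [ENNReal.ofReal_mul (by positivity), ← mul_assoc]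
  calc nsq (fun x => (g x : ℂ) * φ x) = ∫⁻ x, ENNReal.ofReal (g x) ^ 2 * ‖φ x‖ₑ ^ 2 := by
        refine lintegral_congr fun x => ?_
        rw [enorm_mul, hge, mul_pow]
    _ ≤ ∫⁻ x, (Cg ^ 2 * ENNReal.ofReal κ) *
          (ENNReal.ofReal (1 / (1 + (2 * Real.pi * ((⟪x, e⟫ - ⟪x₀, e⟫) / ρ)) ^ 2)) * ‖φ x‖ₑ ^ 2) := by
        refine lintegral_mono fun x => ?_
        rw [← mul_assoc]
        exact mul_le_mul_left (hpt x) _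
    _ ≤ (Cg ^ 2 * ENNReal.ofReal κ) * (ENNReal.ofReal (δ / r ^ 2 * ρ) * nsq φ) := by
        rw [lintegral_const_mul' _ _ (by finiteness)]
        exact mul_le_mul_right hen _
    _ = _ := by
        have : δ / r ^ 2 * ρ = δ * m⁻¹ ^ 2 := by simp only [ρ]; field_simp
        rw [this, ENNReal.ofReal_mul hδ]
        ring

end Fourier

section Fourier
variable {E : Type*} [NormedAddCommGroup E] [InnerProductSpace ℝ E] [FiniteDimensional ℝ E] [MeasurableSpace E]
  [BorelSpace E]

/-- A finite grid of cells of diameter `ρ / t` covering a ball of radius `ρ`. -/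
theorem exists_grid (E : Type*) [NormedAddCommGroup E] [InnerProductSpace ℝ E] [FiniteDimensional ℝ E]
    [MeasurableSpace E] [BorelSpace E] {t : ℝ} (ht : 0 < t) (k : ℕ) :
    ∃ n : ℕ, ∀ {ρ : ℝ}, 0 < ρ → ∀ x₀ : E, ∃ (I : Finset (Fin (Module.finrank ℝ E) → ℤ))
      (Q : (Fin (Module.finrank ℝ E) → ℤ) → Set E)
      (adj : (Fin (Module.finrank ℝ E) → ℤ) → (Fin (Module.finrank ℝ E) → ℤ) → Prop),
      I.card ≤ n ∧ I.Nonempty ∧ (∀ i, MeasurableSet (Q i)) ∧ (∀ i, (Q i).Nonempty) ∧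
      (∀ i, ∃ x, Q i ⊆ closedBall x (ρ / t)) ∧ (∀ i j, i ≠ j → Disjoint (Q i) (Q j)) ∧
      closedBall x₀ ρ ⊆ ⋃ i ∈ I, Q i ∧ (∀ i j, adj i j → adj j i) ∧
      (∀ i, ∀ J ⊆ I, (∀ j ∈ J, adj i j) → J.card ≤ (2 * k + 1) ^ Module.finrank ℝ E) ∧
      ∀ i j, ¬ adj i j → ∀ x ∈ Q i, ∀ y ∈ Q j, k * ρ ≤ t * (√(Module.finrank ℝ E) + 1) * ‖y - x‖ := by
  classical
  set σ := √(Module.finrank ℝ E) + 1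
  have hσ : 0 < σ := by positivity
  set T : ℤ := ⌈t * σ⌉ + 1
  have hT : t * σ ≤ T - 1 := by simp only [T]; push_cast; linarith [Int.le_ceil (t * σ)]
  have hT0 : (0 : ℝ) < T := by have := mul_pos ht hσ; linarith
  have hT0' : 0 < T := by exact_mod_cast hT0
  set I : Finset (Fin (Module.finrank ℝ E) → ℤ) := Fintype.piFinset fun _ => Finset.Icc (-T) T
  refine ⟨I.card, fun {ρ} hρ x₀ => ?_⟩
  set ℓ := ρ / (t * σ)
  have hℓ : 0 < ℓ := by positivity
  have hm : Measurable fun x : E => ℓ⁻¹ • (x - x₀) := by fun_prop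
  refine ⟨I, fun z => (fun x => ℓ⁻¹ • (x - x₀)) ⁻¹' cell z, fun z z' => ∀ j, |z j - z' j| ≤ k, le_rfl,
    ⟨0, ?_⟩, fun z => hm (measurableSet_cell z), fun z => ?_, fun z => ?_, fun z z' h =>
    (disjoint_cell h).preimage _, fun x hx => ?_, fun z z' h j => by rw [abs_sub_comm]; exact h j, fun z J _ hJ => ?_,
    fun z z' h x hx y hy => ?_⟩
  · simp only [I, Fintype.mem_piFinset, Finset.mem_Icc, Pi.zero_apply]
    exact fun _ => ⟨by omega, by omega⟩
  · obtain ⟨c, hc⟩ := exists_ball_subset_cell (E := E) z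
    refine ⟨x₀ + ℓ • c, ?_⟩
    have : ℓ⁻¹ • (x₀ + ℓ • c - x₀) = c := by rw [add_sub_cancel_left, smul_smul, inv_mul_cancel₀ hℓ.ne', one_smul]
    rw [Set.mem_preimage, this]
    exact hc (mem_ball_self (by norm_num))
  · obtain ⟨c, hc⟩ := exists_ball_subset_cell (E := E) z
    refine ⟨x₀ + ℓ • c, fun x hx => ?_⟩
    have h1 := norm_sub_le_of_mem_cell hx (hc (mem_ball_self (by norm_num)))
    have h2 : x - (x₀ + ℓ • c) = ℓ • (ℓ⁻¹ • (x - x₀) - c) := by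
      rw [smul_sub, smul_smul, mul_inv_cancel₀ hℓ.ne', one_smul]; abel
    rw [mem_closedBall, dist_eq_norm, h2, norm_smul, Real.norm_of_nonneg hℓ.le]
    calc ℓ * ‖ℓ⁻¹ • (x - x₀) - c‖ ≤ ℓ * σ := by
          gcongr
          simp only [σ]
          linarith
      _ = ρ / t := by simp only [ℓ]; field_simp
  · refine Set.mem_biUnion (x := fun j => ⌊⟪stdOrthonormalBasis ℝ E j, ℓ⁻¹ • (x - x₀)⟫⌋) ?_ fun j => rfl
    simp only [I, Fintype.coe_piFinset, Finset.coe_Icc, Set.mem_pi, Set.mem_univ, Set.mem_Icc, true_implies]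
    intro j
    have h1 := abs_real_inner_le_norm (stdOrthonormalBasis ℝ E j) (ℓ⁻¹ • (x - x₀))
    rw [(stdOrthonormalBasis ℝ E).norm_eq_one, one_mul, norm_smul, norm_inv, Real.norm_of_nonneg hℓ.le] at h1
    have h2 : ℓ⁻¹ * ‖x - x₀‖ ≤ ℓ⁻¹ * ρ := by gcongr; simpa [dist_eq_norm] using hx
    have h3 : ℓ⁻¹ * ρ = t * σ := by simp only [ℓ]; field_simp
    have h4 := abs_le.1 (h1.trans (h2.trans_eq h3))
    constructor
    · rw [Int.le_floor]; push_cast; linarith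
    · have := (Int.floor_le ⟪stdOrthonormalBasis ℝ E j, ℓ⁻¹ • (x - x₀)⟫)
      exact_mod_cast (show ((⌊⟪stdOrthonormalBasis ℝ E j, ℓ⁻¹ • (x - x₀)⟫⌋ : ℤ) : ℝ) ≤ T by linarith)
  · have h1 : J ⊆ Fintype.piFinset fun j => Finset.Icc (z j - k) (z j + k) := fun z' hz' => by
      simp only [Fintype.mem_piFinset, Finset.mem_Icc]
      intro j
      have := abs_le.1 (hJ z' hz' j)
      omega
    refine (Finset.card_le_card h1).trans ?_
    rw [Fintype.card_piFinset]
    simp only [Int.card_Icc]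
    rw [Finset.prod_congr rfl (fun j _ => by rw [show (z j + k + 1 - (z j - k)).toNat = 2 * k + 1 by omega]),
      Finset.prod_const, Finset.card_univ, Fintype.card_fin]
  · push Not at h
    obtain ⟨j, hj⟩ := h
    have h1 := abs_real_inner_le_norm (stdOrthonormalBasis ℝ E j) (ℓ⁻¹ • (y - x₀) - ℓ⁻¹ • (x - x₀))
    rw [(stdOrthonormalBasis ℝ E).norm_eq_one, one_mul, ← smul_sub, sub_sub_sub_cancel_right, norm_smul, norm_inv,
      Real.norm_of_nonneg hℓ.le] at h1
    have e1 : ⟪stdOrthonormalBasis ℝ E j, ℓ⁻¹ • (y - x)⟫ = ⟪stdOrthonormalBasis ℝ E j, ℓ⁻¹ • (y - x₀)⟫ -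
        ⟪stdOrthonormalBasis ℝ E j, ℓ⁻¹ • (x - x₀)⟫ := by
      rw [← inner_sub_right, ← smul_sub, sub_sub_sub_cancel_right]
    rw [e1] at h1
    have hx1 := Int.floor_eq_iff.1 (hx j)
    have hy1 := Int.floor_eq_iff.1 (hy j)
    have h2 : (k : ℝ) ≤ |⟪stdOrthonormalBasis ℝ E j, ℓ⁻¹ • (y - x₀)⟫ - ⟪stdOrthonormalBasis ℝ E j, ℓ⁻¹ • (x - x₀)⟫| := by
      rw [le_abs]
      rcases lt_abs.1 hj with h3 | h3
      · have h4 : z' j + k + 1 ≤ z j := by omega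
        have h5 : (z' j : ℝ) + k + 1 ≤ z j := by exact_mod_cast h4
        right; linarith
      · have h4 : z j + k + 1 ≤ z' j := by omega
        have h5 : (z j : ℝ) + k + 1 ≤ z' j := by exact_mod_cast h4
        left; linarith
    have h3 := h2.trans h1
    rw [inv_mul_eq_div, le_div_iff₀ hℓ] at h3
    have h4 : t * σ * (k * ℓ) = k * ρ := by simp only [ℓ]; field_simp
    rw [← h4]
    gcongr

/-- Weights of dimension `s` at scales larger than one. -/
structure IsWeight (s : ℝ) (h : E → ℝ≥0∞) : Prop where
  measurable : Measurable h
  le_one : ∀ x, h x ≤ 1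
  growth : ∀ x ρ, 1 ≤ ρ → ∫⁻ y in closedBall x ρ, h y ≤ ENNReal.ofReal (ρ ^ s)

theorem IsWeight.sq_lintegral_le {s : ℝ} {h : E → ℝ≥0∞} (hh : IsWeight s h) {Q : Set E} {x : E} {ρ : ℝ}
    (hρ : 1 ≤ ρ) (hQ : Q ⊆ closedBall x ρ) {g : E → ℝ≥0∞} (hg : Measurable g) :
    (∫⁻ y in Q, g y * h y) ^ 2 ≤ ENNReal.ofReal (ρ ^ s) * ∫⁻ y in Q, g y ^ 2 := by
  have h1 := sq_lintegral_mul_le (μ := volume.restrict Q) hh.measurable.aemeasurable hg.aemeasurable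
  simp_rw [mul_comm (g _)]
  refine h1.trans (mul_le_mul' ((lintegral_mono_set hQ).trans (hh.growth x ρ hρ)) (lintegral_mono fun y => ?_))
  exact mul_le_of_le_one_left' (hh.le_one y)

/-- The bilinear estimate at scale `r` with constant `b`. -/
def BilBound (E : Type*) [NormedAddCommGroup E] [InnerProductSpace ℝ E] [FiniteDimensional ℝ E]
    [MeasurableSpace E] [BorelSpace E] (c C D s r : ℝ) (b : ℝ≥0∞) : Prop :=
  ∀ ⦃e : E⦄ ⦃ν : E → E⦄ ⦃S S₁ S₂ : Set E⦄, IsCapPair e ν c C D S S₁ S₂ →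
  ∀ ⦃h : E → ℝ≥0∞⦄, IsWeight s h → ∀ (x₀ : E) ⦃u w : E → ℂ⦄, Spec (nbhd e ν r 1 S₁) u → Spec (nbhd e ν r 1 S₂) w →
  ∫⁻ x in closedBall x₀ (r ^ 2), ‖u x * w x‖ₑ * h x ≤ b * (nsq u + nsq w)

theorem lintegral_enorm_mul_le_nsq_add {h : E → ℝ≥0∞} (hh : ∀ x, h x ≤ 1) (Q : Set E) {u w : E → ℂ}
    (hu : Measurable u) : ∫⁻ x in Q, ‖u x * w x‖ₑ * h x ≤ nsq u + nsq w := by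
  rw [nsq, nsq, ← lintegral_add_left (by fun_prop)]
  refine (setLIntegral_le_lintegral _ _).trans (lintegral_mono fun x => ?_)
  refine (mul_le_of_le_one_right' (hh x)).trans ?_
  rw [enorm_mul]
  exact ENNReal.mul_le_sq_add_sq _ _

theorem bilBound_one (c C D s r : ℝ) : BilBound E c C D s r 1 := by
  intro e ν S S₁ S₂ _ h hh x₀ u w hu hw
  rw [one_mul]
  exact lintegral_enorm_mul_le_nsq_add hh.le_one _ hu.continuous.measurable

end Fourier

section Fourier
variable {E : Type*} [NormedAddCommGroup E] [InnerProductSpace ℝ E] [FiniteDimensional ℝ E] [MeasurableSpace E]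
  [BorelSpace E]

theorem Spec.nsq_sum_le_card {ι : Type*} {s : Finset ι} {S : Set E} {φ : ι → E → ℂ}
    (h : ∀ i ∈ s, Spec S (φ i)) {N : ℕ} (hN : s.card ≤ N) :
    nsq (fun x => ∑ i ∈ s, φ i x) ≤ N * ∑ i ∈ s, nsq (φ i) :=
  Spec.nsq_sum_le h N fun _ _ ht _ => (Finset.card_le_card ht).trans hN

open Classical in
theorem sum_sum_filter_le {ι : Type*} {I : Finset ι} {adj : ι → ι → Prop} (hsymm : ∀ i j, adj i j → adj j i) {N : ℕ}
    (hN : ∀ i, ∀ J ⊆ I, (∀ j ∈ J, adj i j) → J.card ≤ N) (f : ι → ℝ≥0∞) :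
    ∑ i ∈ I, ∑ j ∈ I with adj i j, f j ≤ N * ∑ j ∈ I, f j := by
  simp_rw [Finset.sum_filter]
  rw [Finset.sum_comm, Finset.mul_sum]
  refine Finset.sum_le_sum fun j _ => ?_
  rw [← Finset.sum_filter, Finset.sum_const, nsmul_eq_mul]
  gcongr
  exact hN j _ (Finset.filter_subset _ _) fun i hi => hsymm _ _ (Finset.mem_filter.1 hi).2

theorem rpow_identity {r s : ℝ} (hr : 0 < r) (d : ℕ) :
    (r ^ 2) ^ s * (r⁻¹ * r⁻¹ ^ (d + 1)) = (r ^ (s - ((d : ℝ) + 2) / 2)) ^ 2 := by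
  have h1 : r⁻¹ * r⁻¹ ^ (d + 1) = r ^ (-((d : ℝ) + 2)) := by
    rw [← pow_succ', inv_pow, Real.rpow_neg hr.le, ← Real.rpow_natCast]
    push_cast
    ring_nf
  rw [h1, ← Real.rpow_natCast r 2, ← Real.rpow_mul hr.le, ← Real.rpow_add hr, ← Real.rpow_natCast, ← Real.rpow_mul hr.le]
  congr 1
  push_cast
  ring

theorem IsWeight.lintegral_le_of_sq {s : ℝ} {h : E → ℝ≥0∞} (hh : IsWeight s h) {Q : Set E} {x : E} {r : ℝ}
    (hr : 1 ≤ r) (hQ : Q ⊆ closedBall x (r ^ 2)) {g : E → ℝ≥0∞} (hg : Measurable g) {C₁ A B : ℝ≥0∞}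
    (h2 : ∫⁻ y in Q, g y ^ 2 ≤ C₁ * ENNReal.ofReal r⁻¹ * ENNReal.ofReal (r⁻¹ ^ (Module.finrank ℝ E + 1)) * A * B) :
    ∫⁻ y in Q, g y * h y ≤ (C₁ + 1) * ENNReal.ofReal (r ^ (s - ((Module.finrank ℝ E : ℝ) + 2) / 2)) * (A + B) := by
  have hr0 : 0 < r := by linarith
  rw [mul_add]
  refine ENNReal.le_add_of_sq_le_mul ((hh.sq_lintegral_le (one_le_pow₀ hr) hQ hg).trans ?_)
  calc ENNReal.ofReal ((r ^ 2) ^ s) * ∫⁻ y in Q, g y ^ 2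
      ≤ ENNReal.ofReal ((r ^ 2) ^ s) * (C₁ * ENNReal.ofReal r⁻¹ * ENNReal.ofReal (r⁻¹ ^ (Module.finrank ℝ E + 1)) * A * B) :=
        mul_le_mul_right h2 _
    _ = C₁ * ENNReal.ofReal ((r ^ 2) ^ s * (r⁻¹ * r⁻¹ ^ (Module.finrank ℝ E + 1))) * (A * B) := by
        rw [ENNReal.ofReal_mul (by positivity), ENNReal.ofReal_mul (by positivity)]
        ring
    _ ≤ (C₁ + 1) * (C₁ + 1) * ENNReal.ofReal ((r ^ 2) ^ s * (r⁻¹ * r⁻¹ ^ (Module.finrank ℝ E + 1))) * (A * B) := by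
        gcongr
        exact le_self_add.trans (le_mul_of_one_le_right' le_add_self)
    _ = _ := by
        rw [rpow_identity hr0, ENNReal.ofReal_pow (by positivity)]
        ring

open Classical in
/-- One step of the induction on scales. -/
theorem exists_bilBound_step {c C D s : ℝ} (hc : 0 < c) (hC : 1 ≤ C) (hD : 0 < D) :
    ∃ (a : ℝ) (C₀ : ℝ≥0∞), C₀ ≠ ⊤ ∧ ∀ {m : ℝ}, 1 ≤ m → a ≤ m → ∃ C₁ : ℝ≥0∞, C₁ ≠ ⊤ ∧
      ∀ {r : ℝ}, m ≤ r → ∀ {b : ℝ≥0∞}, BilBound E c C D s (r / m) b →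
        BilBound E c C D s r (C₀ * ENNReal.ofReal (m⁻¹ ^ 2) * b +
          C₁ * ENNReal.ofReal (r ^ (s - ((Module.finrank ℝ E : ℝ) + 2) / 2))) := by
  obtain ⟨a₁, N₁, hN₁, hfar₁⟩ := exists_far_decomp (E := E) hc hC hD 1 1
  obtain ⟨a₂, N₂, hN₂, hfar₂⟩ := exists_far_decomp (E := E) hc hC hD a₁ 1
  set a := max 0 (max a₁ a₂)
  obtain ⟨K, hK, hlocal⟩ := exists_localize E hC (le_max_left 0 (max a₁ a₂))
  set N := (2 * 1 + 1) ^ Module.finrank ℝ E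
  refine ⟨2 * a, K * (N * (N * (N₁ + N₂))), by finiteness, fun {m} hm ham => ?_⟩
  have hm0 : 0 < m := by linarith
  obtain ⟨n, hgrid⟩ := exists_grid E (t := m ^ 2) (by positivity) 1
  obtain ⟨F₁, hF₁, hfar₁⟩ := hfar₁ (M := m ^ 2 * (√(Module.finrank ℝ E) + 1)) (by positivity)
  obtain ⟨F₂, hF₂, hfar₂⟩ := hfar₂ (M := m ^ 2 * (√(Module.finrank ℝ E) + 1)) (by positivity)
  refine ⟨n * (n * ((F₁ + 1) + (F₂ + 1) * (N * N₁ + 1))), by finiteness, fun {r} hr {b} hb => ?_⟩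
  intro e ν S S₁ S₂ hS h hh x₀ u w hu hw
  have hr1 : 1 ≤ r := hm.trans hr
  have hr0 : 0 < r := by linarith
  obtain ⟨I, Q, adj, hI, hIne, hQm, hQne, hQb, hQd, hQc, hsymm, hadj, hnadj⟩ := hgrid (ρ := r ^ 2) (by positivity) x₀
  choose x hx using hQb
  have hρ : r ^ 2 / m ^ 2 ≤ r ^ 2 := div_le_self (by positivity) (one_le_pow₀ hm)
  have hxr : ∀ i, Q i ⊆ closedBall (x i) (r ^ 2) := fun i => (hx i).trans (closedBall_subset_closedBall hρ)
  have hQbd : ∀ i ∈ I, Bornology.IsBounded (Q i) := fun i _ => isBounded_closedBall.subset (hx i)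
  obtain ⟨W, hW, hWs, hWn, hWf⟩ := hfar₁ hS hr1 hIne hQbd (fun i _ => hQne i) (u := fun _ => u) (fun _ _ => hu) hw
  set w' : (Fin (Module.finrank ℝ E) → ℤ) → E → ℂ := fun i x => ∑ j ∈ I with adj i j, W j x
  have hw' : ∀ i, Spec (nbhd e ν r a₁ S₂) (w' i) := fun i => Spec.sum fun j hj => hW j (Finset.mem_filter.1 hj).1
  obtain ⟨U, hU, hUs, hUn, hUf⟩ := hfar₂ hS.symm hr1 hIne hQbd (fun i _ => hQne i) (fun i _ => hw' i) hu
  set u' : (Fin (Module.finrank ℝ E) → ℤ) → E → ℂ := fun i x => ∑ j ∈ I with adj i j, U j x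
  have hu' : ∀ i, Spec (nbhd e ν r a₂ S₁) (u' i) := fun i => Spec.sum fun j hj => hU j (Finset.mem_filter.1 hj).1
  have hcard : ∀ i, (I.filter fun j => adj i j).card ≤ N := fun i =>
    hadj i _ (Finset.filter_subset _ _) fun j hj => (Finset.mem_filter.1 hj).2
  have hw'n : ∀ i, nsq (w' i) ≤ N * ∑ j ∈ I with adj i j, nsq (W j) := fun i =>
    Spec.nsq_sum_le_card (fun j hj => hW j (Finset.mem_filter.1 hj).1) (hcard i)
  have hu'n : ∀ i, nsq (u' i) ≤ N * ∑ j ∈ I with adj i j, nsq (U j) := fun i =>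
    Spec.nsq_sum_le_card (fun j hj => hU j (Finset.mem_filter.1 hj).1) (hcard i)
  have hw'b : ∀ i, nsq (w' i) ≤ N * N₁ * nsq w := fun i => (hw'n i).trans (by
    rw [mul_assoc]
    exact mul_le_mul_right ((Finset.sum_le_sum_of_subset (Finset.filter_subset _ _)).trans hWn) _)
  set X := ENNReal.ofReal (r ^ (s - ((Module.finrank ℝ E : ℝ) + 2) / 2))
  have hpt : ∀ i, ∀ x, ‖u x * w x‖ₑ ≤ (∑ j ∈ I with ¬ adj i j, ‖u x * W j x‖ₑ) +
      (∑ j ∈ I with ¬ adj i j, ‖w' i x * U j x‖ₑ) + ‖u' i x * w' i x‖ₑ := by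
    intro i x
    have e1 : w x = w' i x + ∑ j ∈ I with ¬ adj i j, W j x := by
      rw [hWs, Finset.sum_filter_add_sum_filter_not]
    have e2 : u x = u' i x + ∑ j ∈ I with ¬ adj i j, U j x := by
      rw [hUs, Finset.sum_filter_add_sum_filter_not]
    have e3 : u x * w x = (∑ j ∈ I with ¬ adj i j, u x * W j x) + (∑ j ∈ I with ¬ adj i j, w' i x * U j x) +
        u' i x * w' i x := by
      rw [← Finset.mul_sum, ← Finset.mul_sum]
      nth_rewrite 1 [e1]
      rw [mul_add]
      nth_rewrite 1 [e2]
      ring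
    rw [e3]
    refine (enorm_add_le _ _).trans (add_le_add ((enorm_add_le _ _).trans (add_le_add ?_ ?_)) le_rfl)
    · exact enorm_sum_le _ _
    · exact enorm_sum_le _ _
  have hcu := hu.continuous.measurable
  have hcW : ∀ j ∈ I, Measurable (W j) := fun j hj => (hW j hj).continuous.measurable
  have hcU : ∀ j ∈ I, Measurable (U j) := fun j hj => (hU j hj).continuous.measurable
  have hcw' : ∀ i, Measurable (w' i) := fun i => (hw' i).continuous.measurable
  have hcu' : ∀ i, Measurable (u' i) := fun i => (hu' i).continuous.measurable
  have hcell : ∀ i ∈ I, ∫⁻ x in Q i, ‖u x * w x‖ₑ * h x ≤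
      n * ((F₁ + 1) * X * (nsq u + nsq w)) + n * ((F₂ + 1) * X * (N * N₁ * nsq w + nsq u)) +
        b * (K * ENNReal.ofReal (m⁻¹ ^ 2) * nsq (u' i) + K * ENNReal.ofReal (m⁻¹ ^ 2) * nsq (w' i)) := by
    intro i hi
    have hnI : ((I.filter fun j => ¬ adj i j).card : ℝ≥0∞) ≤ n := by
      exact_mod_cast (Finset.card_filter_le _ _).trans hI
    have hh' := hh.measurable
    calc ∫⁻ x in Q i, ‖u x * w x‖ₑ * h x
        ≤ ∫⁻ x in Q i, ((∑ j ∈ I with ¬ adj i j, ‖u x * W j x‖ₑ * h x) +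
          (∑ j ∈ I with ¬ adj i j, ‖w' i x * U j x‖ₑ * h x) + ‖u' i x * w' i x‖ₑ * h x) := by
          refine lintegral_mono fun x => ?_
          rw [← Finset.sum_mul, ← Finset.sum_mul, ← add_mul, ← add_mul]
          exact mul_le_mul_left (hpt i x) _
      _ = (∑ j ∈ I with ¬ adj i j, ∫⁻ x in Q i, ‖u x * W j x‖ₑ * h x) +
          (∑ j ∈ I with ¬ adj i j, ∫⁻ x in Q i, ‖w' i x * U j x‖ₑ * h x) + ∫⁻ x in Q i, ‖u' i x * w' i x‖ₑ * h x := by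
          rw [lintegral_add_right _ (by have := hcu' i; have := hcw' i; fun_prop),
            lintegral_add_right, lintegral_finsetSum', lintegral_finsetSum']
          · intro j hj
            have := hcU j (Finset.mem_filter.1 hj).1
            have := hcw' i
            fun_prop
          · intro j hj
            have := hcW j (Finset.mem_filter.1 hj).1
            fun_prop
          · refine Finset.measurable_fun_sum _ fun j hj => ?_
            have := hcU j (Finset.mem_filter.1 hj).1
            have := hcw' i
            fun_prop
      _ ≤ _ := by
          refine add_le_add (add_le_add ?_ ?_) ?_
          · refine (Finset.sum_le_card_nsmul _ _ ((F₁ + 1) * X * (nsq u + nsq w)) fun j hj => ?_).trans ?_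
            · obtain ⟨hj, hij⟩ := Finset.mem_filter.1 hj
              have := hcW j hj
              exact hh.lintegral_le_of_sq hr1 (hxr i) (by fun_prop)
                (hWf i hi j hj fun x hx y hy => by simpa using hnadj i j hij x hx y hy)
            · rw [nsmul_eq_mul]
              exact mul_le_mul_left hnI _
          · refine (Finset.sum_le_card_nsmul _ _ ((F₂ + 1) * X * (N * N₁ * nsq w + nsq u)) fun j hj => ?_).trans ?_
            · obtain ⟨hj, hij⟩ := Finset.mem_filter.1 hj
              have := hcU j hj
              have := hcw' i
              refine (hh.lintegral_le_of_sq hr1 (hxr i) (by fun_prop)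
                (hUf i hi j hj fun x hx y hy => by simpa using hnadj i j hij x hx y hy)).trans ?_
              gcongr
              exact hw'b j
            · rw [nsmul_eq_mul]
              exact mul_le_mul_left hnI _
          · obtain ⟨ψ, hψ, hψp, hψn⟩ := hlocal (hS.cap.subset hS.subset₁) hm ham hr (x i)
              ((hu' i).mono (nbhd_mono ((le_max_right _ _).trans (le_max_right _ _)) subset_rfl))
            obtain ⟨χ, hχ, hχp, hχn⟩ := hlocal (hS.cap.subset hS.subset₂) hm ham hr (x i)
              ((hw' i).mono (nbhd_mono ((le_max_left _ _).trans (le_max_right _ _)) subset_rfl))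
            calc ∫⁻ x in Q i, ‖u' i x * w' i x‖ₑ * h x ≤ ∫⁻ x in closedBall (x i) ((r / m) ^ 2), ‖ψ x * χ x‖ₑ * h x := by
                  refine (lintegral_mono_set (by rw [div_pow]; exact hx i)).trans
                    (setLIntegral_mono' measurableSet_closedBall fun y hy => ?_)
                  rw [enorm_mul, enorm_mul]
                  exact mul_le_mul_left (mul_le_mul' (hψp y hy) (hχp y hy)) _
              _ ≤ b * (nsq ψ + nsq χ) := hb hS hh (x i) hψ hχ
              _ ≤ _ := mul_le_mul_right (add_le_add hψn hχn) _
  have hsumu : ∑ i ∈ I, nsq (u' i) ≤ N * (N * (N₂ * nsq u)) := by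
    refine (Finset.sum_le_sum fun i _ => hu'n i).trans ?_
    rw [← Finset.mul_sum]
    refine mul_le_mul_right ((sum_sum_filter_le hsymm hadj _).trans ?_) _
    exact mul_le_mul_right hUn _
  have hsumw : ∑ i ∈ I, nsq (w' i) ≤ N * (N * (N₁ * nsq w)) := by
    refine (Finset.sum_le_sum fun i _ => hw'n i).trans ?_
    rw [← Finset.mul_sum]
    refine mul_le_mul_right ((sum_sum_filter_le hsymm hadj _).trans ?_) _
    exact mul_le_mul_right hWn _
  have hIn : (I.card : ℝ≥0∞) ≤ n := by exact_mod_cast hI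
  set k := ENNReal.ofReal (m⁻¹ ^ 2)
  calc ∫⁻ x in closedBall x₀ (r ^ 2), ‖u x * w x‖ₑ * h x ≤ ∑ i ∈ I, ∫⁻ x in Q i, ‖u x * w x‖ₑ * h x := by
        rw [← lintegral_biUnion_finset (fun i _ j _ hij => hQd i j hij) (fun i _ => hQm i)]
        exact lintegral_mono_set hQc
    _ ≤ ∑ i ∈ I, (n * ((F₁ + 1) * X * (nsq u + nsq w)) + n * ((F₂ + 1) * X * (N * N₁ * nsq w + nsq u)) +
        b * (K * k * nsq (u' i) + K * k * nsq (w' i))) := Finset.sum_le_sum hcell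
    _ = I.card * (n * ((F₁ + 1) * X * (nsq u + nsq w)) + n * ((F₂ + 1) * X * (N * N₁ * nsq w + nsq u))) +
        b * (K * k * ∑ i ∈ I, nsq (u' i) + K * k * ∑ i ∈ I, nsq (w' i)) := by
        rw [Finset.sum_add_distrib, Finset.sum_const, nsmul_eq_mul, ← Finset.mul_sum, Finset.sum_add_distrib,
          Finset.mul_sum, Finset.mul_sum]
    _ ≤ n * (n * ((F₁ + 1) * X * (nsq u + nsq w)) + n * ((F₂ + 1) * X * ((N * N₁ + 1) * (nsq u + nsq w)))) +
        b * (K * k * (N * (N * ((N₁ + N₂) * nsq u))) + K * k * (N * (N * ((N₁ + N₂) * nsq w)))) := by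
        have h1 : N * N₁ * nsq w + nsq u ≤ (N * N₁ + 1) * (nsq u + nsq w) := by
          calc N * N₁ * nsq w + nsq u ≤ N * N₁ * nsq w + nsq u + (N * N₁ * nsq u + nsq w) := le_self_add
            _ = _ := by ring
        have h2 : N₂ ≤ N₁ + N₂ := le_add_self
        have h3 : N₁ ≤ N₁ + N₂ := le_self_add
        have h4 := hsumu.trans (mul_le_mul_right (mul_le_mul_right (mul_le_mul_left h2 (nsq u)) N) N)
        have h5 := hsumw.trans (mul_le_mul_right (mul_le_mul_right (mul_le_mul_left h3 (nsq w)) N) N)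
        gcongr
    _ = _ := by ring

end Fourier

section Fourier
variable {E : Type*} [NormedAddCommGroup E] [InnerProductSpace ℝ E] [FiniteDimensional ℝ E] [MeasurableSpace E]
  [BorelSpace E]

theorem BilBound.mono {c C D s r : ℝ} {b b' : ℝ≥0∞} (h : BilBound E c C D s r b) (hb : b ≤ b') :
    BilBound E c C D s r b' := fun _ _ _ _ _ hS _ hh x₀ _ _ hu hw => (h hS hh x₀ hu hw).trans (mul_le_mul_left hb _)

theorem exists_large_scale {K : ℝ≥0∞} (hK : K ≠ ⊤) {τ : ℝ} (hτ : 0 < τ) (a : ℝ) :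
    ∃ m, a ≤ m ∧ K * ENNReal.ofReal (m ^ (-τ)) ≤ 2⁻¹ := by
  have h1 : Filter.Tendsto (fun m : ℝ => K * ENNReal.ofReal (m ^ (-τ))) Filter.atTop (𝓝 (K * ENNReal.ofReal 0)) :=
    ENNReal.Tendsto.const_mul (ENNReal.tendsto_ofReal (tendsto_rpow_neg_atTop hτ)) (Or.inr hK)
  rw [ENNReal.ofReal_zero, mul_zero] at h1
  have h2 := h1.eventually (Iic_mem_nhds (show (0 : ℝ≥0∞) < 2⁻¹ by simp))
  obtain ⟨m, h3, h4⟩ := ((Filter.eventually_ge_atTop a).and h2).exists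
  exact ⟨m, h3, h4⟩

theorem one_le_rpow_abs_mul {r m τ : ℝ} (hr : 1 ≤ r) (hrm : r ≤ m) : 1 ≤ m ^ |τ| * r ^ τ := by
  have hr0 : 0 < r := by linarith
  calc (1 : ℝ) = r ^ |τ| * r ^ (-|τ|) := by rw [← Real.rpow_add hr0, add_neg_cancel, Real.rpow_zero]
    _ ≤ m ^ |τ| * r ^ τ := by
        refine mul_le_mul (Real.rpow_le_rpow hr0.le hrm (abs_nonneg τ)) ?_ (by positivity) (Real.rpow_nonneg (by linarith) _)
        exact Real.rpow_le_rpow_of_exponent_le hr (neg_abs_le τ)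

/-- The weighted bilinear estimate. -/
theorem exists_bilBound {c C D s : ℝ} (hc : 0 < c) (hC : 1 ≤ C) (hD : 0 < D)
    (hs : (Module.finrank ℝ E : ℝ) / 2 - 1 < s) : ∃ K : ℝ≥0∞, K ≠ ⊤ ∧ ∀ {r : ℝ}, 1 ≤ r →
      BilBound E c C D s r (K * ENNReal.ofReal (r ^ (s - ((Module.finrank ℝ E : ℝ) + 2) / 2))) := by
  obtain ⟨a, C₀, hC₀, hstep⟩ := exists_bilBound_step (E := E) (s := s) hc hC hD
  set τ := s - ((Module.finrank ℝ E : ℝ) + 2) / 2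
  obtain ⟨m, ham, hm⟩ := exists_large_scale hC₀ (τ := τ + 2) (by simp only [τ]; linarith) (max 2 a)
  have hm2 : 2 ≤ m := (le_max_left _ _).trans ham
  have hm0 : 0 < m := by linarith
  obtain ⟨C₁, hC₁, hstep⟩ := hstep (m := m) (by linarith) ((le_max_right _ _).trans ham)
  set K := 2 * C₁ + ENNReal.ofReal (m ^ |τ|)
  have hind : ∀ n : ℕ, ∀ r : ℝ, 1 ≤ r → r ≤ m ^ n → BilBound E c C D s r (K * ENNReal.ofReal (r ^ τ)) := by
    have base : ∀ r : ℝ, 1 ≤ r → r ≤ m → BilBound E c C D s r (K * ENNReal.ofReal (r ^ τ)) := by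
      intro r hr hrm
      refine BilBound.mono (bilBound_one c C D s r) ?_
      calc (1 : ℝ≥0∞) ≤ ENNReal.ofReal (m ^ |τ| * r ^ τ) := by
            rw [← ENNReal.ofReal_one]; exact ENNReal.ofReal_le_ofReal (one_le_rpow_abs_mul hr hrm)
        _ = ENNReal.ofReal (m ^ |τ|) * ENNReal.ofReal (r ^ τ) := ENNReal.ofReal_mul (by positivity)
        _ ≤ _ := mul_le_mul_left le_add_self _
    intro n
    induction n with
    | zero => intro r hr hrn; exact base r hr (by simp at hrn; linarith)
    | succ n ih =>
      intro r hr hrn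
      rcases le_total r m with hrm | hrm
      · exact base r hr hrm
      have h1 : 1 ≤ r / m := by rwa [one_le_div hm0]
      refine BilBound.mono (hstep hrm (ih (r / m) h1 (by rwa [div_le_iff₀ hm0, ← pow_succ]))) ?_
      have hr0 : 0 < r := by linarith
      have e1 : ENNReal.ofReal (m⁻¹ ^ 2) * ENNReal.ofReal ((r / m) ^ τ) =
          ENNReal.ofReal (m ^ (-(τ + 2))) * ENNReal.ofReal (r ^ τ) := by
        rw [← ENNReal.ofReal_mul (by positivity), ← ENNReal.ofReal_mul (by positivity), Real.div_rpow hr0.le hm0.le,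
          Real.rpow_neg hm0.le, Real.rpow_add hm0, Real.rpow_two]
        congr 1
        field_simp
      have e2 : C₁ ≤ 2⁻¹ * K := by
        calc C₁ = 2⁻¹ * (2 * C₁) := by rw [← mul_assoc, ENNReal.inv_mul_cancel two_ne_zero ENNReal.ofNat_ne_top, one_mul]
          _ ≤ 2⁻¹ * K := mul_le_mul_right le_self_add _
      calc C₀ * ENNReal.ofReal (m⁻¹ ^ 2) * (K * ENNReal.ofReal ((r / m) ^ τ)) + C₁ * ENNReal.ofReal (r ^ τ)
          = C₀ * K * (ENNReal.ofReal (m⁻¹ ^ 2) * ENNReal.ofReal ((r / m) ^ τ)) + C₁ * ENNReal.ofReal (r ^ τ) := by ring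
        _ = C₀ * ENNReal.ofReal (m ^ (-(τ + 2))) * K * ENNReal.ofReal (r ^ τ) + C₁ * ENNReal.ofReal (r ^ τ) := by
            rw [e1]; ring
        _ ≤ 2⁻¹ * K * ENNReal.ofReal (r ^ τ) + 2⁻¹ * K * ENNReal.ofReal (r ^ τ) := by gcongr
        _ = (2⁻¹ + 2⁻¹) * K * ENNReal.ofReal (r ^ τ) := by ring
        _ = _ := by rw [ENNReal.inv_two_add_inv_two, one_mul]
  refine ⟨K, by finiteness, fun {r} hr => ?_⟩
  obtain ⟨n, hn⟩ := pow_unbounded_of_one_lt r (show 1 < m by linarith)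
  exact hind n r hr hn.le

end Fourier

section Fourier
variable {E : Type*} [NormedAddCommGroup E] [InnerProductSpace ℝ E] [FiniteDimensional ℝ E] [MeasurableSpace E]
  [BorelSpace E]

theorem exists_enorm_le_dec (E : Type*) [NormedAddCommGroup E] [InnerProductSpace ℝ E]
    [FiniteDimensional ℝ E] [MeasurableSpace E] [BorelSpace E] (r : ℝ) (N : ℕ) :
    ∃ C : ℝ≥0∞, C ≠ ⊤ ∧ ∀ (p : E) {φ : E → ℂ}, Spec (closedBall p r) φ → ∀ x,
      ‖φ x‖ₑ ≤ C * ∫⁻ y, dec N ‖x - y‖ₑ * ‖φ y‖ₑ := by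
  obtain ⟨ρ, hρ⟩ := exists_schwartz_fourierInv_eq_one (E := E) r
  obtain ⟨C, hC, hdec⟩ := ρ.exists_enorm_le_dec N
  refine ⟨C, hC, fun p φ hφ x => ?_⟩
  have h := (hφ.affine (L := id) (LinearEquiv.refl ℝ E) (fun _ _ => rfl) (-p)).mono (T := {ζ | ‖ζ‖ ≤ r})
    (fun ζ hζ => by simpa [dist_eq_norm] using hζ)
  have h1 := h.repro ρ.integrable (fun ξ hξ => hρ ξ hξ) x
  have h2 := (congrArg (fun z : ℂ => ‖z‖ₑ) h1).le.trans (enorm_integral_le_lintegral_enorm _)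
  simp only [enorm_mul, enorm_circle, one_mul, id_eq] at h2
  refine h2.trans ?_
  calc ∫⁻ y, ‖ρ y‖ₑ * ‖φ (x - y)‖ₑ ≤ ∫⁻ y, C * (dec N ‖y‖ₑ * ‖φ (x - y)‖ₑ) := by
        refine lintegral_mono fun y => ?_
        rw [← mul_assoc]
        exact mul_le_mul_left (hdec y) _
    _ = C * ∫⁻ y, dec N ‖y‖ₑ * ‖φ (x - y)‖ₑ := lintegral_const_mul' _ _ hC
    _ = _ := by
        rw [← lintegral_sub_left_eq_self (fun y => dec N ‖y‖ₑ * ‖φ (x - y)‖ₑ) x]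
        simp

theorem exists_enorm_sq_le_lintegral_dec (E : Type*) [NormedAddCommGroup E] [InnerProductSpace ℝ E]
    [FiniteDimensional ℝ E] [MeasurableSpace E] [BorelSpace E] (r : ℝ) {N : ℕ} (hN : Module.finrank ℝ E < N) :
    ∃ C : ℝ≥0∞, C ≠ ⊤ ∧ ∀ (p : E) {φ : E → ℂ}, Spec (closedBall p r) φ → ∀ x,
      ‖φ x‖ₑ ^ 2 ≤ C * ∫⁻ y, dec N ‖x - y‖ₑ * ‖φ y‖ₑ ^ 2 := by
  obtain ⟨C, hC, h⟩ := exists_enorm_le_dec E r N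
  have hI := (lintegral_dec_lt_top hN).ne
  refine ⟨C ^ 2 * ∫⁻ x : E, dec N ‖x‖ₑ, by finiteness, fun p φ hφ x => ?_⟩
  have hm := hφ.continuous.measurable
  calc ‖φ x‖ₑ ^ 2 ≤ (C * ∫⁻ y, dec N ‖x - y‖ₑ * ‖φ y‖ₑ) ^ 2 := pow_le_pow_left' (h p hφ x) 2
    _ ≤ C ^ 2 * ((∫⁻ y, dec N ‖x - y‖ₑ) * ∫⁻ y, dec N ‖x - y‖ₑ * ‖φ y‖ₑ ^ 2) := by
        rw [mul_pow]
        exact mul_le_mul_right (sq_lintegral_mul_le (by fun_prop) (by fun_prop)) _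
    _ = _ := by
        rw [lintegral_sub_left_eq_self (fun y : E => dec N ‖y‖ₑ) x, mul_assoc]

/-- Growth of order `s` at scales larger than one. -/
def HasGrowth (s : ℝ) (H : Measure E) : Prop :=
  ∀ x ρ, 1 ≤ ρ → H (closedBall x ρ) ≤ ENNReal.ofReal (ρ ^ s)

theorem dec_ofReal_le_tsum (N : ℕ) {t : ℝ} (ht : 0 ≤ t) : dec N (ENNReal.ofReal t) ≤
    ∑' j : ℕ, (Set.Iic ((2 : ℝ) ^ j)).indicator (fun _ => ENNReal.ofReal (2 ^ N * (2⁻¹ ^ N) ^ j)) t := by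
  classical
  have hex : ∃ j : ℕ, t ≤ 2 ^ j := (pow_unbounded_of_one_lt t one_lt_two).imp fun _ h => h.le
  refine le_trans ?_ (ENNReal.le_tsum (Nat.find hex))
  rw [Set.indicator_of_mem (Set.mem_Iic.2 (Nat.find_spec hex))]
  rcases h : Nat.find hex with _ | j
  · refine (dec_le_one _ _).trans ?_
    rw [pow_zero, mul_one, ← ENNReal.ofReal_one]
    exact ENNReal.ofReal_le_ofReal (one_le_pow₀ one_le_two)
  · have h1 : (2 : ℝ) ^ j < t := by
      have := Nat.find_min hex (m := j) (by omega)
      simpa using this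
    have e1 : (2 : ℝ) ^ N * (2⁻¹ ^ N) ^ (j + 1) = (2 ^ j)⁻¹ ^ N := by
      rw [pow_succ, ← pow_mul, mul_comm N j, pow_mul, mul_comm (((2 : ℝ)⁻¹ ^ j) ^ N), ← mul_assoc, ← mul_pow,
        mul_inv_cancel₀ two_ne_zero, one_pow, one_mul, inv_pow]
    rw [e1, ENNReal.ofReal_pow (by positivity), dec, ENNReal.ofReal_inv_of_pos (by positivity)]
    refine pow_le_pow_left' (ENNReal.inv_le_inv.2 ?_) N
    exact (ENNReal.ofReal_le_ofReal h1.le).trans le_add_self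

theorem exists_lintegral_dec_le (E : Type*) [NormedAddCommGroup E] [InnerProductSpace ℝ E]
    [FiniteDimensional ℝ E] [MeasurableSpace E] [BorelSpace E] {s : ℝ} {N : ℕ} (hN : s < N) :
    ∃ B : ℝ≥0∞, B ≠ ⊤ ∧ ∀ {H : Measure E}, HasGrowth s H → ∀ (x₀ : E) {ρ : ℝ}, 1 ≤ ρ →
      ∫⁻ x, dec N (ENNReal.ofReal (‖x - x₀‖ / ρ)) ∂H ≤ B * ENNReal.ofReal (ρ ^ s) := by
  set q := ENNReal.ofReal (2 ^ (s - N))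
  have hq : q < 1 := by
    rw [← ENNReal.ofReal_one]
    exact (ENNReal.ofReal_lt_ofReal_iff one_pos).2 (Real.rpow_lt_one_of_one_lt_of_neg one_lt_two (by linarith))
  have hq' : 1 - q ≠ 0 := (tsub_pos_of_lt hq).ne'
  refine ⟨ENNReal.ofReal (2 ^ N) * (1 - q)⁻¹, by finiteness, fun {H} hH x₀ ρ hρ => ?_⟩
  have hρ0 : 0 < ρ := by linarith
  calc ∫⁻ x, dec N (ENNReal.ofReal (‖x - x₀‖ / ρ)) ∂H
      ≤ ∫⁻ x, ∑' j : ℕ, (closedBall x₀ (2 ^ j * ρ)).indicator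
          (fun _ => ENNReal.ofReal (2 ^ N * (2⁻¹ ^ N) ^ j)) x ∂H := by
        refine lintegral_mono fun x => (dec_ofReal_le_tsum N (by positivity)).trans_eq (tsum_congr fun j => ?_)
        have h1 : ‖x - x₀‖ / ρ ∈ Set.Iic ((2 : ℝ) ^ j) ↔ x ∈ closedBall x₀ (2 ^ j * ρ) := by
          rw [Set.mem_Iic, mem_closedBall, dist_eq_norm, div_le_iff₀ hρ0]
        by_cases h2 : x ∈ closedBall x₀ (2 ^ j * ρ)
        · rw [Set.indicator_of_mem h2, Set.indicator_of_mem (h1.2 h2)]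
        · rw [Set.indicator_of_notMem h2, Set.indicator_of_notMem (mt h1.1 h2)]
    _ = ∑' j : ℕ, ENNReal.ofReal (2 ^ N * (2⁻¹ ^ N) ^ j) * H (closedBall x₀ (2 ^ j * ρ)) := by
        rw [lintegral_tsum fun j => (measurable_const.indicator measurableSet_closedBall).aemeasurable]
        exact tsum_congr fun j => lintegral_indicator_const measurableSet_closedBall _
    _ ≤ ∑' j : ℕ, ENNReal.ofReal (2 ^ N) * ENNReal.ofReal (ρ ^ s) * q ^ j := by
        refine ENNReal.tsum_le_tsum fun j => ?_
        have h1 : (1 : ℝ) ≤ 2 ^ j := one_le_pow₀ one_le_two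
        refine (mul_le_mul_right (hH x₀ (2 ^ j * ρ) (by nlinarith)) _).trans_eq ?_
        rw [← ENNReal.ofReal_pow (by positivity), ← ENNReal.ofReal_mul (by positivity),
          ← ENNReal.ofReal_mul (by positivity), ← ENNReal.ofReal_mul (by positivity)]
        congr 1
        rw [Real.mul_rpow (by positivity) hρ0.le, Real.rpow_sub two_pos, Real.rpow_natCast, div_pow,
          ← Real.rpow_natCast 2 j, ← Real.rpow_mul two_pos.le, mul_comm (j : ℝ) s, Real.rpow_mul two_pos.le,
          Real.rpow_natCast]
        simp only [inv_pow]
        field_simp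
    _ = _ := by
        rw [ENNReal.tsum_mul_left, ENNReal.tsum_geometric]
        ring

/-- Convolving a measure with growth `s` with a rapidly decaying kernel gives a weight. -/
theorem exists_isWeight (E : Type*) [NormedAddCommGroup E] [InnerProductSpace ℝ E]
    [FiniteDimensional ℝ E] [MeasurableSpace E] [BorelSpace E] {s : ℝ} :
    ∃ (N : ℕ) (B : ℝ≥0∞), Module.finrank ℝ E < N ∧ 1 ≤ B ∧ B ≠ ⊤ ∧
      ∀ {H : Measure E} [IsFiniteMeasure H], HasGrowth s H →
      IsWeight s fun y => B⁻¹ * ∫⁻ x, dec N ‖x - y‖ₑ ∂H := by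
  set d := Module.finrank ℝ E
  obtain ⟨N, hN⟩ := exists_nat_gt s
  obtain ⟨B₀, hB₀, h⟩ := exists_lintegral_dec_le E hN
  have hI := (lintegral_dec_lt_top (E := E) (N := d + 1) (Nat.lt_succ_self d)).ne
  set Id := ∫⁻ x : E, dec (d + 1) ‖x‖ₑ
  set B := 1 + B₀ + Id * 2 ^ N * B₀
  have hB : B ≠ ⊤ := by finiteness
  have hB1 : 1 ≤ B := by simp only [B]; rw [add_assoc]; exact le_self_add
  have hB0 : B ≠ 0 := (zero_lt_one.trans_le hB1).ne'
  refine ⟨d + 1 + N, B, by omega, hB1, hB, fun {H} _ hH => ⟨?_, fun y => ?_, fun x₀ ρ hρ => ?_⟩⟩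
  · refine Measurable.const_mul (Measurable.lintegral_prod_right' (f := fun p : E × E => dec (d + 1 + N) ‖p.2 - p.1‖ₑ) ?_) _
    fun_prop
  · rw [ENNReal.inv_mul_le_iff hB0 hB, mul_one]
    calc ∫⁻ x, dec (d + 1 + N) ‖x - y‖ₑ ∂H ≤ ∫⁻ x, dec N (ENNReal.ofReal (‖x - y‖ / 1)) ∂H := by
          refine lintegral_mono fun x => ?_
          rw [div_one, ofReal_norm]
          exact dec_anti_left (by omega) _
      _ ≤ B₀ := by simpa using h hH y le_rfl
      _ ≤ B := by simp only [B]; exact le_add_self.trans le_self_add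
  · have hρ0 : 0 < ρ := by linarith
    rw [lintegral_const_mul' _ _ (ENNReal.inv_ne_top.2 hB0), ENNReal.inv_mul_le_iff hB0 hB]
    calc ∫⁻ y in closedBall x₀ ρ, ∫⁻ x, dec (d + 1 + N) ‖x - y‖ₑ ∂H
        = ∫⁻ x, (∫⁻ y in closedBall x₀ ρ, dec (d + 1 + N) ‖x - y‖ₑ) ∂H := by
          refine lintegral_lintegral_swap (Measurable.aemeasurable ?_)
          fun_prop
      _ ≤ ∫⁻ x, Id * 2 ^ N * dec N (ENNReal.ofReal (‖x - x₀‖ / ρ)) ∂H := by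
          refine lintegral_mono fun x => ?_
          have hfin : Id * 2 ^ N * dec N (ENNReal.ofReal (‖x - x₀‖ / ρ)) =
            ∫⁻ y, (2 ^ N * dec N (ENNReal.ofReal (‖x - x₀‖ / ρ))) * dec (d + 1) ‖x - y‖ₑ := by
            rw [lintegral_const_mul _ (by fun_prop), lintegral_sub_left_eq_self (fun y : E => dec (d + 1) ‖y‖ₑ) x]
            ring
          rw [hfin]
          refine (setLIntegral_mono' measurableSet_closedBall fun y hy => ?_).trans (setLIntegral_le_lintegral _ _)
          rw [dec_add, mul_comm]
          refine mul_le_mul_left ?_ _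
          rw [← one_add_one_eq_two]
          refine dec_le_mul_dec N ENNReal.one_ne_top (by simp) ?_
          rw [← ofReal_norm, ← ENNReal.ofReal_one, ← ENNReal.ofReal_add (norm_nonneg _) zero_le_one]
          refine ENNReal.ofReal_le_ofReal ?_
          rw [div_le_iff₀ hρ0]
          have h1 := norm_sub_le_norm_sub_add_norm_sub x y x₀
          have h2 : ‖y - x₀‖ ≤ ρ := by simpa [dist_eq_norm] using hy
          nlinarith [norm_nonneg (x - y)]
      _ = Id * 2 ^ N * ∫⁻ x, dec N (ENNReal.ofReal (‖x - x₀‖ / ρ)) ∂H := lintegral_const_mul _ (by fun_prop)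
      _ ≤ Id * 2 ^ N * (B₀ * ENNReal.ofReal (ρ ^ s)) := mul_le_mul_right (h hH x₀ hρ) _
      _ ≤ B * ENNReal.ofReal (ρ ^ s) := by
          rw [← mul_assoc]
          exact mul_le_mul_left le_add_self _

end Fourier

section Fourier
variable {E : Type*} [NormedAddCommGroup E] [InnerProductSpace ℝ E]

theorem IsCap.exists_nbhd_subset {e : E} {ν : E → E} {c C : ℝ} {S : Set E} (hS : IsCap e ν c C S) {r : ℝ}
    (hr : 1 ≤ r) : ∃ p, nbhd e ν r 1 S ⊆ closedBall p ((2 + 2 * C * C) * C + (3 + C * C)) := by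
  rcases S.eq_empty_or_nonempty with rfl | ⟨p0, h0⟩
  · exact ⟨0, fun ζ ⟨p, hp, _⟩ => hp.elim⟩
  refine ⟨p0, fun ζ ⟨p, hp, hζ⟩ => ?_⟩
  have hC := hS.one_le
  have h1 := hS.norm_sub_le_of_mem_plate hr hp hζ
  have h2 := (hS.norm_sub_le hp h0).trans (mul_le_mul_of_nonneg_left (hS.diam p hp p0 h0) (by positivity))
  rw [mem_closedBall, dist_eq_norm]
  have h3 := norm_sub_le_norm_sub_add_norm_sub ζ p p0
  nlinarith [norm_nonneg (ζ - p)]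

variable [FiniteDimensional ℝ E] [MeasurableSpace E] [BorelSpace E]

/-- Localization to a ball of radius `(r / 2) ^ 2` with decaying tails. -/
theorem exists_localize_dec (E : Type*) [NormedAddCommGroup E] [InnerProductSpace ℝ E] [FiniteDimensional ℝ E]
    [MeasurableSpace E] [BorelSpace E] (N : ℕ) {C : ℝ} (hC : 1 ≤ C) : ∃ K : ℝ≥0∞, K ≠ ⊤ ∧
    ∀ {e : E} {ν : E → E} {c : ℝ} {S : Set E}, IsCap e ν c C S →
    ∀ {r : ℝ}, 2 ≤ r → ∀ (x₀ : E) {φ : E → ℂ}, Spec (nbhd e ν r 1 S) φ →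
    ∃ ψ, Spec (nbhd e ν (r / 2) 1 S) ψ ∧ (∀ x ∈ closedBall x₀ ((r / 2) ^ 2), ‖φ x‖ₑ ≤ ‖ψ x‖ₑ) ∧
      nsq ψ ≤ ∫⁻ x, K * (dec N (ENNReal.ofReal (‖x - x₀‖ / (r / 2) ^ 2)) * ‖φ x‖ₑ ^ 2) := by
  obtain ⟨Cg, hCg, hloc⟩ := exists_localizer (E := E) N
  set Λ := 2 * (1 + C * C)
  have hΛ : 1 ≤ Λ := by nlinarith
  refine ⟨(Cg * ((1 + ENNReal.ofReal Λ) ^ N)) ^ 2, by finiteness, ?_⟩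
  intro e ν c S hS r hr x₀ φ hφ
  obtain ⟨ρ, hρdef⟩ : ∃ ρ, (r / 2) ^ 2 = ρ := ⟨_, rfl⟩
  have hρ : 0 < ρ := by rw [← hρdef]; positivity
  have hsub := hS.ball_add_nbhd_subset (r := r) (m := 2) (a := 1) (by norm_num) (by norm_num) hr
  rw [hρdef] at hsub ⊢
  obtain ⟨g, hg0, hg1, hgS, hgd⟩ := hloc (l := Λ * ρ) (by positivity) (q := closedBall x₀ ρ) isBounded_closedBall
    ⟨x₀, mem_closedBall_self hρ.le⟩
  have hge : ∀ x, ‖((g x : ℝ) : ℂ)‖ₑ = ENNReal.ofReal (g x) := fun x => by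
    rw [← ofReal_norm, Complex.norm_real, Real.norm_of_nonneg (hg0 x)]
  refine ⟨fun x => (g x : ℂ) * φ x, (hgS.mul hφ).mono hsub, fun x hx => ?_, lintegral_mono fun x => ?_⟩
  · rw [enorm_mul, hge]
    exact le_mul_of_one_le_left' (by simpa using hg1 x hx)
  rw [enorm_mul, hge, mul_pow, ← mul_assoc]
  refine mul_le_mul_left ?_ _
  have h2 : dist x x₀ - ρ ≤ infDist x (closedBall x₀ ρ) := by
    refine (le_infDist ⟨x₀, mem_closedBall_self hρ.le⟩).2 fun y hy => ?_
    have := dist_triangle x y x₀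
    have := mem_closedBall.1 hy
    linarith
  rw [dist_eq_norm] at h2
  have h3 : dec N (ENNReal.ofReal (infDist x (closedBall x₀ ρ) / (Λ * ρ))) ≤
      (1 + ENNReal.ofReal Λ) ^ N * dec N (ENNReal.ofReal (‖x - x₀‖ / ρ)) := by
    unfold dec
    rw [← mul_pow]
    refine pow_le_pow_left' ?_ N
    rw [← ENNReal.ofReal_one, ← ENNReal.ofReal_add zero_le_one (div_nonneg infDist_nonneg (by positivity)),
      ← ENNReal.ofReal_add zero_le_one (by positivity), ← ENNReal.ofReal_add zero_le_one (by positivity),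
      ← ENNReal.ofReal_inv_of_pos (add_pos_of_pos_of_nonneg one_pos (div_nonneg infDist_nonneg (by positivity))),
      ← ENNReal.ofReal_inv_of_pos (by positivity), ← ENNReal.ofReal_mul (by positivity)]
    refine ENNReal.ofReal_le_ofReal ?_
    have hi : 0 ≤ infDist x (closedBall x₀ ρ) / (Λ * ρ) := div_nonneg infDist_nonneg (by positivity)
    have h4 : ‖x - x₀‖ / ρ ≤ Λ * (infDist x (closedBall x₀ ρ) / (Λ * ρ)) + 1 := by
      have : Λ * (infDist x (closedBall x₀ ρ) / (Λ * ρ)) + 1 = (infDist x (closedBall x₀ ρ) + ρ) / ρ := by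
        field_simp
      rw [this]
      gcongr
      linarith
    rw [← div_eq_mul_inv, inv_eq_one_div, div_le_div_iff₀ (by positivity) (by positivity)]
    nlinarith
  calc ENNReal.ofReal (g x) ^ 2 ≤ (Cg * ((1 + ENNReal.ofReal Λ) ^ N * dec N (ENNReal.ofReal (‖x - x₀‖ / ρ)))) ^ 2 :=
        pow_le_pow_left' ((hgd x).trans (mul_le_mul_right h3 _)) 2
    _ = (Cg * (1 + ENNReal.ofReal Λ) ^ N) ^ 2 * dec N (ENNReal.ofReal (‖x - x₀‖ / ρ)) ^ 2 := by ring
    _ ≤ (Cg * (1 + ENNReal.ofReal Λ) ^ N) ^ 2 * dec N (ENNReal.ofReal (‖x - x₀‖ / ρ)) := by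
        gcongr
        rw [sq]
        exact mul_le_of_le_one_left' (dec_le_one _ _)

theorem lintegral_setLIntegral_closedBall {f : E → ℝ≥0∞} (hf : Measurable f) (ρ : ℝ) :
    ∫⁻ x₀, (∫⁻ x in closedBall x₀ ρ, f x) = volume (closedBall (0 : E) ρ) * ∫⁻ x, f x := by
  have h1 : ∀ x₀ : E, ∫⁻ x in closedBall x₀ ρ, f x = ∫⁻ x, {z : E × E | dist z.2 z.1 ≤ ρ}.indicator (fun z => f z.2) (x₀, x) := by
    intro x₀
    rw [← lintegral_indicator measurableSet_closedBall]
    rfl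
  have hm : MeasurableSet {z : E × E | dist z.2 z.1 ≤ ρ} :=
    measurableSet_le (by fun_prop) (by fun_prop)
  simp_rw [h1]
  rw [lintegral_lintegral_swap
      (f := fun x₀ x => {z : E × E | dist z.2 z.1 ≤ ρ}.indicator (fun z => f z.2) (x₀, x))
      (((hf.comp measurable_snd).indicator hm).aemeasurable), ← lintegral_const_mul _ hf]
  refine lintegral_congr fun x => ?_
  have h2 : ∀ x₀ : E, {z : E × E | dist z.2 z.1 ≤ ρ}.indicator (fun z => f z.2) (x₀, x) =
      (closedBall x ρ).indicator (fun _ => f x) x₀ := by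
    intro x₀
    simp only [Set.indicator, Set.mem_ofPred_eq, mem_closedBall, dist_comm x]
  simp_rw [h2]
  rw [lintegral_indicator measurableSet_closedBall, setLIntegral_const, mul_comm, ← Measure.addHaar_closedBall_center volume x ρ]

/-- The weighted bilinear estimate on the whole space. -/
theorem exists_lintegral_bil_le {c C D s : ℝ} (hc : 0 < c) (hC : 1 ≤ C) (hD : 0 < D)
    (hs : (Module.finrank ℝ E : ℝ) / 2 - 1 < s) : ∃ K : ℝ≥0∞, K ≠ ⊤ ∧ ∀ {r : ℝ}, 2 ≤ r →
      ∀ {e : E} {ν : E → E} {S S₁ S₂ : Set E}, IsCapPair e ν c C D S S₁ S₂ →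
      ∀ {h : E → ℝ≥0∞}, IsWeight s h → ∀ {u w : E → ℂ}, Spec (nbhd e ν r 1 S₁) u → Spec (nbhd e ν r 1 S₂) w →
      ∫⁻ x, ‖u x * w x‖ₑ * h x ≤
        K * ENNReal.ofReal (r ^ (s - ((Module.finrank ℝ E : ℝ) + 2) / 2)) * (nsq u + nsq w) := by
  set d := Module.finrank ℝ E
  set τ := s - ((d : ℝ) + 2) / 2
  obtain ⟨K₁, hK₁, hloc⟩ := exists_localize_dec E (d + 1) hC
  obtain ⟨K₂, hK₂, hbil⟩ := exists_bilBound (E := E) hc hC hD hs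
  have hI := (lintegral_dec_lt_top (E := E) (N := d + 1) (Nat.lt_succ_self d)).ne
  set I := ∫⁻ y : E, dec (d + 1) ‖y‖ₑ
  set v := volume (ball (0 : E) 1)
  have hv0 : v ≠ 0 := (measure_ball_pos volume _ one_pos).ne'
  have hv : v ≠ ⊤ := measure_ball_lt_top.ne
  refine ⟨v⁻¹ * (K₂ * ENNReal.ofReal (2⁻¹ ^ τ) * K₁ * I), by finiteness, ?_⟩
  intro r hr e ν S S₁ S₂ hS h hh u w hu hw
  obtain ⟨ρ, hρdef⟩ : ∃ ρ, (r / 2) ^ 2 = ρ := ⟨_, rfl⟩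
  have hρ : 0 < ρ := by rw [← hρdef]; positivity
  have hum := hu.continuous.measurable
  have hwm := hw.continuous.measurable
  have hhm := hh.measurable
  have hmain : ∀ x₀ : E, ∫⁻ x in closedBall x₀ ρ, ‖u x * w x‖ₑ * h x ≤
      K₂ * ENNReal.ofReal ((r / 2) ^ τ) *
        ∫⁻ x, K₁ * (dec (d + 1) (ENNReal.ofReal (‖x - x₀‖ / ρ)) * (‖u x‖ₑ ^ 2 + ‖w x‖ₑ ^ 2)) := by
    intro x₀
    obtain ⟨ψ, hψ, hψ1, hψ2⟩ := hloc (hS.cap.subset hS.subset₁) hr x₀ hu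
    obtain ⟨χ, hχ, hχ1, hχ2⟩ := hloc (hS.cap.subset hS.subset₂) hr x₀ hw
    rw [hρdef] at hψ1 hψ2 hχ1 hχ2
    have h1 := hbil (r := r / 2) (by linarith) hS hh x₀ hψ hχ
    rw [hρdef] at h1
    refine (setLIntegral_mono' measurableSet_closedBall fun x hx => ?_).trans (h1.trans (mul_le_mul_right ?_ _))
    · rw [enorm_mul, enorm_mul]
      exact mul_le_mul_left (mul_le_mul' (hψ1 x hx) (hχ1 x hx)) _
    · refine (add_le_add hψ2 hχ2).trans_eq ?_
      rw [← lintegral_add_left (by fun_prop)]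
      exact lintegral_congr fun x => by ring
  have h2 := lintegral_mono (μ := volume) hmain
  rw [lintegral_setLIntegral_closedBall (by fun_prop), Measure.addHaar_closedBall volume 0 hρ.le,
    lintegral_const_mul _ (by fun_prop), lintegral_lintegral_swap (by fun_prop)] at h2
  have h3 : ∀ x : E, ∫⁻ x₀ : E, K₁ * (dec (d + 1) (ENNReal.ofReal (‖x - x₀‖ / ρ)) * (‖u x‖ₑ ^ 2 + ‖w x‖ₑ ^ 2)) =
      K₁ * (ENNReal.ofReal ρ ^ d * I) * (‖u x‖ₑ ^ 2 + ‖w x‖ₑ ^ 2) := by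
    intro x
    simp_rw [norm_sub_rev x]
    rw [lintegral_const_mul _ (by fun_prop), lintegral_mul_const _ (by fun_prop), lintegral_dec_div _ hρ]
    ring
  simp_rw [h3] at h2
  rw [lintegral_const_mul _ (by fun_prop), lintegral_add_left (by fun_prop)] at h2
  have hp0 : ENNReal.ofReal (ρ ^ d) * v ≠ 0 := mul_ne_zero (by simpa using pow_pos hρ d) hv0
  have hcancel : ∀ {a b P : ℝ≥0∞}, P ≠ 0 → P ≠ ⊤ → P * a ≤ P * b → a ≤ b := fun h0 h1 h =>
    (ENNReal.mul_le_mul_iff_right h0 h1).1 h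
  refine hcancel hp0 (by finiteness) (h2.trans_eq ?_)
  rw [div_eq_mul_inv, Real.mul_rpow (by linarith) (by norm_num), ENNReal.ofReal_mul (by positivity),
    ENNReal.ofReal_pow hρ.le]
  calc _ = (v * v⁻¹) * (ENNReal.ofReal ρ ^ d * (K₂ * (ENNReal.ofReal (r ^ τ) * ENNReal.ofReal (2⁻¹ ^ τ)) * (K₁ * I) *
        (nsq u + nsq w))) := by rw [ENNReal.mul_inv_cancel hv0 hv, nsq, nsq]; ring
    _ = _ := by ring

/-- The bilinear estimate for measures. -/
theorem exists_lintegral_measure_bil_le {c C D s : ℝ} (hc : 0 < c) (hC : 1 ≤ C) (hD : 0 < D)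
    (hs : (Module.finrank ℝ E : ℝ) / 2 - 1 < s) : ∃ K : ℝ≥0∞, K ≠ ⊤ ∧ ∀ {r : ℝ}, 2 ≤ r →
      ∀ {e : E} {ν : E → E} {S S₁ S₂ : Set E}, IsCapPair e ν c C D S S₁ S₂ →
      ∀ {H : Measure E} [IsFiniteMeasure H], HasGrowth s H →
      ∀ {u w : E → ℂ}, Spec (nbhd e ν r 1 S₁) u → Spec (nbhd e ν r 1 S₂) w →
      ∫⁻ x, ‖u x * w x‖ₑ ∂H ≤
        K * ENNReal.ofReal (r ^ (s - ((Module.finrank ℝ E : ℝ) + 2) / 2)) * (nsq u + nsq w) := by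
  obtain ⟨N, B, -, hB1, hB, hweight⟩ := exists_isWeight E (s := s)
  set ρ := (2 + 2 * C * C) * C + (3 + C * C)
  obtain ⟨C₁, hC₁, hrep⟩ := exists_enorm_le_dec E (ρ + ρ) N
  obtain ⟨K, hK, hbil⟩ := exists_lintegral_bil_le (E := E) hc hC hD hs
  refine ⟨C₁ * B * K, by finiteness, ?_⟩
  intro r hr e ν S S₁ S₂ hS H hH hg u w hu hw
  have hum := hu.continuous.measurable
  have hwm := hw.continuous.measurable
  obtain ⟨p, hp⟩ := (hS.cap.subset hS.subset₁).exists_nbhd_subset (r := r) (by linarith)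
  obtain ⟨q, hq⟩ := (hS.cap.subset hS.subset₂).exists_nbhd_subset (r := r) (by linarith)
  have hC0 : 0 ≤ ρ := by positivity
  have huw : Spec (closedBall (p + q) (ρ + ρ)) fun x => u x * w x :=
    (hu.mul hw).mono ((Set.add_subset_add hp hq).trans (by rw [closedBall_add_closedBall hC0 hC0]))
  calc ∫⁻ x, ‖u x * w x‖ₑ ∂H ≤ ∫⁻ x, C₁ * (∫⁻ y, dec N ‖x - y‖ₑ * ‖u y * w y‖ₑ) ∂H :=
        lintegral_mono fun x => hrep _ huw x
    _ = C₁ * ∫⁻ y, ∫⁻ x, dec N ‖x - y‖ₑ * ‖u y * w y‖ₑ ∂H := by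
        rw [lintegral_const_mul _ (by fun_prop), lintegral_lintegral_swap (by fun_prop)]
    _ = C₁ * B * ∫⁻ y, ‖u y * w y‖ₑ * (B⁻¹ * ∫⁻ x, dec N ‖x - y‖ₑ ∂H) := by
        rw [mul_assoc, ← lintegral_const_mul B (by fun_prop)]
        congr 1
        refine lintegral_congr fun y => ?_
        rw [lintegral_mul_const _ (by fun_prop)]
        have hBB : B * B⁻¹ = 1 := ENNReal.mul_inv_cancel (one_pos.trans_le hB1).ne' hB
        calc _ = B * B⁻¹ * ((∫⁻ x, dec N ‖x - y‖ₑ ∂H) * ‖u y * w y‖ₑ) := by rw [hBB, one_mul]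
          _ = _ := by ring
    _ ≤ C₁ * B * (K * ENNReal.ofReal (r ^ (s - ((Module.finrank ℝ E : ℝ) + 2) / 2)) * (nsq u + nsq w)) :=
        mul_le_mul_right (hbil hr hS (hweight hg) hu hw) _
    _ = _ := by ring

end Fourier

section Fourier
variable {E : Type*} [NormedAddCommGroup E] [InnerProductSpace ℝ E] [FiniteDimensional ℝ E]
  [MeasurableSpace E] [BorelSpace E]

theorem IsCap.hpart_dualTube_symm {e : E} {ν : E → E} {c C : ℝ} {S : Set E} (hS : IsCap e ν c C S) {K : ℝ}
    (hK : 0 < K) (p x : E) : hpart e ((hS.dualTube hK p).symm x) = K • hpart e x := by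
  have hee : ⟪e, e⟫ = 1 := by simp [hS.norm_e]
  rw [hS.dualTube_symm_apply]
  simp only [hpart, inner_add_left, inner_sub_left, inner_smul_left, hee, conj_trivial]
  module

/-- The normals of the parabolic rescaling of a cap. -/
noncomputable def IsCap.scaledNormal {e : E} {ν : E → E} {c C : ℝ} {S : Set E} (hS : IsCap e ν c C S) {K : ℝ}
    (hK : 0 < K) (p q : E) : E := e + K • (ν (hS.dualTube hK p q) - ν p)

theorem IsCap.inner_scaledNormal {e : E} {ν : E → E} {c C : ℝ} {S : Set E} (hS : IsCap e ν c C S) {K : ℝ}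
    (hK : 0 < K) (p q x : E) :
    ⟪(hS.dualTube hK p).symm x, hS.scaledNormal hK p ((hS.dualTube hK p).symm q)⟫ = K ^ 2 * ⟪x, ν q⟫ := by
  have hee : ⟪e, e⟫ = 1 := by simp [hS.norm_e]
  have h1 := hS.inner_normal p
  have h2 := hS.inner_normal q
  rw [real_inner_comm] at h1 h2
  rw [hS.dualTube_symm_apply, scaledNormal, LinearEquiv.apply_symm_apply]
  simp only [hpart, inner_add_left, inner_sub_left, inner_smul_left, inner_add_right, inner_sub_right,
    inner_smul_right, hee, conj_trivial, h1, h2]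
  ring

theorem IsCap.rescale {e : E} {ν : E → E} {c C : ℝ} {S : Set E} (hS : IsCap e ν c C S) {K : ℝ}
    (hK : 0 < K) {p : E} (hp : p ∈ S) (hd : ∀ q ∈ S, ∀ q' ∈ S, K * ‖hpart e (q - q')‖ ≤ C) :
    IsCap e (hS.scaledNormal hK p) c C ((hS.dualTube hK p).symm '' S) where
  norm_e := hS.norm_e
  inner_normal q := by
    have hee : ⟪e, e⟫ = 1 := by simp [hS.norm_e]
    rw [scaledNormal, inner_add_left, inner_smul_left, inner_sub_left, hS.inner_normal, hS.inner_normal, hee]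
    simp
  pos := hS.pos
  one_le := hS.one_le
  norm_normal := by
    rintro _ ⟨q, hq, rfl⟩
    have h1 := hS.lip q hq p hp
    have h2 := hd q hq p hp
    have h3 := hS.one_le
    rw [scaledNormal, LinearEquiv.apply_symm_apply]
    refine (norm_add_le _ _).trans ?_
    rw [hS.norm_e, norm_smul, Real.norm_of_nonneg hK.le]
    have h4 : K * ‖ν q - ν p‖ ≤ C * (K * ‖hpart e (q - p)‖) := by
      calc _ ≤ K * (C * ‖hpart e (q - p)‖) := by gcongr
        _ = _ := by ring
    have h5 : C * (K * ‖hpart e (q - p)‖) ≤ C * C := by gcongr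
    linarith
  lower := by
    rintro _ ⟨q, hq, rfl⟩ _ ⟨q', hq', rfl⟩
    rw [← map_sub, hS.inner_scaledNormal, hS.hpart_dualTube_symm, norm_smul, Real.norm_of_nonneg hK.le]
    have := mul_le_mul_of_nonneg_left (hS.lower q hq q' hq') (sq_nonneg K)
    linarith
  upper := by
    rintro _ ⟨q, hq, rfl⟩ _ ⟨q', hq', rfl⟩
    rw [← map_sub, hS.inner_scaledNormal, hS.hpart_dualTube_symm, norm_smul, Real.norm_of_nonneg hK.le]
    have := mul_le_mul_of_nonneg_left (hS.upper q hq q' hq') (sq_nonneg K)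
    linarith
  lip := by
    rintro _ ⟨q, hq, rfl⟩ _ ⟨q', hq', rfl⟩
    have h1 := mul_le_mul_of_nonneg_left (hS.lip q hq q' hq') hK.le
    rw [← map_sub, hS.hpart_dualTube_symm, norm_smul, Real.norm_of_nonneg hK.le, scaledNormal, scaledNormal,
      LinearEquiv.apply_symm_apply, LinearEquiv.apply_symm_apply, add_sub_add_left_eq_sub, ← smul_sub,
      sub_sub_sub_cancel_right, norm_smul, Real.norm_of_nonneg hK.le]
    linarith
  diam := by
    rintro _ ⟨q, hq, rfl⟩ _ ⟨q', hq', rfl⟩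
    rw [← map_sub, hS.hpart_dualTube_symm, norm_smul, Real.norm_of_nonneg hK.le]
    exact hd q hq q' hq'

theorem IsCap.mem_nbhd_rescale {e : E} {ν : E → E} {c C : ℝ} {S : Set E} (hS : IsCap e ν c C S) {K : ℝ}
    (hK : 0 < K) (p : E) {r a : ℝ} {ζ : E} (h : ζ ∈ nbhd e ν r a S) :
    (hS.dualTube hK p).symm ζ ∈ nbhd e (hS.scaledNormal hK p) (r / K) a ((hS.dualTube hK p).symm '' S) := by
  obtain ⟨q, hq, h1, h2⟩ := h
  refine ⟨_, ⟨q, hq, rfl⟩, ?_, ?_⟩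
  · rw [← map_sub, hS.hpart_dualTube_symm, norm_smul, Real.norm_of_nonneg hK.le]
    calc _ = r * ‖hpart e (ζ - q)‖ := by field_simp
      _ ≤ a := h1
  · rw [← map_sub, hS.inner_scaledNormal, abs_mul, abs_of_nonneg (sq_nonneg K)]
    calc _ = r ^ 2 * |⟪ζ - q, ν q⟫| := by field_simp
      _ ≤ a := h2

theorem HasGrowth.preimage_tube_le {s : ℝ} {H : Measure E} (hH : HasGrowth s H) {e : E} {ν : E → E} {c C : ℝ}
    {S : Set E} (hS : IsCap e ν c C S) {K : ℝ} (hK : 1 ≤ K) {p : E} (hp : p ∈ S) (x : E) {ρ : ℝ} (hρ : 1 ≤ ρ) :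
    H (hS.tube (one_pos.trans_le hK) p ⁻¹' closedBall x ρ) ≤
      ENNReal.ofReal (5 * (2 + C * C) ^ s * K ^ (s + 1)) * ENNReal.ofReal (ρ ^ s) := by
  have hK0 : 0 < K := one_pos.trans_le hK
  have hee : ⟪e, e⟫ = 1 := by simp [hS.norm_e]
  set L := (hS.tube hK0 p).symm with hL
  have hLa : ∀ y, L y = K • hpart e y + (K ^ 2 * ⟪y, e⟫) • ν p := fun y => rfl
  set n := ⌈K⌉₊
  have hn : K ≤ n := Nat.le_ceil K
  have hn' : (n : ℝ) < K + 1 := Nat.ceil_lt_add_one hK0.le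
  set I := Finset.Icc (-n : ℤ) n
  set R := (2 + C * C) * (K * ρ)
  have hR : 1 ≤ R := by
    have : 1 ≤ K * ρ := one_le_mul_of_one_le_of_one_le hK hρ
    have := mul_self_nonneg C
    nlinarith
  have hsub : hS.tube hK0 p ⁻¹' closedBall x ρ ⊆ ⋃ i ∈ I, closedBall (L x + (K * ρ * i) • ν p) R := by
    intro y hy
    obtain ⟨z, rfl⟩ : ∃ z, L z = y := ⟨hS.tube hK0 p y, by simp [hL]⟩
    have hz : ‖z - x‖ ≤ ρ := by simpa [hL, dist_eq_norm] using hy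
    have ht : |⟪z - x, e⟫| ≤ ρ :=
      ((abs_real_inner_le_norm _ e).trans (mul_le_of_le_one_right (norm_nonneg _) hS.norm_e.le)).trans hz
    set t := ⟪z - x, e⟫
    set i := ⌊K * t / ρ⌋
    have hi : (i : ℝ) ≤ K * t / ρ := Int.floor_le _
    have hi' : K * t / ρ < i + 1 := Int.lt_floor_add_one _
    have hρ0 : 0 < ρ := by linarith
    have hu : K * t / ρ ≤ K := by
      rw [div_le_iff₀ hρ0]
      exact mul_le_mul_of_nonneg_left (abs_le.1 ht).2 hK0.le
    have hl : -K ≤ K * t / ρ := by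
      rw [le_div_iff₀ hρ0]
      have := mul_le_mul_of_nonneg_left (abs_le.1 ht).1 hK0.le
      linarith
    simp only [Set.mem_iUnion, exists_prop]
    refine ⟨i, Finset.mem_Icc.2 ⟨?_, ?_⟩, ?_⟩
    · refine Int.le_floor.2 ?_
      push_cast
      linarith
    · have : (i : ℝ) ≤ (n : ℤ) := by push_cast; linarith
      exact_mod_cast this
    rw [mem_closedBall, dist_eq_norm, sub_add_eq_sub_sub, ← map_sub, hLa, add_sub_assoc, ← sub_smul]
    refine (norm_add_le _ _).trans ?_
    rw [norm_smul, norm_smul, Real.norm_of_nonneg hK0.le, Real.norm_eq_abs]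
    have h1 : |K ^ 2 * t - K * ρ * i| ≤ K * ρ := by
      have : K ^ 2 * t - K * ρ * i = K * ρ * (K * t / ρ - i) := by field_simp
      rw [this, abs_mul, abs_of_pos (by positivity)]
      refine mul_le_of_le_one_right (by positivity) ?_
      rw [abs_le]
      constructor <;> linarith
    have h2 := mul_le_mul h1 (hS.norm_normal p hp) (norm_nonneg _) (by positivity)
    have h3 := mul_le_mul_of_nonneg_left ((norm_hpart_le hS.norm_e _).trans hz) hK0.le
    calc _ ≤ K * ρ + K * ρ * (1 + C * C) := add_le_add h3 h2
      _ = R := by ring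
  have hC := hS.one_le
  calc _ ≤ ∑ i ∈ I, H (closedBall (L x + (K * ρ * i) • ν p) R) :=
        (measure_mono hsub).trans (measure_biUnion_finset_le _ _)
    _ ≤ ∑ i ∈ I, ENNReal.ofReal (R ^ s) := Finset.sum_le_sum fun i _ => hH _ _ hR
    _ = ENNReal.ofReal (2 * n + 1) * ENNReal.ofReal (R ^ s) := by
        rw [Finset.sum_const, nsmul_eq_mul, Int.card_Icc]
        congr 1
        rw [show ((n : ℤ) + 1 - -n).toNat = 2 * n + 1 by omega, ← ENNReal.ofReal_natCast]
        push_cast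
        rfl
    _ ≤ _ := by
        rw [← ENNReal.ofReal_mul (by positivity), ← ENNReal.ofReal_mul (by positivity)]
        refine ENNReal.ofReal_le_ofReal ?_
        rw [Real.mul_rpow (by positivity) (by positivity), Real.mul_rpow (by positivity) (by positivity),
          Real.rpow_add hK0, Real.rpow_one]
        calc _ ≤ (5 * K) * ((2 + C * C) ^ s * (K ^ s * ρ ^ s)) := by gcongr; linarith
          _ = _ := by ring

/-- The linear estimate with constant `b` at scale `r`. -/
def LinBound (E : Type*) [NormedAddCommGroup E] [InnerProductSpace ℝ E] [FiniteDimensional ℝ E]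
    [MeasurableSpace E] [BorelSpace E] (c C s r : ℝ) (b : ℝ≥0∞) : Prop :=
  ∀ ⦃e : E⦄ ⦃ν : E → E⦄ ⦃S : Set E⦄, IsCap e ν c C S → ∀ ⦃H : Measure E⦄ [IsFiniteMeasure H], HasGrowth s H →
  ∀ ⦃φ : E → ℂ⦄, Spec (nbhd e ν r 1 S) φ → ∫⁻ x, ‖φ x‖ₑ ^ 2 ∂H ≤ b * nsq φ

theorem LinBound.rescale {c C s r K : ℝ} (hK : 1 ≤ K) {b : ℝ≥0∞} (hb : LinBound E c C s (r / K) b)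
    {e : E} {ν : E → E} {S : Set E} (hS : IsCap e ν c C S) (hd : ∀ q ∈ S, ∀ q' ∈ S, K * ‖hpart e (q - q')‖ ≤ C)
    {H : Measure E} [IsFiniteMeasure H] (hH : HasGrowth s H) {φ : E → ℂ} (hφ : Spec (nbhd e ν r 1 S) φ) :
    ∫⁻ x, ‖φ x‖ₑ ^ 2 ∂H ≤
      ENNReal.ofReal (5 * (2 + C * C) ^ s) * ENNReal.ofReal (K ^ (s - Module.finrank ℝ E)) * b * nsq φ := by
  have hK0 : 0 < K := one_pos.trans_le hK
  have hC := hS.one_le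
  rcases S.eq_empty_or_nonempty with rfl | ⟨p, hp⟩
  · obtain ⟨f, -, -, hf0, rfl⟩ := hφ
    have : f = 0 := by
      ext ξ
      refine hf0 ξ ?_
      rintro ⟨p, hp, -⟩
      exact hp.elim
    rw [this]
    have h0 : ∀ x, 𝓕 (0 : E → ℂ) x = 0 := fun x => by simp [Real.fourier_eq]
    simp [h0]
  have hm := hφ.continuous.measurable
  set T := hS.tube hK0 p
  have hT : Measurable T := T.toContinuousLinearEquiv.continuous.measurable
  have hTs : Measurable T.symm := T.symm.toContinuousLinearEquiv.continuous.measurable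
  have hψ := hφ.affine (L := T.symm) (hS.dualTube hK0 p).symm (fun x ξ => by
    have := hS.inner_tube hK0 p (T.symm x) ((hS.dualTube hK0 p).symm ξ)
    rwa [LinearEquiv.apply_symm_apply, LinearEquiv.apply_symm_apply, eq_comm] at this) 0
  set ψ : E → ℂ := fun x => φ (T.symm x) with hψdef
  have hψS : Spec (nbhd e (hS.scaledNormal hK0 p) (r / K) 1 ((hS.dualTube hK0 p).symm '' S)) ψ := by
    have h1 := hψ.mono (T := nbhd e (hS.scaledNormal hK0 p) (r / K) 1 ((hS.dualTube hK0 p).symm '' S)) (by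
      intro ζ hζ
      have := hS.mem_nbhd_rescale hK0 p (Set.mem_ofPred_eq ▸ hζ)
      simpa using this)
    simpa [hψdef] using h1
  have hM0 : 0 < 5 * (2 + C * C) ^ s * K ^ (s + 1) := by positivity
  set M := ENNReal.ofReal (5 * (2 + C * C) ^ s * K ^ (s + 1)) with hM
  have hMne : M ≠ 0 := by simpa [hM] using hM0
  have hMtop : M ≠ ⊤ := ENNReal.ofReal_ne_top
  have hMM : M * M⁻¹ = 1 := ENNReal.mul_inv_cancel hMne hMtop
  have hfin : IsFiniteMeasure (M⁻¹ • H.map T) := by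
    refine ⟨?_⟩
    rw [Measure.smul_apply, smul_eq_mul]
    exact ENNReal.mul_lt_top (by simp [pos_iff_ne_zero, hMne]) (measure_lt_top _ _)
  have hgr : HasGrowth s (M⁻¹ • H.map T) := fun x ρ hρ => by
    rw [Measure.smul_apply, smul_eq_mul, Measure.map_apply hT measurableSet_closedBall]
    calc _ ≤ M⁻¹ * (M * ENNReal.ofReal (ρ ^ s)) := mul_le_mul_right (hH.preimage_tube_le hS hK hp x hρ) _
      _ = M * M⁻¹ * ENNReal.ofReal (ρ ^ s) := by ring
      _ = _ := by rw [hMM, one_mul]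
  have h1 := hb (hS.rescale hK0 hp hd) hgr hψS
  have h2 : ∫⁻ x, ‖ψ x‖ₑ ^ 2 ∂(M⁻¹ • H.map T) = M⁻¹ * ∫⁻ x, ‖φ x‖ₑ ^ 2 ∂H := by
    rw [lintegral_smul_measure, lintegral_map (by fun_prop) hT, smul_eq_mul]
    simp [hψdef]
  have h3 : nsq φ = ENNReal.ofReal (K ^ (Module.finrank ℝ E + 1)) * nsq ψ := by
    have := lintegral_comp_linearEquiv T (F := fun x => ‖ψ x‖ₑ ^ 2) (by fun_prop)
    rw [hS.abs_det_tube hK0 p] at this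
    simp only [hψdef, LinearEquiv.symm_apply_apply] at this
    rw [nsq, nsq, this]
    simp [hψdef]
  have h4 : ENNReal.ofReal (5 * (2 + C * C) ^ s) * ENNReal.ofReal (K ^ (s - Module.finrank ℝ E)) *
      ENNReal.ofReal (K ^ (Module.finrank ℝ E + 1)) = M := by
    rw [← ENNReal.ofReal_mul (by positivity), ← ENNReal.ofReal_mul (by positivity), hM, mul_assoc,
      ← Real.rpow_natCast, ← Real.rpow_add hK0]
    push_cast
    ring_nf
  calc ∫⁻ x, ‖φ x‖ₑ ^ 2 ∂H = M * (M⁻¹ * ∫⁻ x, ‖φ x‖ₑ ^ 2 ∂H) := by rw [← mul_assoc, hMM, one_mul]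
    _ ≤ M * (b * nsq ψ) := by rw [← h2]; exact mul_le_mul_right h1 _
    _ = _ := by rw [← h4, h3]; ring

end Fourier

section Fourier
variable {E : Type*} [NormedAddCommGroup E] [InnerProductSpace ℝ E] [FiniteDimensional ℝ E] [MeasurableSpace E]
  [BorelSpace E]

theorem LinBound.mono {c C s r : ℝ} {b b' : ℝ≥0∞} (h : LinBound E c C s r b) (hb : b ≤ b') :
    LinBound E c C s r b' := fun _ _ _ hS _ _ hH _ hφ => (h hS hH hφ).trans (mul_le_mul_left hb _)

theorem exists_lintegral_enorm_sq_le (E : Type*) [NormedAddCommGroup E] [InnerProductSpace ℝ E]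
    [FiniteDimensional ℝ E] [MeasurableSpace E] [BorelSpace E] (R s : ℝ) :
    ∃ b : ℝ≥0∞, b ≠ ⊤ ∧ ∀ {H : Measure E} [IsFiniteMeasure H], HasGrowth s H → ∀ (p : E) {φ : E → ℂ},
      Spec (closedBall p R) φ → ∫⁻ x, ‖φ x‖ₑ ^ 2 ∂H ≤ b * nsq φ := by
  obtain ⟨N, B, hN, hB1, hB, hweight⟩ := exists_isWeight E (s := s)
  obtain ⟨C₁, hC₁, hrep⟩ := exists_enorm_sq_le_lintegral_dec E R hN
  refine ⟨C₁ * B, by finiteness, fun {H} hfin hH p φ hφ => ?_⟩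
  have hm := hφ.continuous.measurable
  have hB0 : B ≠ 0 := (one_pos.trans_le hB1).ne'
  calc ∫⁻ x, ‖φ x‖ₑ ^ 2 ∂H ≤ ∫⁻ x, C₁ * (∫⁻ y, dec N ‖x - y‖ₑ * ‖φ y‖ₑ ^ 2) ∂H :=
        lintegral_mono fun x => hrep p hφ x
    _ = C₁ * ∫⁻ y, (∫⁻ x, dec N ‖x - y‖ₑ ∂H) * ‖φ y‖ₑ ^ 2 := by
        rw [lintegral_const_mul _ (by fun_prop), lintegral_lintegral_swap (by fun_prop)]
        congr 1
        exact lintegral_congr fun y => lintegral_mul_const _ (by fun_prop)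
    _ ≤ C₁ * ∫⁻ y, B * ‖φ y‖ₑ ^ 2 := by
        refine mul_le_mul_right (lintegral_mono fun y => mul_le_mul_left ?_ _) _
        have h1 := (hweight hH).le_one y
        calc _ = B * (B⁻¹ * ∫⁻ x, dec N ‖x - y‖ₑ ∂H) := by
              rw [← mul_assoc, ENNReal.mul_inv_cancel hB0 hB, one_mul]
          _ ≤ B * 1 := mul_le_mul_right h1 _
          _ = B := mul_one B
    _ = _ := by rw [lintegral_const_mul _ (by fun_prop), nsq, mul_assoc]

theorem exists_linBound_const (E : Type*) [NormedAddCommGroup E] [InnerProductSpace ℝ E] [FiniteDimensional ℝ E]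
    [MeasurableSpace E] [BorelSpace E] (c C s : ℝ) :
    ∃ b : ℝ≥0∞, b ≠ ⊤ ∧ ∀ {r : ℝ}, 1 ≤ r → LinBound E c C s r b := by
  obtain ⟨b, hb, h⟩ := exists_lintegral_enorm_sq_le E ((2 + 2 * C * C) * C + (3 + C * C)) s
  refine ⟨b, hb, fun {r} hr e ν S hS H hfin hH φ hφ => ?_⟩
  obtain ⟨p, hp⟩ := hS.exists_nbhd_subset hr
  exact h hH p (hφ.mono hp)

theorem enorm_sum_sq_le {ι : Type*} {I : Finset ι} {adj : ι → ι → Prop} (hsymm : ∀ i j, adj i j → adj j i) {N : ℕ}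
    (hN : ∀ i, ∀ J ⊆ I, (∀ j ∈ J, adj i j) → J.card ≤ N) (z : ι → ℂ) [DecidableRel adj] :
    ‖∑ i ∈ I, z i‖ₑ ^ 2 ≤ 2 * N * ∑ i ∈ I, ‖z i‖ₑ ^ 2 + ∑ i ∈ I, ∑ j ∈ I with ¬ adj i j, ‖z i * z j‖ₑ := by
  classical
  have h1 : ‖∑ i ∈ I, z i‖ₑ ^ 2 ≤ ∑ i ∈ I, ∑ j ∈ I, ‖z i * z j‖ₑ := by
    refine (pow_le_pow_left' (enorm_sum_le I z) 2).trans_eq ?_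
    rw [sq, Finset.sum_mul_sum]
    simp_rw [enorm_mul]
  refine h1.trans ?_
  have h2 : ∀ i ∈ I, ∑ j ∈ I, ‖z i * z j‖ₑ =
      ∑ j ∈ I with adj i j, ‖z i * z j‖ₑ + ∑ j ∈ I with ¬ adj i j, ‖z i * z j‖ₑ := fun i _ =>
    (Finset.sum_filter_add_sum_filter_not I (adj i) _).symm
  rw [Finset.sum_congr rfl h2, Finset.sum_add_distrib]
  refine add_le_add_left ?_ _
  calc ∑ i ∈ I, ∑ j ∈ I with adj i j, ‖z i * z j‖ₑ
      ≤ ∑ i ∈ I, ∑ j ∈ I with adj i j, (‖z i‖ₑ ^ 2 + ‖z j‖ₑ ^ 2) := by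
        refine Finset.sum_le_sum fun i _ => Finset.sum_le_sum fun j _ => ?_
        rw [enorm_mul]
        exact ENNReal.mul_le_sq_add_sq _ _
    _ = ∑ i ∈ I, ((I.filter (adj i)).card * ‖z i‖ₑ ^ 2) + ∑ i ∈ I, ∑ j ∈ I with adj i j, ‖z j‖ₑ ^ 2 := by
        simp_rw [Finset.sum_add_distrib, Finset.sum_const, nsmul_eq_mul]
    _ ≤ ∑ i ∈ I, (N * ‖z i‖ₑ ^ 2) + N * ∑ i ∈ I, ‖z i‖ₑ ^ 2 := by
        refine add_le_add (Finset.sum_le_sum fun i _ => mul_le_mul_left ?_ _) ?_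
        · exact_mod_cast hN i _ (Finset.filter_subset _ _) fun j hj => (Finset.mem_filter.1 hj).2
        · refine le_of_eq_of_le ?_ (sum_sum_filter_le hsymm hN fun j => ‖z j‖ₑ ^ 2)
          congr!
    _ = _ := by rw [← Finset.mul_sum]; ring

theorem exists_linBound_step {c C s : ℝ} (hc : 0 < c) (hC : 1 ≤ C) (hs : (Module.finrank ℝ E : ℝ) / 2 - 1 < s) :
    ∃ C₀ : ℝ≥0∞, C₀ ≠ ⊤ ∧ ∀ {K : ℝ}, 1 ≤ K → ∃ C₁ : ℝ≥0∞, C₁ ≠ ⊤ ∧ ∀ {r : ℝ}, 4 * K ≤ r → ∀ {b : ℝ≥0∞},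
      LinBound E c C s (r / K) b → LinBound E c C s r (C₀ * ENNReal.ofReal (K ^ (s - Module.finrank ℝ E)) * b +
        C₁ * ENNReal.ofReal (r ^ (s - ((Module.finrank ℝ E : ℝ) + 2) / 2))) := by
  classical
  set d := Module.finrank ℝ E
  set σ := √d + 1
  have hσ : 0 < σ := by positivity
  set L := 6 * C ^ 2 / c ^ 2
  have hL : 0 < L := by positivity
  obtain ⟨k, hk⟩ := exists_nat_ge (σ * (2 * (3 + C * C) + L * (2 + 2 * C * C)))
  set ρ := (2 + 2 * C * C) * C + (3 + C * C)
  have hρ : 0 < ρ := by positivity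
  refine ⟨2 * ((2 * k + 1) ^ d : ℕ) * ENNReal.ofReal (5 * (2 + C * C) ^ s), by finiteness, fun {K} hK => ?_⟩
  have hK0 : 0 < K := by linarith
  set δ := (4 * K)⁻¹ with hδdef
  have hδ : 0 < δ := by positivity
  obtain ⟨n, hgrid⟩ := exists_grid E (t := ρ * (4 * K)) (by positivity) k
  obtain ⟨K₁, hK₁, hbil⟩ := exists_lintegral_measure_bil_le (E := E) (s := s) hc hC (D := L * δ) (by positivity) hs
  refine ⟨2 * n * K₁, by finiteness, fun {r} hr b hb e ν S hS H hfin hH φ hφ => ?_⟩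
  have hr0 : 0 < r := by linarith
  have hrδ : 1 / r ≤ δ := by
    rw [hδdef, one_div]
    exact inv_anti₀ (by positivity) hr
  obtain ⟨p₀, hp₀⟩ := hS.exists_nbhd_subset (r := r) (by linarith)
  obtain ⟨I, Q, adj, hIn, -, hQm, -, hQd, hdisj, hcov, hsymm, hcard, hfar⟩ := hgrid hρ p₀
  have hδt : ρ / (ρ * (4 * K)) = δ := by rw [hδdef]; field_simp
  obtain ⟨Φ, hΦS, hΦ, hΦn⟩ := hφ.exists_split (s := I) hQm hdisj fun ξ hξ => by simpa using hcov (hp₀ hξ)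
  set T : (Fin d → ℤ) → Set E := fun i => {p | p ∈ S ∧ ∃ ζ ∈ Q i, ζ ∈ plate e ν r 1 p}
  have hTS : ∀ i, T i ⊆ S := fun i p hp => hp.1
  have hΦT : ∀ i, Spec (nbhd e ν r 1 (T i)) (Φ i) := fun i => (hΦS i).mono fun ζ ⟨⟨p, hp, h⟩, hζ⟩ =>
    ⟨p, ⟨hp, ζ, hζ, h⟩, h⟩
  have hpl : ∀ {p ζ : E}, ζ ∈ plate e ν r 1 p → ‖hpart e (ζ - p)‖ ≤ δ := fun {p ζ} h =>
    ((le_div_iff₀' hr0).2 h.1).trans hrδ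
  have hpl' : ∀ {p ζ : E}, p ∈ S → ζ ∈ plate e ν r 1 p → ‖ζ - p‖ ≤ (3 + C * C) * δ := fun {p ζ} hp h => by
    have h1 := hS.norm_sub_le_of_mem_plate (r := r) (by linarith) hp h
    rw [mul_one] at h1
    calc ‖ζ - p‖ ≤ (3 + C * C) / r := (le_div_iff₀' hr0).2 h1
      _ = (3 + C * C) * (1 / r) := by ring
      _ ≤ _ := by gcongr
  have hTd : ∀ i, ∀ p ∈ T i, ∀ q ∈ T i, ‖hpart e (p - q)‖ ≤ 4 * δ := by
    rintro i p ⟨hp, ζ, hζ, h⟩ q ⟨hq, ζ', hζ', h'⟩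
    obtain ⟨x, hx⟩ := hQd i
    rw [hδt] at hx
    have h1 : ‖ζ - ζ'‖ ≤ 2 * δ := by
      have h1 := hx hζ
      have h2 := hx hζ'
      rw [mem_closedBall, dist_eq_norm] at h1 h2
      have := norm_sub_le_norm_sub_add_norm_sub ζ x ζ'
      rw [norm_sub_rev x] at this
      linarith
    have h2 := (norm_hpart_le hS.norm_e (ζ - ζ')).trans h1
    have h3 : hpart e (p - q) = -hpart e (ζ - p) + hpart e (ζ - ζ') + hpart e (ζ' - q) := by
      simp only [hpart, inner_sub_left]
      module
    rw [h3]
    have h4 := norm_add₃_le (a := -hpart e (ζ - p)) (b := hpart e (ζ - ζ')) (c := hpart e (ζ' - q))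
    rw [norm_neg] at h4
    linarith [hpl h, hpl h']
  have hpair : ∀ i j, ¬ adj i j → IsCapPair e ν c C (L * δ) S (T i) (T j) := by
    intro i j hij
    have hdiam : ∀ i, ∀ p ∈ T i, ∀ q ∈ T i, 3 * C ^ 2 * ‖hpart e (p - q)‖ ≤ 2 * c ^ 2 * (L * δ) := by
      intro i p hp q hq
      calc 3 * C ^ 2 * ‖hpart e (p - q)‖ ≤ 3 * C ^ 2 * (4 * δ) := by gcongr; exact hTd i p hp q hq
        _ = _ := by simp only [L]; field_simp; ring
    refine ⟨hS, hTS i, hTS j, by positivity, ?_, hdiam i, hdiam j⟩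
    rintro p ⟨hp, ζ, hζ, h⟩ q ⟨hq, ζ', hζ', h'⟩
    have h1 := hfar i j hij ζ hζ ζ' hζ'
    have h2 := hpl' hp h
    have h3 := hpl' hq h'
    have h4 := hS.norm_sub_le hp hq
    have h5 : ‖ζ' - ζ‖ ≤ (3 + C * C) * δ + ‖p - q‖ + (3 + C * C) * δ := by
      have : ζ' - ζ = (ζ' - q) + -(p - q) + -(ζ - p) := by abel
      rw [this]
      refine norm_add₃_le.trans ?_
      rw [norm_neg, norm_neg]
      linarith
    have h6 : k * δ ≤ σ * ‖ζ' - ζ‖ := by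
      have : k * ρ = ρ * (4 * K) * (k * δ) := by rw [hδdef]; field_simp
      rw [this, mul_assoc (ρ * (4 * K)) (√_ + 1)] at h1
      exact le_of_mul_le_mul_left h1 (by positivity)
    have h7 : σ * ((2 * (3 + C * C) + L * (2 + 2 * C * C)) * δ) ≤
        σ * ((3 + C * C) * δ + ‖p - q‖ + (3 + C * C) * δ) := by
      calc _ = σ * (2 * (3 + C * C) + L * (2 + 2 * C * C)) * δ := by ring
        _ ≤ k * δ := by gcongr
        _ ≤ _ := h6.trans (by gcongr)
    have h8 := le_of_mul_le_mul_left h7 hσ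
    have h9 : (2 + 2 * C * C) * (L * δ) ≤ (2 + 2 * C * C) * ‖hpart e (p - q)‖ := by linarith
    exact le_of_mul_le_mul_left h9 (by positivity)
  have hΦm : ∀ i, Measurable (Φ i) := fun i => (hΦS i).continuous.measurable
  set M := ENNReal.ofReal (5 * (2 + C * C) ^ s) * ENNReal.ofReal (K ^ (s - d)) * b
  set R := K₁ * ENNReal.ofReal (r ^ (s - ((d : ℝ) + 2) / 2))
  set P := (2 * k + 1) ^ d
  have hnear : ∀ i, ∫⁻ x, ‖Φ i x‖ₑ ^ 2 ∂H ≤ M * nsq (Φ i) := fun i =>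
    hb.rescale hK (hS.subset (hTS i)) (fun p hp q hq => by
      calc K * ‖hpart e (p - q)‖ ≤ K * (4 * δ) := by gcongr; exact hTd i p hp q hq
        _ = 1 := by rw [hδdef]; field_simp
        _ ≤ C := hC) hH (hΦT i)
  have hfar' : ∀ i j, ¬ adj i j → ∫⁻ x, ‖Φ i x * Φ j x‖ₑ ∂H ≤ R * (nsq (Φ i) + nsq (Φ j)) := fun i j hij =>
    hbil (by linarith) (hpair i j hij) hH (hΦT i) (hΦT j)
  calc ∫⁻ x, ‖φ x‖ₑ ^ 2 ∂H ≤ ∫⁻ x, (2 * P * ∑ i ∈ I, ‖Φ i x‖ₑ ^ 2 +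
        ∑ i ∈ I, ∑ j ∈ I with ¬ adj i j, ‖Φ i x * Φ j x‖ₑ) ∂H := by
        refine lintegral_mono fun x => ?_
        rw [hΦ x]
        exact enorm_sum_sq_le hsymm hcard fun i => Φ i x
    _ = 2 * P * ∑ i ∈ I, ∫⁻ x, ‖Φ i x‖ₑ ^ 2 ∂H +
        ∑ i ∈ I, ∑ j ∈ I with ¬ adj i j, ∫⁻ x, ‖Φ i x * Φ j x‖ₑ ∂H := by
        rw [lintegral_add_left (by fun_prop), lintegral_const_mul _ (by fun_prop),
          lintegral_finsetSum _ (fun i _ => by fun_prop), lintegral_finsetSum _ (fun i _ => by fun_prop)]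
        congr 1
        exact Finset.sum_congr rfl fun i _ => lintegral_finsetSum _ fun j _ => by fun_prop
    _ ≤ 2 * P * ∑ i ∈ I, M * nsq (Φ i) + ∑ i ∈ I, ∑ j ∈ I, R * (nsq (Φ i) + nsq (Φ j)) := by
        gcongr with i hi i hi
        · exact hnear i
        · refine (Finset.sum_le_sum fun j hj => hfar' i j (Finset.mem_filter.1 hj).2).trans ?_
          exact Finset.sum_le_sum_of_subset (Finset.filter_subset _ _)
    _ = 2 * P * M * ∑ i ∈ I, nsq (Φ i) + 2 * I.card * R * ∑ i ∈ I, nsq (Φ i) := by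
        simp_rw [← Finset.mul_sum, Finset.sum_add_distrib, Finset.sum_const, nsmul_eq_mul, ← Finset.mul_sum]
        ring
    _ ≤ 2 * P * M * nsq φ + 2 * n * R * nsq φ := by gcongr
    _ = _ := by simp only [M, R]; ring

/-- The weighted restriction estimate for caps. -/
theorem exists_linBound {c C s ε : ℝ} (hc : 0 < c) (hC : 1 ≤ C) (hd : 2 ≤ Module.finrank ℝ E)
    (hs : (Module.finrank ℝ E : ℝ) / 2 - 1 < s) (hε : 0 < ε) : ∃ K : ℝ≥0∞, K ≠ ⊤ ∧ ∀ {r : ℝ}, 1 ≤ r →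
      LinBound E c C s r (K * ENNReal.ofReal (r ^ (s - ((Module.finrank ℝ E : ℝ) + 2) / 2 + ε))) := by
  obtain ⟨C₀, hC₀, hstep⟩ := exists_linBound_step (E := E) (s := s) hc hC hs
  obtain ⟨b₀, hb₀, hconst⟩ := exists_linBound_const E c C s
  set d := Module.finrank ℝ E
  set τ := s - ((d : ℝ) + 2) / 2
  obtain ⟨m, hm2, hm⟩ := exists_large_scale hC₀ hε 2
  have hm0 : 0 < m := by linarith
  obtain ⟨C₁, hC₁, hstep⟩ := hstep (K := m) (by linarith)
  set K := 2 * C₁ + b₀ * ENNReal.ofReal ((4 * m) ^ |τ + ε|)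
  have hind : ∀ n : ℕ, ∀ r : ℝ, 1 ≤ r → r ≤ m ^ n → LinBound E c C s r (K * ENNReal.ofReal (r ^ (τ + ε))) := by
    have base : ∀ r : ℝ, 1 ≤ r → r ≤ 4 * m → LinBound E c C s r (K * ENNReal.ofReal (r ^ (τ + ε))) := by
      intro r hr hrm
      refine LinBound.mono (hconst hr) ?_
      calc b₀ = b₀ * ENNReal.ofReal 1 := by rw [ENNReal.ofReal_one, mul_one]
        _ ≤ b₀ * ENNReal.ofReal ((4 * m) ^ |τ + ε| * r ^ (τ + ε)) := by
            gcongr; exact one_le_rpow_abs_mul hr hrm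
        _ = b₀ * ENNReal.ofReal ((4 * m) ^ |τ + ε|) * ENNReal.ofReal (r ^ (τ + ε)) := by
            rw [ENNReal.ofReal_mul (by positivity), mul_assoc]
        _ ≤ _ := mul_le_mul_left le_add_self _
    intro n
    induction n with
    | zero => intro r hr hrn; exact base r hr (by simp at hrn; linarith)
    | succ n ih =>
      intro r hr hrn
      rcases le_total r (4 * m) with hrm | hrm
      · exact base r hr hrm
      have h1 : 1 ≤ r / m := by rw [one_le_div hm0]; linarith
      refine LinBound.mono (hstep hrm (ih (r / m) h1 (by rwa [div_le_iff₀ hm0, ← pow_succ]))) ?_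
      have hr0 : 0 < r := by linarith
      have e1 : ENNReal.ofReal (m ^ (s - d)) * ENNReal.ofReal ((r / m) ^ (τ + ε)) ≤
          ENNReal.ofReal (m ^ (-ε)) * ENNReal.ofReal (r ^ (τ + ε)) := by
        rw [← ENNReal.ofReal_mul (by positivity), ← ENNReal.ofReal_mul (by positivity), Real.div_rpow hr0.le hm0.le]
        refine ENNReal.ofReal_le_ofReal ?_
        calc m ^ (s - d) * (r ^ (τ + ε) / m ^ (τ + ε)) = m ^ (s - d - (τ + ε)) * r ^ (τ + ε) := by
              rw [Real.rpow_sub hm0 (s - d)]; ring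
          _ ≤ _ := by
              gcongr
              · linarith
              · have : (2 : ℝ) ≤ d := by exact_mod_cast hd
                simp only [τ]
                linarith
      have e2 : C₁ ≤ 2⁻¹ * K := by
        calc C₁ = 2⁻¹ * (2 * C₁) := by rw [← mul_assoc, ENNReal.inv_mul_cancel two_ne_zero ENNReal.ofNat_ne_top, one_mul]
          _ ≤ 2⁻¹ * K := mul_le_mul_right le_self_add _
      have e3 : ENNReal.ofReal (r ^ τ) ≤ ENNReal.ofReal (r ^ (τ + ε)) :=
        ENNReal.ofReal_le_ofReal (Real.rpow_le_rpow_of_exponent_le hr (by linarith))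
      calc C₀ * ENNReal.ofReal (m ^ (s - d)) * (K * ENNReal.ofReal ((r / m) ^ (τ + ε))) + C₁ * ENNReal.ofReal (r ^ τ)
          = C₀ * K * (ENNReal.ofReal (m ^ (s - d)) * ENNReal.ofReal ((r / m) ^ (τ + ε))) +
            C₁ * ENNReal.ofReal (r ^ τ) := by ring
        _ ≤ C₀ * K * (ENNReal.ofReal (m ^ (-ε)) * ENNReal.ofReal (r ^ (τ + ε))) +
            2⁻¹ * K * ENNReal.ofReal (r ^ (τ + ε)) := by gcongr
        _ = C₀ * ENNReal.ofReal (m ^ (-ε)) * K * ENNReal.ofReal (r ^ (τ + ε)) +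
            2⁻¹ * K * ENNReal.ofReal (r ^ (τ + ε)) := by ring
        _ ≤ 2⁻¹ * K * ENNReal.ofReal (r ^ (τ + ε)) + 2⁻¹ * K * ENNReal.ofReal (r ^ (τ + ε)) := by gcongr
        _ = (2⁻¹ + 2⁻¹) * K * ENNReal.ofReal (r ^ (τ + ε)) := by ring
        _ = _ := by rw [ENNReal.inv_two_add_inv_two, one_mul]
  refine ⟨K, by finiteness, fun {r} hr => ?_⟩
  obtain ⟨n, hn⟩ := pow_unbounded_of_one_lt r (show 1 < m by linarith)
  exact hind n r hr hn.le

end Fourier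

section MeasureFT
variable {d : ℕ} {μ : Measure (EuclideanSpace ℝ (Fin d))}

theorem measureFT_eq_integral_fourierChar (ξ : EuclideanSpace ℝ (Fin d)) :
    measureFT μ ξ = ∫ x, (Real.fourierChar (-⟪x, ξ⟫) : ℂ) ∂μ := by
  refine integral_congr_ae (.of_forall fun x => ?_)
  simp only [Real.fourierChar_apply]
  congr 1
  push_cast
  ring

theorem continuous_fourierChar_neg_inner {E : Type*} [NormedAddCommGroup E] [InnerProductSpace ℝ E] :
    Continuous fun p : E × E => (Real.fourierChar (-⟪p.1, p.2⟫) : ℂ) := by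
  have := Real.continuous_fourierChar
  fun_prop

theorem continuous_measureFT [IsFiniteMeasure μ] : Continuous (measureFT μ) := by
  simp only [funext (measureFT_eq_integral_fourierChar (μ := μ))]
  refine continuous_of_dominated (bound := fun _ => 1) (fun ξ => ?_) (fun ξ => ?_)
    (integrable_const _) (.of_forall fun x => ?_)
  · exact (continuous_fourierChar_neg_inner.comp
      (continuous_id.prodMk continuous_const)).aestronglyMeasurable
  · exact .of_forall fun x => (Circle.norm_coe _).le
  · exact continuous_fourierChar_neg_inner.comp (continuous_const.prodMk continuous_id)

theorem norm_measureFT_le_one [IsProbabilityMeasure μ] (ξ : EuclideanSpace ℝ (Fin d)) :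
    ‖measureFT μ ξ‖ ≤ 1 := by
  rw [measureFT_eq_integral_fourierChar]
  simpa using norm_integral_le_of_norm_le_const (μ := μ) (C := 1)
    (f := fun x => (Real.fourierChar (-⟪x, ξ⟫) : ℂ)) (.of_forall fun x => (Circle.norm_coe _).le)

theorem enorm_measureFT_le_one [IsProbabilityMeasure μ] (ξ : EuclideanSpace ℝ (Fin d)) :
    ‖measureFT μ ξ‖ₑ ≤ 1 := by
  rw [← ofReal_norm]
  exact ENNReal.ofReal_le_one.2 (norm_measureFT_le_one ξ)

/-- Pairing a function with the Fourier transform of a measure. -/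
theorem integral_mul_measureFT_smul [IsFiniteMeasure μ] {f : EuclideanSpace ℝ (Fin d) → ℂ} (hf : Integrable f)
    (t : ℝ) : ∫ η, f η * measureFT μ (t • η) = ∫ x, 𝓕 f (t • x) ∂μ := by
  have hI : Integrable (fun p : EuclideanSpace ℝ (Fin d) × EuclideanSpace ℝ (Fin d) =>
      f p.1 * (Real.fourierChar (-⟪p.2, t • p.1⟫) : ℂ)) (volume.prod μ) := by
    have hc : Continuous fun p : EuclideanSpace ℝ (Fin d) × EuclideanSpace ℝ (Fin d) =>
        (Real.fourierChar (-⟪p.2, t • p.1⟫) : ℂ) :=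
      continuous_fourierChar_neg_inner.comp (by fun_prop : Continuous fun p :
        EuclideanSpace ℝ (Fin d) × EuclideanSpace ℝ (Fin d) => (p.2, t • p.1))
    have h := hf.mul_prod (integrable_const (μ := μ) (1 : ℂ))
    refine (h.bdd_mul (c := 1) hc.aestronglyMeasurable
      (.of_forall fun p => (Circle.norm_coe _).le)).congr (.of_forall fun p => by ring)
  simp only [measureFT_eq_integral_fourierChar, Real.fourier_eq, Circle.smul_def, smul_eq_mul,
    ← integral_const_mul]
  rw [integral_integral_swap hI]
  refine integral_congr_ae (.of_forall fun x => integral_congr_ae (.of_forall fun η => ?_))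
  simp only [real_inner_comm, inner_smul_right]
  ring

theorem hasGrowth_map_smul {s A : ℝ} (hA : 0 < A)
    (hfrost : ∀ (x : EuclideanSpace ℝ (Fin d)) (r : ℝ), 0 < r →
      μ (closedBall x r) ≤ ENNReal.ofReal (A * r ^ s)) {t : ℝ} (ht : 0 < t) :
    HasGrowth s ((ENNReal.ofReal (A * t ^ (-s)))⁻¹ • μ.map (t • ·)) := by
  intro x ρ hρ
  have h0 : 0 < A * t ^ (-s) := by positivity
  have hpre : (t • · : EuclideanSpace ℝ (Fin d) → _) ⁻¹' closedBall x ρ ⊆ closedBall (t⁻¹ • x) (ρ / t) := by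
    intro y hy
    rw [Set.mem_preimage, mem_closedBall, dist_eq_norm] at hy
    rw [mem_closedBall, dist_eq_norm, le_div_iff₀ ht]
    rw [show t • y - x = t • (y - t⁻¹ • x) by rw [smul_sub, smul_inv_smul₀ ht.ne'], norm_smul,
      Real.norm_of_nonneg ht.le, mul_comm] at hy
    exact hy
  rw [Measure.smul_apply, Measure.map_apply (by fun_prop) measurableSet_closedBall, smul_eq_mul]
  calc _ ≤ (ENNReal.ofReal (A * t ^ (-s)))⁻¹ * ENNReal.ofReal (A * (ρ / t) ^ s) :=
        mul_le_mul_right ((measure_mono hpre).trans (hfrost _ _ (by positivity))) _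
    _ = _ := by
        rw [Real.div_rpow (by positivity) ht.le, show A * (ρ ^ s / t ^ s) = A * t ^ (-s) * ρ ^ s by
          rw [Real.rpow_neg ht.le]; ring, ENNReal.ofReal_mul h0.le, ← mul_assoc,
          ENNReal.inv_mul_cancel (by simpa using h0) (by finiteness), one_mul]

/-- A restriction estimate for functions with spectrum in `T` gives a bound for the `L²` mass of the
Fourier transform of a Frostman measure on dilates of `T`. -/
theorem setLIntegral_enorm_measureFT_smul_sq_le [IsProbabilityMeasure μ] {s A : ℝ} (hA : 0 < A)
    (hfrost : ∀ (x : EuclideanSpace ℝ (Fin d)) (r : ℝ), 0 < r →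
      μ (closedBall x r) ≤ ENNReal.ofReal (A * r ^ s)) {t : ℝ} (ht : 0 < t)
    {T : Set (EuclideanSpace ℝ (Fin d))} (hT : MeasurableSet T) (hTb : Bornology.IsBounded T) {b : ℝ≥0∞}
    (hb : ∀ ⦃H : Measure (EuclideanSpace ℝ (Fin d))⦄ [IsFiniteMeasure H], HasGrowth s H →
      ∀ ⦃φ : EuclideanSpace ℝ (Fin d) → ℂ⦄, Spec T φ → ∫⁻ x, ‖φ x‖ₑ ^ 2 ∂H ≤ b * nsq φ) :
    ∫⁻ η in T, ‖measureFT μ (t • η)‖ₑ ^ 2 ≤ ENNReal.ofReal (A * t ^ (-s)) * b := by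
  have hcont : Continuous fun η => measureFT μ (t • η) := continuous_measureFT.comp (by fun_prop)
  set f : EuclideanSpace ℝ (Fin d) → ℂ := T.indicator fun η => starRingEnd ℂ (measureFT μ (t • η)) with hf
  have hTfin : volume T ≠ ⊤ := hTb.measure_lt_top.ne
  have hfm : AEStronglyMeasurable f volume :=
    (Complex.continuous_conj.comp hcont).aestronglyMeasurable.indicator hT
  have hfb : ∀ η, ‖f η‖ ≤ 1 := fun η => by
    refine (norm_indicator_le_norm_self _ _).trans ?_
    simpa using norm_measureFT_le_one (t • η)
  have hfi : Integrable f := by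
    have h1 : IntegrableOn (fun _ => (1:ℝ)) T := integrableOn_const hTfin
    refine (h1.integrable_indicator hT).mono' hfm (.of_forall fun η => ?_)
    by_cases h : η ∈ T
    · simpa [h] using hfb η
    · simp [hf, h]
  have hf2 : MemLp f 2 := by
    refine ((memLp_indicator_const 2 hT (1:ℝ) (.inr hTfin))).of_le hfm (.of_forall fun η => ?_)
    by_cases h : η ∈ T
    · simpa [h] using hfb η
    · simp [hf, h]
  have hspec : Spec T (𝓕 f) := ⟨f, hfi, hf2, fun ξ h => by simp [hf, h], rfl⟩
  have hm : ∫⁻ η in T, ‖measureFT μ (t • η)‖ₑ ^ 2 = nsq f := by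
    rw [nsq, ← lintegral_indicator hT]
    refine lintegral_congr fun η => ?_
    by_cases h : η ∈ T <;> simp [hf, h]
  have hlt : nsq f < ⊤ := by rw [← nsq_fourier hfi hf2]; exact hspec.nsq_lt_top
  have hpair : nsq f ≤ ∫⁻ x, ‖𝓕 f (t • x)‖ₑ ∂μ := by
    have h1 : ∀ η, f η * measureFT μ (t • η) = ((‖f η‖ ^ 2 : ℝ) : ℂ) := fun η => by
      by_cases h : η ∈ T
      · simp [hf, h, Complex.conj_mul']
      · simp [hf, h]
    have h2 : nsq f = ‖∫ η, f η * measureFT μ (t • η)‖ₑ := by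
      simp only [h1]
      rw [integral_complex_ofReal, ← ofReal_norm, Complex.norm_real, Real.norm_of_nonneg (by positivity),
        ofReal_integral_eq_lintegral_ofReal hf2.norm.integrable_sq (.of_forall fun _ => by positivity), nsq]
      refine lintegral_congr fun η => ?_
      rw [ENNReal.ofReal_pow (by positivity), ofReal_norm]
    rw [h2, integral_mul_measureFT_smul hfi]
    exact enorm_integral_le_lintegral_enorm _
  have hsq : (∫⁻ x, ‖𝓕 f (t • x)‖ₑ ∂μ) ^ 2 ≤ ∫⁻ x, ‖𝓕 f (t • x)‖ₑ ^ 2 ∂μ := by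
    have hc := hspec.continuous
    simpa using sq_lintegral_mul_le (μ := μ) (k := fun _ => 1) (g := fun x => ‖𝓕 f (t • x)‖ₑ)
      (by fun_prop) (by fun_prop)
  set M := ENNReal.ofReal (A * t ^ (-s)) with hM
  have hM0 : M ≠ 0 := by simp [hM]; positivity
  have hMt : M ≠ ⊤ := by finiteness
  have hmass : ∫⁻ x, ‖𝓕 f (t • x)‖ₑ ^ 2 ∂μ ≤ M * (b * nsq f) := by
    have hMi : M⁻¹ ≠ ⊤ := by simpa using hM0
    have : IsFiniteMeasure (M⁻¹ • μ.map (t • ·)) := by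
      have := Measure.isFiniteMeasure_map μ (t • · : EuclideanSpace ℝ (Fin d) → _)
      exact ⟨by rw [Measure.smul_apply, smul_eq_mul]; finiteness⟩
    have h1 := hb (hasGrowth_map_smul hA hfrost ht) hspec
    have hc := hspec.continuous
    rw [lintegral_smul_measure, lintegral_map (by fun_prop) (by fun_prop), nsq_fourier hfi hf2,
      smul_eq_mul] at h1
    calc _ = M * (M⁻¹ * ∫⁻ x, ‖𝓕 f (t • x)‖ₑ ^ 2 ∂μ) := by
          rw [← mul_assoc, ENNReal.mul_inv_cancel hM0 hMt, one_mul]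
      _ ≤ _ := mul_le_mul_right h1 _
  rw [hm]
  by_cases h0 : nsq f = 0
  · simp [h0]
  · refine (ENNReal.mul_le_mul_iff_right h0 hlt.ne).1 ?_
    calc nsq f * nsq f = nsq f ^ 2 := (sq _).symm
      _ ≤ _ := pow_le_pow_left' hpair 2
      _ ≤ _ := hsq
      _ ≤ _ := hmass
      _ = _ := by ring

/-- Reproducing inequality for the Fourier transform of a compactly supported measure. -/
theorem exists_enorm_measureFT_sq_le [IsProbabilityMeasure μ] (hcpt : ∃ K, IsCompact K ∧ μ Kᶜ = 0) (N : ℕ) :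
    ∃ C : ℝ≥0∞, C ≠ ⊤ ∧ ∀ ξ, ‖measureFT μ ξ‖ₑ ^ 2 ≤
      C * ∫⁻ η, dec N ‖ξ - η‖ₑ * ‖measureFT μ η‖ₑ ^ 2 := by
  obtain ⟨K, hK, hK0⟩ := hcpt
  obtain ⟨R, hR⟩ := hK.isBounded.subset_closedBall 0
  obtain ⟨ρ, hρ⟩ := exists_schwartz_fourierInv_eq_one (E := EuclideanSpace ℝ (Fin d)) R
  obtain ⟨C, hC, hCρ⟩ := ρ.exists_enorm_le_dec N
  have hρi : Integrable (ρ : EuclideanSpace ℝ (Fin d) → ℂ) := ρ.integrable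
  have hρl : ∫⁻ y, ‖ρ y‖ₑ ≠ ⊤ := hρi.2.ne
  refine ⟨(∫⁻ y, ‖ρ y‖ₑ) * C, by finiteness, fun ξ => ?_⟩
  have hrep : measureFT μ ξ = ∫ y, ρ y * measureFT μ (ξ - y) := by
    have hI : Integrable (fun p : EuclideanSpace ℝ (Fin d) × EuclideanSpace ℝ (Fin d) =>
        ρ p.1 * (Real.fourierChar (-⟪p.2, ξ - p.1⟫) : ℂ)) (volume.prod μ) := by
      have hc : Continuous fun p : EuclideanSpace ℝ (Fin d) × EuclideanSpace ℝ (Fin d) =>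
          (Real.fourierChar (-⟪p.2, ξ - p.1⟫) : ℂ) :=
        continuous_fourierChar_neg_inner.comp (by fun_prop : Continuous fun p :
          EuclideanSpace ℝ (Fin d) × EuclideanSpace ℝ (Fin d) => (p.2, ξ - p.1))
      have h := hρi.mul_prod (integrable_const (μ := μ) (1 : ℂ))
      refine (h.bdd_mul (c := 1) hc.aestronglyMeasurable
        (.of_forall fun p => (Circle.norm_coe _).le)).congr (.of_forall fun p => by ring)
    simp only [measureFT_eq_integral_fourierChar, ← integral_const_mul]
    rw [integral_integral_swap hI]
    have hae : ∀ᵐ x ∂μ, x ∈ K := by rwa [ae_iff]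
    refine integral_congr_ae (hae.mono fun x hx => ?_)
    have h1 := hρ x (by simpa using hR hx)
    rw [Real.fourierInv_eq] at h1
    calc (Real.fourierChar (-⟪x, ξ⟫) : ℂ) = (Real.fourierChar (-⟪x, ξ⟫) : ℂ) *
          ∫ y, Real.fourierChar ⟪y, x⟫ • ρ y := by rw [h1, mul_one]
      _ = _ := by
        rw [← integral_const_mul]
        refine integral_congr_ae (.of_forall fun y => ?_)
        have : (-⟪x, ξ - y⟫ : ℝ) = -⟪x, ξ⟫ + ⟪y, x⟫ := by
          rw [inner_sub_right, real_inner_comm x y]; ring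
        simp only [this, AddChar.map_add_eq_mul, Circle.coe_mul, Circle.smul_def, smul_eq_mul]
        ring
  have hc := continuous_measureFT (μ := μ)
  have hm := hc.measurable
  have hρc := ρ.continuous
  have h : ‖measureFT μ ξ‖ₑ ≤ ∫⁻ y, ‖ρ y‖ₑ * ‖measureFT μ (ξ - y)‖ₑ := by
    conv_lhs => rw [hrep]
    refine (enorm_integral_le_lintegral_enorm _).trans_eq ?_
    simp [enorm_mul]
  calc _ ≤ _ := pow_le_pow_left' h 2
    _ ≤ _ := sq_lintegral_mul_le (by fun_prop) (by fun_prop)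
    _ ≤ (∫⁻ y, ‖ρ y‖ₑ) * ∫⁻ y, C * (dec N ‖y‖ₑ * ‖measureFT μ (ξ - y)‖ₑ ^ 2) := by
        refine mul_le_mul_right (lintegral_mono fun y => ?_) _
        rw [← mul_assoc]
        exact mul_le_mul_left (hCρ y) _
    _ = _ := by
        rw [lintegral_const_mul _ (by fun_prop), ← mul_assoc,
          ← lintegral_sub_left_eq_self (fun y => dec N ‖y‖ₑ * ‖measureFT μ (ξ - y)‖ₑ ^ 2) ξ]
        simp
end MeasureFT

section SphereCap
variable {E : Type*} [NormedAddCommGroup E] [InnerProductSpace ℝ E]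

open Classical in
/-- The normal direction of the unit sphere on the cap around `e`, normalized along `e`. -/
noncomputable def sphereNormal (e p : E) : E := if ⟪p, e⟫ = 0 then e else ⟪p, e⟫⁻¹ • p

theorem isCap_sphere {e : E} (he : ‖e‖ = 1) :
    IsCap e (sphereNormal e) (1 / 2) 3 {p | ‖p‖ = 1 ∧ ‖p - e‖ ≤ 1 / 2} := by
  have hee : ⟪e, e⟫ = 1 := by simp [he]
  have ha : ∀ p : E, ‖p‖ = 1 ∧ ‖p - e‖ ≤ 1 / 2 → 7 / 8 ≤ ⟪p, e⟫ := fun p ⟨h1, h2⟩ => by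
    have h3 := norm_sub_sq_real p e
    rw [h1, he] at h3
    nlinarith [norm_nonneg (p - e)]
  have hn : ∀ p : E, ‖p‖ = 1 ∧ ‖p - e‖ ≤ 1 / 2 → sphereNormal e p = ⟪p, e⟫⁻¹ • p := fun p hp => by
    rw [sphereNormal, if_neg]
    linarith [ha p hp]
  have hinv : ∀ p : E, ‖p‖ = 1 ∧ ‖p - e‖ ≤ 1 / 2 → ⟪p, e⟫⁻¹ ≤ 8 / 7 := fun p hp => by
    rw [inv_le_comm₀ (by linarith [ha p hp]) (by norm_num)]
    linarith [ha p hp]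
  have hone : ∀ p : E, ‖p‖ = 1 ∧ ‖p - e‖ ≤ 1 / 2 → 1 ≤ ⟪p, e⟫⁻¹ := fun p hp => by
    rw [one_le_inv₀ (by linarith [ha p hp])]
    simpa [hp.1, he] using real_inner_le_norm p e
  have hpos : ∀ p : E, ‖p‖ = 1 ∧ ‖p - e‖ ≤ 1 / 2 → 0 < ⟪p, e⟫ := fun p hp => by linarith [ha p hp]
  have hh : ∀ x : E, ‖hpart e x‖ ^ 2 = ‖x‖ ^ 2 - ⟪x, e⟫ ^ 2 := fun x => by
    rw [← real_inner_self_eq_norm_sq, ← real_inner_self_eq_norm_sq]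
    simp only [hpart, inner_sub_left, inner_sub_right, inner_smul_left, inner_smul_right, conj_trivial, hee,
      real_inner_comm x e]
    ring
  have hhle : ∀ p : E, ‖p‖ = 1 ∧ ‖p - e‖ ≤ 1 / 2 → ‖hpart e p‖ ≤ 1 / 2 := fun p hp => by
    have h1 := hh p
    rw [hp.1] at h1
    have := ha p hp
    nlinarith [norm_nonneg (hpart e p)]
  have hdiff : ∀ p : E, ‖p‖ = 1 ∧ ‖p - e‖ ≤ 1 / 2 → ∀ p' : E, ‖p'‖ = 1 ∧ ‖p' - e‖ ≤ 1 / 2 →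
      |⟪p, e⟫ - ⟪p', e⟫| ≤ 4 / 7 * ‖hpart e (p - p')‖ := fun p hp p' hp' => by
    have h1 := hh p
    have h2 := hh p'
    rw [hp.1] at h1
    rw [hp'.1] at h2
    have h3 : (⟪p, e⟫ - ⟪p', e⟫) * (⟪p, e⟫ + ⟪p', e⟫) =
      (‖hpart e p'‖ - ‖hpart e p‖) * (‖hpart e p'‖ + ‖hpart e p‖) := by linarith
    have h4 := abs_norm_sub_norm_le (hpart e p') (hpart e p)
    rw [norm_sub_rev, ← hpart_sub] at h4
    have h5 := congrArg abs h3
    rw [abs_mul, abs_mul, abs_of_pos (add_pos (hpos p hp) (hpos p' hp')),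
      abs_of_nonneg (by positivity : 0 ≤ ‖hpart e p'‖ + ‖hpart e p‖)] at h5
    have h6 : |‖hpart e p'‖ - ‖hpart e p‖| * (‖hpart e p'‖ + ‖hpart e p‖) ≤ ‖hpart e (p - p')‖ * 1 :=
      mul_le_mul h4 (by linarith [hhle p hp, hhle p' hp']) (by positivity) (norm_nonneg _)
    have h7 : |⟪p, e⟫ - ⟪p', e⟫| * (7 / 4) ≤ |⟪p, e⟫ - ⟪p', e⟫| * (⟪p, e⟫ + ⟪p', e⟫) :=
      mul_le_mul_of_nonneg_left (by linarith [ha p hp, ha p' hp']) (abs_nonneg _)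
    linarith
  have hnorm : ∀ p : E, ‖p‖ = 1 ∧ ‖p - e‖ ≤ 1 / 2 → ∀ p' : E, ‖p'‖ = 1 ∧ ‖p' - e‖ ≤ 1 / 2 →
      ⟪p - p', sphereNormal e p⟫ = ⟪p, e⟫⁻¹ * (‖p - p'‖ ^ 2 / 2) := fun p hp p' hp' => by
    rw [hn p hp, inner_smul_right, norm_sub_sq_real, hp.1, hp'.1, inner_sub_left,
      real_inner_self_eq_norm_sq, hp.1, real_inner_comm p' p]
    ring
  refine ⟨he, fun p => ?_, by norm_num, by norm_num, fun p hp => ?_, fun p hp p' hp' => ?_,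
    fun p hp p' hp' => ?_, fun p hp p' hp' => ?_, fun p hp p' hp' => ?_⟩
  · by_cases h : ⟪p, e⟫ = 0
    · rw [sphereNormal, if_pos h, hee]
    · simp [sphereNormal, h, inner_smul_left]
  · rw [hn p hp, norm_smul, hp.1, Real.norm_of_nonneg (inv_nonneg.2 (hpos p hp).le)]
    linarith [hinv p hp]
  · rw [hnorm p hp p' hp']
    have h1 := hone p hp
    have h2 := hh (p - p')
    nlinarith [sq_nonneg ⟪p - p', e⟫, sq_nonneg ‖p - p'‖]
  · rw [hnorm p hp p' hp']
    have h1 := hinv p hp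
    have h2 := hh (p - p')
    have h3 := hdiff p hp p' hp'
    rw [← inner_sub_left] at h3
    have h4 : ⟪p - p', e⟫ ^ 2 ≤ (4 / 7 * ‖hpart e (p - p')‖) ^ 2 := sq_le_sq' (by linarith [abs_le.1 h3]) (abs_le.1 h3).2
    have h5 : ⟪p, e⟫⁻¹ * (‖p - p'‖ ^ 2 / 2) ≤ 8 / 7 * (‖p - p'‖ ^ 2 / 2) := by gcongr
    nlinarith [sq_nonneg ‖hpart e (p - p')‖]
  · have h3 := hdiff p hp p' hp'
    have h1 := norm_le_norm_hpart_add he (p - p')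
    rw [inner_sub_left] at h1
    have e1 : sphereNormal e p - sphereNormal e p' =
        ⟪p, e⟫⁻¹ • (p - p') + ((⟪p', e⟫ - ⟪p, e⟫) * ⟪p, e⟫⁻¹ * ⟪p', e⟫⁻¹) • p' := by
      rw [hn p hp, hn p' hp', show (⟪p', e⟫ - ⟪p, e⟫) * ⟪p, e⟫⁻¹ * ⟪p', e⟫⁻¹ = ⟪p, e⟫⁻¹ - ⟪p', e⟫⁻¹ by
        have := (hpos p hp).ne'
        have := (hpos p' hp').ne'
        field_simp]
      module
    have e2 := norm_add_le (⟪p, e⟫⁻¹ • (p - p')) (((⟪p', e⟫ - ⟪p, e⟫) * ⟪p, e⟫⁻¹ * ⟪p', e⟫⁻¹) • p')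
    have i1 := inv_pos.2 (hpos p hp)
    have i2 := inv_pos.2 (hpos p' hp')
    rw [← e1, norm_smul, norm_smul, hp'.1, mul_one, norm_mul, norm_mul, Real.norm_eq_abs, Real.norm_eq_abs,
      Real.norm_eq_abs, abs_of_pos i1, abs_of_pos i2, abs_sub_comm] at e2
    have h4 : ⟪p, e⟫⁻¹ * ‖p - p'‖ ≤ 8 / 7 * ‖p - p'‖ := by gcongr; exact hinv p hp
    have h5 : |⟪p, e⟫ - ⟪p', e⟫| * ⟪p, e⟫⁻¹ * ⟪p', e⟫⁻¹ ≤ |⟪p, e⟫ - ⟪p', e⟫| * (8 / 7) * (8 / 7) := by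
      gcongr
      · exact hinv p hp
      · exact hinv p' hp'
    linarith [norm_nonneg (hpart e (p - p'))]
  · have h1 := norm_hpart_le he (p - p')
    have h2 : ‖p - p'‖ ≤ ‖p - e‖ + ‖p' - e‖ := by
      rw [norm_sub_rev p' e]; exact norm_sub_le_norm_sub_add_norm_sub _ _ _
    linarith [hp.2, hp'.2]

theorem mem_nbhd_sphere {e η : E} (he : ‖e‖ = 1) {r : ℝ} (hr : 1 ≤ r) (h : |‖η‖ - 1| ≤ 1 / (2 * r ^ 2))
    (hη : ‖‖η‖⁻¹ • η‖ = 1 ∧ ‖‖η‖⁻¹ • η - e‖ ≤ 1 / 2) :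
    η ∈ nbhd e (sphereNormal e) r 1 {p | ‖p‖ = 1 ∧ ‖p - e‖ ≤ 1 / 2} := by
  have hη0 : ‖η‖ ≠ 0 := fun h0 => by simp [h0] at hη
  have hcap := isCap_sphere he
  refine ⟨‖η‖⁻¹ • η, hη, ?_⟩
  set p := ‖η‖⁻¹ • η with hp
  have e1 : η - p = (‖η‖ - 1) • p := by
    rw [sub_smul, one_smul, hp, smul_inv_smul₀ hη0]
  have ha : 7 / 8 ≤ ⟪p, e⟫ := by
    have h3 := norm_sub_sq_real p e
    rw [hη.1, he] at h3
    nlinarith [norm_nonneg (p - e), hη.2]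
  have e2 : ⟪p, sphereNormal e p⟫ = ⟪p, e⟫⁻¹ := by
    rw [sphereNormal, if_neg (by linarith), inner_smul_right, real_inner_self_eq_norm_sq, hη.1]; simp
  have e3 : ⟪p, e⟫⁻¹ ≤ 8 / 7 := by
    rw [inv_le_comm₀ (by linarith) (by norm_num)]; linarith
  have hr2 : r ^ 2 * |‖η‖ - 1| ≤ 1 / 2 := by
    rw [le_div_iff₀ (by positivity)] at h
    linarith
  constructor
  · have h1 := norm_hpart_le he (η - p)
    rw [e1, norm_smul, hη.1, mul_one, Real.norm_eq_abs, ← e1] at h1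
    have h2 : r * ‖hpart e (η - p)‖ ≤ r ^ 2 * |‖η‖ - 1| :=
      mul_le_mul (by nlinarith) h1 (norm_nonneg _) (by positivity)
    linarith
  · rw [e1, inner_smul_left, conj_trivial, e2, abs_mul, abs_of_pos (inv_pos.2 (by linarith : 0 < ⟪p, e⟫)), ← mul_assoc]
    have : r ^ 2 * |‖η‖ - 1| * ⟪p, e⟫⁻¹ ≤ 1 / 2 * (8 / 7) := by gcongr
    linarith
end SphereCap

theorem lintegral_eq_pow_mul_lintegral_comp_smul {E : Type*} [NormedAddCommGroup E] [InnerProductSpace ℝ E]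
    [FiniteDimensional ℝ E] [MeasurableSpace E] [BorelSpace E] {t : ℝ} (ht : 0 < t) {F : E → ℝ≥0∞}
    (hF : Measurable F) :
    ∫⁻ ξ, F ξ = ENNReal.ofReal t ^ Module.finrank ℝ E * ∫⁻ η, F (t • η) := by
  have h := lintegral_map (μ := (volume : Measure E)) hF (measurable_const_smul t)
  rw [← h, Measure.map_addHaar_smul _ ht.ne', lintegral_smul_measure, smul_eq_mul, ← mul_assoc,
    ← ENNReal.ofReal_pow ht.le, ← ENNReal.ofReal_mul (by positivity), abs_of_pos (by positivity),
    mul_inv_cancel₀ (by positivity), ENNReal.ofReal_one, one_mul]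

section MeasureFT
variable {d : ℕ} {μ : Measure (EuclideanSpace ℝ (Fin d))}

theorem exists_lintegral_shell_le [IsProbabilityMeasure μ] (hd : 2 ≤ d) {s A κ : ℝ} (hA : 0 < A)
    (hfrost : ∀ (x : EuclideanSpace ℝ (Fin d)) (r : ℝ), 0 < r →
      μ (closedBall x r) ≤ ENNReal.ofReal (A * r ^ s)) (hs : (d : ℝ) / 2 - 1 < s)
    (hκ : (d : ℝ) - 1 - (d + 2 * s - 2) / 4 < κ) (hκ0 : 0 ≤ κ) :
    ∃ K : ℝ≥0∞, K ≠ ⊤ ∧ ∀ t : ℝ, ∫⁻ ξ in {ξ : EuclideanSpace ℝ (Fin d) | |‖ξ‖ - t| ≤ 1}, ‖measureFT μ ξ‖ₑ ^ 2 ≤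
      K * ENNReal.ofReal ((1 + |t|) ^ κ) := by
  have hfr : Module.finrank ℝ (EuclideanSpace ℝ (Fin d)) = d := by simp
  set ε := 2 * (κ - (d - 1 - (d + 2 * s - 2) / 4)) with hε
  obtain ⟨K₀, hK₀, hlin⟩ := exists_linBound (E := EuclideanSpace ℝ (Fin d)) (c := 1 / 2) (C := 3) (s := s) (ε := ε)
    (by norm_num) (by norm_num) (by rwa [hfr]) (by rwa [hfr]) (by linarith)
  rw [hfr] at hlin
  obtain ⟨F, hFs, hFfin, hFcov⟩ := (isCompact_sphere (0 : EuclideanSpace ℝ (Fin d)) 1).finite_cover_balls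
    (e := 1 / 2) (by norm_num)
  lift F to Finset (EuclideanSpace ℝ (Fin d)) using hFfin
  have hm : Measurable (measureFT μ) := continuous_measureFT.measurable
  set x := s - (d + 2) / 2 + ε with hx
  set V := volume (closedBall (0 : EuclideanSpace ℝ (Fin d)) 3) with hV
  have hVt : V ≠ ⊤ := measure_closedBall_lt_top.ne
  refine ⟨V + F.card * (ENNReal.ofReal (A * 2 ^ (-x / 2)) * K₀), by finiteness, fun t => ?_⟩
  have h1 : (1 : ℝ≥0∞) ≤ ENNReal.ofReal ((1 + |t|) ^ κ) := by
    rw [ENNReal.one_le_ofReal]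
    exact Real.one_le_rpow (by linarith [abs_nonneg t]) hκ0
  rcases lt_or_ge t 2 with ht | ht
  · calc _ ≤ ∫⁻ ξ in closedBall (0 : EuclideanSpace ℝ (Fin d)) 3, 1 := by
          refine (lintegral_mono_set fun ξ hξ => ?_).trans (lintegral_mono fun ξ => ?_)
          · rw [mem_closedBall_zero_iff]
            linarith [(abs_le.1 (Set.mem_ofPred_eq ▸ hξ)).2]
          · exact pow_le_one₀ zero_le (enorm_measureFT_le_one ξ)
      _ = V * 1 := by simp [hV]
      _ ≤ _ := mul_le_mul' le_self_add h1
  have ht0 : 0 < t := by linarith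
  set r := √(t / 2) with hr
  have hr1 : 1 ≤ r := by rw [hr, Real.one_le_sqrt]; linarith
  have hr2 : r ^ 2 = t / 2 := Real.sq_sqrt (by positivity)
  set T : EuclideanSpace ℝ (Fin d) → Set (EuclideanSpace ℝ (Fin d)) := fun e =>
    {η | |‖η‖ - 1| ≤ 1 / (2 * r ^ 2) ∧ (‖‖η‖⁻¹ • η‖ = 1 ∧ ‖‖η‖⁻¹ • η - e‖ ≤ 1 / 2)} with hT
  have hTm : ∀ e, MeasurableSet (T e) := fun e => by
    have m1 : Measurable fun η : EuclideanSpace ℝ (Fin d) => |‖η‖ - 1| := by fun_prop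
    have m2 : Measurable fun η : EuclideanSpace ℝ (Fin d) => ‖‖η‖⁻¹ • η‖ := by fun_prop
    have m3 : Measurable fun η : EuclideanSpace ℝ (Fin d) => ‖‖η‖⁻¹ • η - e‖ := by fun_prop
    exact (measurableSet_le m1 measurable_const).inter
      ((measurableSet_eq_fun m2 measurable_const).inter (measurableSet_le m3 measurable_const))
  have hTb : ∀ e, Bornology.IsBounded (T e) := fun e => by
    refine (isBounded_closedBall (x := (0 : EuclideanSpace ℝ (Fin d))) (r := 2)).subset fun η hη => ?_
    have h2 := (abs_le.1 hη.1).2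
    have h3 : 1 / (2 * r ^ 2) ≤ 1 := by rw [div_le_one (by positivity), hr2]; linarith
    rw [mem_closedBall_zero_iff]
    linarith
  have hpiece : ∀ e ∈ F, ∫⁻ η in T e, ‖measureFT μ (t • η)‖ₑ ^ 2 ≤
      ENNReal.ofReal (A * t ^ (-s)) * (K₀ * ENNReal.ofReal (r ^ x)) := fun e he => by
    have hen : ‖e‖ = 1 := by simpa using hFs he
    refine setLIntegral_enorm_measureFT_smul_sq_le hA hfrost ht0 (hTm e) (hTb e) fun H _ hH φ hφ => ?_
    exact hlin hr1 (isCap_sphere hen) hH (hφ.mono fun η hη => mem_nbhd_sphere hen hr1 hη.1 hη.2)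
  have hcov : ∀ η : EuclideanSpace ℝ (Fin d), |‖t • η‖ - t| ≤ 1 → ∃ e ∈ F, η ∈ T e := fun η hη => by
    have e1 : |‖t • η‖ - t| = t * |‖η‖ - 1| := by
      rw [norm_smul, Real.norm_of_nonneg ht0.le, show t * ‖η‖ - t = t * (‖η‖ - 1) by ring, abs_mul, abs_of_pos ht0]
    rw [e1] at hη
    have h2 : |‖η‖ - 1| ≤ 1 / t := by rw [le_div_iff₀ ht0]; linarith
    have h3 : 1 / t ≤ 1 / 2 := one_div_le_one_div_of_le (by norm_num) ht
    have h4 : ‖η‖ ≠ 0 := by linarith [(abs_le.1 h2).1]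
    have h5 : ‖‖η‖⁻¹ • η‖ = 1 := by rw [norm_smul, norm_inv, norm_norm, inv_mul_cancel₀ h4]
    have h6 := hFcov (show ‖η‖⁻¹ • η ∈ sphere (0 : EuclideanSpace ℝ (Fin d)) 1 by simpa using h5)
    rw [Set.mem_iUnion₂] at h6
    obtain ⟨e, he, h7⟩ := h6
    refine ⟨e, he, ?_, h5, ?_⟩
    · rw [hr2, show 2 * (t / 2) = t by ring]; exact h2
    · rw [mem_ball, dist_eq_norm] at h7; exact h7.le
  have hSm : MeasurableSet {ξ : EuclideanSpace ℝ (Fin d) | |‖ξ‖ - t| ≤ 1} :=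
    measurableSet_le (by fun_prop) (by fun_prop)
  calc _ = ENNReal.ofReal t ^ d * ∫⁻ η, ({ξ : EuclideanSpace ℝ (Fin d) | |‖ξ‖ - t| ≤ 1}.indicator
        fun ξ => ‖measureFT μ ξ‖ₑ ^ 2) (t • η) := by
        rw [← lintegral_indicator hSm,
          lintegral_eq_pow_mul_lintegral_comp_smul ht0 ((by fun_prop : Measurable _).indicator hSm), hfr]
    _ ≤ ENNReal.ofReal t ^ d * ∫⁻ η, ∑ e ∈ F, (T e).indicator (fun η => ‖measureFT μ (t • η)‖ₑ ^ 2) η := by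
        refine mul_le_mul_right (lintegral_mono fun η => ?_) _
        by_cases h : |‖t • η‖ - t| ≤ 1
        · obtain ⟨e, he, hη⟩ := hcov η h
          rw [Set.indicator_of_mem (by exact h)]
          refine le_trans ?_ (Finset.single_le_sum (fun _ _ => zero_le) he)
          rw [Set.indicator_of_mem hη]
        · rw [Set.indicator_of_notMem (by exact h)]
          exact zero_le
    _ ≤ ENNReal.ofReal t ^ d * ∑ e ∈ F, ENNReal.ofReal (A * t ^ (-s)) * (K₀ * ENNReal.ofReal (r ^ x)) := by
        rw [lintegral_finsetSum _ fun e _ => (by fun_prop : Measurable _).indicator (hTm e)]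
        refine mul_le_mul_right (Finset.sum_le_sum fun e he => ?_) _
        rw [lintegral_indicator (hTm e)]
        exact hpiece e he
    _ = F.card * (ENNReal.ofReal (A * 2 ^ (-x / 2)) * K₀) * ENNReal.ofReal (t ^ κ) := by
        have e1 : ENNReal.ofReal t ^ d * (ENNReal.ofReal (A * t ^ (-s)) * ENNReal.ofReal (r ^ x)) =
            ENNReal.ofReal (A * 2 ^ (-x / 2)) * ENNReal.ofReal (t ^ κ) := by
          rw [← ENNReal.ofReal_pow ht0.le, ← ENNReal.ofReal_mul (by positivity), ← ENNReal.ofReal_mul (by positivity),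
            ← ENNReal.ofReal_mul (by positivity), hr, Real.sqrt_eq_rpow, ← Real.rpow_mul (by positivity),
            Real.div_rpow (by positivity) (by positivity), ← Real.rpow_natCast, neg_div,
            Real.rpow_neg (show (0:ℝ) ≤ 2 by norm_num), show κ = d + -s + 1 / 2 * x by rw [hx, hε]; ring,
            Real.rpow_add ht0, Real.rpow_add ht0, show 1 / 2 * x = x / 2 by ring]
          congr 1
          ring
        rw [Finset.sum_const, nsmul_eq_mul]
        calc _ = F.card * K₀ * (ENNReal.ofReal t ^ d * (ENNReal.ofReal (A * t ^ (-s)) * ENNReal.ofReal (r ^ x))) := by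
              ring
          _ = _ := by rw [e1]; ring
    _ ≤ _ := by
        refine mul_le_mul' le_add_self (ENNReal.ofReal_le_ofReal ?_)
        rw [abs_of_pos ht0]
        gcongr
        linarith

/-- Growth of the `L²` mass of the Fourier transform of a Frostman measure. -/
theorem exists_hasGrowth_measureFT [IsProbabilityMeasure μ] {s A : ℝ} (hA : 0 < A)
    (hfrost : ∀ (x : EuclideanSpace ℝ (Fin d)) (r : ℝ), 0 < r →
      μ (closedBall x r) ≤ ENNReal.ofReal (A * r ^ s)) :
    ∃ K : ℝ≥0∞, K ≠ ⊤ ∧ K ≠ 0 ∧ HasGrowth ((d : ℝ) - s) (K⁻¹ • volume.withDensity fun ξ => ‖measureFT μ ξ‖ₑ ^ 2) := by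
  have hfr : Module.finrank ℝ (EuclideanSpace ℝ (Fin d)) = d := by simp
  obtain ⟨b, hb, hbd⟩ := exists_lintegral_enorm_sq_le (EuclideanSpace ℝ (Fin d)) 1 s
  have hm : Measurable (measureFT μ) := continuous_measureFT.measurable
  set K := ENNReal.ofReal A * b + 1 with hK
  have hK0 : K ≠ 0 := by simp [hK]
  have hKt : K ≠ ⊤ := by finiteness
  refine ⟨K, hKt, hK0, fun x t ht => ?_⟩
  have ht0 : 0 < t := by linarith
  have hBm : MeasurableSet (closedBall x t) := measurableSet_closedBall
  rw [Measure.smul_apply, smul_eq_mul, withDensity_apply _ hBm]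
  have h1 : ∫⁻ η in closedBall (t⁻¹ • x) 1, ‖measureFT μ (t • η)‖ₑ ^ 2 ≤ ENNReal.ofReal (A * t ^ (-s)) * b :=
    setLIntegral_enorm_measureFT_smul_sq_le hA hfrost ht0 measurableSet_closedBall isBounded_closedBall
      fun H _ hH φ hφ => hbd hH _ hφ
  have h2 : ∫⁻ ξ in closedBall x t, ‖measureFT μ ξ‖ₑ ^ 2 ≤ K * ENNReal.ofReal (t ^ ((d : ℝ) - s)) := by
    calc _ = ENNReal.ofReal t ^ d * ∫⁻ η, ((closedBall x t).indicator
          fun ξ => ‖measureFT μ ξ‖ₑ ^ 2) (t • η) := by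
          rw [← lintegral_indicator hBm,
            lintegral_eq_pow_mul_lintegral_comp_smul ht0 ((by fun_prop : Measurable _).indicator hBm), hfr]
      _ = ENNReal.ofReal t ^ d * ∫⁻ η in closedBall (t⁻¹ • x) 1, ‖measureFT μ (t • η)‖ₑ ^ 2 := by
          rw [← lintegral_indicator measurableSet_closedBall]
          congr 1
          refine lintegral_congr fun η => ?_
          have : t • η ∈ closedBall x t ↔ η ∈ closedBall (t⁻¹ • x) 1 := by
            rw [mem_closedBall, mem_closedBall, dist_eq_norm, dist_eq_norm,
              show t • η - x = t • (η - t⁻¹ • x) by rw [smul_sub, smul_inv_smul₀ ht0.ne'], norm_smul,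
              Real.norm_of_nonneg ht0.le]
            exact mul_le_iff_le_one_right ht0
          by_cases h : η ∈ closedBall (t⁻¹ • x) 1
          · rw [Set.indicator_of_mem h, Set.indicator_of_mem (this.2 h)]
          · rw [Set.indicator_of_notMem h, Set.indicator_of_notMem (mt this.1 h)]
      _ ≤ ENNReal.ofReal t ^ d * (ENNReal.ofReal (A * t ^ (-s)) * b) := mul_le_mul_right h1 _
      _ = ENNReal.ofReal A * b * ENNReal.ofReal (t ^ ((d : ℝ) - s)) := by
          rw [ENNReal.ofReal_mul hA.le, ← ENNReal.ofReal_pow ht0.le, sub_eq_add_neg, Real.rpow_add ht0,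
            Real.rpow_natCast, ENNReal.ofReal_mul (by positivity)]
          ring
      _ ≤ _ := mul_le_mul_left le_self_add _
  calc _ ≤ K⁻¹ * (K * ENNReal.ofReal (t ^ ((d : ℝ) - s))) := mul_le_mul_right h2 _
    _ = _ := by rw [← mul_assoc, ENNReal.inv_mul_cancel hK0 hKt, one_mul]
end MeasureFT

section Rotation
variable {d : ℕ}

theorem exists_linearIsometryEquiv_eq (θ : Matrix.orthogonalGroup (Fin d) ℝ) :
    ∃ L : EuclideanSpace ℝ (Fin d) ≃ₗᵢ[ℝ] EuclideanSpace ℝ (Fin d),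
      ∀ ξ, Matrix.toEuclideanLin (θ : Matrix (Fin d) (Fin d) ℝ) ξ = L ξ := by
  have h : Matrix.toEuclideanCLM (𝕜 := ℝ) (n := Fin d) (θ : Matrix (Fin d) (Fin d) ℝ) ∈ unitary _ :=
    Unitary.map_mem _ θ.2
  refine ⟨Unitary.linearIsometryEquiv ⟨_, h⟩, fun ξ => ?_⟩
  have := congrArg (fun f : EuclideanSpace ℝ (Fin d) →L[ℝ] EuclideanSpace ℝ (Fin d) => f ξ)
    (Unitary.coe_linearIsometryEquiv_apply ⟨_, h⟩)
  exact this.symm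

theorem exists_orthogonalGroup_eq (L : EuclideanSpace ℝ (Fin d) ≃ₗᵢ[ℝ] EuclideanSpace ℝ (Fin d)) :
    ∃ θ : Matrix.orthogonalGroup (Fin d) ℝ, ∀ ξ, Matrix.toEuclideanLin (θ : Matrix (Fin d) (Fin d) ℝ) ξ = L ξ := by
  set u := Unitary.linearIsometryEquiv.symm L with hu
  have h : (Matrix.toEuclideanCLM (𝕜 := ℝ) (n := Fin d)).symm (u : EuclideanSpace ℝ (Fin d) →L[ℝ] _) ∈
      unitary (Matrix (Fin d) (Fin d) ℝ) := by
    have h1 := Unitary.mem_iff.1 u.2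
    rw [Unitary.mem_iff]
    constructor <;> refine EquivLike.injective (Matrix.toEuclideanCLM (𝕜 := ℝ) (n := Fin d)) ?_
    · rw [map_mul, map_star, StarAlgEquiv.apply_symm_apply, h1.1, map_one]
    · rw [map_mul, map_star, StarAlgEquiv.apply_symm_apply, h1.2, map_one]
  refine ⟨⟨_, h⟩, fun ξ => ?_⟩
  have h1 := (Matrix.toEuclideanCLM (𝕜 := ℝ) (n := Fin d)).apply_symm_apply
    (u : EuclideanSpace ℝ (Fin d) →L[ℝ] _)
  have h2 := congrArg (fun f : EuclideanSpace ℝ (Fin d) →L[ℝ] EuclideanSpace ℝ (Fin d) => f ξ) h1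
  exact h2

theorem toEuclideanLin_mul (θ θ' : Matrix (Fin d) (Fin d) ℝ) (ξ : EuclideanSpace ℝ (Fin d)) :
    Matrix.toEuclideanLin (θ * θ') ξ = Matrix.toEuclideanLin θ (Matrix.toEuclideanLin θ' ξ) := by
  simp [Matrix.toLpLin_apply]

theorem exists_orthogonalGroup_map_eq {ξ ξ' : EuclideanSpace ℝ (Fin d)} (h : ‖ξ‖ = ‖ξ'‖) :
    ∃ θ : Matrix.orthogonalGroup (Fin d) ℝ, Matrix.toEuclideanLin (θ : Matrix (Fin d) (Fin d) ℝ) ξ = ξ' := by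
  obtain ⟨θ, hθ⟩ := exists_orthogonalGroup_eq (Submodule.reflection (ℝ ∙ (ξ - ξ'))ᗮ)
  exact ⟨θ, by rw [hθ, Submodule.reflection_sub h]⟩

theorem measurable_toEuclideanLin : Measurable fun p : Matrix.orthogonalGroup (Fin d) ℝ × EuclideanSpace ℝ (Fin d) =>
    Matrix.toEuclideanLin (p.1 : Matrix (Fin d) (Fin d) ℝ) p.2 := by
  have : Continuous fun p : Matrix.orthogonalGroup (Fin d) ℝ × EuclideanSpace ℝ (Fin d) =>
      Matrix.toEuclideanLin (p.1 : Matrix (Fin d) (Fin d) ℝ) p.2 := by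
    simp only [Matrix.toLpLin_apply]
    have h1 : Continuous fun p : Matrix.orthogonalGroup (Fin d) ℝ × EuclideanSpace ℝ (Fin d) =>
      (p.1 : Matrix (Fin d) (Fin d) ℝ) := continuous_subtype_val.comp continuous_fst
    have h2 : Continuous fun p : Matrix.orthogonalGroup (Fin d) ℝ × EuclideanSpace ℝ (Fin d) =>
      p.2.ofLp := by fun_prop
    exact (PiLp.continuous_toLp 2 _).comp (h1.matrix_mulVec h2)
  exact this.measurable

/-- The average of `g` over the orthogonal orbit of `ξ`. -/
noncomputable def orbAvg (lam : Measure (Matrix.orthogonalGroup (Fin d) ℝ))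
    (g : EuclideanSpace ℝ (Fin d) → ℝ≥0∞) (ξ : EuclideanSpace ℝ (Fin d)) : ℝ≥0∞ :=
  ∫⁻ θ, g (Matrix.toEuclideanLin (θ : Matrix (Fin d) (Fin d) ℝ) ξ) ∂lam

variable {lam : Measure (Matrix.orthogonalGroup (Fin d) ℝ)} {g : EuclideanSpace ℝ (Fin d) → ℝ≥0∞}

theorem measurable_orbAvg [SFinite lam] (hg : Measurable g) : Measurable (orbAvg lam g) :=
  Measurable.lintegral_prod_left' (f := fun p : Matrix.orthogonalGroup (Fin d) ℝ × EuclideanSpace ℝ (Fin d) =>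
    g (Matrix.toEuclideanLin (p.1 : Matrix (Fin d) (Fin d) ℝ) p.2)) (hg.comp measurable_toEuclideanLin)

theorem measurable_comp_toEuclideanLin (hg : Measurable g) (ξ : EuclideanSpace ℝ (Fin d)) :
    Measurable fun θ : Matrix.orthogonalGroup (Fin d) ℝ =>
      g (Matrix.toEuclideanLin (θ : Matrix (Fin d) (Fin d) ℝ) ξ) := by
  have h := measurable_toEuclideanLin.comp (measurable_prodMk_right (y := ξ))
  exact hg.comp h

theorem orbAvg_eq_of_norm_eq (hinv : ∀ θ₀ : Matrix.orthogonalGroup (Fin d) ℝ, lam.map (fun θ => θ * θ₀) = lam)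
    (hg : Measurable g) {ξ ξ' : EuclideanSpace ℝ (Fin d)} (h : ‖ξ‖ = ‖ξ'‖) : orbAvg lam g ξ = orbAvg lam g ξ' := by
  obtain ⟨θ₀, hθ₀⟩ := exists_orthogonalGroup_map_eq h
  have hm : Measurable fun θ : Matrix.orthogonalGroup (Fin d) ℝ => θ * θ₀ :=
    (continuous_id.mul continuous_const).measurable
  unfold orbAvg
  conv_lhs => rw [← hinv θ₀]
  rw [lintegral_map (measurable_comp_toEuclideanLin hg ξ) hm]
  refine lintegral_congr fun θ => ?_
  rw [Matrix.UnitaryGroup.mul_val, toEuclideanLin_mul, hθ₀]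

theorem orbAvg_le_one [IsProbabilityMeasure lam] (hg1 : ∀ ξ, g ξ ≤ 1) (ξ : EuclideanSpace ℝ (Fin d)) :
    orbAvg lam g ξ ≤ 1 :=
  (lintegral_mono fun _ => hg1 _).trans_eq (by simp)

theorem exists_le_volume_shell (hd : 1 ≤ d) : ∃ v : ℝ≥0∞, v ≠ 0 ∧ v ≠ ⊤ ∧ ∀ {t : ℝ}, 0 ≤ t →
    ENNReal.ofReal ((1 + t) ^ (d - 1)) * v ≤ volume {ξ : EuclideanSpace ℝ (Fin d) | t ≤ ‖ξ‖ ∧ ‖ξ‖ ≤ t + 1} := by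
  have hfr : Module.finrank ℝ (EuclideanSpace ℝ (Fin d)) = d := by simp
  have : Nontrivial (EuclideanSpace ℝ (Fin d)) := Module.nontrivial_of_finrank_pos (R := ℝ) (by omega)
  have hv : volume (ball (0 : EuclideanSpace ℝ (Fin d)) 1) ≠ ⊤ := measure_ball_lt_top.ne
  refine ⟨volume (ball (0 : EuclideanSpace ℝ (Fin d)) 1), (measure_ball_pos _ _ one_pos).ne', hv,
    fun {t} ht => ?_⟩
  have h1 : closedBall (0 : EuclideanSpace ℝ (Fin d)) (t + 1) ⊆
      {ξ : EuclideanSpace ℝ (Fin d) | t ≤ ‖ξ‖ ∧ ‖ξ‖ ≤ t + 1} ∪ ball 0 t := fun ξ hξ => by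
    rw [mem_closedBall_zero_iff] at hξ
    rcases lt_or_ge ‖ξ‖ t with h | h
    · exact .inr (by simpa using h)
    · exact .inl ⟨h, hξ⟩
  have h2 := (measure_mono (μ := volume) h1).trans (measure_union_le _ _)
  rw [Measure.addHaar_closedBall _ _ (by positivity), Measure.addHaar_ball _ _ ht, hfr] at h2
  have h3 : ENNReal.ofReal ((1 + t) ^ (d - 1)) * volume (ball (0 : EuclideanSpace ℝ (Fin d)) 1) +
      ENNReal.ofReal (t ^ d) * volume (ball (0 : EuclideanSpace ℝ (Fin d)) 1) ≤
      ENNReal.ofReal ((t + 1) ^ d) * volume (ball (0 : EuclideanSpace ℝ (Fin d)) 1) := by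
    rw [← add_mul, ← ENNReal.ofReal_add (by positivity) (by positivity)]
    refine mul_le_mul_left (ENNReal.ofReal_le_ofReal ?_) _
    obtain ⟨m, rfl⟩ : ∃ m, d = m + 1 := ⟨d - 1, by omega⟩
    have h4 : t ^ m ≤ (t + 1) ^ m := by gcongr; linarith
    rw [Nat.add_sub_cancel, pow_succ, pow_succ, add_comm 1 t]
    nlinarith
  exact ENNReal.le_of_add_le_add_right (by finiteness) (h3.trans h2)

theorem measurable_lintegral_dec_toEuclideanLin (N : ℕ) (hg : Measurable g) :
    Measurable fun p : EuclideanSpace ℝ (Fin d) × Matrix.orthogonalGroup (Fin d) ℝ => ∫⁻ η,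
      dec N ‖Matrix.toEuclideanLin (p.2 : Matrix (Fin d) (Fin d) ℝ) p.1 - η‖ₑ * g η := by
  have h0 : Measurable fun q : (EuclideanSpace ℝ (Fin d) × Matrix.orthogonalGroup (Fin d) ℝ) ×
      EuclideanSpace ℝ (Fin d) => (q.1.2, q.1.1) :=
    (measurable_snd.comp measurable_fst).prodMk (measurable_fst.comp measurable_fst)
  have h1 := measurable_toEuclideanLin.comp h0
  have h2 := (h1.sub measurable_snd).enorm.dec (N := N) |>.mul (hg.comp measurable_snd)
  exact h2.lintegral_prod_right'

/-- Orbit averages are controlled by averages over shells. -/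
theorem exists_orbAvg_le [IsProbabilityMeasure lam] (hd : 1 ≤ d)
    (hinv : ∀ θ₀ : Matrix.orthogonalGroup (Fin d) ℝ, lam.map (fun θ => θ * θ₀) = lam) (hg : Measurable g)
    (hrep : ∀ N : ℕ, ∃ C : ℝ≥0∞, C ≠ ⊤ ∧ ∀ ξ, g ξ ≤ C * ∫⁻ η, dec N ‖ξ - η‖ₑ * g η) (N : ℕ) :
    ∃ C : ℝ≥0∞, C ≠ ⊤ ∧ ∀ ξ, ENNReal.ofReal ((1 + ‖ξ‖) ^ (d - 1)) * orbAvg lam g ξ ≤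
      C * ∫⁻ η, dec N (ENNReal.ofReal |‖η‖ - ‖ξ‖|) * g η := by
  have hfr : Module.finrank ℝ (EuclideanSpace ℝ (Fin d)) = d := by simp
  obtain ⟨v, hv0, hvt, hvol⟩ := exists_le_volume_shell hd
  obtain ⟨C, hC, hCg⟩ := hrep (d + 1 + N)
  set I := ∫⁻ x : EuclideanSpace ℝ (Fin d), dec (d + 1) ‖x‖ₑ with hI
  have hIt : I ≠ ⊤ := (lintegral_dec_lt_top (by omega)).ne
  refine ⟨v⁻¹ * (C * ((1 + 1) ^ (d + 1) * (1 + 1) ^ N * I)), by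
    have : v⁻¹ ≠ ⊤ := by simpa using hv0
    finiteness, fun ξ => ?_⟩
  set t := ‖ξ‖ with ht
  set U := {ξ : EuclideanSpace ℝ (Fin d) | t ≤ ‖ξ‖ ∧ ‖ξ‖ ≤ t + 1} with hU
  have hUm : MeasurableSet U := (measurableSet_le measurable_const measurable_norm).inter
    (measurableSet_le measurable_norm measurable_const)
  set J := ∫⁻ η, dec N (ENNReal.ofReal |‖η‖ - t|) * g η with hJ
  have hrad : ∀ ξ' ∈ U, ‖(t / ‖ξ'‖) • ξ'‖ = t ∧ ‖ξ' - (t / ‖ξ'‖) • ξ'‖ ≤ 1 := fun ξ' hξ' => by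
    have ht0 : 0 ≤ t := norm_nonneg ξ
    by_cases h0 : ξ' = 0
    · have h1 := hξ'.1
      rw [h0, norm_zero] at h1
      simp [h0, le_antisymm h1 ht0]
    have hn : 0 < ‖ξ'‖ := norm_pos_iff.2 h0
    constructor
    · rw [norm_smul, Real.norm_of_nonneg (by positivity), div_mul_cancel₀ _ hn.ne']
    · rw [show ξ' - (t / ‖ξ'‖) • ξ' = (1 - t / ‖ξ'‖) • ξ' by module, norm_smul, Real.norm_eq_abs,
        ← abs_of_pos hn, ← abs_mul, abs_of_pos hn, sub_mul, div_mul_cancel₀ _ hn.ne', one_mul, abs_le]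
      constructor <;> linarith [hξ'.1, hξ'.2]
  have hker : ∀ (L : EuclideanSpace ℝ (Fin d) ≃ₗᵢ[ℝ] EuclideanSpace ℝ (Fin d)), ∀ ξ' ∈ U, ∀ η,
      dec (d + 1 + N) ‖L ((t / ‖ξ'‖) • ξ') - η‖ₑ ≤
        (1 + 1) ^ (d + 1) * (1 + 1) ^ N * (dec (d + 1) ‖L ξ' - η‖ₑ * dec N (ENNReal.ofReal |‖η‖ - t|)) := by
    intro L ξ' hξ' η
    obtain ⟨e1, e2⟩ := hrad ξ' hξ'
    rw [dec_add, mul_mul_mul_comm]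
    refine mul_le_mul' (dec_le_mul_dec _ (by finiteness) (by finiteness) ?_)
      (dec_le_mul_dec _ (by finiteness) (by finiteness) ?_)
    · rw [← ofReal_norm, ← ofReal_norm, ← ENNReal.ofReal_one, ← ENNReal.ofReal_add (by positivity) zero_le_one]
      refine ENNReal.ofReal_le_ofReal ?_
      have h1 := norm_sub_le_norm_sub_add_norm_sub (L ξ') (L ((t / ‖ξ'‖) • ξ')) η
      rw [← map_sub, L.norm_map] at h1
      linarith
    · refine le_trans ?_ le_self_add
      rw [← ofReal_norm]
      refine ENNReal.ofReal_le_ofReal ?_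
      have h1 := abs_norm_sub_norm_le η (L ((t / ‖ξ'‖) • ξ'))
      rwa [L.norm_map, e1, norm_sub_rev] at h1
  set B : ℝ≥0∞ := (1 + 1) ^ (d + 1) * (1 + 1) ^ N with hB
  set w : EuclideanSpace ℝ (Fin d) → ℝ≥0∞ := fun η => dec N (ENNReal.ofReal |‖η‖ - t|) * g η with hw
  have hwm : Measurable w := by fun_prop
  have hpt : ∀ ξ' ∈ U, orbAvg lam g ξ ≤
      ∫⁻ θ : Matrix.orthogonalGroup (Fin d) ℝ, (C * (B * ∫⁻ η,
        dec (d + 1) ‖Matrix.toEuclideanLin (θ : Matrix (Fin d) (Fin d) ℝ) ξ' - η‖ₑ * w η)) ∂lam := by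
    intro ξ' hξ'
    rw [orbAvg_eq_of_norm_eq hinv hg (hrad ξ' hξ').1.symm]
    refine lintegral_mono fun θ => (hCg _).trans (mul_le_mul_right ?_ _)
    obtain ⟨L, hL⟩ := exists_linearIsometryEquiv_eq θ
    rw [hL, hL, ← lintegral_const_mul _ (by fun_prop)]
    refine lintegral_mono fun η => ?_
    calc _ ≤ _ := mul_le_mul_left (hker L ξ' hξ' η) (g η)
      _ = _ := by rw [hw]; ring
  have hmeas := ((measurable_lintegral_dec_toEuclideanLin (d + 1) hwm).const_mul B).const_mul C
  have hinner : ∀ θ : Matrix.orthogonalGroup (Fin d) ℝ, ∫⁻ ξ', C * (B * ∫⁻ η,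
      dec (d + 1) ‖Matrix.toEuclideanLin (θ : Matrix (Fin d) (Fin d) ℝ) ξ' - η‖ₑ * w η) = C * (B * (I * J)) := by
    intro θ
    obtain ⟨L, hL⟩ := exists_linearIsometryEquiv_eq θ
    have hLm : Measurable L := L.continuous.measurable
    simp only [hL]
    rw [lintegral_const_mul _ (by fun_prop), lintegral_const_mul _ (by fun_prop),
      lintegral_lintegral_swap (by fun_prop), hJ, ← lintegral_const_mul _ hwm]
    congr 2
    refine lintegral_congr fun η => ?_
    rw [lintegral_mul_const _ (by fun_prop)]
    congr 1
    rw [hI, ← lintegral_sub_right_eq_self (fun x : EuclideanSpace ℝ (Fin d) => dec (d + 1) ‖x‖ₑ) (L.symm η)]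
    refine lintegral_congr fun x => ?_
    rw [← ofReal_norm, ← ofReal_norm, ← L.norm_map (x - L.symm η), map_sub, L.apply_symm_apply]
  have hmain : ENNReal.ofReal ((1 + t) ^ (d - 1)) * v * orbAvg lam g ξ ≤ C * (B * (I * J)) :=
    calc _ ≤ volume U * orbAvg lam g ξ := mul_le_mul_left (hvol (norm_nonneg ξ)) _
      _ = ∫⁻ _ in U, orbAvg lam g ξ := by rw [lintegral_const, Measure.restrict_apply_univ, mul_comm]
      _ ≤ ∫⁻ ξ' in U, (∫⁻ θ : Matrix.orthogonalGroup (Fin d) ℝ, (C * (B * ∫⁻ η,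
            dec (d + 1) ‖Matrix.toEuclideanLin (θ : Matrix (Fin d) (Fin d) ℝ) ξ' - η‖ₑ * w η)) ∂lam) :=
          setLIntegral_mono' hUm hpt
      _ ≤ ∫⁻ ξ', (∫⁻ θ : Matrix.orthogonalGroup (Fin d) ℝ, (C * (B * ∫⁻ η,
            dec (d + 1) ‖Matrix.toEuclideanLin (θ : Matrix (Fin d) (Fin d) ℝ) ξ' - η‖ₑ * w η)) ∂lam) :=
          setLIntegral_le_lintegral _ _
      _ = _ := by
          rw [lintegral_lintegral_swap hmeas.aemeasurable]
          simp only [hinner, lintegral_const, measure_univ, mul_one]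
  calc _ = v⁻¹ * (ENNReal.ofReal ((1 + t) ^ (d - 1)) * v * orbAvg lam g ξ) := by
        rw [mul_right_comm, mul_comm _ v, ← mul_assoc, ENNReal.inv_mul_cancel hv0 hvt, one_mul]
    _ ≤ _ := mul_le_mul_right hmain _
    _ = _ := by ring

end Rotation

section Bracket
variable {E : Type*} [NormedAddCommGroup E]

/-- The weight `(1 + ‖ξ‖) ^ p`. -/
noncomputable def bracket (p : ℝ) (ξ : E) : ℝ≥0∞ := ENNReal.ofReal ((1 + ‖ξ‖) ^ p)

theorem bracket_mul_bracket (p q : ℝ) (ξ : E) : bracket p ξ * bracket q ξ = bracket (p + q) ξ := by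
  rw [bracket, bracket, bracket, ← ENNReal.ofReal_mul (by positivity), ← Real.rpow_add (by positivity)]

theorem bracket_zero (ξ : E) : bracket 0 ξ = 1 := by simp [bracket]

theorem bracket_mono {p : ℝ} (hp : 0 ≤ p) {ξ ξ' : E} (h : ‖ξ‖ ≤ ‖ξ'‖) : bracket p ξ ≤ bracket p ξ' :=
  ENNReal.ofReal_le_ofReal (Real.rpow_le_rpow (by positivity) (by linarith) hp)

theorem bracket_pow (p : ℝ) (n : ℕ) (ξ : E) : bracket p ξ ^ n = bracket (n * p) ξ := by
  rw [bracket, bracket, ← ENNReal.ofReal_pow (by positivity), ← Real.rpow_natCast, ← Real.rpow_mul (by positivity),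
    mul_comm]

theorem measurable_bracket [MeasurableSpace E] [BorelSpace E] (p : ℝ) : Measurable (bracket (E := E) p) := by
  unfold bracket
  fun_prop

theorem bracket_le_mul_bracket_of_le {p M : ℝ} (hp : p ≤ 0) (hM : 1 ≤ M) {ξ ξ' : E} (h : ‖ξ'‖ ≤ M * ‖ξ‖) :
    bracket p ξ ≤ ENNReal.ofReal (M ^ (-p)) * bracket p ξ' := by
  rw [bracket, bracket, ← ENNReal.ofReal_mul (by positivity)]
  refine ENNReal.ofReal_le_ofReal ?_
  have hM0 : 0 < M := by linarith
  have h1 : (1 + ‖ξ'‖) / M ≤ 1 + ‖ξ‖ := by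
    rw [div_le_iff₀ hM0]
    nlinarith
  refine (Real.rpow_le_rpow_of_nonpos (by positivity) h1 hp).trans_eq ?_
  rw [Real.div_rpow (by positivity) hM0.le, Real.rpow_neg hM0.le, div_eq_inv_mul]

end Bracket

section Decay
variable {d : ℕ} {lam : Measure (Matrix.orthogonalGroup (Fin d) ℝ)} {g : EuclideanSpace ℝ (Fin d) → ℝ≥0∞}

theorem dec_ofReal_abs_le_lintegral (N : ℕ) (u : ℝ) : dec N (ENNReal.ofReal |u|) ≤
    ∫⁻ v : ℝ in Set.Icc (u - 1) (u + 1), 2 ^ N * dec N ‖v‖ₑ := by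
  calc dec N (ENNReal.ofReal |u|) ≤ dec N (ENNReal.ofReal |u|) * volume (Set.Icc (u - 1) (u + 1)) := by
        rw [Real.volume_Icc]
        refine le_mul_of_one_le_right' ?_
        rw [← ENNReal.ofReal_one]
        exact ENNReal.ofReal_le_ofReal (by linarith)
    _ = ∫⁻ _ : ℝ in Set.Icc (u - 1) (u + 1), dec N (ENNReal.ofReal |u|) := by
        rw [lintegral_const, Measure.restrict_apply_univ]
    _ ≤ _ := by
        refine setLIntegral_mono' measurableSet_Icc fun v hv => ?_
        rw [← one_add_one_eq_two]
        refine dec_le_mul_dec N ENNReal.one_ne_top (by finiteness) ?_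
        rw [← ofReal_norm, ← ENNReal.ofReal_one, ← ENNReal.ofReal_add (by positivity) zero_le_one]
        refine ENNReal.ofReal_le_ofReal ?_
        rw [Real.norm_eq_abs]
        have h1 : |v - u| ≤ 1 := abs_le.2 ⟨by linarith [hv.1], by linarith [hv.2]⟩
        have h2 := abs_sub_abs_le_abs_sub v u
        linarith

theorem exists_lintegral_dec_shell_le {κ : ℝ} (hκ0 : 0 ≤ κ) (hg : Measurable g) {K : ℝ≥0∞} (hK : K ≠ ⊤)
    (hshell : ∀ t : ℝ, ∫⁻ ξ in {ξ : EuclideanSpace ℝ (Fin d) | |‖ξ‖ - t| ≤ 1}, g ξ ≤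
      K * ENNReal.ofReal ((1 + |t|) ^ κ)) :
    ∃ (N : ℕ) (C : ℝ≥0∞), C ≠ ⊤ ∧ ∀ t : ℝ, 0 ≤ t →
      ∫⁻ η, dec N (ENNReal.ofReal |‖η‖ - t|) * g η ≤ C * ENNReal.ofReal ((1 + t) ^ κ) := by
  set n := ⌈κ⌉₊ with hn
  set I := ∫⁻ x : ℝ, dec 2 ‖x‖ₑ with hI
  have hIt : I ≠ ⊤ := (lintegral_dec_lt_top (by simp)).ne
  refine ⟨n + 2, 2 ^ (n + 2) * K * I, by finiteness, fun t ht => ?_⟩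
  have hsh : ∀ c : ℝ, MeasurableSet {ξ : EuclideanSpace ℝ (Fin d) | |‖ξ‖ - c| ≤ 1} := fun c =>
    measurableSet_le ((measurable_norm.sub_const c).abs) measurable_const
  set D := {p : EuclideanSpace ℝ (Fin d) × ℝ | |‖p.1‖ - (t + p.2)| ≤ 1} with hD
  have hDm : MeasurableSet D := measurableSet_le
    (((measurable_norm.comp measurable_fst).sub (measurable_const.add measurable_snd)).abs) measurable_const
  have hm : Measurable fun p : EuclideanSpace ℝ (Fin d) × ℝ =>
      D.indicator (fun p => 2 ^ (n + 2) * dec (n + 2) ‖p.2‖ₑ * g p.1) p :=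
    Measurable.indicator (by fun_prop) hDm
  have hbd : ∀ v : ℝ, dec (n + 2) ‖v‖ₑ * ENNReal.ofReal ((1 + |t + v|) ^ κ) ≤
      ENNReal.ofReal ((1 + t) ^ κ) * dec 2 ‖v‖ₑ := fun v => by
    have h1 : (1 + |t + v|) ^ κ ≤ (1 + t) ^ κ * (1 + ‖v‖) ^ n := by
      have h2 : 1 + |t + v| ≤ (1 + t) * (1 + ‖v‖) := by
        have := abs_add_le t v
        rw [abs_of_nonneg ht] at this
        rw [Real.norm_eq_abs]
        nlinarith [abs_nonneg v, mul_nonneg ht (abs_nonneg v)]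
      refine (Real.rpow_le_rpow (by positivity) h2 hκ0).trans ?_
      rw [Real.mul_rpow (by positivity) (by positivity), ← Real.rpow_natCast]
      refine mul_le_mul_of_nonneg_left (Real.rpow_le_rpow_of_exponent_le (by linarith [norm_nonneg v])
        (Nat.le_ceil κ)) (by positivity)
    have h3 : ENNReal.ofReal ((1 + ‖v‖) ^ n) = (1 + ‖v‖ₑ) ^ n := by
      rw [ENNReal.ofReal_pow (by positivity), ENNReal.ofReal_add zero_le_one (norm_nonneg _), ofReal_norm,
        ENNReal.ofReal_one]
    calc _ ≤ dec (n + 2) ‖v‖ₑ * (ENNReal.ofReal ((1 + t) ^ κ) * (1 + ‖v‖ₑ) ^ n) := by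
          rw [← h3, ← ENNReal.ofReal_mul (by positivity)]
          exact mul_le_mul_right (ENNReal.ofReal_le_ofReal h1) _
      _ = ENNReal.ofReal ((1 + t) ^ κ) * (((1 + ‖v‖ₑ) ^ n * dec n ‖v‖ₑ) * dec 2 ‖v‖ₑ) := by
          rw [dec_add]; ring
      _ = _ := by rw [pow_mul_dec n (by finiteness), one_mul]
  calc ∫⁻ η, dec (n + 2) (ENNReal.ofReal |‖η‖ - t|) * g η
      ≤ ∫⁻ η, ∫⁻ v : ℝ, D.indicator (fun p => 2 ^ (n + 2) * dec (n + 2) ‖p.2‖ₑ * g p.1) (η, v) := by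
        refine lintegral_mono fun η => ?_
        refine (mul_le_mul_left (dec_ofReal_abs_le_lintegral _ _) _).trans_eq ?_
        rw [← lintegral_mul_const _ (by fun_prop), ← lintegral_indicator measurableSet_Icc]
        refine lintegral_congr fun v => ?_
        have h1 : v ∈ Set.Icc (‖η‖ - t - 1) (‖η‖ - t + 1) ↔ (η, v) ∈ D := by
          simp only [hD, Set.mem_Icc, Set.mem_ofPred_eq, abs_le]
          constructor <;> rintro ⟨h1, h2⟩ <;> constructor <;> linarith
        by_cases h2 : (η, v) ∈ D
        · rw [Set.indicator_of_mem h2, Set.indicator_of_mem (h1.2 h2)]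
        · rw [Set.indicator_of_notMem h2, Set.indicator_of_notMem (mt h1.1 h2)]
    _ = ∫⁻ v : ℝ, ∫⁻ η, D.indicator (fun p => 2 ^ (n + 2) * dec (n + 2) ‖p.2‖ₑ * g p.1) (η, v) :=
        lintegral_lintegral_swap hm.aemeasurable
    _ ≤ ∫⁻ v : ℝ, 2 ^ (n + 2) * K * ENNReal.ofReal ((1 + t) ^ κ) * dec 2 ‖v‖ₑ := by
        refine lintegral_mono fun v => ?_
        have e1 : ∀ η, D.indicator (fun p => 2 ^ (n + 2) * dec (n + 2) ‖p.2‖ₑ * g p.1) (η, v) =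
            {ξ : EuclideanSpace ℝ (Fin d) | |‖ξ‖ - (t + v)| ≤ 1}.indicator
              (fun η => 2 ^ (n + 2) * dec (n + 2) ‖v‖ₑ * g η) η := fun η => rfl
        simp only [e1]
        rw [lintegral_indicator (hsh _), lintegral_const_mul _ hg]
        calc _ ≤ 2 ^ (n + 2) * dec (n + 2) ‖v‖ₑ * (K * ENNReal.ofReal ((1 + |t + v|) ^ κ)) :=
              mul_le_mul_right (hshell _) _
          _ = 2 ^ (n + 2) * K * (dec (n + 2) ‖v‖ₑ * ENNReal.ofReal ((1 + |t + v|) ^ κ)) := by ring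
          _ ≤ _ := (mul_le_mul_right (hbd v) _).trans_eq (by ring)
    _ = _ := by
        rw [lintegral_const_mul _ (by fun_prop)]
        ring

theorem exists_orbAvg_le_bracket [IsProbabilityMeasure lam] (hd : 1 ≤ d)
    (hinv : ∀ θ₀ : Matrix.orthogonalGroup (Fin d) ℝ, lam.map (fun θ => θ * θ₀) = lam) (hg : Measurable g)
    (hrep : ∀ N : ℕ, ∃ C : ℝ≥0∞, C ≠ ⊤ ∧ ∀ ξ, g ξ ≤ C * ∫⁻ η, dec N ‖ξ - η‖ₑ * g η)
    {κ : ℝ} (hκ0 : 0 ≤ κ) {K : ℝ≥0∞} (hK : K ≠ ⊤)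
    (hshell : ∀ t : ℝ, ∫⁻ ξ in {ξ : EuclideanSpace ℝ (Fin d) | |‖ξ‖ - t| ≤ 1}, g ξ ≤
      K * ENNReal.ofReal ((1 + |t|) ^ κ)) :
    ∃ C : ℝ≥0∞, C ≠ ⊤ ∧ ∀ ξ, orbAvg lam g ξ ≤ C * bracket (κ - (d - 1)) ξ := by
  obtain ⟨N, C₁, hC₁, h₁⟩ := exists_lintegral_dec_shell_le hκ0 hg hK hshell
  obtain ⟨C₂, hC₂, h₂⟩ := exists_orbAvg_le hd hinv hg hrep N
  refine ⟨C₂ * C₁, by finiteness, fun ξ => ?_⟩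
  have h3 : ENNReal.ofReal ((1 + ‖ξ‖) ^ (d - 1)) = bracket ((d : ℝ) - 1) ξ := by
    rw [bracket, ← Real.rpow_natCast, Nat.cast_sub hd, Nat.cast_one]
  have h4 := (h₂ ξ).trans (mul_le_mul_right (h₁ _ (norm_nonneg ξ)) _)
  rw [h3] at h4
  calc orbAvg lam g ξ = bracket (-((d : ℝ) - 1)) ξ * (bracket ((d : ℝ) - 1) ξ * orbAvg lam g ξ) := by
        rw [← mul_assoc, bracket_mul_bracket, neg_add_cancel, bracket_zero, one_mul]
    _ ≤ bracket (-((d : ℝ) - 1)) ξ * (C₂ * (C₁ * bracket κ ξ)) := mul_le_mul_right h4 _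
    _ = C₂ * C₁ * (bracket κ ξ * bracket (-((d : ℝ) - 1)) ξ) := by ring
    _ = _ := by rw [bracket_mul_bracket, sub_eq_add_neg κ]

end Decay

section Growth
variable {E : Type*} [NormedAddCommGroup E] [MeasurableSpace E] [BorelSpace E]

theorem bracket_neg_le_tsum {b : ℝ} (hb : 0 < b) (ξ : E) : bracket (-b) ξ ≤
    ∑' j : ℕ, (closedBall (0 : E) (2 ^ j)).indicator (fun _ => ENNReal.ofReal (2 ^ b * (2 ^ (-b)) ^ j)) ξ := by
  classical
  have hex : ∃ j : ℕ, ‖ξ‖ ≤ 2 ^ j := (pow_unbounded_of_one_lt ‖ξ‖ one_lt_two).imp fun _ h => h.le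
  refine le_trans ?_ (ENNReal.le_tsum (Nat.find hex))
  rw [Set.indicator_of_mem (mem_closedBall_zero_iff.2 (Nat.find_spec hex))]
  refine ENNReal.ofReal_le_ofReal ?_
  have hn := norm_nonneg ξ
  rcases h : Nat.find hex with _ | j
  · rw [pow_zero, mul_one]
    exact (Real.rpow_le_one_of_one_le_of_nonpos (by linarith) (by linarith)).trans
      (Real.one_le_rpow one_le_two hb.le)
  · have h1 : (2 : ℝ) ^ j < ‖ξ‖ := by
      have := Nat.find_min hex (m := j) (by omega)
      simpa using this
    have e1 : (2 : ℝ) ^ b * (2 ^ (-b)) ^ (j + 1) = (2 ^ j) ^ (-b) := by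
      rw [pow_succ, mul_comm, mul_assoc, ← Real.rpow_add two_pos, neg_add_cancel, Real.rpow_zero, mul_one,
        ← Real.rpow_natCast, ← Real.rpow_natCast, ← Real.rpow_mul two_pos.le, ← Real.rpow_mul two_pos.le, mul_comm]
    rw [e1]
    exact Real.rpow_le_rpow_of_nonpos (by positivity) (by linarith) (by linarith)

theorem HasGrowth.lintegral_bracket_lt_top {σ b : ℝ} (hb : 0 < b) (hσ : σ < b) {H : Measure E}
    (hH : HasGrowth σ H) : ∫⁻ ξ, bracket (-b) ξ ∂H < ⊤ := by
  set q := ENNReal.ofReal (2 ^ (σ - b))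
  have hq : q < 1 := by
    rw [← ENNReal.ofReal_one]
    exact (ENNReal.ofReal_lt_ofReal_iff one_pos).2 (Real.rpow_lt_one_of_one_lt_of_neg one_lt_two (by linarith))
  have hq' : 1 - q ≠ 0 := (tsub_pos_of_lt hq).ne'
  calc ∫⁻ ξ, bracket (-b) ξ ∂H
      ≤ ∫⁻ ξ, ∑' j : ℕ, (closedBall (0 : E) (2 ^ j)).indicator
          (fun _ => ENNReal.ofReal (2 ^ b * (2 ^ (-b)) ^ j)) ξ ∂H := lintegral_mono fun ξ => bracket_neg_le_tsum hb ξ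
    _ = ∑' j : ℕ, ENNReal.ofReal (2 ^ b * (2 ^ (-b)) ^ j) * H (closedBall (0 : E) (2 ^ j)) := by
        rw [lintegral_tsum fun j => (measurable_const.indicator measurableSet_closedBall).aemeasurable]
        exact tsum_congr fun j => lintegral_indicator_const measurableSet_closedBall _
    _ ≤ ∑' j : ℕ, ENNReal.ofReal (2 ^ b) * q ^ j := by
        refine ENNReal.tsum_le_tsum fun j => ?_
        refine (mul_le_mul_right (hH 0 (2 ^ j) (one_le_pow₀ one_le_two)) _).trans_eq ?_
        rw [← ENNReal.ofReal_pow (by positivity), ← ENNReal.ofReal_mul (by positivity),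
          ← ENNReal.ofReal_mul (by positivity)]
        congr 1
        rw [mul_assoc, ← Real.rpow_natCast 2 j, ← Real.rpow_mul two_pos.le, mul_comm (j : ℝ) σ, Real.rpow_mul two_pos.le,
          Real.rpow_natCast, ← mul_pow, ← Real.rpow_add two_pos, neg_add_eq_sub]
    _ = ENNReal.ofReal (2 ^ b) * (1 - q)⁻¹ := by rw [ENNReal.tsum_mul_left, ENNReal.tsum_geometric]
    _ < ⊤ := by finiteness

end Growth

section RadialAverage
variable {d : ℕ} {lam : Measure (Matrix.orthogonalGroup (Fin d) ℝ)} {g : EuclideanSpace ℝ (Fin d) → ℝ≥0∞}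

theorem lintegral_mul_bracket_lt_top {σ b : ℝ} (hb : 0 < b) (hσ : σ < b) (hg : Measurable g) {K : ℝ≥0∞}
    (hK : K ≠ ⊤) (hgrow : HasGrowth σ (K⁻¹ • volume.withDensity g)) :
    ∫⁻ ξ, g ξ * bracket (-b) ξ < ⊤ := by
  have h := hgrow.lintegral_bracket_lt_top hb hσ
  rw [lintegral_smul_measure, lintegral_withDensity_eq_lintegral_mul _ hg (measurable_bracket _)] at h
  by_contra hc
  rw [not_lt, top_le_iff] at hc
  simp only [Pi.mul_apply] at h
  rw [hc, smul_eq_mul, ENNReal.mul_top (ENNReal.inv_ne_zero.2 hK)] at h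
  exact lt_irrefl _ h

theorem lintegral_dec_mul_sub_le {t : ℝ} (ht : 0 < t) (u : ℝ) :
    ∫⁻ r : ℝ, dec 2 (ENNReal.ofReal |u - r * t|) = ENNReal.ofReal t⁻¹ * ∫⁻ x : ℝ, dec 2 ‖x‖ₑ := by
  have h := lintegral_dec_div (E := ℝ) 2 (inv_pos.2 ht) (u / t)
  rw [Module.finrank_self, pow_one] at h
  rw [← h]
  refine lintegral_congr fun r => ?_
  congr 2
  rw [div_inv_eq_mul, Real.norm_eq_abs, abs_sub_comm, ← abs_of_pos ht, ← abs_mul, abs_of_pos ht, sub_mul,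
    div_mul_cancel₀ _ ht.ne']

/-- Averaging orbit averages over dilations gains the full decay of the growth exponent. -/
theorem exists_lintegral_orbAvg_smul_le [IsProbabilityMeasure lam] (hd : 1 ≤ d)
    (hinv : ∀ θ₀ : Matrix.orthogonalGroup (Fin d) ℝ, lam.map (fun θ => θ * θ₀) = lam) (hg : Measurable g)
    (hg1 : ∀ ξ, g ξ ≤ 1)
    (hrep : ∀ N : ℕ, ∃ C : ℝ≥0∞, C ≠ ⊤ ∧ ∀ ξ, g ξ ≤ C * ∫⁻ η, dec N ‖ξ - η‖ₑ * g η)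
    {s : ℝ} (hs : 0 ≤ s) {K : ℝ≥0∞} (hK : K ≠ ⊤) (hK0 : K ≠ 0)
    (hgrow : HasGrowth ((d : ℝ) - s) (K⁻¹ • volume.withDensity g)) {a b : ℝ} (ha : 0 < a) (hab : a ≤ b) :
    ∃ C : ℝ≥0∞, C ≠ ⊤ ∧ ∀ ξ, ∫⁻ r in Set.Icc a b, orbAvg lam g (r • ξ) ≤ C * bracket (-s) ξ := by
  obtain ⟨M, hM⟩ := exists_nat_gt ((d : ℝ) - s)
  obtain ⟨B, hB, hBd⟩ := exists_lintegral_dec_le (EuclideanSpace ℝ (Fin d)) hM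
  obtain ⟨C, hC, hCd⟩ := exists_orbAvg_le hd hinv hg hrep (2 + M)
  set I := ∫⁻ x : ℝ, dec 2 ‖x‖ₑ with hI
  have hIt : I ≠ ⊤ := (lintegral_dec_lt_top (by simp)).ne
  set C' := ENNReal.ofReal ((a ^ (d - 1))⁻¹) * (C * ((1 + ENNReal.ofReal b) ^ M * I * (K * B))) with hC'
  have hC't : C' ≠ ⊤ := by finiteness
  refine ⟨ENNReal.ofReal (2 ^ s) * (C' + ENNReal.ofReal (b - a)), by finiteness, fun ξ => ?_⟩
  set t := ‖ξ‖ with ht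
  have ht0 : 0 ≤ t := norm_nonneg ξ
  rcases le_or_gt t 1 with h1 | h1
  · calc ∫⁻ r in Set.Icc a b, orbAvg lam g (r • ξ) ≤ ∫⁻ r in Set.Icc a b, 1 :=
          lintegral_mono fun r => orbAvg_le_one hg1 _
      _ = ENNReal.ofReal (b - a) * 1 := by simp [Real.volume_Icc]
      _ ≤ ENNReal.ofReal (b - a) * (ENNReal.ofReal (2 ^ s) * bracket (-s) ξ) := by
          refine mul_le_mul_right ?_ _
          rw [bracket, ← ENNReal.ofReal_mul (by positivity), ← ENNReal.ofReal_one]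
          refine ENNReal.ofReal_le_ofReal ?_
          rw [Real.rpow_neg (by positivity), ← div_eq_mul_inv, one_le_div (by positivity)]
          exact Real.rpow_le_rpow (by positivity) (by linarith) hs
      _ ≤ (C' + ENNReal.ofReal (b - a)) * (ENNReal.ofReal (2 ^ s) * bracket (-s) ξ) :=
          mul_le_mul_left le_add_self _
      _ = _ := by ring
  have htp : 0 < t := by linarith
  have hpow : ∀ r ∈ Set.Icc a b, orbAvg lam g (r • ξ) ≤ ENNReal.ofReal (((a * t) ^ (d - 1))⁻¹) *
      (C * ∫⁻ η, dec (2 + M) (ENNReal.ofReal |‖η‖ - r * t|) * g η) := fun r hr => by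
    have hr0 : 0 < r := ha.trans_le hr.1
    have e1 : ‖r • ξ‖ = r * t := by rw [norm_smul, Real.norm_of_nonneg hr0.le]
    have h2 := hCd (r • ξ)
    rw [e1] at h2
    have h3 : ENNReal.ofReal ((a * t) ^ (d - 1)) ≤ ENNReal.ofReal ((1 + r * t) ^ (d - 1)) := by
      refine ENNReal.ofReal_le_ofReal (pow_le_pow_left₀ (by positivity) ?_ _)
      nlinarith [hr.1]
    calc _ = ENNReal.ofReal (((a * t) ^ (d - 1))⁻¹) * (ENNReal.ofReal ((a * t) ^ (d - 1)) * orbAvg lam g (r • ξ)) := by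
          rw [← mul_assoc, ← ENNReal.ofReal_mul (by positivity), inv_mul_cancel₀ (by positivity), ENNReal.ofReal_one,
            one_mul]
      _ ≤ _ := mul_le_mul_right ((mul_le_mul_left h3 _).trans h2) _
  have hgi : ∫⁻ η, g η * dec M (ENNReal.ofReal (‖η‖ / t)) ≤ K * (B * ENNReal.ofReal (t ^ ((d : ℝ) - s))) := by
    have h2 := hBd hgrow 0 h1.le
    rw [lintegral_smul_measure, lintegral_withDensity_eq_lintegral_mul _ hg (by fun_prop), smul_eq_mul] at h2
    rw [ENNReal.inv_mul_le_iff hK0 hK] at h2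
    simpa only [Pi.mul_apply, sub_zero] using h2
  have hker : ∀ r ∈ Set.Icc a b, ∀ η : EuclideanSpace ℝ (Fin d), dec (2 + M) (ENNReal.ofReal |‖η‖ - r * t|) * g η ≤
      (1 + ENNReal.ofReal b) ^ M * (g η * dec M (ENNReal.ofReal (‖η‖ / t))) *
        dec 2 (ENNReal.ofReal |‖η‖ - r * t|) := fun r hr η => by
    rw [dec_add]
    have h2 : dec M (ENNReal.ofReal |‖η‖ - r * t|) ≤
        (1 + ENNReal.ofReal b) ^ M * dec M (ENNReal.ofReal (‖η‖ / t)) := by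
      refine dec_le_mul_dec M (by finiteness) (by finiteness) ?_
      rw [← ENNReal.ofReal_add (by positivity) (ha.le.trans hab)]
      refine ENNReal.ofReal_le_ofReal ?_
      rw [div_le_iff₀ htp]
      have h3 := le_abs_self (‖η‖ - r * t)
      have h4 := abs_nonneg (‖η‖ - r * t)
      nlinarith [mul_le_mul_of_nonneg_right hr.2 ht0, mul_nonneg h4 (sub_nonneg.2 h1.le)]
    calc _ ≤ dec 2 (ENNReal.ofReal |‖η‖ - r * t|) *
          ((1 + ENNReal.ofReal b) ^ M * dec M (ENNReal.ofReal (‖η‖ / t))) * g η :=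
          mul_le_mul_left (mul_le_mul_right h2 _) _
      _ = _ := by ring
  have hintegrable : ∫⁻ r in Set.Icc a b, ∫⁻ η, dec (2 + M) (ENNReal.ofReal |‖η‖ - r * t|) * g η ≤
      (1 + ENNReal.ofReal b) ^ M * (ENNReal.ofReal t⁻¹ * I) * (K * (B * ENNReal.ofReal (t ^ ((d : ℝ) - s)))) := by
    calc _ ≤ ∫⁻ r in Set.Icc a b, ∫⁻ η : EuclideanSpace ℝ (Fin d), (1 + ENNReal.ofReal b) ^ M *
            (g η * dec M (ENNReal.ofReal (‖η‖ / t))) * dec 2 (ENNReal.ofReal |‖η‖ - r * t|) :=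
          setLIntegral_mono' measurableSet_Icc fun r hr => lintegral_mono fun η => hker r hr η
      _ ≤ ∫⁻ r : ℝ, ∫⁻ η : EuclideanSpace ℝ (Fin d), (1 + ENNReal.ofReal b) ^ M *
            (g η * dec M (ENNReal.ofReal (‖η‖ / t))) * dec 2 (ENNReal.ofReal |‖η‖ - r * t|) :=
          setLIntegral_le_lintegral _ _
      _ = ∫⁻ η : EuclideanSpace ℝ (Fin d), ∫⁻ r : ℝ, (1 + ENNReal.ofReal b) ^ M *
            (g η * dec M (ENNReal.ofReal (‖η‖ / t))) * dec 2 (ENNReal.ofReal |‖η‖ - r * t|) :=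
          lintegral_lintegral_swap (by fun_prop)
      _ = ∫⁻ η : EuclideanSpace ℝ (Fin d), (1 + ENNReal.ofReal b) ^ M * (ENNReal.ofReal t⁻¹ * I) *
            (g η * dec M (ENNReal.ofReal (‖η‖ / t))) := by
          refine lintegral_congr fun η => ?_
          rw [lintegral_const_mul _ (by fun_prop), lintegral_dec_mul_sub_le htp]
          ring
      _ ≤ _ := by
          rw [lintegral_const_mul _ (by fun_prop)]
          exact mul_le_mul_right hgi _
  have hfin : ENNReal.ofReal (((a * t) ^ (d - 1))⁻¹) * (ENNReal.ofReal t⁻¹ * ENNReal.ofReal (t ^ ((d : ℝ) - s))) ≤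
      ENNReal.ofReal ((a ^ (d - 1))⁻¹) * (ENNReal.ofReal (2 ^ s) * bracket (-s) ξ) := by
    rw [bracket, ← ENNReal.ofReal_mul (by positivity), ← ENNReal.ofReal_mul (by positivity),
      ← ENNReal.ofReal_mul (by positivity), ← ENNReal.ofReal_mul (by positivity)]
    refine ENNReal.ofReal_le_ofReal ?_
    rw [mul_pow, mul_inv, mul_assoc]
    refine mul_le_mul_of_nonneg_left ?_ (by positivity)
    have e1 : (t ^ (d - 1))⁻¹ * (t⁻¹ * t ^ ((d : ℝ) - s)) = t ^ (-s) := by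
      rw [← mul_assoc, ← mul_inv, ← pow_succ, Nat.sub_add_cancel hd, Real.rpow_sub htp, Real.rpow_natCast,
        Real.rpow_neg ht0]
      field_simp
    rw [e1, Real.rpow_neg ht0, Real.rpow_neg (by positivity), ← div_eq_mul_inv, le_div_iff₀ (by positivity),
      inv_mul_le_iff₀ (by positivity), ← Real.mul_rpow ht0 two_pos.le]
    exact Real.rpow_le_rpow (by positivity) (by linarith) hs
  calc ∫⁻ r in Set.Icc a b, orbAvg lam g (r • ξ)
      ≤ ∫⁻ r in Set.Icc a b, ENNReal.ofReal (((a * t) ^ (d - 1))⁻¹) *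
          (C * ∫⁻ η, dec (2 + M) (ENNReal.ofReal |‖η‖ - r * t|) * g η) := setLIntegral_mono' measurableSet_Icc hpow
    _ = ENNReal.ofReal (((a * t) ^ (d - 1))⁻¹) * (C * ∫⁻ r in Set.Icc a b,
          ∫⁻ η, dec (2 + M) (ENNReal.ofReal |‖η‖ - r * t|) * g η) := by
        rw [lintegral_const_mul _ (by fun_prop), lintegral_const_mul _ (by fun_prop)]
    _ ≤ ENNReal.ofReal (((a * t) ^ (d - 1))⁻¹) * (C * ((1 + ENNReal.ofReal b) ^ M * (ENNReal.ofReal t⁻¹ * I) *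
          (K * (B * ENNReal.ofReal (t ^ ((d : ℝ) - s)))))) := mul_le_mul_right (mul_le_mul_right hintegrable _) _
    _ = (ENNReal.ofReal (((a * t) ^ (d - 1))⁻¹) * (ENNReal.ofReal t⁻¹ * ENNReal.ofReal (t ^ ((d : ℝ) - s)))) *
          (C * ((1 + ENNReal.ofReal b) ^ M * I * (K * B))) := by ring
    _ ≤ (ENNReal.ofReal ((a ^ (d - 1))⁻¹) * (ENNReal.ofReal (2 ^ s) * bracket (-s) ξ)) *
          (C * ((1 + ENNReal.ofReal b) ^ M * I * (K * B))) := mul_le_mul_left hfin _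
    _ = ENNReal.ofReal (2 ^ s) * C' * bracket (-s) ξ := by rw [hC']; ring
    _ ≤ _ := mul_le_mul_left (mul_le_mul_right le_self_add _) _

end RadialAverage

section PiIntegral

theorem lintegral_pi_fin_succAbove {X : Type*} [MeasurableSpace X] {n : ℕ} (ν : Measure X) [SigmaFinite ν]
    (i : Fin (n + 1)) {F : (Fin (n + 1) → X) → ℝ≥0∞} (hF : Measurable F) :
    ∫⁻ x, F x ∂(Measure.pi fun _ => ν) =
      ∫⁻ y : Fin n → X, (∫⁻ x : X, F (i.insertNth x y) ∂ν) ∂(Measure.pi fun _ => ν) := by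
  have h := (measurePreserving_piFinSuccAbove (fun _ : Fin (n + 1) => ν) i).symm
  rw [← h.lintegral_comp hF]
  exact lintegral_prod_symm' _ (hF.comp h.measurable)

theorem lintegral_fin_prod_eq_prod {X : Type*} [MeasurableSpace X] {n : ℕ} (ν : Measure X) [SigmaFinite ν]
    {f : Fin n → X → ℝ≥0∞} (hf : ∀ i, Measurable (f i)) :
    ∫⁻ x : Fin n → X, ∏ i, f i (x i) ∂(Measure.pi fun _ => ν) = ∏ i, ∫⁻ x, f i x ∂ν := by
  induction n with
  | zero => simp
  | succ n ih =>
    have hm : ∀ j : Fin (n + 1), Measurable fun x : Fin (n + 1) → X => f j (x j) :=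
      fun j => (hf j).comp (measurable_pi_apply j)
    have hm' : Measurable fun y : Fin n → X => ∏ i : Fin n, f i.succ (y i) :=
      Finset.measurable_prod _ fun j _ => (hf j.succ).comp (measurable_pi_apply j)
    rw [lintegral_pi_fin_succAbove ν 0 (Finset.measurable_prod _ fun j _ => hm j), Fin.prod_univ_succ,
      ← ih fun i => hf i.succ, ← lintegral_const_mul _ hm']
    refine lintegral_congr fun y => ?_
    rw [← lintegral_mul_const _ (hf 0)]
    refine lintegral_congr fun x => ?_
    simp [Fin.prod_univ_succ]

theorem setLIntegral_comp_inv_le (F : ℝ → ℝ≥0∞) :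
    ∫⁻ x in Set.Icc (1 / 2 : ℝ) 2, F x⁻¹ ≤ 4 * ∫⁻ x in Set.Icc (1 / 2 : ℝ) 2, F x := by
  have hpos : ∀ x ∈ Set.Icc (1 / 2 : ℝ) 2, 0 < x := fun x hx => by linarith [hx.1]
  have h := lintegral_image_eq_lintegral_abs_deriv_mul (measurableSet_Icc (a := (1 / 2 : ℝ)) (b := 2))
    (fun x hx => (hasDerivAt_inv (hpos x hx).ne').hasDerivWithinAt) (inv_injective.injOn) F
  have hsub : (fun x : ℝ => x⁻¹) '' Set.Icc (1 / 2 : ℝ) 2 ⊆ Set.Icc (1 / 2 : ℝ) 2 := by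
    rintro _ ⟨x, hx, rfl⟩
    have := hpos x hx
    refine ⟨?_, ?_⟩
    · rw [one_div]; exact inv_anti₀ this hx.2
    · rw [inv_le_comm₀ this two_pos, ← one_div]; exact hx.1
  calc ∫⁻ x in Set.Icc (1 / 2 : ℝ) 2, F x⁻¹
      ≤ ∫⁻ x in Set.Icc (1 / 2 : ℝ) 2, 4 * (ENNReal.ofReal |-(x ^ 2)⁻¹| * F x⁻¹) := by
        refine setLIntegral_mono' measurableSet_Icc fun x hx => ?_
        rw [← mul_assoc]
        refine le_mul_of_one_le_left' ?_
        have := hpos x hx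
        rw [show (4 : ℝ≥0∞) = ENNReal.ofReal 4 by simp, ← ENNReal.ofReal_mul (by norm_num), ← ENNReal.ofReal_one]
        refine ENNReal.ofReal_le_ofReal ?_
        rw [abs_neg, abs_of_pos (by positivity), ← div_eq_mul_inv, one_le_div (by positivity)]
        nlinarith [hx.2]
    _ = 4 * ∫⁻ x in (fun x : ℝ => x⁻¹) '' Set.Icc (1 / 2 : ℝ) 2, F x := by
        rw [lintegral_const_mul' _ _ (by finiteness)]
        exact congrArg _ h.symm
    _ ≤ _ := mul_le_mul_right (lintegral_mono_set hsub) _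

end PiIntegral

section Dilations
variable {E : Type*} [NormedAddCommGroup E] [NormedSpace ℝ E] [MeasurableSpace E] [BorelSpace E]
  {S : E → ℝ≥0∞} {γ s : ℝ} {C₁ C₂ : ℝ≥0∞}

theorem volume_restrict_cube (n : ℕ) (I : Set ℝ) : (volume : Measure (Fin n → ℝ)).restrict (Set.univ.pi fun _ => I) =
    Measure.pi fun _ => volume.restrict I := by
  rw [volume_pi, Measure.restrict_pi_pi]

theorem bracket_inv_smul_le {p P : ℝ} (hp : p ≤ 0) (hP : 0 < P) {n : ℕ} (hPn : P ≤ 2 ^ n) (ξ : E) :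
    bracket p (P⁻¹ • ξ) ≤ ENNReal.ofReal ((2 ^ n) ^ (-p)) * bracket p ξ := by
  refine bracket_le_mul_bracket_of_le hp (one_le_pow₀ one_le_two) ?_
  rw [norm_smul, norm_inv, Real.norm_of_nonneg hP.le, ← mul_assoc, ← div_eq_mul_inv]
  exact le_mul_of_one_le_left (norm_nonneg _) ((one_le_div hP).2 hPn)

theorem prod_pos_and_le_of_mem_cube {n : ℕ} {r : Fin n → ℝ}
    (hr : r ∈ Set.univ.pi fun _ => Set.Icc (1 / 2 : ℝ) 2) : 0 < ∏ j, r j ∧ ∏ j, r j ≤ 2 ^ n := by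
  have h0 : ∀ j, 0 < r j := fun j => by linarith [(hr j trivial).1]
  refine ⟨Finset.prod_pos fun j _ => h0 j, ?_⟩
  simpa using Finset.prod_le_prod (fun j _ => (h0 j).le) fun (j : Fin n) (_ : j ∈ Finset.univ) => (hr j trivial).2

theorem measurable_cube_integrand (hS : Measurable S) (n : ℕ) (ξ : Fin (n + 1) → E) :
    Measurable fun r : Fin n → ℝ => (∏ j, S (r j • ξ j.castSucc)) * S ((∏ j, r j)⁻¹ • ξ (Fin.last n)) := by
  have h1 : ∀ x : E, Measurable fun c : ℝ => S (c • x) := fun x =>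
    hS.comp (continuous_id.smul continuous_const).measurable
  refine (Finset.measurable_prod _ fun j _ => (h1 _).comp (measurable_pi_apply j)).mul ((h1 _).comp ?_)
  fun_prop

theorem lintegral_cube_prod_le (hS : Measurable S)
    (h2 : ∀ ξ, ∫⁻ r in Set.Icc (1 / 2 : ℝ) 2, S (r • ξ) ≤ C₂ * bracket (-s) ξ) {n : ℕ} (ξ : Fin n → E) :
    ∫⁻ r : Fin n → ℝ in Set.univ.pi fun _ => Set.Icc (1 / 2) 2, ∏ j, S (r j • ξ j) ≤
      C₂ ^ n * ∏ j, bracket (-s) (ξ j) := by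
  have h1 : ∀ x : E, Measurable fun c : ℝ => S (c • x) := fun x =>
    hS.comp (continuous_id.smul continuous_const).measurable
  rw [volume_restrict_cube, lintegral_fin_prod_eq_prod (f := fun j c => S (c • ξ j)) _ fun j => h1 _]
  refine (Finset.prod_le_prod' fun j _ => h2 (ξ j)).trans_eq ?_
  rw [Finset.prod_mul_distrib, Finset.prod_const, Finset.card_univ, Fintype.card_fin]

/-- In the integral over dilations, the decay of one chosen factor is estimated pointwise and the others in mean. -/
theorem exists_lintegral_cube_le (hS : Measurable S) (hγ : 0 ≤ γ) (hs : 0 ≤ s) (hC₁ : C₁ ≠ ⊤) (hC₂ : C₂ ≠ ⊤)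
    (h1 : ∀ ξ, S ξ ≤ C₁ * bracket (-γ) ξ)
    (h2 : ∀ ξ, ∫⁻ r in Set.Icc (1 / 2 : ℝ) 2, S (r • ξ) ≤ C₂ * bracket (-s) ξ) (n : ℕ) (m : Fin (n + 1)) :
    ∃ C : ℝ≥0∞, C ≠ ⊤ ∧ ∀ ξ : Fin (n + 1) → E,
      ∫⁻ r : Fin n → ℝ in Set.univ.pi fun _ => Set.Icc (1 / 2) 2,
        (∏ j, S (r j • ξ j.castSucc)) * S ((∏ j, r j)⁻¹ • ξ (Fin.last n)) ≤
      C * ∏ j, bracket (if j = m then -γ else -s) (ξ j) := by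
  have hcube : ∀ n : ℕ, MeasurableSet (Set.univ.pi fun _ : Fin n => Set.Icc (1 / 2 : ℝ) 2) :=
    fun n => MeasurableSet.univ_pi fun _ => measurableSet_Icc
  have hsm : ∀ x : E, Measurable fun c : ℝ => S (c • x) := fun x =>
    hS.comp (continuous_id.smul continuous_const).measurable
  have hprod : ∀ {n : ℕ} (η : Fin n → E), Measurable fun r : Fin n → ℝ => ∏ j, S (r j • η j) := fun η =>
    Finset.measurable_prod _ fun j _ => (hsm _).comp (measurable_pi_apply j)
  induction m using Fin.lastCases with
  | last =>
    refine ⟨C₁ * ENNReal.ofReal ((2 ^ n) ^ (- -γ)) * C₂ ^ n, by finiteness, fun ξ => ?_⟩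
    set D := C₁ * (ENNReal.ofReal ((2 ^ n) ^ (- -γ)) * bracket (-γ) (ξ (Fin.last n))) with hD
    calc _ ≤ ∫⁻ r : Fin n → ℝ in Set.univ.pi fun _ => Set.Icc (1 / 2) 2, (∏ j, S (r j • ξ j.castSucc)) * D := by
          refine setLIntegral_mono' (hcube n) fun r hr => mul_le_mul_right ((h1 _).trans (mul_le_mul_right ?_ _)) _
          exact bracket_inv_smul_le (by linarith) (prod_pos_and_le_of_mem_cube hr).1
            (prod_pos_and_le_of_mem_cube hr).2 _
      _ ≤ C₂ ^ n * (∏ j : Fin n, bracket (-s) (ξ j.castSucc)) * D := by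
          rw [lintegral_mul_const _ (hprod _)]
          exact mul_le_mul_left (lintegral_cube_prod_le hS h2 _) _
      _ = _ := by
          rw [Fin.prod_univ_castSucc]
          simp only [Fin.castSucc_ne_last, if_false, if_true, hD]
          ring
  | cast i =>
    obtain _ | n := n
    · exact i.elim0
    set B₁ := ENNReal.ofReal ((2 ^ 1) ^ (- -γ)) with hB₁
    set B₂ := ENNReal.ofReal ((2 ^ n) ^ (- -s)) with hB₂
    refine ⟨C₁ * B₁ * (4 * C₂ * B₂) * C₂ ^ n, by finiteness, fun ξ => ?_⟩
    set D := C₁ * (B₁ * bracket (-γ) (ξ i.castSucc)) * (4 * (C₂ * (B₂ * bracket (-s) (ξ (Fin.last (n + 1)))))) with hD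
    have hx : ∀ x ∈ Set.Icc (1 / 2 : ℝ) 2, S (x • ξ i.castSucc) ≤ C₁ * (B₁ * bracket (-γ) (ξ i.castSucc)) := by
      intro x hx
      have hx0 : 0 < x := by linarith [hx.1]
      refine (h1 _).trans (mul_le_mul_right ?_ _)
      have h3 := bracket_inv_smul_le (p := -γ) (P := x⁻¹) (n := 1) (by linarith) (inv_pos.2 hx0)
        (by rw [pow_one, inv_le_comm₀ hx0 two_pos, ← one_div]; exact hx.1) (ξ i.castSucc)
      rwa [inv_inv] at h3
    have hlast : ∀ y ∈ Set.univ.pi fun _ : Fin n => Set.Icc (1 / 2 : ℝ) 2,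
        ∫⁻ x in Set.Icc (1 / 2 : ℝ) 2, S ((x * ∏ j, y j)⁻¹ • ξ (Fin.last (n + 1))) ≤
          4 * (C₂ * (B₂ * bracket (-s) (ξ (Fin.last (n + 1))))) := by
      intro y hy
      obtain ⟨hP0, hP⟩ := prod_pos_and_le_of_mem_cube hy
      simp only [mul_inv, mul_smul]
      refine (setLIntegral_comp_inv_le fun x => S (x • ((∏ j, y j)⁻¹ • ξ (Fin.last (n + 1))))).trans ?_
      exact mul_le_mul_right ((h2 _).trans (mul_le_mul_right (bracket_inv_smul_le (by linarith) hP0 hP _) _)) _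
    calc _ = ∫⁻ y : Fin n → ℝ in Set.univ.pi fun _ => Set.Icc (1 / 2) 2, ∫⁻ x in Set.Icc (1 / 2 : ℝ) 2,
            S (x • ξ i.castSucc) * (∏ j, S (y j • ξ (i.succAbove j).castSucc)) *
              S ((x * ∏ j, y j)⁻¹ • ξ (Fin.last (n + 1))) := by
          rw [volume_restrict_cube, volume_restrict_cube,
            lintegral_pi_fin_succAbove _ i (measurable_cube_integrand hS (n + 1) ξ)]
          refine lintegral_congr fun y => lintegral_congr fun x => ?_
          rw [Fin.prod_univ_succAbove _ i, Fin.prod_univ_succAbove _ i]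
          simp
      _ ≤ ∫⁻ y : Fin n → ℝ in Set.univ.pi fun _ => Set.Icc (1 / 2) 2,
            (∏ j, S (y j • ξ (i.succAbove j).castSucc)) * D := by
          refine setLIntegral_mono' (hcube n) fun y hy => ?_
          calc _ ≤ ∫⁻ x in Set.Icc (1 / 2 : ℝ) 2, C₁ * (B₁ * bracket (-γ) (ξ i.castSucc)) *
                (∏ j, S (y j • ξ (i.succAbove j).castSucc)) * S ((x * ∏ j, y j)⁻¹ • ξ (Fin.last (n + 1))) :=
                setLIntegral_mono' measurableSet_Icc fun x h => mul_le_mul_left (mul_le_mul_left (hx x h) _) _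
            _ ≤ _ := by
                have hm : Measurable fun x : ℝ => S ((x * ∏ j, y j)⁻¹ • ξ (Fin.last (n + 1))) :=
                  (hsm _).comp (measurable_id.mul_const _).inv
                rw [lintegral_const_mul _ hm]
                exact (mul_le_mul_right (hlast y hy) _).trans_eq (by rw [hD]; ring)
      _ ≤ C₂ ^ n * (∏ j, bracket (-s) (ξ (i.succAbove j).castSucc)) * D := by
          rw [lintegral_mul_const _ (hprod _)]
          exact mul_le_mul_left (lintegral_cube_prod_le hS h2 _) _
      _ = _ := by
          rw [Fin.prod_univ_castSucc, Fin.prod_univ_succAbove _ i]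
          simp only [Fin.castSucc_inj, Fin.succAbove_ne, if_false, if_true, (Fin.castSucc_ne_last i).symm, hD]
          ring

end Dilations

section Final
variable {d : ℕ}

theorem prod_bracket_le {E : Type*} [NormedAddCommGroup E] {γ s α : ℝ} (hα : 0 ≤ α) {n : ℕ} (ξ : Fin (n + 1) → E)
    (m : Fin (n + 1)) (hm : ∀ j, ‖ξ m‖ ≤ ‖ξ j‖) : ∏ j, bracket (if j = m then -γ else -s) (ξ j) ≤
      ∏ j, bracket (if j = m then -(γ + n * α) else -(s - α)) (ξ j) := by
  rw [Fin.prod_univ_succAbove _ m, Fin.prod_univ_succAbove _ m]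
  simp only [Fin.succAbove_ne, if_false, if_true]
  have h1 : bracket (n * α) (ξ m) ≤ ∏ j : Fin n, bracket α (ξ (m.succAbove j)) := by
    rw [← bracket_pow]
    refine le_of_eq_of_le ?_ (Finset.prod_le_prod' fun j _ => bracket_mono hα (hm (m.succAbove j)))
    rw [Finset.prod_const, Finset.card_univ, Fintype.card_fin]
  calc bracket (-γ) (ξ m) * ∏ j : Fin n, bracket (-s) (ξ (m.succAbove j))
      = bracket (-(γ + n * α)) (ξ m) * bracket (n * α) (ξ m) * ∏ j : Fin n, bracket (-s) (ξ (m.succAbove j)) := by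
        rw [bracket_mul_bracket]
        congr 3
        ring
    _ ≤ bracket (-(γ + n * α)) (ξ m) * (∏ j : Fin n, bracket α (ξ (m.succAbove j))) *
          ∏ j : Fin n, bracket (-s) (ξ (m.succAbove j)) := mul_le_mul_left (mul_le_mul_right h1 _) _
    _ = _ := by
        rw [mul_assoc, ← Finset.prod_mul_distrib]
        simp only [bracket_mul_bracket]
        congr 3 with j
        ring_nf

/-- The multilinear integral is finite once the pointwise and the mean decay of `S` beat the growth of `g`. -/
theorem lintegral_prod_mul_lintegral_cube_lt_top {S g : EuclideanSpace ℝ (Fin d) → ℝ≥0∞} {γ s α : ℝ} {C₁ C₂ : ℝ≥0∞}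
    (hS : Measurable S) (hg : Measurable g) (hγ : 0 ≤ γ) (hs : 0 ≤ s) (hα : 0 ≤ α) (hC₁ : C₁ ≠ ⊤) (hC₂ : C₂ ≠ ⊤)
    (h1 : ∀ ξ, S ξ ≤ C₁ * bracket (-γ) ξ)
    (h2 : ∀ ξ, ∫⁻ r in Set.Icc (1 / 2 : ℝ) 2, S (r • ξ) ≤ C₂ * bracket (-s) ξ) (n : ℕ)
    (h3 : ∫⁻ ξ, g ξ * bracket (-(γ + n * α)) ξ < ⊤) (h4 : ∫⁻ ξ, g ξ * bracket (-(s - α)) ξ < ⊤) :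
    ∫⁻ ξ : Fin (n + 1) → EuclideanSpace ℝ (Fin d), (∏ j, g (ξ j)) *
      ∫⁻ r : Fin n → ℝ in Set.univ.pi fun _ => Set.Icc (1 / 2) 2,
        (∏ j, S (r j • ξ j.castSucc)) * S ((∏ j, r j)⁻¹ • ξ (Fin.last n)) < ⊤ := by
  choose C hC hCm using exists_lintegral_cube_le hS hγ hs hC₁ hC₂ h1 h2 n
  set w : Fin (n + 1) → Fin (n + 1) → EuclideanSpace ℝ (Fin d) → ℝ≥0∞ := fun m j x =>
    g x * bracket (if j = m then -(γ + n * α) else -(s - α)) x with hw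
  have hwm : ∀ m j, Measurable (w m j) := fun m j => hg.mul (measurable_bracket _)
  have hwp : ∀ m, Measurable fun ξ : Fin (n + 1) → EuclideanSpace ℝ (Fin d) => ∏ j, w m j (ξ j) := fun m =>
    Finset.measurable_prod _ fun j _ => (hwm m j).comp (measurable_pi_apply j)
  calc _ ≤ ∫⁻ ξ : Fin (n + 1) → EuclideanSpace ℝ (Fin d), ∑ m, C m * ∏ j, w m j (ξ j) := by
        refine lintegral_mono fun ξ => ?_
        obtain ⟨m, hm⟩ := Finite.exists_min fun j => ‖ξ j‖
        refine le_trans ?_ (Finset.single_le_sum (f := fun m => C m * ∏ j, w m j (ξ j)) (fun _ _ => zero_le)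
          (Finset.mem_univ m))
        calc _ ≤ (∏ j, g (ξ j)) * (C m * ∏ j, bracket (if j = m then -(γ + n * α) else -(s - α)) (ξ j)) :=
              mul_le_mul_right ((hCm m ξ).trans (mul_le_mul_right (prod_bracket_le hα ξ m hm) _)) _
          _ = _ := by
              simp only [hw, Finset.prod_mul_distrib]
              ring
    _ = ∑ m, C m * ∏ j, ∫⁻ x, w m j x := by
        rw [lintegral_finsetSum _ fun m _ => (hwp m).const_mul _]
        refine Finset.sum_congr rfl fun m _ => ?_
        rw [lintegral_const_mul _ (hwp m), volume_pi, lintegral_fin_prod_eq_prod _ (hwm m)]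
    _ < ⊤ := by
        refine ENNReal.sum_lt_top.2 fun m _ => ENNReal.mul_lt_top (hC m).lt_top (ENNReal.prod_lt_top fun j _ => ?_)
        by_cases h : j = m
        · simpa only [hw, h, if_true] using h3
        · simpa only [hw, h, if_false] using h4

theorem lintegral_pi_orthogonalGroup {lam : Measure (Matrix.orthogonalGroup (Fin d) ℝ)} [IsProbabilityMeasure lam]
    {g : EuclideanSpace ℝ (Fin d) → ℝ≥0∞} (hg : Measurable g) {n : ℕ} (y : Fin n → EuclideanSpace ℝ (Fin d))
    (z : EuclideanSpace ℝ (Fin d)) :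
    ∫⁻ θ : Fin (n + 1) → Matrix.orthogonalGroup (Fin d) ℝ,
      (∏ j : Fin n, g (Matrix.toEuclideanLin (θ j.castSucc : Matrix (Fin d) (Fin d) ℝ) (y j))) *
        g (Matrix.toEuclideanLin (θ (Fin.last n) : Matrix (Fin d) (Fin d) ℝ) z) ∂(Measure.pi fun _ => lam) =
      (∏ j, orbAvg lam g (y j)) * orbAvg lam g z := by
  have h := lintegral_fin_prod_eq_prod lam
    (f := fun j θ => g (Matrix.toEuclideanLin (θ : Matrix (Fin d) (Fin d) ℝ)
      (Fin.snoc (α := fun _ => EuclideanSpace ℝ (Fin d)) y z j)))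
    fun j => measurable_comp_toEuclideanLin hg _
  simp only [Fin.prod_univ_castSucc, Fin.snoc_castSucc, Fin.snoc_last] at h
  exact h

theorem frostman_of_le {μ : Measure (EuclideanSpace ℝ (Fin d))} [IsProbabilityMeasure μ] {s s' A : ℝ}
    (hs' : 0 ≤ s') (hss : s' ≤ s) (hfrost : ∀ (x : EuclideanSpace ℝ (Fin d)) (r : ℝ), 0 < r →
      μ (closedBall x r) ≤ ENNReal.ofReal (A * r ^ s)) (x : EuclideanSpace ℝ (Fin d)) (r : ℝ) (hr : 0 < r) :
    μ (closedBall x r) ≤ ENNReal.ofReal (max A 1 * r ^ s') := by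
  rcases le_or_gt 1 r with h | h
  · refine prob_le_one.trans ?_
    rw [← ENNReal.ofReal_one]
    refine ENNReal.ofReal_le_ofReal ?_
    exact one_le_mul_of_one_le_of_one_le (le_max_right _ _) (Real.one_le_rpow h hs')
  · refine (hfrost x r hr).trans (ENNReal.ofReal_le_ofReal ?_)
    exact mul_le_mul (le_max_left _ _) (Real.rpow_le_rpow_of_exponent_ge hr h.le hss) (by positivity) (by positivity)

end Final

/-- The case `s < d`, with the integral over the orthogonal group written as a product of orbit averages. -/
theorem lintegral_orbAvg_measureFT_lt_top {d : ℕ} (hd : 2 ≤ d) (n : ℕ) {s A : ℝ} (hA : 0 < A)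
    (hsn : (d : ℝ) / 2 + 1 / (4 * n + 3) < s) (hsd : s < d)
    {μ : Measure (EuclideanSpace ℝ (Fin d))} [IsProbabilityMeasure μ] (hcpt : ∃ K, IsCompact K ∧ μ Kᶜ = 0)
    (hfrost : ∀ (x : EuclideanSpace ℝ (Fin d)) (r : ℝ), 0 < r → μ (closedBall x r) ≤ ENNReal.ofReal (A * r ^ s))
    {lam : Measure (Matrix.orthogonalGroup (Fin d) ℝ)} [IsProbabilityMeasure lam]
    (hinv : ∀ θ₀ : Matrix.orthogonalGroup (Fin d) ℝ, lam.map (fun θ => θ * θ₀) = lam) :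
    ∫⁻ ξ : Fin (n + 1) → EuclideanSpace ℝ (Fin d), (∏ j, ‖measureFT μ (ξ j)‖ₑ ^ 2) *
      ∫⁻ r : Fin n → ℝ in Set.univ.pi fun _ => Set.Icc (1 / 2) 2,
        (∏ j, orbAvg lam (fun ξ => ‖measureFT μ ξ‖ₑ ^ 2) (r j • ξ j.castSucc)) *
          orbAvg lam (fun ξ => ‖measureFT μ ξ‖ₑ ^ 2) ((∏ j, r j)⁻¹ • ξ (Fin.last n)) < ⊤ := by
  have hd' : (2 : ℝ) ≤ d := by exact_mod_cast hd
  have hn : (0 : ℝ) ≤ n := n.cast_nonneg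
  set x := s - d / 2 with hx
  have hx1 : 1 < x * (4 * n + 3) := by
    rw [← div_lt_iff₀ (by positivity)]
    linarith
  have hx0 : 0 < x := by
    by_contra hc
    have := mul_nonneg (neg_nonneg.2 (not_lt.1 hc)) (show (0 : ℝ) ≤ 4 * n + 3 by positivity)
    linarith
  obtain ⟨δ, hδ⟩ : ∃ δ, δ * (4 * n + 4) = x * (4 * n + 3) - 1 :=
    ⟨(x * (4 * n + 3) - 1) / (4 * n + 4), div_mul_cancel₀ _ (by positivity)⟩
  have hδ0 : 0 < δ := by
    by_contra hc
    have := mul_nonneg (neg_nonneg.2 (not_lt.1 hc)) (show (0 : ℝ) ≤ 4 * n + 4 by positivity)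
    linarith
  have hδx : δ < x := by
    by_contra hc
    have := mul_nonneg (sub_nonneg.2 (not_lt.1 hc)) (show (0 : ℝ) ≤ 4 * n + 4 by positivity)
    linarith
  set κ := (d : ℝ) - 1 - (d + 2 * s - 2) / 4 + δ with hκ
  have hm : Measurable fun ξ => ‖measureFT μ ξ‖ₑ ^ 2 := continuous_measureFT.measurable.enorm.pow_const 2
  have hg1 : ∀ ξ, ‖measureFT μ ξ‖ₑ ^ 2 ≤ 1 := fun ξ => pow_le_one' (enorm_measureFT_le_one ξ) 2
  have hrep := exists_enorm_measureFT_sq_le hcpt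
  obtain ⟨K₁, hK₁, hshell⟩ := exists_lintegral_shell_le hd hA hfrost (κ := κ) (by linarith) (by linarith) (by linarith)
  obtain ⟨K₂, hK₂, hK₂0, hgrow⟩ := exists_hasGrowth_measureFT hA hfrost
  obtain ⟨C₁, hC₁, h1⟩ := exists_orbAvg_le_bracket (by omega) hinv hm hrep (by linarith) hK₁ hshell
  obtain ⟨C₂, hC₂, h2⟩ := exists_lintegral_orbAvg_smul_le (by omega) hinv hm hg1 hrep (s := s) (by linarith) hK₂ hK₂0
    hgrow (a := 1 / 2) (b := 2) (by norm_num) (by norm_num)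
  refine lintegral_prod_mul_lintegral_cube_lt_top (γ := d - 1 - κ) (s := s) (α := 2 * x - δ)
    (measurable_orbAvg hm) hm (by linarith) (by linarith) (by linarith) hC₁ hC₂
    (fun ξ => by rw [neg_sub]; exact h1 ξ) h2 n ?_ ?_
  · have h3 : (d : ℝ) - s < d - 1 - κ + n * (2 * x - δ) := by nlinarith
    exact lintegral_mul_bracket_lt_top (by linarith) h3 hm hK₂ hgrow
  · exact lintegral_mul_bracket_lt_top (by linarith) (by linarith) hm hK₂ hgrow

/-- **Finiteness of the Mattila-type integral** arising in the proof of the product of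
distances theorem: for `d ≥ 2`, `k ≥ 1` and a compactly supported Borel probability
measure `μ` on `ℝ^d` obeying the Frostman condition `μ(B(x,r)) ≤ A r^s` with
`s > d/2 + 1/(4k-1)`, the integral
`∫_{(ℝ^d)^k} ∏_j |μ̂(ξ^j)|² ( ∫_{[1/2,2]^{k-1}} ∫_{O(d)^k}
  (∏_{j=1}^{k-1} |μ̂(r_j θ_j ξ^j)|²) |μ̂((r_1⋯r_{k-1})^{-1} θ_k ξ^k)|²
  dλ(θ_1)⋯dλ(θ_k) dr ) dξ` is finite, where `λ` is the Haar probability measure on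
`O(d)`. -/
theorem mattila_type_integral_product_distances_finite
    (d k : ℕ) (hd : 2 ≤ d) (hk : 1 ≤ k) (s A : ℝ) (hA : 0 < A)
    (hsk : (d : ℝ) / 2 + 1 / (4 * (k : ℝ) - 1) < s)
    (μ : Measure (EuclideanSpace ℝ (Fin d))) [IsProbabilityMeasure μ]
    (hcpt : ∃ K, IsCompact K ∧ μ Kᶜ = 0)
    (hfrost : ∀ (x : EuclideanSpace ℝ (Fin d)) (r : ℝ), 0 < r →
      μ (closedBall x r) ≤ ENNReal.ofReal (A * r ^ s))
    (lam : Measure (Matrix.orthogonalGroup (Fin d) ℝ)) [IsProbabilityMeasure lam]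
    (hinv : ∀ θ₀ : Matrix.orthogonalGroup (Fin d) ℝ,
      lam.map (fun θ => θ * θ₀) = lam) :
    ∫⁻ ξ : Fin k → EuclideanSpace ℝ (Fin d),
      (∏ j, (‖measureFT μ (ξ j)‖₊ : ℝ≥0∞) ^ 2) *
        ∫⁻ r : Fin (k - 1) → ℝ in Set.univ.pi fun _ => Set.Icc (1/2 : ℝ) 2,
          ∫⁻ θ : Fin k → Matrix.orthogonalGroup (Fin d) ℝ,
            (∏ j : Fin (k - 1),
              (‖measureFT μ (r j • Matrix.toEuclideanLin
                  ((θ (Fin.castLE (Nat.sub_le k 1) j) : Matrix (Fin d) (Fin d) ℝ))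
                  (ξ (Fin.castLE (Nat.sub_le k 1) j)))‖₊ : ℝ≥0∞) ^ 2) *
            (‖measureFT μ ((∏ j, r j)⁻¹ • Matrix.toEuclideanLin
                ((θ (⟨k - 1, by omega⟩ : Fin k) : Matrix (Fin d) (Fin d) ℝ))
                (ξ (⟨k - 1, by omega⟩ : Fin k)))‖₊ : ℝ≥0∞) ^ 2
          ∂(Measure.pi fun _ => lam)
      < ⊤ := by
  obtain ⟨n, rfl⟩ : ∃ n, k = n + 1 := ⟨k - 1, by omega⟩
  have hd' : (2 : ℝ) ≤ d := by exact_mod_cast hd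
  have hn : (0 : ℝ) ≤ n := n.cast_nonneg
  have hden : 4 * ((n + 1 : ℕ) : ℝ) - 1 = 4 * n + 3 := by push_cast; ring
  rw [hden] at hsk
  have hlt : (d : ℝ) / 2 + 1 / (4 * n + 3) < d := by
    have : 1 / (4 * (n : ℝ) + 3) < 1 := by
      rw [div_lt_one (by positivity)]
      linarith
    linarith
  obtain ⟨s', h1, h2⟩ := exists_between (lt_min hsk hlt)
  have hpos : 0 < 1 / (4 * (n : ℝ) + 3) := by positivity
  have hm : Measurable fun ξ => ‖measureFT μ ξ‖ₑ ^ 2 := continuous_measureFT.measurable.enorm.pow_const 2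
  have h := lintegral_orbAvg_measureFT_lt_top hd n (lt_max_of_lt_left hA) h1 (h2.trans_le (min_le_right _ _)) hcpt
    (frostman_of_le (by linarith) (h2.le.trans (min_le_left _ _)) hfrost) hinv
  simp only [← lintegral_pi_orthogonalGroup hm, map_smul] at h
  exact h
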